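/- Let φ and φ₀ be psh functions on the unit polydisc Δⁿ ⊆ ℂⁿ and let f₀ be a tuple of holomorphic functions on Δⁿ. Assume that |f₀|²e^{-2(φ+φ₀)} is not integrable near the origin o, while |f₀|²e^{-2φ₀} is integrable near o. Then for every small enough neighborhood U ⊂⊂ Δⁿ of o there exists C > 0 such that e^{2t}·∫_{{φ<-t}∩U} |f₀|²e^{-2φ₀} > C for every t ≥ 0. -/

import Mathlib

open MeasureTheory Filter Topology
open scoped ENNReal NNReal

noncomputable section

/-- `ℂⁿ`. -/
abbrev Cn (n : ℕ) : Type := Fin n → ℂ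

variable {n : ℕ}

/-- The exponential function `EReal → ℝ≥0∞`, with `exp ⊥ = 0` and `exp ⊤ = ⊤`. -/
def expE (x : EReal) : ℝ≥0∞ :=
  if x = ⊥ then 0 else if x = ⊤ then ⊤ else ENNReal.ofReal (Real.exp x.toReal)

/-- The logarithm `ℝ → EReal`, with value `⊥` for `x ≤ 0`. -/
def elog (x : ℝ) : EReal := if x ≤ 0 then (⊥ : EReal) else ((Real.log x : ℝ) : EReal)

/-- The density `e^{c·φ} : ℂⁿ → [0,∞]` associated to an extended-real-valued `φ`. -/
def wexp (c : ℝ) (φ : Cn n → EReal) (z : Cn n) : ℝ≥0∞ := expE ((c : EReal) * φ z)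

/-- `|f₀|² = ∑ⱼ |f₀ⱼ|²` as a `[0,∞]`-valued density, for a tuple `f₀` of functions. -/
def normSq2 {m : ℕ} (f₀ : Fin m → Cn n → ℂ) (z : Cn n) : ℝ≥0∞ :=
  ∑ j, (‖f₀ j z‖₊ : ℝ≥0∞) ^ 2

/-- `log |f₀| = (1/2) log ∑ⱼ |f₀ⱼ|²` for a tuple `f₀`. -/
def logAbsT {m : ℕ} (f₀ : Fin m → Cn n → ℂ) (z : Cn n) : EReal :=
  elog (Real.sqrt (∑ j, ‖f₀ j z‖ ^ 2))

/-- The weight `|f₀|² e^{-2φ₀}`. -/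
def dens0 {m : ℕ} (f₀ : Fin m → Cn n → ℂ) (φ₀ : Cn n → EReal) (z : Cn n) : ℝ≥0∞ :=
  normSq2 f₀ z * wexp (-2) φ₀ z

/-- A nonnegative function is (Lebesgue-)integrable near the origin. -/
def IntNear (g : Cn n → ℝ≥0∞) : Prop := ∃ U ∈ 𝓝 (0 : Cn n), (∫⁻ z in U, g z) < ⊤

/-- `ψ ≤ φ + O(1)` near the origin. -/
def leO (ψ φ : Cn n → EReal) : Prop := ∃ C : ℝ, ∀ᶠ z in 𝓝 (0 : Cn n), ψ z ≤ φ z + (C : EReal)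

/-- `ψ = φ + O(1)` near the origin. -/
def eqO (ψ φ : Cn n → EReal) : Prop := leO ψ φ ∧ leO φ ψ

/-- The truncated average of `u` over the circle `θ ↦ z + r e^{iθ} w`, truncated below at `-m`. -/
def circleAvg (u : Cn n → EReal) (z w : Cn n) (r : ℝ) (m : ℕ) : ℝ :=
  (2 * Real.pi)⁻¹ * ∫ θ in (0:ℝ)..(2 * Real.pi),
    (max (u (z + ((r : ℂ) * Complex.exp (Complex.I * (θ : ℂ))) • w)) ((-(m : ℝ) : ℝ) : EReal)).toReal

/-- `u` is plurisubharmonic on `Ω`: it is upper semicontinuous on `Ω`, takes values in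
`[-∞, ∞)`, is not identically `-∞` on any connected component of `Ω`, and satisfies the
sub-mean value inequality on all small circles inside complex lines. -/
structure PSHOn (u : Cn n → EReal) (Ω : Set (Cn n)) : Prop where
  usc : UpperSemicontinuousOn u Ω
  lt_top : ∀ z ∈ Ω, u z < ⊤
  not_botOnComponents : ∀ z ∈ Ω, ∃ w ∈ connectedComponentIn Ω z, u w ≠ ⊥
  submean : ∀ z ∈ Ω, ∀ w : Cn n, ∃ ε > 0, ∀ r : ℝ, 0 < r → r < ε →
    u z ≤ ⨅ m : ℕ, ((circleAvg u z w r m : ℝ) : EReal)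

/-- `u` is plurisubharmonic near the origin. -/
def PSHNear (u : Cn n → EReal) : Prop := ∃ U ∈ 𝓝 (0 : Cn n), IsOpen U ∧ PSHOn u U

/-- `f` is holomorphic near the origin. -/
def HoloNear (f : Cn n → ℂ) : Prop := ∃ U ∈ 𝓝 (0 : Cn n), IsOpen U ∧ DifferentiableOn ℂ f U

/-- `Φ` is a (local) Zhou weight near the origin related to a general nonnegative
weight `W`. -/
structure IsZhouWeightFor (W : Cn n → ℝ≥0∞) (Φ : Cn n → EReal) : Prop where
  psh : PSHNear Φ
  intN : ∃ N₁ : ℕ, ∀ N₀ : ℕ, N₁ ≤ N₀ →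
    IntNear fun z => W z * ENNReal.ofReal (‖z‖ ^ (2 * N₀)) * wexp (-2) Φ z
  nonint : ¬ IntNear fun z => W z * wexp (-2) Φ z
  maximal : ∀ φ' : Cn n → EReal, PSHNear φ' → leO Φ φ' →
    (¬ IntNear fun z => W z * wexp (-2) φ' z) → eqO φ' Φ

/-- `Φ` is a local Zhou weight related to `|f₀|² e^{-2φ₀}` near the origin (including the
standing assumptions that `f₀` is a tuple of holomorphic functions near `o`, `φ₀` is
plurisubharmonic near `o`, and `|f₀|² e^{-2φ₀}` is integrable near `o`). -/
structure IsLocalZhouWeight {m : ℕ} (f₀ : Fin m → Cn n → ℂ) (φ₀ : Cn n → EReal)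
    (Φ : Cn n → EReal) : Prop where
  holo : ∀ j, HoloNear (f₀ j)
  psh₀ : PSHNear φ₀
  int₀ : IntNear (dens0 f₀ φ₀)
  zhou : IsZhouWeightFor (dens0 f₀ φ₀) Φ

/-- The Zhou number (relative type) `σ(ψ, Φ) = sup { b ≥ 0 : ψ ≤ bΦ + O(1) near o }`. -/
def zhouNumber (ψ Φ : Cn n → EReal) : ℝ :=
  sSup {b : ℝ | 0 ≤ b ∧ leO ψ fun z => (b : EReal) * Φ z}

/-- `log ‖f‖ : ℂⁿ → EReal`. -/
def logAbs (f : Cn n → ℂ) (z : Cn n) : EReal := elog ‖f z‖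

/-- `ν(f, Φ) = σ(log|f|, Φ)`. -/
def nuNumber (f : Cn n → ℂ) (Φ : Cn n → EReal) : ℝ := zhouNumber (logAbs f) Φ

/-- The jumping number `c_o^G(Φ) = sup { c ≥ 0 : |G|² e^{-2cΦ} integrable near o }`. -/
def jumping (G : Cn n → ℂ) (Φ : Cn n → EReal) : ℝ :=
  sSup {c : ℝ | 0 ≤ c ∧ IntNear fun z => (‖G z‖₊ : ℝ≥0∞) ^ 2 * wexp (-2 * c) Φ z}

/-- The inclusion `ℐ(φ)ₒ ⊆ ℐ(ψ)ₒ` of multiplier ideals at the origin. -/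
def mIdealLE (φ ψ : Cn n → EReal) : Prop :=
  ∀ f : Cn n → ℂ, HoloNear f →
    (IntNear fun z => (‖f z‖₊ : ℝ≥0∞) ^ 2 * wexp (-2) φ z) →
    IntNear fun z => (‖f z‖₊ : ℝ≥0∞) ^ 2 * wexp (-2) ψ z

/-- The Tian function `Tn(t; f, v, φ₀) = sup { c ≥ 0 : |f|^{2t} e^{-2cv - 2φ₀} integrable near o }`. -/
def tian (t : ℝ) (f : Cn n → ℂ) (v φ₀ : Cn n → EReal) : ℝ :=
  sSup {c : ℝ | 0 ≤ c ∧
    IntNear fun z => ENNReal.ofReal (‖f z‖ ^ (2 * t)) * wexp (-2 * c) v z * wexp (-2) φ₀ z}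

/-- The unit polydisc `Δⁿ ⊆ ℂⁿ`. -/
def polydisc (n : ℕ) : Set (Cn n) := {z | ∀ j, ‖z j‖ < 1}

open scoped ContDiff

/-! ### A rotation invariant mollifier on `ℂⁿ` -/

/-- The squared Euclidean norm on `ℂⁿ`. -/
def nsq (z : Cn n) : ℝ := ∑ j, ‖z j‖ ^ 2

lemma nsq_nonneg (z : Cn n) : 0 ≤ nsq z := Finset.sum_nonneg fun _ _ => by positivity

@[simp] lemma nsq_zero : nsq (0 : Cn n) = 0 := by simp [nsq]

lemma contDiff_nsq {k : WithTop ℕ∞} : ContDiff ℝ k (nsq (n := n)) := by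
  unfold nsq
  refine ContDiff.sum fun j _ => ?_
  exact (contDiff_norm_sq ℝ).comp (contDiff_apply ℝ ℂ j)

lemma continuous_nsq : Continuous (nsq (n := n)) :=
  (contDiff_nsq (k := 0)).continuous

lemma nsq_smul (c : ℂ) (z : Cn n) : nsq (c • z) = ‖c‖ ^ 2 * nsq z := by
  simp [nsq, mul_pow, Finset.mul_sum]

lemma norm_sq_le_nsq (z : Cn n) : ‖z‖ ^ 2 ≤ nsq z := by
  have h : ‖z‖ ≤ √(nsq z) := by
    rw [pi_norm_le_iff_of_nonneg (Real.sqrt_nonneg _)]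
    intro j
    apply Real.le_sqrt_of_sq_le
    exact Finset.single_le_sum (f := fun j => ‖z j‖ ^ 2) (fun _ _ => by positivity)
      (Finset.mem_univ j)
  calc ‖z‖ ^ 2 ≤ √(nsq z) ^ 2 := by gcongr
    _ = nsq z := Real.sq_sqrt (nsq_nonneg z)

lemma nsq_le_norm_sq (z : Cn n) : nsq z ≤ n * ‖z‖ ^ 2 := by
  calc nsq z ≤ ∑ _j : Fin n, ‖z‖ ^ 2 := Finset.sum_le_sum fun j _ => by
        gcongr; exact norm_le_pi_norm z j
    _ = n * ‖z‖ ^ 2 := by simp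

/-- The unnormalized mollifier. -/
def preRho (ε : ℝ) (z : Cn n) : ℝ := Real.smoothTransition (1 - nsq z / ε ^ 2)

lemma contDiff_preRho (ε : ℝ) {k : ℕ∞} : ContDiff ℝ k (preRho (n := n) ε) :=
  Real.smoothTransition.contDiff.comp (contDiff_const.sub (contDiff_nsq.div_const _))

lemma preRho_nonneg (ε : ℝ) (z : Cn n) : 0 ≤ preRho ε z := Real.smoothTransition.nonneg _

lemma preRho_eq_zero {ε : ℝ} (hε : 0 < ε) {z : Cn n} (hz : ε ^ 2 ≤ nsq z) : preRho ε z = 0 := by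
  apply Real.smoothTransition.zero_of_nonpos
  have : 1 ≤ nsq z / ε ^ 2 := by rw [le_div_iff₀ (by positivity)]; linarith
  linarith

lemma norm_lt_of_preRho_ne {ε : ℝ} (hε : 0 < ε) {z : Cn n} (hz : preRho ε z ≠ 0) : ‖z‖ < ε := by
  by_contra h
  push Not at h
  exact hz (preRho_eq_zero hε ((by gcongr : ε ^ 2 ≤ ‖z‖ ^ 2).trans (norm_sq_le_nsq z)))

lemma hasCompactSupport_preRho {ε : ℝ} (hε : 0 < ε) : HasCompactSupport (preRho (n := n) ε) := by
  apply HasCompactSupport.of_support_subset_isCompact (isCompact_closedBall (0 : Cn n) ε)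
  intro z hz
  simpa using (norm_lt_of_preRho_ne hε hz).le

lemma integral_preRho_pos {ε : ℝ} (hε : 0 < ε) : 0 < ∫ z : Cn n, preRho ε z := by
  apply ((contDiff_preRho (n := n) ε (k := 0)).continuous).integral_pos_of_hasCompactSupport_nonneg_nonzero
    (hasCompactSupport_preRho hε) (preRho_nonneg ε) (x := 0)
  have : (0 : ℝ) < preRho ε (0 : Cn n) := by
    apply Real.smoothTransition.pos_of_pos; simp
  exact this.ne'

/-- The mollifier, supported in the Euclidean ball of radius `ε`. -/
def rho (ε : ℝ) (z : Cn n) : ℝ := (∫ w : Cn n, preRho ε w)⁻¹ * preRho ε z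

lemma contDiff_rho (ε : ℝ) {k : ℕ∞} : ContDiff ℝ k (rho (n := n) ε) :=
  contDiff_const.mul (contDiff_preRho ε)

lemma continuous_rho (ε : ℝ) : Continuous (rho (n := n) ε) :=
  (contDiff_rho ε (k := 0)).continuous

lemma rho_nonneg (ε : ℝ) (z : Cn n) : 0 ≤ rho ε z :=
  mul_nonneg (inv_nonneg.2 (integral_nonneg (preRho_nonneg ε))) (preRho_nonneg ε z)

lemma norm_lt_of_rho_ne {ε : ℝ} (hε : 0 < ε) {z : Cn n} (hz : rho ε z ≠ 0) : ‖z‖ < ε :=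
  norm_lt_of_preRho_ne hε fun h => hz (by rw [rho, h, mul_zero])

lemma hasCompactSupport_rho {ε : ℝ} (hε : 0 < ε) : HasCompactSupport (rho (n := n) ε) := by
  apply HasCompactSupport.of_support_subset_isCompact (isCompact_closedBall (0 : Cn n) ε)
  intro z hz
  simpa using (norm_lt_of_rho_ne hε hz).le

lemma integrable_rho {ε : ℝ} (hε : 0 < ε) : Integrable (rho (n := n) ε) :=
  (continuous_rho ε).integrable_of_hasCompactSupport (hasCompactSupport_rho hε)

lemma integral_rho {ε : ℝ} (hε : 0 < ε) : ∫ z : Cn n, rho ε z = 1 := by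
  simp only [rho, integral_const_mul]
  exact inv_mul_cancel₀ (integral_preRho_pos hε).ne'

lemma rho_smul (ε : ℝ) {c : ℂ} (hc : ‖c‖ = 1) (z : Cn n) : rho ε (c • z) = rho ε z := by
  simp [rho, preRho, nsq_smul, hc]

lemma rho_neg (ε : ℝ) (z : Cn n) : rho ε (-z) = rho ε z := by
  simpa using rho_smul ε (c := -1) (by simp) z

/-- Rotation by a unimodular number preserves Lebesgue measure. -/
lemma measurePreserving_smul_unit {c : ℂ} (hc : ‖c‖ = 1) :
    MeasurePreserving (fun z : Cn n => c • z) volume volume := by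
  have h1 : MeasurePreserving (fun z : ℂ => c * z) volume volume := by
    exact LinearIsometryEquiv.measurePreserving (rotation ⟨c, by simp [Submonoid.unitSphere, hc]⟩)
  exact volume_preserving_pi (fun _ : Fin n => h1)

/-- Averaging against `rho` may be preceded by averaging over circles. -/
lemma integral_rho_smul_eq {E : Type*} [NormedAddCommGroup E] [NormedSpace ℝ E] [CompleteSpace E]
    {ε : ℝ} (hε : 0 < ε) {g : Cn n → E} (hg : StronglyMeasurable g) {C : ℝ}
    (hC : ∀ y, ‖y‖ < ε → ‖g y‖ ≤ C) :
    ∫ y, rho ε y • g y =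
      ∫ y, rho ε y • ((2 * Real.pi)⁻¹ • ∫ θ in (0:ℝ)..(2 * Real.pi),
        g (Complex.exp (Complex.I * θ) • y)) := by
  have hpi : (0:ℝ) < 2 * Real.pi := by positivity
  have hexp : ∀ θ : ℝ, ‖Complex.exp (Complex.I * θ)‖ = 1 := fun θ => by
    rw [mul_comm]; exact Complex.norm_exp_ofReal_mul_I θ
  have h1 : ∀ θ : ℝ, ∫ y, rho ε y • g (Complex.exp (Complex.I * θ) • y) = ∫ y, rho ε y • g y := by
    intro θ
    have hmp := measurePreserving_smul_unit (n := n) (hexp θ)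
    have he : MeasurableEmbedding (fun z : Cn n => Complex.exp (Complex.I * θ) • z) :=
      (Homeomorph.smulOfNeZero _ (Complex.exp_ne_zero _)).measurableEmbedding
    have := hmp.integral_comp he (fun y => rho ε y • g y)
    simpa only [rho_smul ε (hexp θ)] using this
  have hmeas : StronglyMeasurable (fun p : ℝ × Cn n =>
      rho ε p.2 • g (Complex.exp (Complex.I * p.1) • p.2)) := by
    refine ((continuous_rho ε).comp continuous_snd).stronglyMeasurable.smul ?_
    refine hg.comp_measurable ?_
    have : Continuous (fun p : ℝ × Cn n => Complex.exp (Complex.I * p.1) • p.2) := by fun_prop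
    exact this.measurable
  have hint : Integrable (fun p : ℝ × Cn n =>
      rho ε p.2 • g (Complex.exp (Complex.I * p.1) • p.2))
      ((volume.restrict (Set.Ioc 0 (2 * Real.pi))).prod volume) := by
    have hb : Integrable (fun p : ℝ × Cn n => (1:ℝ) * (rho ε p.2 * C))
        ((volume.restrict (Set.Ioc 0 (2 * Real.pi))).prod volume) :=
      Integrable.mul_prod (f := fun _ : ℝ => (1:ℝ)) (g := fun y : Cn n => rho ε y * C)
        (by simp) ((integrable_rho hε).mul_const C)
    refine hb.mono' hmeas.aestronglyMeasurable (ae_of_all _ fun p => ?_)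
    rw [norm_smul, Real.norm_of_nonneg (rho_nonneg ε _), one_mul]
    by_cases h0 : rho ε p.2 = 0
    · simp [h0]
    · refine mul_le_mul_of_nonneg_left (hC _ ?_) (rho_nonneg ε _)
      rw [norm_smul, hexp, one_mul]
      exact norm_lt_of_rho_ne hε h0
  have h2 := integral_integral_swap
    (f := fun (θ : ℝ) (y : Cn n) => rho ε y • g (Complex.exp (Complex.I * θ) • y)) hint
  have h3 : ∫ θ : ℝ in Set.Ioc 0 (2 * Real.pi), ∫ y, rho ε y • g (Complex.exp (Complex.I * θ) • y)
      = (2 * Real.pi) • ∫ y, rho ε y • g y := by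
    simp only [h1]
    simp [hpi.le]
  rw [h3] at h2
  have h4 : ∫ y, rho ε y • g y = (2 * Real.pi)⁻¹ • ((2 * Real.pi) • ∫ y, rho ε y • g y) := by
    rw [smul_smul, inv_mul_cancel₀ hpi.ne', one_smul]
  rw [h4, h2, ← integral_smul]
  congr 1
  ext y
  rw [integral_smul, intervalIntegral.integral_of_le hpi.le, smul_comm]

/-- Mollification. -/
def moll {E : Type*} [NormedAddCommGroup E] [NormedSpace ℝ E] (ε : ℝ) (f : Cn n → E) : Cn n → E :=
  convolution (rho ε) f (ContinuousLinearMap.lsmul ℝ ℝ) volume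

lemma moll_apply {E : Type*} [NormedAddCommGroup E] [NormedSpace ℝ E] (ε : ℝ) (f : Cn n → E)
    (z : Cn n) : moll ε f z = ∫ y, rho ε y • f (z - y) := rfl

section moll
variable {E : Type*} [NormedAddCommGroup E] [NormedSpace ℝ E]

lemma norm_exp_I_mul (θ : ℝ) : ‖Complex.exp (Complex.I * θ)‖ = 1 := by
  rw [mul_comm]; exact Complex.norm_exp_ofReal_mul_I θ

/-- Mollification only depends on the values in the ball of radius `ε`. -/
lemma moll_congr {ε : ℝ} (hε : 0 < ε) {f g : Cn n → E} {z : Cn n}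
    (h : ∀ y, ‖y‖ < ε → f (z - y) = g (z - y)) : moll ε f z = moll ε g z := by
  rw [moll_apply, moll_apply]
  congr 1
  ext y
  by_cases h0 : rho ε y = 0
  · simp [h0]
  · rw [h y (norm_lt_of_rho_ne hε h0)]

lemma moll_eq_avg [CompleteSpace E] {ε : ℝ} (hε : 0 < ε) {f : Cn n → E} {z : Cn n}
    (hf : StronglyMeasurable ((Metric.ball z ε).indicator f)) {C : ℝ}
    (hC : ∀ y ∈ Metric.ball z ε, ‖f y‖ ≤ C) :
    moll ε f z = ∫ y, rho ε y • ((2 * Real.pi)⁻¹ • ∫ θ in (0:ℝ)..(2 * Real.pi),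
        f (z - Complex.exp (Complex.I * θ) • y)) := by
  set g : Cn n → E := fun y => (Metric.ball z ε).indicator f (z - y) with hg
  have hgf : ∀ y, ‖y‖ < ε → g y = f (z - y) := fun y hy => by
    rw [hg]
    exact Set.indicator_of_mem (by simpa [dist_eq_norm] using hy) f
  have hgm : StronglyMeasurable g := hf.comp_measurable (measurable_const.sub measurable_id)
  have h1 := integral_rho_smul_eq hε hgm (C := C) (fun y hy => by
    rw [hgf y hy]; exact hC _ (by simpa [dist_eq_norm] using hy))
  have h2 : ∀ F G : Cn n → E, (∀ y, ‖y‖ < ε → F y = G y) →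
      ∫ y, rho ε y • F y = ∫ y, rho ε y • G y := by
    intro F G hFG
    congr 1
    ext y
    by_cases h0 : rho ε y = 0
    · simp [h0]
    · rw [hFG y (norm_lt_of_rho_ne hε h0)]
  rw [moll_apply, ← h2 _ _ hgf, h1]
  refine h2 _ _ fun y hy => ?_
  congr 2
  ext θ
  refine hgf _ ?_
  rwa [norm_smul, norm_exp_I_mul, one_mul]

lemma contDiff_moll [CompleteSpace E] {ε : ℝ} (hε : 0 < ε) {f : Cn n → E}
    (hf : LocallyIntegrable f) : ContDiff ℝ ∞ (moll ε f) :=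
  (hasCompactSupport_rho hε).contDiff_convolution_left _ (contDiff_rho ε) hf

end moll

lemma stronglyMeasurable_indicator_of_continuousOn {F : Type*} [NormedAddCommGroup F]
    [MeasurableSpace F] [BorelSpace F] [SecondCountableTopology F] {s : Set (Cn n)}
    (hs : MeasurableSet s) {f : Cn n → F} (hf : ContinuousOn f s) :
    StronglyMeasurable (s.indicator f) := by
  classical
  rw [← Set.piecewise_eq_indicator]
  exact (hf.measurable_piecewise continuous_zero.continuousOn hs).stronglyMeasurable

/-- A continuous function satisfying the mean value property is equal to its mollification. -/
lemma moll_eq_self {f : Cn n → ℂ} {z : Cn n} {ε : ℝ} (hε : 0 < ε)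
    (hc : ContinuousOn f (Metric.closedBall z ε))
    (hm : ∀ y, ‖y‖ < ε → (2 * Real.pi)⁻¹ • ∫ θ in (0:ℝ)..(2 * Real.pi),
        f (z - Complex.exp (Complex.I * θ) • y) = f z) : moll ε f z = f z := by
  obtain ⟨C, hC⟩ := (isCompact_closedBall z ε).exists_bound_of_continuousOn hc
  rw [moll_eq_avg hε (C := C) _ fun y hy => hC y (Metric.ball_subset_closedBall hy)]
  · have : ∀ y : Cn n, rho ε y • ((2 * Real.pi)⁻¹ • ∫ θ in (0:ℝ)..(2 * Real.pi),
        f (z - Complex.exp (Complex.I * θ) • y)) = rho ε y • f z := by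
      intro y
      by_cases h0 : rho ε y = 0
      · simp [h0]
      · rw [hm y (norm_lt_of_rho_ne hε h0)]
    simp only [this]
    rw [integral_smul_const, integral_rho hε, one_smul]
  · exact stronglyMeasurable_indicator_of_continuousOn Metric.isOpen_ball.measurableSet
      (hc.mono Metric.ball_subset_closedBall)

/-- Mean value property along complex lines. -/
lemma line_mean_value {f : Cn n → ℂ} {z w : Cn n} {ε : ℝ}
    (hc : ContinuousOn f (Metric.closedBall z ε))
    (hl : ∀ x ∈ Metric.closedBall z ε, ∀ w, DifferentiableAt ℂ (fun ζ : ℂ => f (x + ζ • w)) 0)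
    (hw : ‖w‖ ≤ ε) :
    (2 * Real.pi)⁻¹ • ∫ θ in (0:ℝ)..(2 * Real.pi),
        f (z - Complex.exp (Complex.I * θ) • w) = f z := by
  have hmem : ∀ ζ ∈ Metric.closedBall (0:ℂ) 1, z + ζ • (-w) ∈ Metric.closedBall z ε := by
    intro ζ hζ
    have : ‖ζ‖ ≤ 1 := by simpa using hζ
    simp only [Metric.mem_closedBall, dist_eq_norm, add_sub_cancel_left, norm_smul, norm_neg]
    nlinarith [norm_nonneg w, norm_nonneg ζ]
  have hd : DiffContOnCl ℂ (fun ζ : ℂ => f (z + ζ • (-w))) (Metric.ball 0 |1|) := by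
    refine ⟨fun ζ hζ => ?_, ?_⟩
    · have h1 := hl (z + ζ • (-w)) (hmem ζ (Metric.ball_subset_closedBall (by simpa using hζ))) (-w)
      have h2 : DifferentiableAt ℂ (fun ξ : ℂ => ξ - ζ) ζ := by fun_prop
      have h3 := DifferentiableAt.comp (f := fun ξ : ℂ => ξ - ζ)
        (g := fun ξ : ℂ => f (z + ζ • (-w) + ξ • (-w))) ζ (by simpa using h1) h2
      refine (h3.congr_of_eventuallyEq (Eventually.of_forall fun ξ => ?_)).differentiableWithinAt
      simp only [Function.comp]
      congr 1
      rw [add_assoc, ← add_smul]; congr 2; ring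
    · rw [abs_one, closure_ball _ one_ne_zero]
      exact hc.comp (by fun_prop) hmem
  have h := hd.circleAverage
  rw [Real.circleAverage_def] at h
  simp only [circleMap, zero_add, zero_smul, add_zero, Complex.ofReal_one, one_mul] at h
  rw [← h]
  congr 2
  ext θ
  rw [mul_comm Complex.I, smul_neg, ← sub_eq_add_neg]

/-- A continuous function which is holomorphic along complex lines coincides with its
mollification, so it is smooth and complex differentiable. -/
lemma moll_eq_self_of_line {f : Cn n → ℂ} {z : Cn n} {ε : ℝ} (hε : 0 < ε)
    (hc : ContinuousOn f (Metric.closedBall z ε))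
    (hl : ∀ x ∈ Metric.closedBall z ε, ∀ w, DifferentiableAt ℂ (fun ζ : ℂ => f (x + ζ • w)) 0) :
    moll ε f z = f z :=
  moll_eq_self hε hc fun _ hy => line_mean_value hc hl hy.le

lemma locallyIntegrable_indicator_of_continuousOn {F : Type*} [NormedAddCommGroup F]
    {f : Cn n → F} {s : Set (Cn n)} (hs : IsCompact s) (hf : ContinuousOn f s) :
    Integrable (s.indicator f) :=
  (hf.integrableOn_compact hs).integrable_indicator hs.measurableSet

lemma contDiffAt_of_line {f : Cn n → ℂ} {U : Set (Cn n)} (hU : IsOpen U) (hc : ContinuousOn f U)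
    (hl : ∀ x ∈ U, ∀ w, DifferentiableAt ℂ (fun ζ : ℂ => f (x + ζ • w)) 0) {z : Cn n}
    (hz : z ∈ U) : ContDiffAt ℝ ∞ f z := by
  obtain ⟨r, hr, hrU⟩ := Metric.nhds_basis_closedBall.mem_iff.1 (hU.mem_nhds hz)
  set ε := r / 2
  have hε : 0 < ε := by positivity
  have hint := locallyIntegrable_indicator_of_continuousOn (isCompact_closedBall z r) (hc.mono hrU)
  have hsm := contDiff_moll hε hint.locallyIntegrable
  refine hsm.contDiffAt.congr_of_eventuallyEq ?_
  filter_upwards [Metric.ball_mem_nhds z hε] with x hx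
  have hsub : Metric.closedBall x ε ⊆ Metric.closedBall z r := by
    apply Metric.closedBall_subset_closedBall'
    have := Metric.mem_ball.1 hx
    simp only [ε] at this ⊢; linarith
  rw [← moll_eq_self_of_line hε (hc.mono (hsub.trans hrU))
    (fun y hy => hl y (hrU (hsub hy)))]
  apply moll_congr hε
  intro y hy
  rw [Set.indicator_of_mem]
  apply hsub
  simpa [dist_eq_norm] using hy.le

lemma differentiableAt_of_line {f : Cn n → ℂ} {z : Cn n} (hd : DifferentiableAt ℝ f z)
    (hl : ∀ w, DifferentiableAt ℂ (fun ζ : ℂ => f (z + ζ • w)) 0) : DifferentiableAt ℂ f z := by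
  have key : ∀ (c : ℂ) (w : Cn n), fderiv ℝ f z (c • w) = c • fderiv ℝ f z w := by
    intro c w
    have h1 := (hl w).hasDerivAt
    have h2 : ∀ c : ℂ, fderiv ℝ f z (c • w) = c • deriv (fun ζ : ℂ => f (z + ζ • w)) 0 := by
      intro c
      have h3 : HasDerivAt (fun t : ℝ => f (z + t • (c • w))) (fderiv ℝ f z (c • w)) 0 := by
        have h5 : HasDerivAt (fun t : ℝ => z + t • (c • w)) (c • w) 0 := by
          simpa using ((hasDerivAt_id (0:ℝ)).smul_const (c • w)).const_add z
        have h4 : HasFDerivAt f (fderiv ℝ f z) (z + (0:ℝ) • (c • w)) := by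
          simpa using hd.hasFDerivAt
        exact h4.comp_hasDerivAt (0:ℝ) h5
      have h6 : HasDerivAt (fun t : ℝ => f (z + ((t:ℂ) * c) • w))
          (c • deriv (fun ζ : ℂ => f (z + ζ • w)) 0) 0 := by
        have h7 : HasDerivAt (fun t : ℝ => (t:ℂ) * c) c 0 := by
          simpa using (Complex.ofRealCLM.hasDerivAt (x := (0:ℝ))).mul_const c
        have h8 : HasDerivAt (fun ζ : ℂ => f (z + ζ • w))
          (deriv (fun ζ : ℂ => f (z + ζ • w)) 0) (((0:ℝ):ℂ) * c) := by simpa using h1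
        exact h8.scomp (0:ℝ) h7
      refine h3.unique (h6.congr_of_eventuallyEq (Eventually.of_forall fun t => ?_))
      simp only [mul_smul, Complex.coe_smul]
    have h3 := h2 1
    rw [one_smul, one_smul] at h3
    rw [h2 c, h3]
  let L : Cn n →L[ℂ] ℂ :=
    { toFun := fderiv ℝ f z
      map_add' := fun x y => map_add _ x y
      map_smul' := fun c x => key c x
      cont := (fderiv ℝ f z).cont }
  exact (hasFDerivAt_of_restrictScalars ℝ (f' := L) hd.hasFDerivAt (by ext; rfl)).differentiableAt

lemma differentiableOn_of_line {f : Cn n → ℂ} {U : Set (Cn n)} (hU : IsOpen U)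
    (hc : ContinuousOn f U)
    (hl : ∀ x ∈ U, ∀ w, DifferentiableAt ℂ (fun ζ : ℂ => f (x + ζ • w)) 0) :
    DifferentiableOn ℂ f U := fun z hz =>
  (differentiableAt_of_line ((contDiffAt_of_line hU hc hl hz).differentiableAt (by simp))
    (hl z hz)).differentiableWithinAt

lemma differentiableAt_line {f : Cn n → ℂ} {z : Cn n} (h : DifferentiableAt ℂ f z) (w : Cn n) :
    DifferentiableAt ℂ (fun ζ : ℂ => f (z + ζ • w)) 0 := by
  have h1 : DifferentiableAt ℂ f (z + (0:ℂ) • w) := by simpa using h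
  exact h1.comp (f := fun ζ : ℂ => z + ζ • w) 0 (by fun_prop)

/-- Holomorphic functions are smooth. -/
lemma DifferentiableOn.contDiffAt_real {f : Cn n → ℂ} {U : Set (Cn n)} (hU : IsOpen U)
    (hf : DifferentiableOn ℂ f U) {z : Cn n} (hz : z ∈ U) : ContDiffAt ℝ ∞ f z :=
  contDiffAt_of_line hU hf.continuousOn
    (fun _ hx => differentiableAt_line (hf.differentiableAt (hU.mem_nhds hx))) hz

lemma moll_eq_self_of_differentiableOn {f : Cn n → ℂ} {U : Set (Cn n)} (hU : IsOpen U)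
    (hf : DifferentiableOn ℂ f U) {z : Cn n} {ε : ℝ} (hε : 0 < ε)
    (hz : Metric.closedBall z ε ⊆ U) : moll ε f z = f z :=
  moll_eq_self_of_line hε (hf.continuousOn.mono hz)
    fun _ hx => differentiableAt_line (hf.differentiableAt (hU.mem_nhds (hz hx)))

/-- Locally uniform limits of holomorphic functions are holomorphic. -/
lemma differentiableOn_of_tendstoLocallyUniformlyOn {ι : Type*} {l : Filter ι} [l.NeBot]
    {F : ι → Cn n → ℂ} {f : Cn n → ℂ} {U : Set (Cn n)} (hU : IsOpen U)
    (hF : ∀ᶠ i in l, DifferentiableOn ℂ (F i) U) (h : TendstoLocallyUniformlyOn F f l U) :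
    DifferentiableOn ℂ f U := by
  refine differentiableOn_of_line hU
    (h.continuousOn (hF.mono fun i hi => hi.continuousOn).frequently) fun x hx w => ?_
  set p : ℂ → Cn n := fun ζ => x + ζ • w
  have hp : Continuous p := by fun_prop
  have hV : IsOpen (p ⁻¹' U) := hU.preimage hp
  have h0 : (0:ℂ) ∈ p ⁻¹' U := by simpa [p] using hx
  have h1 : TendstoLocallyUniformlyOn (fun i => F i ∘ p) (f ∘ p) l (p ⁻¹' U) :=
    h.comp p (Set.mapsTo_preimage _ _) hp.continuousOn
  have h2 : DifferentiableOn ℂ (f ∘ p) (p ⁻¹' U) := by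
    refine h1.differentiableOn (hF.mono fun i hi => ?_) hV
    exact hi.comp (by fun_prop) (Set.mapsTo_preimage _ _)
  exact h2.differentiableAt (hV.mem_nhds h0)

/-- The Cauchy-Schwarz inequality for lower integrals. -/
lemma lintegral_mul_sq_le {α : Type*} [MeasurableSpace α] (μ : Measure α) {f g : α → ℝ≥0∞}
    (hf : AEMeasurable f μ) (hg : AEMeasurable g μ) :
    (∫⁻ a, f a * g a ∂μ) ^ 2 ≤ (∫⁻ a, f a ^ 2 ∂μ) * ∫⁻ a, g a ^ 2 ∂μ := by
  have h := ENNReal.lintegral_mul_le_Lp_mul_Lq μ (p := 2) (q := 2)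
    (by constructor <;> norm_num) hf hg
  simp only [Pi.mul_apply] at h
  have h2 : ∀ x : ℝ≥0∞, (x ^ (1 / (2:ℝ))) ^ 2 = x := fun x => by
    rw [← ENNReal.rpow_natCast, ← ENNReal.rpow_mul]; norm_num
  have h3 : ∀ x : ℝ≥0∞, x ^ (2:ℝ) = x ^ 2 := fun x => by
    rw [← ENNReal.rpow_natCast]; norm_num
  simp only [h3] at h
  calc _ ≤ _ := pow_le_pow_left' h 2
    _ = _ := by rw [mul_pow, h2, h2]

/-- Jensen's inequality for the mollifier. -/
lemma lintegral_rho_mul_sq_le {ε : ℝ} (hε : 0 < ε) {g : Cn n → ℝ≥0∞} (hg : Measurable g) :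
    (∫⁻ y, ENNReal.ofReal (rho ε y) * g y) ^ 2 ≤ ∫⁻ y, ENNReal.ofReal (rho ε y) * g y ^ 2 := by
  have hr : Measurable fun y : Cn n => ENNReal.ofReal (rho ε y) :=
    (continuous_rho ε).measurable.ennreal_ofReal
  set μ : Measure (Cn n) := volume.withDensity fun y => ENNReal.ofReal (rho ε y)
  have h1 : ∫⁻ y, ENNReal.ofReal (rho ε y) * g y = ∫⁻ y, g y ∂μ := by
    rw [lintegral_withDensity_eq_lintegral_mul _ hr hg]; rfl
  have h2 : ∫⁻ y, ENNReal.ofReal (rho ε y) * g y ^ 2 = ∫⁻ y, g y ^ 2 ∂μ := by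
    rw [lintegral_withDensity_eq_lintegral_mul _ hr (hg.pow_const 2)]; rfl
  have h3 : ∫⁻ _, 1 ∂μ = 1 := by
    rw [lintegral_one, withDensity_apply _ MeasurableSet.univ, Measure.restrict_univ,
      ← ofReal_integral_eq_lintegral_ofReal (integrable_rho hε) (ae_of_all _ (rho_nonneg ε)),
      integral_rho hε, ENNReal.ofReal_one]
  have h4 := lintegral_mul_sq_le μ (f := fun _ => 1) (g := g) aemeasurable_const hg.aemeasurable
  simp only [one_mul, one_pow, h3] at h4
  rwa [h1, h2]

lemma exists_rho_le {ε : ℝ} (hε : 0 < ε) : ∃ C : ℝ, 0 < C ∧ ∀ y : Cn n, rho ε y ≤ C := by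
  obtain ⟨C, hC⟩ := (hasCompactSupport_rho (n := n) hε).exists_bound_of_continuous (continuous_rho ε)
  refine ⟨|C| + 1, by positivity, fun y => ?_⟩
  have := hC y
  rw [Real.norm_of_nonneg (rho_nonneg ε y)] at this
  linarith [le_abs_self C]

/-- The values of a holomorphic function are controlled by its local `L²` norm. -/
lemma exists_sq_le_lintegral {ε : ℝ} (hε : 0 < ε) : ∃ C : ℝ≥0∞, C ≠ ⊤ ∧
    ∀ (f : Cn n → ℂ) (U : Set (Cn n)), IsOpen U → DifferentiableOn ℂ f U →
    ∀ z, Metric.closedBall z ε ⊆ U → ‖f z‖ₑ ^ 2 ≤ C * ∫⁻ y in Metric.ball z ε, ‖f y‖ₑ ^ 2 := by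
  obtain ⟨C, -, hC⟩ := exists_rho_le (n := n) hε
  refine ⟨ENNReal.ofReal C, ENNReal.ofReal_ne_top, fun f U hU hf z hz => ?_⟩
  set g := (Metric.ball z ε).indicator f
  have hg : Measurable g := (stronglyMeasurable_indicator_of_continuousOn
    Metric.isOpen_ball.measurableSet
      (hf.continuousOn.mono (Metric.ball_subset_closedBall.trans hz))).measurable
  have h1 : f z = ∫ y, rho ε y • g (z - y) := by
    rw [← moll_eq_self_of_differentiableOn hU hf hε hz, ← moll_apply]
    refine moll_congr hε fun y hy => (Set.indicator_of_mem ?_ f).symm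
    simpa [dist_eq_norm] using hy
  calc ‖f z‖ₑ ^ 2 ≤ (∫⁻ y, ENNReal.ofReal (rho ε y) * ‖g (z - y)‖ₑ) ^ 2 := by
        gcongr
        rw [h1]
        refine (enorm_integral_le_lintegral_enorm _).trans_eq ?_
        congr 1; ext y
        rw [enorm_smul, Real.enorm_of_nonneg (rho_nonneg ε y)]
    _ ≤ ∫⁻ y, ENNReal.ofReal (rho ε y) * ‖g (z - y)‖ₑ ^ 2 :=
        lintegral_rho_mul_sq_le hε (hg.comp (measurable_const.sub measurable_id)).enorm
    _ ≤ ∫⁻ y, ENNReal.ofReal C * ‖g (z - y)‖ₑ ^ 2 := by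
        gcongr with y; exact hC y
    _ = ENNReal.ofReal C * ∫⁻ y, ‖g (z - y)‖ₑ ^ 2 :=
        lintegral_const_mul' _ _ ENNReal.ofReal_ne_top
    _ = ENNReal.ofReal C * ∫⁻ y, ‖g y‖ₑ ^ 2 := by
        rw [lintegral_sub_left_eq_self (fun y => ‖g y‖ₑ ^ 2) z]
    _ = _ := by
        rw [← lintegral_indicator Metric.isOpen_ball.measurableSet]
        congr 2; ext y
        simp only [g, Set.indicator]
        split_ifs <;> simp

/-- Bounded holomorphic functions are Lipschitz in the interior. -/
lemma norm_sub_le_of_bounded {f : Cn n → ℂ} {z : Cn n} {R M : ℝ}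
    (hf : DifferentiableOn ℂ f (Metric.ball z (2 * R))) (hR : 0 < R)
    (hM : ∀ x ∈ Metric.ball z (2 * R), ‖f x‖ ≤ M) {a b : Cn n} (ha : a ∈ Metric.ball z R)
    (hab : ‖b - a‖ < R) : ‖f b - f a‖ ≤ 2 * M / R * ‖b - a‖ := by
  rcases eq_or_ne b a with rfl | hne
  · simp
  have hpos : 0 < ‖b - a‖ := norm_pos_iff.2 (sub_ne_zero.2 hne)
  have hmem : ∀ ζ ∈ Metric.ball (0:ℂ) (R / ‖b - a‖), a + ζ • (b - a) ∈ Metric.ball z (2 * R) := by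
    intro ζ hζ
    have h1 : ‖ζ‖ < R / ‖b - a‖ := by simpa using hζ
    rw [lt_div_iff₀ hpos] at h1
    have h2 : ‖a - z‖ < R := by simpa [dist_eq_norm] using ha
    rw [Metric.mem_ball, dist_eq_norm]
    calc ‖a + ζ • (b - a) - z‖ = ‖(a - z) + ζ • (b - a)‖ := by congr 1; abel
      _ ≤ ‖a - z‖ + ‖ζ‖ * ‖b - a‖ := by rw [← norm_smul]; exact norm_add_le _ _
      _ < 2 * R := by linarith
  have h := Complex.dist_le_div_mul_dist_of_mapsTo_ball (f := fun ζ : ℂ => f (a + ζ • (b - a)))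
    (c := 0) (R₁ := R / ‖b - a‖) (R₂ := 2 * M) (z := 1)
    (hf.comp (by fun_prop) hmem) (fun ζ hζ => ?_) ?_
  · simp only [one_smul, add_sub_cancel, zero_smul, add_zero, dist_eq_norm, sub_zero,
      norm_one, mul_one] at h
    calc _ ≤ _ := h
      _ = _ := by field_simp
  · rw [Metric.mem_closedBall, dist_eq_norm]
    calc _ ≤ ‖f (a + ζ • (b - a))‖ + ‖f (a + (0:ℂ) • (b - a))‖ := norm_sub_le _ _
      _ ≤ M + M := add_le_add (hM _ (hmem ζ hζ)) (hM _ (hmem 0 (by simp; positivity)))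
      _ = 2 * M := by ring
  · simp only [Metric.mem_ball, dist_zero_right, norm_one]
    rwa [lt_div_iff₀ hpos, one_mul]

/-- Montel's theorem on balls. -/
lemma exists_tendstoUniformlyOn_of_bounded {F : ℕ → Cn n → ℂ} {z : Cn n} {R M : ℝ} (hR : 0 < R)
    (hF : ∀ k, DifferentiableOn ℂ (F k) (Metric.ball z (2 * R)))
    (hM : ∀ k, ∀ x ∈ Metric.ball z (2 * R), ‖F k x‖ ≤ M) :
    ∃ (f : Cn n → ℂ) (φ : ℕ → ℕ), Tendsto φ atTop atTop ∧
      TendstoUniformlyOn (fun k => F (φ k)) f atTop (Metric.ball z R) ∧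
      DifferentiableOn ℂ f (Metric.ball z R) := by
  set 𝒰 := hyperfilter ℕ
  have hsub : Metric.ball z R ⊆ Metric.ball z (2 * R) := Metric.ball_subset_ball (by linarith)
  have hM0 : 0 ≤ M := (norm_nonneg _).trans (hM 0 z (Metric.mem_ball_self (by linarith)))
  have hlim : ∀ x ∈ Metric.ball z R, ∃ y, Tendsto (fun k => F k x) 𝒰 (𝓝 y) := by
    intro x hx
    have hc : IsCompact (Metric.closedBall (0:ℂ) M) := isCompact_closedBall _ _
    obtain ⟨y, -, hy⟩ := hc.ultrafilter_le_nhds (𝒰.map fun k => F k x) (by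
      simp only [Ultrafilter.coe_map, le_principal_iff, mem_map]
      exact Eventually.of_forall fun k => by simpa using hM k x (hsub hx))
    exact ⟨y, hy⟩
  choose! f hf using hlim
  have hunif : ∀ ε > 0, ∀ᶠ k in (𝒰 : Filter ℕ), ∀ x ∈ Metric.ball z R, ‖F k x - f x‖ < ε := by
    intro ε hε
    set δ := min R (ε * R / (8 * (M + 1)))
    have hδ : 0 < δ := lt_min hR (by positivity)
    have hLδ : 2 * M / R * δ ≤ ε / 4 := by
      calc 2 * M / R * δ ≤ 2 * M / R * (ε * R / (8 * (M + 1))) := by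
            gcongr; exact min_le_right _ _
        _ = ε / 4 * (M / (M + 1)) := by field_simp; ring
        _ ≤ ε / 4 * 1 := by
            gcongr; rw [div_le_one (by linarith)]; linarith
        _ = ε / 4 := mul_one _
    have hLip : ∀ k, ∀ a ∈ Metric.ball z R, ∀ x, ‖x - a‖ < δ → ‖F k x - F k a‖ ≤ ε / 4 := by
      intro k a ha x hxa
      refine (norm_sub_le_of_bounded (hF k) hR (hM k) ha (hxa.trans_le (min_le_left _ _))).trans ?_
      refine le_trans ?_ hLδ
      gcongr
    obtain ⟨t, hts, htf, ht⟩ := Metric.finite_approx_of_totallyBounded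
      ((isCompact_closedBall z R).totallyBounded.subset Metric.ball_subset_closedBall) δ hδ
    have hev : ∀ᶠ k in (𝒰 : Filter ℕ), ∀ a ∈ t, ‖F k a - f a‖ < ε / 4 := by
      rw [Filter.eventually_all_finite htf]
      intro a ha
      have := Metric.tendsto_nhds.1 (hf a (hts ha)) (ε / 4) (by positivity)
      simpa [dist_eq_norm] using this
    filter_upwards [hev] with k hk x hx
    obtain ⟨a, hat, hxa⟩ := Set.mem_iUnion₂.1 (ht hx)
    rw [Metric.mem_ball, dist_eq_norm] at hxa
    have h1 := hLip k a (hts hat) x hxa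
    have h2 : ‖f x - f a‖ ≤ ε / 4 :=
      le_of_tendsto ((hf x hx).sub (hf a (hts hat))).norm
        (Eventually.of_forall fun j => hLip j a (hts hat) x hxa)
    calc ‖F k x - f x‖ = ‖(F k x - F k a) + (F k a - f a) - (f x - f a)‖ := by congr 1; ring
      _ ≤ ‖F k x - F k a‖ + ‖F k a - f a‖ + ‖f x - f a‖ :=
          (norm_sub_le _ _).trans (add_le_add_left (norm_add_le _ _) _)
      _ < ε := by linarith [hk a hat]
  have hex : ∀ j : ℕ, ∃ k, j ≤ k ∧ ∀ x ∈ Metric.ball z R, ‖F k x - f x‖ < 1 / ((j:ℝ) + 1) := by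
    intro j
    have h1 := hunif (1 / ((j:ℝ) + 1)) (by positivity)
    have h2 : ∀ᶠ k in (𝒰 : Filter ℕ), j ≤ k := Nat.hyperfilter_le_atTop (eventually_ge_atTop j)
    exact (h2.and h1).exists
  choose φ hφ1 hφ2 using hex
  have hφ : Tendsto φ atTop atTop := tendsto_atTop_mono hφ1 tendsto_id
  have hu : TendstoUniformlyOn (fun k => F (φ k)) f atTop (Metric.ball z R) := by
    rw [Metric.tendstoUniformlyOn_iff]
    intro ε hε
    obtain ⟨N, hN⟩ := exists_nat_one_div_lt hε
    filter_upwards [eventually_ge_atTop N] with k hk x hx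
    rw [dist_comm, dist_eq_norm]
    refine (hφ2 k x hx).trans (lt_of_le_of_lt ?_ hN)
    gcongr
  refine ⟨f, φ, hφ, hu, ?_⟩
  exact differentiableOn_of_tendstoLocallyUniformlyOn Metric.isOpen_ball
    (Eventually.of_forall fun k => (hF (φ k)).mono hsub) hu.tendstoLocallyUniformlyOn

/-! ### The sub-mean value inequality on discs -/

lemma mean_re_of_differentiable {Q : ℂ → ℂ} (hQ : Differentiable ℂ Q) (a : ℂ) (r : ℝ) :
    (2 * Real.pi)⁻¹ * ∫ θ in (0:ℝ)..(2 * Real.pi),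
      (Q (a + r * Complex.exp (Complex.I * θ))).re = (Q a).re := by
  have h := hQ.diffContOnCl.circleAverage (c := a) (R := r)
  rw [Real.circleAverage_def] at h
  rw [← h, Complex.smul_re, smul_eq_mul]
  congr 1
  have h2 := Complex.reCLM.intervalIntegral_comp_comm (μ := volume) (a := 0) (b := 2 * Real.pi)
    (f := fun θ => Q (circleMap a r θ))
    ((hQ.continuous.comp (continuous_circleMap a r)).intervalIntegrable _ _)
  simp only [Complex.reCLM_apply] at h2
  rw [← h2]
  simp only [circleMap, mul_comm Complex.I]

/-- Maximum principle for functions satisfying a local sub-mean value inequality. -/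
lemma le_re_of_submean {h : ℂ → ℝ} (husc : UpperSemicontinuousOn h (Metric.closedBall 0 1))
    (hint : ∀ a r, 0 ≤ r → Metric.closedBall a r ⊆ Metric.closedBall (0:ℂ) 1 →
      IntervalIntegrable (fun θ : ℝ => h (a + r * Complex.exp (Complex.I * θ))) volume 0 (2 * Real.pi))
    (hsub : ∀ a ∈ Metric.ball (0:ℂ) 1, ∃ ε > 0, ∀ r : ℝ, 0 < r → r < ε →
      h a ≤ (2 * Real.pi)⁻¹ * ∫ θ in (0:ℝ)..(2 * Real.pi), h (a + r * Complex.exp (Complex.I * θ)))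
    {P : ℂ → ℂ} (hP : Differentiable ℂ P) (hle : ∀ ζ : ℂ, ‖ζ‖ = 1 → h ζ ≤ (P ζ).re) :
    h 0 ≤ (P 0).re := by
  refine le_of_forall_pos_le_add fun δ hδ => ?_
  set k : ℂ → ℝ := fun ζ => h ζ + (-(P ζ).re + δ * ‖ζ‖ ^ 2) with hk
  have hcont : Continuous fun ζ : ℂ => -(P ζ).re + δ * ‖ζ‖ ^ 2 := by
    have := hP.continuous
    fun_prop
  have hkusc : UpperSemicontinuousOn k (Metric.closedBall 0 1) :=
    husc.add hcont.continuousOn.upperSemicontinuousOn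
  obtain ⟨a, ha, hmax⟩ := UpperSemicontinuousOn.exists_isMaxOn ⟨0, by simp⟩
    (isCompact_closedBall (0:ℂ) 1) hkusc
  have h0 : k 0 ≤ k a := hmax (by simp)
  have hk0 : k 0 = h 0 - (P 0).re := by simp [hk]; ring
  have ha1 : ‖a‖ ≤ 1 := by simpa using ha
  rcases ha1.lt_or_eq with hlt | heq
  · exfalso
    obtain ⟨ε, hε, hs⟩ := hsub a (by simpa using hlt)
    set r := min (ε / 2) (1 - ‖a‖)
    have hr : 0 < r := lt_min (by positivity) (by linarith)
    have hrε : r < ε := (min_le_left _ _).trans_lt (by linarith)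
    have hra : r ≤ 1 - ‖a‖ := min_le_right _ _
    have hsubset : Metric.closedBall a r ⊆ Metric.closedBall (0:ℂ) 1 := by
      apply Metric.closedBall_subset_closedBall'
      rw [dist_zero_right]; linarith
    have h1 := hs r hr hrε
    set Q : ℂ → ℂ := fun ζ => -P ζ + 2 * δ * (starRingEnd ℂ a) * (ζ - a) with hQ
    have hQd : Differentiable ℂ Q := by fun_prop
    have h2 := mean_re_of_differentiable hQd a r
    have hki := hint a r hr.le hsubset
    have hQi : IntervalIntegrable (fun θ : ℝ => (Q (a + r * Complex.exp (Complex.I * θ))).re)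
        volume 0 (2 * Real.pi) := by
      have := hQd.continuous
      exact Continuous.intervalIntegrable (by fun_prop) _ _
    have h3 : ∀ θ : ℝ, k (a + r * Complex.exp (Complex.I * θ)) =
        h (a + r * Complex.exp (Complex.I * θ)) + (Q (a + r * Complex.exp (Complex.I * θ))).re
          + δ * (‖a‖ ^ 2 + r ^ 2) := by
      intro θ
      simp only [hk, hQ]
      set e := Complex.exp (Complex.I * θ) with he
      have hne : ‖(r:ℂ) * e‖ ^ 2 = r ^ 2 := by rw [norm_mul, he, norm_exp_I_mul]; simp
      have hn : ‖a + r * e‖ ^ 2 = ‖a‖ ^ 2 + ‖(r:ℂ) * e‖ ^ 2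
          + 2 * ((starRingEnd ℂ a) * (r * e)).re := by
        rw [← Complex.normSq_eq_norm_sq, Complex.normSq_add, Complex.normSq_eq_norm_sq,
          Complex.normSq_eq_norm_sq]
        congr 2
        rw [← Complex.conj_re]; simp [mul_comm]
      rw [hn, hne]
      have : ((2:ℂ) * δ * (starRingEnd ℂ a) * (a + r * e - a)).re =
          2 * δ * ((starRingEnd ℂ a) * (r * e)).re := by
        rw [← Complex.re_ofReal_mul]; push_cast; congr 1; ring
      rw [Complex.add_re, this, Complex.neg_re]; ring
    have h4 : (2 * Real.pi)⁻¹ * ∫ θ in (0:ℝ)..(2 * Real.pi), k (a + r * Complex.exp (Complex.I * θ))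
        ≤ k a := by
      have hpi : (0:ℝ) < 2 * Real.pi := by positivity
      have : ∫ θ in (0:ℝ)..(2 * Real.pi), k (a + r * Complex.exp (Complex.I * θ)) ≤
          ∫ θ in (0:ℝ)..(2 * Real.pi), k a := by
        apply intervalIntegral.integral_mono hpi.le _ (by simp)
        · intro θ
          apply hmax
          apply hsubset
          simp [dist_eq_norm, abs_of_pos hr]
        · simp only [h3]
          exact (hki.add hQi).add (by simp)
      rw [intervalIntegral.integral_const, smul_eq_mul, sub_zero] at this
      rw [inv_mul_le_iff₀ hpi]; exact this
    simp only [h3] at h4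
    rw [intervalIntegral.integral_add (hki.add hQi) (by simp),
      intervalIntegral.integral_add hki hQi, intervalIntegral.integral_const] at h4
    have hpi : (2:ℝ) * Real.pi ≠ 0 := by positivity
    rw [mul_add, mul_add, h2, sub_zero, smul_eq_mul, inv_mul_cancel_left₀ hpi] at h4
    have hQa : (Q a).re = -(P a).re := by simp [hQ]
    have hka : k a = h a + (-(P a).re + δ * ‖a‖ ^ 2) := rfl
    have := mul_pos hδ (pow_pos hr 2)
    rw [hQa] at h4
    linarith
  · have hka : k a = h a + (-(P a).re + δ * ‖a‖ ^ 2) := rfl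
    rw [heq] at hka
    have := hle a heq
    linarith

/-- Continuous functions on the circle are approximated by real parts of entire functions. -/
lemma exists_entire_re_approx (c : C(AddCircle (2 * Real.pi), ℝ)) {δ : ℝ} (hδ : 0 < δ) :
    ∃ P : ℂ → ℂ, Differentiable ℂ P ∧
      ∀ θ : ℝ, |(P (Complex.exp (Complex.I * θ))).re - c (θ : AddCircle (2 * Real.pi))| < δ := by
  have : Fact ((0:ℝ) < 2 * Real.pi) := ⟨by positivity⟩
  set cc : C(AddCircle (2 * Real.pi), ℂ) := ⟨fun x => (c x : ℂ), by fun_prop⟩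
  have hmem : cc ∈ (Submodule.span ℂ (Set.range (@fourier (2 * Real.pi)))).topologicalClosure := by
    rw [span_fourier_closure_eq_top]; trivial
  obtain ⟨g, hg, hgc⟩ := Metric.mem_closure_iff.1 hmem δ hδ
  have key : ∃ P₁ P₂ : ℂ → ℂ, Differentiable ℂ P₁ ∧ Differentiable ℂ P₂ ∧ ∀ θ : ℝ,
      g (θ : AddCircle (2 * Real.pi)) = P₁ (Complex.exp (Complex.I * θ)) +
        starRingEnd ℂ (P₂ (Complex.exp (Complex.I * θ))) := by
    refine Submodule.span_induction (p := fun g _ => ∃ P₁ P₂ : ℂ → ℂ, Differentiable ℂ P₁ ∧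
      Differentiable ℂ P₂ ∧ ∀ θ : ℝ,
      g (θ : AddCircle (2 * Real.pi)) = P₁ (Complex.exp (Complex.I * θ)) +
        starRingEnd ℂ (P₂ (Complex.exp (Complex.I * θ)))) ?_ ?_ ?_ ?_ hg
    · rintro _ ⟨k, rfl⟩
      have hf : ∀ θ : ℝ, fourier k (θ : AddCircle (2 * Real.pi)) =
          Complex.exp (Complex.I * (k * θ)) := by
        intro θ
        rw [fourier_coe_apply]
        congr 1
        have : (Real.pi : ℂ) ≠ 0 := by exact_mod_cast Real.pi_ne_zero
        push_cast
        field_simp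
      rcases le_total 0 k with hk | hk
      · lift k to ℕ using hk
        refine ⟨fun ζ => ζ ^ k, fun _ => 0, by fun_prop, by fun_prop, fun θ => ?_⟩
        beta_reduce
        rw [hf, ← Complex.exp_nat_mul]
        simp; ring_nf
      · obtain ⟨j, rfl⟩ : ∃ j : ℕ, k = -j := ⟨k.natAbs, by omega⟩
        refine ⟨fun _ => 0, fun ζ => ζ ^ j, by fun_prop, by fun_prop, fun θ => ?_⟩
        beta_reduce
        rw [hf, ← Complex.exp_nat_mul, ← Complex.exp_conj]
        simp; ring_nf
    · exact ⟨fun _ => 0, fun _ => 0, by fun_prop, by fun_prop, fun θ => by simp⟩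
    · rintro x y - - ⟨P₁, P₂, h1, h2, h⟩ ⟨P₁', P₂', h1', h2', h'⟩
      refine ⟨fun ζ => P₁ ζ + P₁' ζ, fun ζ => P₂ ζ + P₂' ζ, h1.add h1', h2.add h2', fun θ => ?_⟩
      simp only [ContinuousMap.add_apply, h θ, h' θ, map_add]; ring
    · rintro a x - ⟨P₁, P₂, h1, h2, h⟩
      refine ⟨fun ζ => a * P₁ ζ, fun ζ => starRingEnd ℂ a * P₂ ζ, h1.const_mul _, h2.const_mul _,
        fun θ => ?_⟩
      simp only [ContinuousMap.smul_apply, h θ, map_mul, smul_eq_mul, Complex.conj_conj]; ring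
  obtain ⟨P₁, P₂, h1, h2, h⟩ := key
  refine ⟨fun ζ => P₁ ζ + P₂ ζ, h1.add h2, fun θ => ?_⟩
  have h3 : dist (cc θ) (g θ) < δ := (ContinuousMap.dist_apply_le_dist _).trans_lt hgc
  rw [dist_comm, dist_eq_norm] at h3
  refine lt_of_le_of_lt ?_ h3
  have h4 : (P₁ (Complex.exp (Complex.I * θ)) + P₂ (Complex.exp (Complex.I * θ))).re
      - c (θ : AddCircle (2 * Real.pi)) = (g θ - cc θ).re := by
    rw [h θ]
    simp [cc]
  rw [h4]
  exact Complex.abs_re_le_norm _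

/-- A bounded upper semicontinuous function is a limit of continuous majorants. -/
lemma exists_continuous_majorants {X : Type*} [PseudoMetricSpace X] {H : X → ℝ}
    (hH : UpperSemicontinuous H) {C : ℝ} (hC : ∀ x, |H x| ≤ C) :
    ∃ c : ℕ → C(X, ℝ), (∀ k x, H x ≤ c k x) ∧ (∀ k x, |c k x| ≤ C) ∧
      ∀ x, Tendsto (fun k => c k x) atTop (𝓝 (H x)) := by
  rcases isEmpty_or_nonempty X with hX | hX
  · exact ⟨fun _ => 0, fun _ x => hX.elim x, fun _ x => hX.elim x, fun x => hX.elim x⟩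
  set f : ℕ → X → ℝ := fun k x => ⨆ y, (H y - k * dist x y) with hf
  have hbdd : ∀ (k : ℕ) (x : X), BddAbove (Set.range fun y => H y - k * dist x y) := fun k x => by
    refine ⟨C, ?_⟩
    rintro _ ⟨y, rfl⟩
    have := (abs_le.1 (hC y)).2
    have h2 : 0 ≤ (k:ℝ) * dist x y := mul_nonneg k.cast_nonneg dist_nonneg
    simp only; linarith
  have hge : ∀ k x, H x ≤ f k x := fun k x => by
    simpa using le_ciSup (hbdd k x) x
  have hle : ∀ k x, f k x ≤ C := fun k x => ciSup_le fun y => by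
    have := (abs_le.1 (hC y)).2
    have h2 : 0 ≤ (k:ℝ) * dist x y := by positivity
    linarith
  have hlip : ∀ k : ℕ, Continuous (f k) := fun k => by
    have : LipschitzWith k (f k) := by
      apply LipschitzWith.of_le_add_mul
      intro x y
      refine ciSup_le fun w => ?_
      have h1 := le_ciSup (hbdd k y) w
      have h2 : dist y w ≤ dist x y + dist x w := by
        rw [dist_comm x y]; exact dist_triangle _ _ _
      have h3 : (k:ℝ) * dist y w ≤ k * (dist x y + dist x w) := by gcongr
      simp only [NNReal.coe_natCast]
      simp only [hf] at h1 ⊢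
      linarith
    exact this.continuous
  refine ⟨fun k => ⟨f k, hlip k⟩, hge, fun k x => abs_le.2 ⟨?_, hle k x⟩, fun x => ?_⟩
  · exact (abs_le.1 (hC x)).1.trans (hge k x)
  · rw [Metric.tendsto_atTop]
    intro ε hε
    obtain ⟨δ, hδ, hball⟩ := Metric.eventually_nhds_iff.1 (hH x (H x + ε / 2) (by linarith))
    obtain ⟨N, hN⟩ := exists_nat_gt (2 * C / δ)
    refine ⟨N, fun k hk => ?_⟩
    have hup : f k x ≤ H x + ε / 2 := by
      refine ciSup_le fun y => ?_
      rcases lt_or_ge (dist x y) δ with h | h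
      · have := hball (y := y) (by rwa [dist_comm])
        have h2 : 0 ≤ (k:ℝ) * dist x y := by positivity
        linarith
      · have h1 : 2 * C ≤ k * dist x y := by
          rw [div_lt_iff₀ hδ] at hN
          have : (N:ℝ) * δ ≤ k * dist x y := by gcongr
          linarith
        have := (abs_le.1 (hC y)).2
        have := (abs_le.1 (hC x)).1
        linarith
    rw [Real.dist_eq, abs_lt]
    have := hge k x
    simp only [ContinuousMap.coe_mk]
    constructor <;> linarith

lemma intervalIntegrable_of_usc_bounded {h : ℝ → ℝ} (hu : UpperSemicontinuous h) {C : ℝ}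
    (hC : ∀ x, |h x| ≤ C) (a b : ℝ) : IntervalIntegrable h volume a b := by
  rw [intervalIntegrable_iff]
  refine Measure.integrableOn_of_bounded (M := C) (by simp) hu.measurable.aestronglyMeasurable
    (ae_of_all _ fun x => ?_)
  simpa using hC x

/-- The sub-mean value inequality on a disc from the local one. -/
lemma submean_disc {h : ℂ → ℝ} (husc : UpperSemicontinuousOn h (Metric.closedBall 0 1)) {C : ℝ}
    (hC : ∀ ζ ∈ Metric.closedBall (0:ℂ) 1, |h ζ| ≤ C)
    (hsub : ∀ a ∈ Metric.ball (0:ℂ) 1, ∃ ε > 0, ∀ r : ℝ, 0 < r → r < ε →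
      h a ≤ (2 * Real.pi)⁻¹ * ∫ θ in (0:ℝ)..(2 * Real.pi),
        h (a + r * Complex.exp (Complex.I * θ))) :
    h 0 ≤ (2 * Real.pi)⁻¹ * ∫ θ in (0:ℝ)..(2 * Real.pi), h (Complex.exp (Complex.I * θ)) := by
  have : Fact ((0:ℝ) < 2 * Real.pi) := ⟨by positivity⟩
  have hpi : (0:ℝ) < 2 * Real.pi := by positivity
  have hnn : ∀ a r, 0 ≤ r → Metric.closedBall a r ⊆ Metric.closedBall (0:ℂ) 1 →
      IntervalIntegrable (fun θ : ℝ => h (a + r * Complex.exp (Complex.I * θ)))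
        volume 0 (2 * Real.pi) := by
    intro a r hr har
    have hm : ∀ θ : ℝ, a + r * Complex.exp (Complex.I * θ) ∈ Metric.closedBall (0:ℂ) 1 := by
      intro θ
      apply har
      simp [dist_eq_norm, abs_of_nonneg hr]
    apply intervalIntegrable_of_usc_bounded (C := C) _ fun θ => hC _ (hm θ)
    rw [← upperSemicontinuousOn_univ_iff]
    exact husc.comp (g := fun θ : ℝ => a + r * Complex.exp (Complex.I * θ))
      (by fun_prop) fun θ _ => hm θ
  set H : AddCircle (2 * Real.pi) → ℝ := fun x => h (AddCircle.toCircle x : ℂ) with hHdef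
  have hcirc : ∀ x : AddCircle (2 * Real.pi),
      (AddCircle.toCircle x : ℂ) ∈ Metric.closedBall (0:ℂ) 1 := fun x => by
    rw [mem_closedBall_zero_iff]; exact (Circle.norm_coe _).le
  have hHθ : ∀ θ : ℝ, H θ = h (Complex.exp (Complex.I * θ)) := by
    intro θ
    simp only [hHdef, AddCircle.toCircle_apply_mk, Circle.coe_exp]
    congr 2
    have : (Real.pi : ℂ) ≠ 0 := by exact_mod_cast Real.pi_ne_zero
    push_cast
    field_simp
  have hHusc : UpperSemicontinuous H := by
    rw [← upperSemicontinuousOn_univ_iff]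
    exact husc.comp (g := fun x : AddCircle (2 * Real.pi) => (AddCircle.toCircle x : ℂ))
      (by have := AddCircle.continuous_toCircle (T := 2 * Real.pi); fun_prop) fun x _ => hcirc x
  obtain ⟨c, hc1, hc2, hc3⟩ := exists_continuous_majorants hHusc fun x => hC _ (hcirc x)
  have hck : ∀ k, h 0 ≤ (2 * Real.pi)⁻¹ * ∫ θ in (0:ℝ)..(2 * Real.pi),
      c k (θ : AddCircle (2 * Real.pi)) := by
    intro k
    have hcc : Continuous fun θ : ℝ => c k (θ : AddCircle (2 * Real.pi)) :=
      (c k).continuous.comp (AddCircle.continuous_mk' _)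
    refine le_of_forall_pos_le_add fun δ hδ => ?_
    obtain ⟨P, hP, hPc⟩ := exists_entire_re_approx (c k) (half_pos hδ)
    have h1 := le_re_of_submean husc hnn hsub (P := fun ζ => P ζ + ((δ / 2 : ℝ) : ℂ))
      (hP.add_const _) (fun ζ hζ => ?_)
    · have h2 := mean_re_of_differentiable hP 0 1
      simp only [zero_add, Complex.ofReal_one, one_mul] at h2
      have h3 : ∫ θ in (0:ℝ)..(2 * Real.pi), (P (Complex.exp (Complex.I * θ))).re ≤
          ∫ θ in (0:ℝ)..(2 * Real.pi), (c k (θ : AddCircle (2 * Real.pi)) + δ / 2) := by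
        apply intervalIntegral.integral_mono hpi.le
        · have := hP.continuous
          exact Continuous.intervalIntegrable (by fun_prop) _ _
        · exact (hcc.add continuous_const).intervalIntegrable _ _
        · intro θ
          have := (abs_lt.1 (hPc θ)).2
          simp only; linarith
      rw [intervalIntegral.integral_add (hcc.intervalIntegrable _ _) (by simp),
        intervalIntegral.integral_const, smul_eq_mul, sub_zero] at h3
      have h4 := mul_le_mul_of_nonneg_left h3 (inv_nonneg.2 hpi.le)
      rw [h2, mul_add, inv_mul_cancel_left₀ hpi.ne'] at h4
      simp only [Complex.add_re, Complex.ofReal_re] at h1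
      linarith
    · have hζ' : ζ = Complex.exp (Complex.I * (Complex.arg ζ : ℝ)) := by
        conv_lhs => rw [← Complex.norm_mul_exp_arg_mul_I ζ, hζ]
        rw [mul_comm Complex.I]; simp
      have h5 := (abs_lt.1 (hPc (Complex.arg ζ))).1
      have h6 := hc1 k (Complex.arg ζ : ℝ)
      rw [hHθ, ← hζ'] at h6
      rw [← hζ'] at h5
      simp only [Complex.add_re, Complex.ofReal_re]
      linarith
  have hlim : Tendsto (fun k => ∫ θ in (0:ℝ)..(2 * Real.pi), c k (θ : AddCircle (2 * Real.pi)))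
      atTop (𝓝 (∫ θ in (0:ℝ)..(2 * Real.pi), h (Complex.exp (Complex.I * θ)))) := by
    apply intervalIntegral.tendsto_integral_filter_of_dominated_convergence (fun _ => C)
    · refine Eventually.of_forall fun k => ?_
      exact ((c k).continuous.comp (AddCircle.continuous_mk' _)).aestronglyMeasurable
    · exact Eventually.of_forall fun k => ae_of_all _ fun θ _ => by simpa using hc2 k θ
    · simp
    · refine ae_of_all _ fun θ _ => ?_
      rw [← hHθ]; exact hc3 _
  exact ge_of_tendsto (hlim.const_mul _) (Eventually.of_forall hck)

/-- The truncation `max u (-m)` as a real-valued function. -/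
def trunc (u : Cn n → EReal) (m : ℕ) (z : Cn n) : ℝ :=
  (max (u z) ((-(m : ℝ) : ℝ) : EReal)).toReal

lemma neg_le_trunc (u : Cn n → EReal) (m : ℕ) (z : Cn n) : -(m : ℝ) ≤ trunc u m z := by
  unfold trunc
  rcases eq_or_ne (max (u z) ((-(m : ℝ) : ℝ) : EReal)) ⊤ with h | h
  · rw [h]; simp
  · have h1 := EReal.toReal_le_toReal (le_max_right (u z) ((-(m : ℝ) : ℝ) : EReal))
      (EReal.coe_ne_bot _) h
    rwa [EReal.toReal_coe] at h1

lemma coe_trunc {u : Cn n → EReal} {m : ℕ} {z : Cn n} (h : u z < ⊤) :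
    ((trunc u m z : ℝ) : EReal) = max (u z) ((-(m : ℝ) : ℝ) : EReal) := by
  apply EReal.coe_toReal
  · exact (max_lt h (EReal.coe_lt_top _)).ne
  · exact (lt_of_lt_of_le (EReal.bot_lt_coe _) (le_max_right _ _)).ne'

lemma le_trunc {u : Cn n → EReal} {m : ℕ} {z : Cn n} (h : u z < ⊤) :
    u z ≤ (trunc u m z : EReal) := by
  rw [coe_trunc h]; exact le_max_left _ _

lemma trunc_le {u : Cn n → EReal} {m : ℕ} {z : Cn n} {a : ℝ} (h : u z ≤ a) (hm : -(m : ℝ) ≤ a) :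
    trunc u m z ≤ a := by
  rw [← EReal.coe_le_coe_iff, coe_trunc (h.trans_lt (EReal.coe_lt_top _))]
  exact max_le h (EReal.coe_le_coe_iff.2 hm)

lemma PSHOn.upperSemicontinuousOn_trunc {u : Cn n → EReal} {Ω : Set (Cn n)} (hu : PSHOn u Ω)
    (m : ℕ) : UpperSemicontinuousOn (trunc u m) Ω := by
  intro z hz a ha
  have h1 : u z < a := (le_trunc (hu.lt_top z hz)).trans_lt (EReal.coe_lt_coe_iff.2 ha)
  filter_upwards [hu.usc z hz a h1, self_mem_nhdsWithin] with y hy hyΩ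
  rw [← EReal.coe_lt_coe_iff, coe_trunc (hu.lt_top y hyΩ)]
  exact max_lt hy (EReal.coe_lt_coe_iff.2 ((neg_le_trunc u m z).trans_lt ha))

lemma PSHOn.trunc_submean {u : Cn n → EReal} {Ω : Set (Cn n)} (hu : PSHOn u Ω)
    (m : ℕ) {z : Cn n} (hz : z ∈ Ω) (w : Cn n) : ∃ ε > 0, ∀ r : ℝ, 0 < r → r < ε →
    trunc u m z ≤ (2 * Real.pi)⁻¹ * ∫ θ in (0:ℝ)..(2 * Real.pi),
      trunc u m (z + ((r : ℂ) * Complex.exp (Complex.I * (θ : ℂ))) • w) := by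
  obtain ⟨ε, hε, h⟩ := hu.submean z hz w
  refine ⟨ε, hε, fun r hr hrε => trunc_le ((h r hr hrε).trans (iInf_le _ m)) ?_⟩
  have hpi : (0:ℝ) < 2 * Real.pi := by positivity
  by_cases hi : IntervalIntegrable (fun θ : ℝ =>
      trunc u m (z + ((r : ℂ) * Complex.exp (Complex.I * (θ : ℂ))) • w)) volume 0 (2 * Real.pi)
  · have := intervalIntegral.integral_mono (μ := volume) hpi.le
      (intervalIntegrable_const (c := -(m:ℝ))) hi
      (fun θ => neg_le_trunc u m _)
    rw [intervalIntegral.integral_const, smul_eq_mul, sub_zero] at this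
    exact (le_inv_mul_iff₀ hpi).2 this
  · have := intervalIntegral.integral_undef hi
    exact le_of_le_of_eq (by simp) (congrArg (fun x => (2 * Real.pi)⁻¹ * x) this).symm

lemma bounded_trunc {u : Cn n → EReal} {Ω K : Set (Cn n)} (hu : PSHOn u Ω) (m : ℕ)
    (hK : IsCompact K) (hKΩ : K ⊆ Ω) : ∃ C, ∀ z ∈ K, |trunc u m z| ≤ C := by
  obtain ⟨C, hC⟩ := ((hu.upperSemicontinuousOn_trunc m).mono hKΩ).bddAbove_of_isCompact hK
  refine ⟨max C m, fun z hz => abs_le.2 ⟨?_, ?_⟩⟩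
  · have := neg_le_trunc u m z
    have := le_max_right C m
    linarith
  · exact (hC ⟨z, hz, rfl⟩).trans (le_max_left _ _)

/-- The sub-mean value inequality for truncations on all discs inside `Ω`. -/
lemma PSHOn.trunc_le_average {u : Cn n → EReal} {Ω : Set (Cn n)} (hu : PSHOn u Ω)
    (m : ℕ) {z w : Cn n} (hzw : ∀ ζ : ℂ, ‖ζ‖ ≤ 1 → z + ζ • w ∈ Ω) :
    trunc u m z ≤ (2 * Real.pi)⁻¹ * ∫ θ in (0:ℝ)..(2 * Real.pi),
      trunc u m (z + Complex.exp (Complex.I * (θ : ℂ)) • w) := by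
  have hmaps : Set.MapsTo (fun ζ : ℂ => z + ζ • w) (Metric.closedBall 0 1) Ω := fun ζ hζ =>
    hzw ζ (by simpa using hζ)
  have hcont : Continuous fun ζ : ℂ => z + ζ • w := by fun_prop
  obtain ⟨C, hC⟩ := bounded_trunc hu m ((isCompact_closedBall (0:ℂ) 1).image hcont)
    (Set.image_subset_iff.2 hmaps)
  have := submean_disc (h := fun ζ => trunc u m (z + ζ • w)) (C := C)
    ((hu.upperSemicontinuousOn_trunc m).comp hcont.continuousOn hmaps)
    (fun ζ hζ => hC _ ⟨ζ, hζ, rfl⟩) ?_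
  · simpa using this
  · intro a ha
    obtain ⟨ε, hε, h⟩ := hu.trunc_submean m (hmaps (Metric.ball_subset_closedBall ha)) w
    refine ⟨ε, hε, fun r hr hrε => ?_⟩
    simpa only [add_smul, add_assoc] using h r hr hrε

/-! ### Directional derivatives and the Levi form -/

section calculus
variable {E : Type*} [NormedAddCommGroup E] [NormedSpace ℝ E]

/-- The derivative of `f` in the real direction `a`. -/
def dirD (a : Cn n) (f : Cn n → E) (z : Cn n) : E := fderiv ℝ f z a

lemma ContDiff.diff {f : Cn n → E} (hf : ContDiff ℝ ∞ f) : Differentiable ℝ f :=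
  hf.differentiable (by simp)

lemma ContDiff.dirD {f : Cn n → E} (hf : ContDiff ℝ ∞ f) (a : Cn n) : ContDiff ℝ ∞ (dirD a f) :=
  (hf.fderiv_right (m := ∞) (by simp)).clm_apply contDiff_const

lemma dirD_add_dir (a b : Cn n) (f : Cn n → E) : dirD (a + b) f = dirD a f + dirD b f := by
  ext z; simp [dirD]

lemma dirD_smul_dir (c : ℝ) (a : Cn n) (f : Cn n → E) : dirD (c • a) f = c • dirD a f := by
  ext z; simp [dirD]

lemma dirD_sum_dir {ι : Type*} (s : Finset ι) (a : ι → Cn n) (f : Cn n → E) :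
    dirD (∑ i ∈ s, a i) f = ∑ i ∈ s, dirD (a i) f := by
  ext z; simp [dirD]

lemma dirD_add (a : Cn n) {f g : Cn n → E} (hf : ContDiff ℝ ∞ f) (hg : ContDiff ℝ ∞ g) :
    dirD a (fun z => f z + g z) = fun z => dirD a f z + dirD a g z := by
  ext z; simp [dirD, fderiv_fun_add (hf.diff z) (hg.diff z)]

lemma dirD_sub (a : Cn n) {f g : Cn n → E} (hf : ContDiff ℝ ∞ f) (hg : ContDiff ℝ ∞ g) :
    dirD a (fun z => f z - g z) = fun z => dirD a f z - dirD a g z := by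
  ext z; simp [dirD, fderiv_fun_sub (hf.diff z) (hg.diff z)]

lemma dirD_const (a : Cn n) (c : E) : dirD a (fun _ => c) = fun _ => 0 := by
  ext z; simp [dirD]

lemma dirD_sum (a : Cn n) {ι : Type*} (s : Finset ι) {f : ι → Cn n → E}
    (hf : ∀ i, ContDiff ℝ ∞ (f i)) :
    dirD a (fun z => ∑ i ∈ s, f i z) = fun z => ∑ i ∈ s, dirD a (f i) z := by
  ext z; simp [dirD, fderiv_fun_sum fun i _ => (hf i).diff z]

lemma dirD_mul (a : Cn n) {𝔸 : Type*} [NormedCommRing 𝔸] [NormedAlgebra ℝ 𝔸] {f g : Cn n → 𝔸}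
    (hf : ContDiff ℝ ∞ f) (hg : ContDiff ℝ ∞ g) :
    dirD a (fun z => f z * g z) = fun z => dirD a f z * g z + f z * dirD a g z := by
  ext z
  simp [dirD, fderiv_fun_mul (hf.diff z) (hg.diff z)]
  ring

lemma dirD_clm (a : Cn n) {F : Type*} [NormedAddCommGroup F] [NormedSpace ℝ F] (L : E →L[ℝ] F)
    {f : Cn n → E} (hf : ContDiff ℝ ∞ f) :
    dirD a (fun z => L (f z)) = fun z => L (dirD a f z) := by
  ext z
  have := (L.hasFDerivAt.comp z (hf.diff z).hasFDerivAt).fderiv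
  simp only [Function.comp_def] at this
  simp [dirD, this]

lemma dirD_ofReal (a : Cn n) {f : Cn n → ℝ} (hf : ContDiff ℝ ∞ f) :
    dirD a (fun z => (f z : ℂ)) = fun z => ((dirD a f z : ℝ) : ℂ) :=
  dirD_clm a Complex.ofRealCLM hf

lemma dirD_conj (a : Cn n) {f : Cn n → ℂ} (hf : ContDiff ℝ ∞ f) :
    dirD a (fun z => starRingEnd ℂ (f z)) = fun z => starRingEnd ℂ (dirD a f z) :=
  dirD_clm a (Complex.conjCLE : ℂ →L[ℝ] ℂ) hf

lemma dirD_const_mul (a : Cn n) {𝔸 : Type*} [NormedCommRing 𝔸] [NormedAlgebra ℝ 𝔸] (c : 𝔸)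
    {f : Cn n → 𝔸} (hf : ContDiff ℝ ∞ f) :
    dirD a (fun z => c * f z) = fun z => c * dirD a f z := by
  rw [dirD_mul a contDiff_const hf, dirD_const]; simp

lemma dirD_comp (a : Cn n) {χ : ℝ → ℝ} (hχ : ContDiff ℝ ∞ χ) {s : Cn n → ℝ}
    (hs : ContDiff ℝ ∞ s) :
    dirD a (fun z => χ (s z)) = fun z => deriv χ (s z) * dirD a s z := by
  ext z
  have h1 := ((hχ.differentiable (by simp) (s z)).hasDerivAt).comp_hasFDerivAt z
    (hs.diff z).hasFDerivAt
  have := h1.fderiv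
  simp only [Function.comp_def] at this
  simp [dirD, this]

lemma dirD_dirD_apply {f : Cn n → E} (hf : ContDiff ℝ ∞ f) (a b : Cn n) (z : Cn n) :
    dirD a (dirD b f) z = fderiv ℝ (fderiv ℝ f) z a b := by
  have h : DifferentiableAt ℝ (fderiv ℝ f) z :=
    (hf.fderiv_right (m := 1) (by norm_cast)).differentiable (by simp) z
  have := (h.hasFDerivAt.clm_apply (hasFDerivAt_const b z)).fderiv
  simp only [dirD]
  change fderiv ℝ (fun z => fderiv ℝ f z b) z a = _
  rw [this]; simp

lemma dirD_comm {f : Cn n → E} (hf : ContDiff ℝ ∞ f) (a b : Cn n) :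
    dirD a (dirD b f) = dirD b (dirD a f) := by
  ext z
  rw [dirD_dirD_apply hf, dirD_dirD_apply hf]
  exact (hf.contDiffAt.isSymmSndFDerivAt (by simp; norm_cast)).eq a b

end calculus

/-- The Levi form of a real function. -/
def levi (v : Cn n → ℝ) (z β : Cn n) : ℝ :=
  (dirD β (dirD β v) z + dirD (Complex.I • β) (dirD (Complex.I • β) v) z) / 4

/-- Second order Taylor expansion. -/
lemma taylor_two {v : Cn n → ℝ} (hv : ContDiff ℝ ∞ v) (z : Cn n) {ε : ℝ} (hε : 0 < ε) :
    ∃ δ > 0, ∀ y : Cn n, ‖y‖ < δ →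
      |v (z + y) - v z - fderiv ℝ v z y - (1/2) * fderiv ℝ (fderiv ℝ v) z y y| ≤ ε * ‖y‖ ^ 2 := by
  have h : HasFDerivAt (fderiv ℝ v) (fderiv ℝ (fderiv ℝ v) z) z :=
    ((hv.fderiv_right (m := 1) (by norm_cast)).differentiable (by simp) z).hasFDerivAt
  set A := fderiv ℝ (fderiv ℝ v) z
  have hsymm : ∀ a b, A a b = A b a := fun a b =>
    (hv.contDiffAt.isSymmSndFDerivAt (by simp; norm_cast)).eq a b
  obtain ⟨δ, hδ, hb⟩ := Metric.eventually_nhds_iff.1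
    ((hasFDerivAt_iff_isLittleO_nhds_zero.1 h).def hε)
  refine ⟨δ, hδ, fun y hy => ?_⟩
  set R : Cn n → ℝ := fun y => v (z + y) - v z - fderiv ℝ v z y - (1/2) * A y y with hR
  have hRd : ∀ x, HasFDerivAt R (fderiv ℝ v (z + x) - fderiv ℝ v z - A x) x := by
    intro x
    have h1 : HasFDerivAt (fun y => v (z + y)) (fderiv ℝ v (z + x)) x := by
      exact (hasFDerivAt_comp_add_left z).2 (hv.diff (z + x)).hasFDerivAt
    have h2 : HasFDerivAt (fun y => A y y) (A x + A.flip x) x := by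
      have := A.hasFDerivAt (x := x) |>.clm_apply (hasFDerivAt_id x)
      refine this.congr_fderiv ?_
      ext; simp
    have h3 := ((h1.sub_const (v z)).sub (fderiv ℝ v z).hasFDerivAt).sub (h2.const_mul (1/2))
    refine h3.congr_fderiv ?_
    ext w
    simp [hsymm w x]
    ring
  have h0 : R 0 = 0 := by simp [hR]
  have hmv := (convex_closedBall (0 : Cn n) ‖y‖).norm_image_sub_le_of_norm_hasFDerivWithin_le
    (f := R) (C := ε * ‖y‖) (fun x _ => (hRd x).hasFDerivWithinAt) (fun x hx => ?_)
    (x := 0) (y := y) (by simp) (by simp)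
  · rw [h0, sub_zero, sub_zero, Real.norm_eq_abs] at hmv
    rw [pow_two, ← mul_assoc]; exact hmv
  · have hx' : ‖x‖ ≤ ‖y‖ := by simpa using hx
    refine (hb (by simpa using hx'.trans_lt hy)).trans ?_
    gcongr

lemma levi_nonneg_of_submean {v : Cn n → ℝ} (hv : ContDiff ℝ ∞ v) {z : Cn n} (β : Cn n)
    (h : ∃ ε > 0, ∀ r : ℝ, 0 < r → r < ε → v z ≤ (2 * Real.pi)⁻¹ *
      ∫ θ in (0:ℝ)..(2 * Real.pi), v (z + ((r : ℂ) * Complex.exp (Complex.I * θ)) • β)) :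
    0 ≤ levi v z β := by
  obtain ⟨ε₀, hε₀, hs⟩ := h
  unfold levi
  rw [dirD_dirD_apply hv, dirD_dirD_apply hv]
  set A := fderiv ℝ (fderiv ℝ v) z
  set L := fderiv ℝ v z
  set J := Complex.I • β
  suffices H : ∀ ε > 0, 0 ≤ (A β β + A J J) / 4 + ε * ‖β‖ ^ 2 by
    have hc : Tendsto (fun ε : ℝ => (A β β + A J J) / 4 + ε * ‖β‖ ^ 2) (𝓝[>] 0)
        (𝓝 ((A β β + A J J) / 4 + 0 * ‖β‖ ^ 2)) :=
      (Continuous.tendsto (by fun_prop) 0).mono_left nhdsWithin_le_nhds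
    rw [zero_mul, add_zero] at hc
    exact ge_of_tendsto hc (by filter_upwards [self_mem_nhdsWithin] with ε hε using H ε hε)
  intro ε hε
  obtain ⟨δ, hδ, ht⟩ := taylor_two hv z hε
  set r := min (ε₀ / 2) (δ / (2 * (‖β‖ + 1))) with hr
  have hb : 0 < ‖β‖ + 1 := by positivity
  have hr0 : 0 < r := lt_min (by positivity) (by positivity)
  have hrε : r < ε₀ := (min_le_left _ _).trans_lt (by linarith)
  have hrβ : r * ‖β‖ < δ := by
    have h1 : r ≤ δ / (2 * (‖β‖ + 1)) := min_le_right _ _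
    rw [le_div_iff₀ (by positivity)] at h1
    nlinarith [norm_nonneg β]
  have hpi : (0:ℝ) < 2 * Real.pi := by positivity
  have h1 := hs r hr0 hrε
  rw [le_inv_mul_iff₀ hpi] at h1
  have hdec : ∀ θ : ℝ, ((r : ℂ) * Complex.exp (Complex.I * θ)) • β =
      (r * Real.cos θ) • β + (r * Real.sin θ) • J := by
    intro θ
    rw [mul_comm Complex.I, Complex.exp_mul_I]
    ext j
    simp [J]
    ring
  have hle : ∀ θ : ℝ, v (z + ((r : ℂ) * Complex.exp (Complex.I * θ)) • β) ≤
      (v z + ε * r ^ 2 * ‖β‖ ^ 2) + r * L β * Real.cos θ + r * L J * Real.sin θ +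
        (1/2) * r ^ 2 * A β β * Real.cos θ ^ 2 + (1/2) * r ^ 2 * A J J * Real.sin θ ^ 2
        + (1/2) * r ^ 2 * (A β J + A J β) * (Real.sin θ * Real.cos θ) := by
    intro θ
    have hn : ‖((r : ℂ) * Complex.exp (Complex.I * θ)) • β‖ = r * ‖β‖ := by
      rw [norm_smul, norm_mul, norm_exp_I_mul]; simp [abs_of_pos hr0]
    have h2 := (abs_le.1 (ht _ (by rw [hn]; exact hrβ))).2
    rw [hn] at h2
    rw [hdec] at h2 ⊢
    simp only [map_add, map_smul, _root_.add_apply, _root_.smul_apply,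
      smul_eq_mul] at h2
    linarith
  have hint := intervalIntegral.integral_mono (μ := volume) hpi.le
    (f := fun θ : ℝ => v (z + ((r : ℂ) * Complex.exp (Complex.I * θ)) • β)) (g := fun θ =>
      (v z + ε * r ^ 2 * ‖β‖ ^ 2) + r * L β * Real.cos θ + r * L J * Real.sin θ +
        (1/2) * r ^ 2 * A β β * Real.cos θ ^ 2 + (1/2) * r ^ 2 * A J J * Real.sin θ ^ 2
        + (1/2) * r ^ 2 * (A β J + A J β) * (Real.sin θ * Real.cos θ))
    (Continuous.intervalIntegrable (by have := hv.continuous; fun_prop) _ _)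
    (Continuous.intervalIntegrable (by fun_prop) _ _) hle
  rw [intervalIntegral.integral_add, intervalIntegral.integral_add, intervalIntegral.integral_add,
    intervalIntegral.integral_add, intervalIntegral.integral_add,
    intervalIntegral.integral_const, intervalIntegral.integral_const_mul,
    intervalIntegral.integral_const_mul, intervalIntegral.integral_const_mul,
    intervalIntegral.integral_const_mul, intervalIntegral.integral_const_mul,
    integral_cos, integral_sin, integral_cos_sq, integral_sin_sq, integral_sin_mul_cos₁] at hint
  · simp at hint
    have h3 : 0 ≤ (2 * Real.pi * r ^ 2) * ((A β β + A J J) / 4 + ε * ‖β‖ ^ 2) := by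
      nlinarith
    exact nonneg_of_mul_nonneg_right h3 (by positivity)
  all_goals exact Continuous.intervalIntegrable (by fun_prop) _ _

lemma polydisc_eq_ball : polydisc n = Metric.ball 0 1 := by
  ext z
  simp [polydisc, pi_norm_lt_iff]

lemma stronglyMeasurable_indicator_of_usc {f : Cn n → ℝ} {s : Set (Cn n)} (hs : MeasurableSet s)
    (hf : UpperSemicontinuousOn f s) : StronglyMeasurable (s.indicator f) := by
  apply Measurable.stronglyMeasurable
  apply measurable_of_Iio
  intro a
  have h1 : MeasurableSet (s ∩ f ⁻¹' Set.Iio a) := by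
    obtain ⟨U, hU, h⟩ := upperSemicontinuousOn_iff_preimage_Iio.1 hf a
    rw [h]; exact hs.inter hU.measurableSet
  have h2 : s.indicator f ⁻¹' Set.Iio a =
      (s ∩ f ⁻¹' Set.Iio a) ∪ (sᶜ ∩ {_z | (0:ℝ) < a}) := by
    ext z
    by_cases hz : z ∈ s <;> simp [hz]
  rw [h2]
  exact h1.union (hs.compl.inter (MeasurableSet.const _))

lemma moll_mono_of_le {ε : ℝ} (hε : 0 < ε) {f g : Cn n → ℝ} {z : Cn n}
    (hf : Integrable fun y => rho ε y • f (z - y)) (hg : Integrable fun y => rho ε y • g (z - y))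
    (h : ∀ y, ‖y‖ < ε → f (z - y) ≤ g (z - y)) : moll ε f z ≤ moll ε g z := by
  rw [moll_apply, moll_apply]
  refine integral_mono hf hg fun y => ?_
  by_cases hy : rho ε y = 0
  · simp [hy]
  · exact smul_le_smul_of_nonneg_left (h y (norm_lt_of_rho_ne hε hy)) (rho_nonneg ε y)

lemma moll_const {ε : ℝ} (hε : 0 < ε) (c : ℝ) (z : Cn n) : moll ε (fun _ => c) z = c := by
  rw [moll_apply]
  simp only [smul_eq_mul]
  rw [integral_mul_const, integral_rho hε, one_mul]

lemma rho_circle_fubini {ε : ℝ} (hε : 0 < ε) {T : Cn n → ℝ} (hT : StronglyMeasurable T) {C : ℝ}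
    (hC : ∀ z, |T z| ≤ C) {γ : ℝ × Cn n → Cn n} (hγ : Continuous γ) :
    Integrable (fun y => rho ε y • ((2 * Real.pi)⁻¹ • ∫ θ in (0:ℝ)..(2 * Real.pi), T (γ (θ, y)))) ∧
    (2 * Real.pi)⁻¹ * (∫ θ in (0:ℝ)..(2 * Real.pi), ∫ y, rho ε y • T (γ (θ, y))) =
      ∫ y, rho ε y • ((2 * Real.pi)⁻¹ • ∫ θ in (0:ℝ)..(2 * Real.pi), T (γ (θ, y))) := by
  have hpi : (0:ℝ) < 2 * Real.pi := by positivity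
  have hmeas : StronglyMeasurable (fun p : ℝ × Cn n => rho ε p.2 • T (γ p)) :=
    ((continuous_rho ε).comp continuous_snd).stronglyMeasurable.smul
      (hT.comp_measurable hγ.measurable)
  have hint : Integrable (fun p : ℝ × Cn n => rho ε p.2 • T (γ p))
      ((volume.restrict (Set.Ioc 0 (2 * Real.pi))).prod volume) := by
    have hb : Integrable (fun p : ℝ × Cn n => (1:ℝ) * (rho ε p.2 * C))
        ((volume.restrict (Set.Ioc 0 (2 * Real.pi))).prod volume) :=
      Integrable.mul_prod (f := fun _ : ℝ => (1:ℝ)) (g := fun y : Cn n => rho ε y * C)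
        (by simp) ((integrable_rho hε).mul_const C)
    refine hb.mono' hmeas.aestronglyMeasurable (ae_of_all _ fun p => ?_)
    rw [norm_smul, Real.norm_of_nonneg (rho_nonneg ε _), one_mul]
    exact mul_le_mul_of_nonneg_left (hC _) (rho_nonneg ε _)
  have heq : (fun y => rho ε y • ((2 * Real.pi)⁻¹ • ∫ θ in (0:ℝ)..(2 * Real.pi), T (γ (θ, y)))) =
      fun y => (2 * Real.pi)⁻¹ • ∫ θ in Set.Ioc 0 (2 * Real.pi), rho ε y • T (γ (θ, y)) := by
    ext y
    rw [integral_smul, intervalIntegral.integral_of_le hpi.le, smul_comm]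
  refine ⟨?_, ?_⟩
  · rw [heq]
    exact hint.integral_prod_right.smul (2 * Real.pi)⁻¹
  · rw [heq, integral_smul, smul_eq_mul, intervalIntegral.integral_of_le hpi.le]
    congr 1
    exact integral_integral_swap (f := fun (θ : ℝ) (y : Cn n) => rho ε y • T (γ (θ, y))) hint

/-- Plurisubharmonic functions are decreasing-type limits of smooth ones. -/
lemma PSHOn.exists_smooth_approx {u : Cn n → EReal} (hu : PSHOn u (polydisc n)) {r r' : ℝ}
    (hrr' : r < r') (hr' : r' < 1) :
    ∃ v : ℕ → Cn n → ℝ, (∀ k, ContDiff ℝ ∞ (v k)) ∧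
      (∀ k, ∀ z ∈ Metric.ball (0 : Cn n) r, u z ≤ (v k z : EReal)) ∧
      (∀ k, ∀ z ∈ Metric.ball (0 : Cn n) r, ∀ β, 0 ≤ levi (v k) z β) ∧
      (∀ z ∈ Metric.ball (0 : Cn n) r, ∀ a : ℝ, u z < a → ∀ᶠ k in atTop, v k z < a) ∧
      (∀ M : ℝ, 0 ≤ M → (∀ z ∈ Metric.ball (0 : Cn n) r', u z ≤ M) → ∀ k,
        ∀ z ∈ Metric.ball (0 : Cn n) r, v k z ≤ M) := by
  set K := Metric.closedBall (0 : Cn n) r'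
  have hKΩ : K ⊆ polydisc n := by
    rw [polydisc_eq_ball]; exact Metric.closedBall_subset_ball hr'
  have hlt : ∀ z ∈ K, u z < ⊤ := fun z hz => hu.lt_top z (hKΩ hz)
  set T : ℕ → Cn n → ℝ := fun k => K.indicator (trunc u k) with hT
  set e : ℕ → ℝ := fun k => (r' - r) / (k + 1) with he
  have he0 : ∀ k, 0 < e k := fun k => div_pos (by linarith) (by positivity)
  have hele : ∀ k, e k ≤ r' - r := fun k => div_le_self (by linarith) (by linarith [k.cast_nonneg (α := ℝ)])
  have helim : Tendsto e atTop (𝓝 0) := by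
    have := (tendsto_one_div_add_atTop_nhds_zero_nat (𝕜 := ℝ)).const_mul (r' - r)
    simpa [he, div_eq_mul_inv] using this
  have hTm : ∀ k, StronglyMeasurable (T k) := fun k =>
    stronglyMeasurable_indicator_of_usc Metric.isClosed_closedBall.measurableSet
      ((hu.upperSemicontinuousOn_trunc k).mono hKΩ)
  have hTb : ∀ k, ∃ C, ∀ z, |T k z| ≤ C := fun k => by
    obtain ⟨C, hC⟩ := bounded_trunc hu k (isCompact_closedBall 0 r') hKΩ
    refine ⟨max C 0, fun z => ?_⟩
    by_cases hz : z ∈ K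
    · simp only [hT, Set.indicator_of_mem hz]; exact (hC z hz).trans (le_max_left _ _)
    · simp [hT, Set.indicator_of_notMem hz]
  have hTi : ∀ k, LocallyIntegrable (T k) := fun k => by
    obtain ⟨C, hC⟩ := hTb k
    exact (locallyIntegrable_const C).mono (hTm k).aestronglyMeasurable
      (ae_of_all _ fun z => by simpa using (hC z).trans (le_abs_self C))
  have hrT : ∀ k z, Integrable fun y => rho (e k) y • T k (z - y) := fun k z => by
    obtain ⟨C, hC⟩ := hTb k
    refine (integrable_rho (he0 k)).smul_bdd C ?_ ?_
    · exact ((hTm k).comp_measurable (measurable_const.sub measurable_id)).aestronglyMeasurable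
    · exact ae_of_all _ fun y => hC _
  have hrc : ∀ k c, Integrable fun y : Cn n => rho (e k) y • (c : ℝ) := fun k c =>
    (integrable_rho (he0 k)).smul_const c
  have hmemK : ∀ k, ∀ z ∈ Metric.ball (0 : Cn n) r, ∀ y, ‖y‖ ≤ e k → z - y ∈ K := by
    intro k z hz y hy
    rw [mem_ball_zero_iff] at hz
    rw [mem_closedBall_zero_iff]
    have := norm_sub_le z y
    linarith [hele k]
  have hmemK' : ∀ k, ∀ z ∈ Metric.ball (0 : Cn n) r, ∀ y, ‖y‖ ≤ e k → z + y ∈ K := by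
    intro k z hz y hy
    simpa using hmemK k z hz (-y) (by simpa using hy)
  have hTK : ∀ k, ∀ z ∈ K, T k z = trunc u k z := fun k z hz => Set.indicator_of_mem hz _
  have havg : ∀ k z, moll (e k) (T k) z = ∫ y, rho (e k) y • ((2 * Real.pi)⁻¹ •
      ∫ θ in (0:ℝ)..(2 * Real.pi), T k (z - Complex.exp (Complex.I * θ) • y)) := fun k z => by
    obtain ⟨C, hC⟩ := hTb k
    exact moll_eq_avg (he0 k) ((hTm k).indicator Metric.isOpen_ball.measurableSet)
      fun y _ => hC y
  have hcont : ∀ k, ContDiff ℝ ∞ (moll (e k) (T k)) := fun k => contDiff_moll (he0 k) (hTi k)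
  refine ⟨fun k => moll (e k) (T k), hcont, ?_, ?_, ?_, ?_⟩
  · intro k z hz
    refine (le_trunc (m := k) (hlt z ?_)).trans (EReal.coe_le_coe_iff.2 ?_)
    · simpa using hmemK k z hz 0 (by simpa using (he0 k).le)
    beta_reduce
    rw [havg, ← moll_const (he0 k) (trunc u k z) z, moll_apply]
    obtain ⟨C, hC⟩ := hTb k
    refine integral_mono (hrc k _) (rho_circle_fubini (he0 k) (hTm k) hC
      (γ := fun p => z - Complex.exp (Complex.I * p.1) • p.2) (by fun_prop)).1 fun y => ?_
    by_cases hy : rho (e k) y = 0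
    · simp [hy]
    have hy' := (norm_lt_of_rho_ne (he0 k) hy).le
    refine smul_le_smul_of_nonneg_left ?_ (rho_nonneg _ y)
    have hin : ∀ ζ : ℂ, ‖ζ‖ ≤ 1 → z + ζ • (-y) ∈ K := fun ζ hζ => hmemK' k z hz _ <| by
      rw [norm_smul, norm_neg]
      exact (mul_le_of_le_one_left (norm_nonneg _) hζ).trans hy'
    refine (hu.trunc_le_average k (w := -y) fun ζ hζ => hKΩ (hin ζ hζ)).trans_eq ?_
    rw [smul_eq_mul]
    congr 1
    refine intervalIntegral.integral_congr fun θ _ => ?_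
    have := hin (Complex.exp (Complex.I * θ)) (norm_exp_I_mul θ).le
    rw [smul_neg, ← sub_eq_add_neg] at this
    simp only [smul_neg, ← sub_eq_add_neg]
    rw [hTK k _ this]
  · intro k z hz β
    apply levi_nonneg_of_submean (hcont k)
    rw [mem_ball_zero_iff] at hz
    have hb : 0 < ‖β‖ + 1 := by positivity
    refine ⟨(r - ‖z‖) / (‖β‖ + 1), div_pos (by linarith) hb, fun ρ hρ hρε => ?_⟩
    rw [lt_div_iff₀ hb] at hρε
    obtain ⟨C, hC⟩ := hTb k
    obtain ⟨h1, h2⟩ := rho_circle_fubini (he0 k) (hTm k) hC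
      (γ := fun p => z + ((ρ : ℂ) * Complex.exp (Complex.I * p.1)) • β - p.2) (by fun_prop)
    simp only [moll_apply]
    rw [h2]
    refine integral_mono (hrT k z) h1 fun y => ?_
    by_cases hy : rho (e k) y = 0
    · simp [hy]
    have hy' := (norm_lt_of_rho_ne (he0 k) hy).le
    refine smul_le_smul_of_nonneg_left ?_ (rho_nonneg _ y)
    have hin : ∀ ζ : ℂ, ‖ζ‖ ≤ 1 → (z - y) + ζ • ((ρ : ℂ) • β) ∈ K := fun ζ hζ => by
      have h3 : z + ζ • ((ρ : ℂ) • β) ∈ Metric.ball (0 : Cn n) r := by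
        rw [mem_ball_zero_iff]
        have h4 : ‖ζ • ((ρ : ℂ) • β)‖ ≤ ρ * ‖β‖ := by
          rw [norm_smul, norm_smul, Complex.norm_real, Real.norm_of_nonneg hρ.le]
          exact mul_le_of_le_one_left (by positivity) hζ
        have := norm_add_le z (ζ • ((ρ : ℂ) • β))
        linarith
      have := hmemK k _ h3 y hy'
      rwa [add_sub_right_comm] at this
    have h5 := hu.trunc_le_average k (w := (ρ : ℂ) • β) fun ζ hζ => hKΩ (hin ζ hζ)
    rw [hTK k _ (by simpa using hin 0 (by simp))]
    refine h5.trans_eq ?_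
    rw [smul_eq_mul]
    congr 1
    refine intervalIntegral.integral_congr fun θ _ => ?_
    have := hin (Complex.exp (Complex.I * θ)) (norm_exp_I_mul θ).le
    have h6 : z + ((ρ : ℂ) * Complex.exp (Complex.I * θ)) • β - y =
        z - y + Complex.exp (Complex.I * θ) • (ρ : ℂ) • β := by
      rw [smul_smul, mul_comm (ρ : ℂ), add_sub_right_comm]
    simp only [h6]
    rw [hTK k _ this]
  · intro z hz a ha
    have hzK : z ∈ K := by simpa using hmemK 0 z hz 0 (by simpa using (he0 0).le)
    obtain ⟨b, hb1, hb2⟩ := EReal.lt_iff_exists_real_btwn.1 ha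
    have hba : b < a := EReal.coe_lt_coe_iff.1 hb2
    have h1 : ∀ᶠ y in 𝓝 z, u y < b := by
      have := hu.usc z (hKΩ hzK) b hb1
      rwa [IsOpen.nhdsWithin_eq _ (hKΩ hzK)] at this
      rw [polydisc_eq_ball]; exact Metric.isOpen_ball
    obtain ⟨δ, hδ, hball⟩ := Metric.eventually_nhds_iff.1 h1
    obtain ⟨N, hN⟩ := exists_nat_gt (-b)
    filter_upwards [helim.eventually_lt_const hδ, eventually_ge_atTop N] with k hk hkN
    refine lt_of_le_of_lt ?_ hba
    rw [← moll_const (he0 k) b z]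
    refine moll_mono_of_le (he0 k) (hrT k z) (hrc k b) fun y hy => ?_
    rw [hTK k _ (hmemK k z hz y hy.le)]
    refine trunc_le (hball ?_).le ?_
    · simpa [dist_eq_norm] using hy.trans hk
    · have : (N:ℝ) ≤ k := by exact_mod_cast hkN
      linarith
  · intro M hM h0 k z hz
    rw [← moll_const (he0 k) M z]
    refine moll_mono_of_le (he0 k) (hrT k z) (hrc k M) fun y hy => ?_
    rw [hTK k _ (hmemK k z hz y hy.le)]
    refine trunc_le (h0 _ ?_) ((neg_nonpos.2 k.cast_nonneg).trans hM)
    rw [mem_ball_zero_iff] at hz ⊢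
    have := norm_sub_le z y
    linarith [hele k]

/-! ### Wirtinger derivatives -/

/-- The `j`-th unit vector. -/
def ee (j : Fin n) : Cn n := Pi.single j 1

/-- `∂f/∂z̄ⱼ`. -/
def dbar (j : Fin n) (f : Cn n → ℂ) (z : Cn n) : ℂ :=
  (dirD (ee j) f z + Complex.I * dirD (Complex.I • ee j) f z) / 2

/-- `∂f/∂zⱼ`. -/
def del (j : Fin n) (f : Cn n → ℂ) (z : Cn n) : ℂ :=
  (dirD (ee j) f z - Complex.I * dirD (Complex.I • ee j) f z) / 2

lemma ContDiff.dbar {f : Cn n → ℂ} (hf : ContDiff ℝ ∞ f) (j : Fin n) : ContDiff ℝ ∞ (dbar j f) :=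
  ((hf.dirD _).add (contDiff_const.mul (hf.dirD _))).div_const _

lemma ContDiff.del {f : Cn n → ℂ} (hf : ContDiff ℝ ∞ f) (j : Fin n) : ContDiff ℝ ∞ (del j f) :=
  ((hf.dirD _).sub (contDiff_const.mul (hf.dirD _))).div_const _

lemma ContDiff.ofReal {f : Cn n → ℝ} (hf : ContDiff ℝ ∞ f) : ContDiff ℝ ∞ (fun z => (f z : ℂ)) :=
  Complex.ofRealCLM.contDiff.comp hf

lemma ContDiff.conj {f : Cn n → ℂ} (hf : ContDiff ℝ ∞ f) :
    ContDiff ℝ ∞ (fun z => starRingEnd ℂ (f z)) :=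
  (Complex.conjCLE : ℂ →L[ℝ] ℂ).contDiff.comp hf

section rules
variable {f g : Cn n → ℂ} (hf : ContDiff ℝ ∞ f) (hg : ContDiff ℝ ∞ g) (j : Fin n)
include hf

lemma dbar_conj : dbar j (fun z => starRingEnd ℂ (f z)) = fun z => starRingEnd ℂ (del j f z) := by
  ext z; simp [dbar, del, dirD_conj _ hf, map_ofNat (starRingEnd ℂ) 2]

lemma del_conj : del j (fun z => starRingEnd ℂ (f z)) = fun z => starRingEnd ℂ (dbar j f z) := by
  ext z; simp [dbar, del, dirD_conj _ hf, map_ofNat (starRingEnd ℂ) 2]; ring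

lemma dbar_const_mul (c : ℂ) : dbar j (fun z => c * f z) = fun z => c * dbar j f z := by
  ext z; simp only [dbar, dirD_const_mul _ c hf]; ring

lemma dbar_dbar_comm (k : Fin n) : dbar j (dbar k f) = dbar k (dbar j f) := by
  have key : ∀ j k : Fin n, dbar j (dbar k f) = fun z => (dirD (ee j) (dirD (ee k) f) z +
      Complex.I * dirD (ee j) (dirD (Complex.I • ee k) f) z + Complex.I *
      (dirD (Complex.I • ee j) (dirD (ee k) f) z +
      Complex.I * dirD (Complex.I • ee j) (dirD (Complex.I • ee k) f) z)) / 4 := by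
    intro j k
    have h : dbar k f = fun z => (1/2:ℂ) * (dirD (ee k) f z +
        Complex.I * dirD (Complex.I • ee k) f z) := by ext z; simp only [dbar]; ring
    have h1 := hf.dirD (ee k)
    have h2 := hf.dirD (Complex.I • ee k)
    rw [h]
    ext z
    simp only [dbar]
    rw [dirD_const_mul _ _ (h1.add (contDiff_const.mul h2)), dirD_const_mul _ _
      (h1.add (contDiff_const.mul h2)), dirD_add _ h1 (contDiff_const.mul h2),
      dirD_add _ h1 (contDiff_const.mul h2), dirD_const_mul _ _ h2, dirD_const_mul _ _ h2]
    ring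
  rw [key j k, key k j]
  ext z
  rw [dirD_comm hf (ee j) (ee k), dirD_comm hf (Complex.I • ee j) (ee k),
    dirD_comm hf (Complex.I • ee k) (ee j),
    dirD_comm hf (Complex.I • ee k) (Complex.I • ee j)]
  ring

lemma dbar_del_comm (k : Fin n) : dbar j (del k f) = del k (dbar j f) := by
  have h : del k f = fun z => (1/2:ℂ) * (dirD (ee k) f z -
      Complex.I * dirD (Complex.I • ee k) f z) := by ext z; simp only [del]; ring
  have h' : dbar j f = fun z => (1/2:ℂ) * (dirD (ee j) f z +
      Complex.I * dirD (Complex.I • ee j) f z) := by ext z; simp only [dbar]; ring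
  have h1 := hf.dirD (ee k)
  have h2 := hf.dirD (Complex.I • ee k)
  have h1' := hf.dirD (ee j)
  have h2' := hf.dirD (Complex.I • ee j)
  rw [h, h']
  ext z
  simp only [dbar, del]
  rw [dirD_const_mul _ _ (h1.sub (contDiff_const.mul h2)), dirD_const_mul _ _
      (h1.sub (contDiff_const.mul h2)), dirD_sub _ h1 (contDiff_const.mul h2),
      dirD_sub _ h1 (contDiff_const.mul h2), dirD_const_mul _ _ h2, dirD_const_mul _ _ h2,
      dirD_const_mul _ _ (h1'.add (contDiff_const.mul h2')), dirD_const_mul _ _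
      (h1'.add (contDiff_const.mul h2')), dirD_add _ h1' (contDiff_const.mul h2'),
      dirD_add _ h1' (contDiff_const.mul h2'), dirD_const_mul _ _ h2', dirD_const_mul _ _ h2',
      dirD_comm hf (ee j) (ee k), dirD_comm hf (Complex.I • ee j) (ee k),
      dirD_comm hf (Complex.I • ee k) (ee j),
      dirD_comm hf (Complex.I • ee k) (Complex.I • ee j)]
  ring

include hg

lemma dbar_add : dbar j (fun z => f z + g z) = fun z => dbar j f z + dbar j g z := by
  ext z; simp only [dbar, dirD_add _ hf hg]; ring

lemma dbar_sub : dbar j (fun z => f z - g z) = fun z => dbar j f z - dbar j g z := by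
  ext z; simp only [dbar, dirD_sub _ hf hg]; ring

lemma dbar_mul : dbar j (fun z => f z * g z) = fun z => dbar j f z * g z + f z * dbar j g z := by
  ext z; simp only [dbar, dirD_mul _ hf hg]; ring

lemma del_mul : del j (fun z => f z * g z) = fun z => del j f z * g z + f z * del j g z := by
  ext z; simp only [del, dirD_mul _ hf hg]; ring

lemma del_add : del j (fun z => f z + g z) = fun z => del j f z + del j g z := by
  ext z; simp only [del, dirD_add _ hf hg]; ring

end rules

lemma del_ofReal {f : Cn n → ℝ} (hf : ContDiff ℝ ∞ f) (j : Fin n) (z : Cn n) :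
    del j (fun z => (f z : ℂ)) z = starRingEnd ℂ (dbar j (fun z => (f z : ℂ)) z) := by
  simp [dbar, del, dirD_ofReal _ hf, map_ofNat (starRingEnd ℂ) 2]; ring

lemma dbar_comp {χ : ℝ → ℝ} (hχ : ContDiff ℝ ∞ χ) {s : Cn n → ℝ} (hs : ContDiff ℝ ∞ s)
    (j : Fin n) : dbar j (fun z => (χ (s z) : ℂ)) =
      fun z => ((deriv χ (s z) : ℝ) : ℂ) * dbar j (fun z => (s z : ℂ)) z := by
  ext z
  have h : ContDiff ℝ ∞ fun z => χ (s z) := hχ.comp hs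
  simp only [dbar]
  rw [dirD_ofReal _ h, dirD_ofReal _ h, dirD_ofReal _ hs, dirD_ofReal _ hs, dirD_comp _ hχ hs,
    dirD_comp _ hχ hs]
  push_cast; ring

lemma del_comp {χ : ℝ → ℝ} (hχ : ContDiff ℝ ∞ χ) {s : Cn n → ℝ} (hs : ContDiff ℝ ∞ s)
    (j : Fin n) : del j (fun z => (χ (s z) : ℂ)) =
      fun z => ((deriv χ (s z) : ℝ) : ℂ) * del j (fun z => (s z : ℂ)) z := by
  ext z
  have h : ContDiff ℝ ∞ fun z => χ (s z) := hχ.comp hs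
  simp only [del]
  rw [dirD_ofReal _ h, dirD_ofReal _ h, dirD_ofReal _ hs, dirD_ofReal _ hs, dirD_comp _ hχ hs,
    dirD_comp _ hχ hs]
  push_cast; ring

/-- A real directional derivative in terms of Wirtinger derivatives. -/
lemma dirD_eq_sum (β : Cn n) (f : Cn n → ℂ) (z : Cn n) :
    dirD β f z = ∑ k, (β k * del k f z + starRingEnd ℂ (β k) * dbar k f z) := by
  have hβ : β = ∑ k, ((β k).re • ee k + (β k).im • (Complex.I • ee k)) := by
    ext j
    rw [Finset.sum_apply, Finset.sum_eq_single j]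
    · simp [ee, mul_comm Complex.I]
    · intro b _ hb
      simp [ee, hb.symm]
    · simp
  conv_lhs => rw [hβ, dirD_sum_dir]
  rw [Finset.sum_apply]
  refine Finset.sum_congr rfl fun k _ => ?_
  rw [dirD_add_dir, dirD_smul_dir, dirD_smul_dir]
  simp only [Pi.add_apply, Pi.smul_apply, Complex.real_smul, del, dbar]
  apply Complex.ext <;> simp <;> ring

lemma dirD_I_eq_sum (β : Cn n) (f : Cn n → ℂ) (z : Cn n) :
    dirD (Complex.I • β) f z =
      ∑ k, (Complex.I * β k * del k f z - Complex.I * starRingEnd ℂ (β k) * dbar k f z) := by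
  rw [dirD_eq_sum]
  refine Finset.sum_congr rfl fun k _ => ?_
  simp
  ring

lemma levi_eq_sum {v : Cn n → ℝ} (hv : ContDiff ℝ ∞ v) (z β : Cn n) :
    (levi v z β : ℂ) = ∑ j, ∑ k, dbar j (del k (fun z => (v z : ℂ))) z * β k *
      starRingEnd ℂ (β j) := by
  set V : Cn n → ℂ := fun z => (v z : ℂ)
  have hV : ContDiff ℝ ∞ V := hv.ofReal
  have h1 : ∀ a, ((dirD a (dirD a v) z : ℝ) : ℂ) = dirD a (dirD a V) z := fun a => by
    rw [dirD_ofReal a hv, dirD_ofReal a (hv.dirD a)]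
  have hd : ∀ a : Cn n, dirD a V = fun z => ∑ k, (a k * del k V z + starRingEnd ℂ (a k) * dbar k V z) :=
    fun a => funext fun z => dirD_eq_sum a V z
  have h2 : ∀ a : Cn n, dirD a (dirD a V) z = ∑ k, (a k * dirD a (del k V) z +
      starRingEnd ℂ (a k) * dirD a (dbar k V) z) := fun a => by
    conv_lhs => rw [hd a]
    rw [dirD_sum _ _ fun k => (contDiff_const.mul (hV.del k)).add (contDiff_const.mul (hV.dbar k))]
    refine Finset.sum_congr rfl fun k _ => ?_
    rw [dirD_add _ (contDiff_const.mul (hV.del k)) (contDiff_const.mul (hV.dbar k)),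
      dirD_const_mul _ _ (hV.del k), dirD_const_mul _ _ (hV.dbar k)]
  have h3 : dirD β (dirD β V) z + dirD (Complex.I • β) (dirD (Complex.I • β) V) z =
      ∑ k, ∑ j, (2 * (dbar j (del k V) z * β k * starRingEnd ℂ (β j)) +
        2 * (dbar k (del j V) z * β j * starRingEnd ℂ (β k))) := by
    rw [h2, h2, ← Finset.sum_add_distrib]
    refine Finset.sum_congr rfl fun k _ => ?_
    rw [dirD_eq_sum, dirD_eq_sum, dirD_I_eq_sum, dirD_I_eq_sum]
    simp only [Finset.mul_sum, ← Finset.sum_add_distrib]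
    refine Finset.sum_congr rfl fun j _ => ?_
    rw [← dbar_del_comm hV]
    simp
    linear_combination (-(β k * β j * del j (del k V) z) + β k * starRingEnd ℂ (β j) * dbar j (del k V) z
      + starRingEnd ℂ (β k) * β j * dbar k (del j V) z - starRingEnd ℂ (β k) * starRingEnd ℂ (β j) * dbar j (dbar k V) z) * (- Complex.I_sq)
  have h4 : (levi v z β : ℂ) = (dirD β (dirD β V) z +
      dirD (Complex.I • β) (dirD (Complex.I • β) V) z) / 4 := by
    rw [← h1, ← h1, levi]; push_cast; rfl
  rw [h4, h3]
  simp only [Finset.sum_add_distrib, ← Finset.mul_sum]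
  rw [Finset.sum_comm]
  ring

/-! ### Integration by parts and the Bochner identity -/

lemma HasCompactSupport.dirD {E : Type*} [NormedAddCommGroup E] [NormedSpace ℝ E] {f : Cn n → E}
    (hf : HasCompactSupport f) (a : Cn n) : HasCompactSupport (dirD a f) :=
  hf.fderiv_apply (𝕜 := ℝ) a

lemma HasCompactSupport.dbar {f : Cn n → ℂ} (hf : HasCompactSupport f) (j : Fin n) :
    HasCompactSupport (dbar j f) :=
  ((hf.dirD (ee j)).add (hf.dirD (Complex.I • ee j)).mul_left).comp_left (g := fun x => x / 2)
    (by simp)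

lemma HasCompactSupport.del {f : Cn n → ℂ} (hf : HasCompactSupport f) (j : Fin n) :
    HasCompactSupport (del j f) :=
  ((hf.dirD (ee j)).sub (hf.dirD (Complex.I • ee j)).mul_left).comp_left (g := fun x => x / 2)
    (by simp)

lemma HasCompactSupport.conj {f : Cn n → ℂ} (hf : HasCompactSupport f) :
    HasCompactSupport (fun z => starRingEnd ℂ (f z)) :=
  hf.comp_left (g := starRingEnd ℂ) (by simp)

lemma integral_dirD_eq_zero {f : Cn n → ℂ} (hf : ContDiff ℝ ∞ f) (hc : HasCompactSupport f)
    (a : Cn n) : ∫ z, dirD a f z = 0 := by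
  have hi : Integrable (dirD a f) volume :=
    (hf.dirD a).continuous.integrable_of_hasCompactSupport (hc.dirD a)
  have hi0 : Integrable f volume := hf.continuous.integrable_of_hasCompactSupport hc
  have := integral_mul_fderiv_eq_neg_fderiv_mul_of_integrable (𝕜 := ℂ) (μ := volume) (f := fun _ : Cn n => (1:ℂ)) (g := f)
    (v := a) (by simp) (by simpa [dirD] using! hi) (by simpa using hi0) (fun x _ => by fun_prop) (fun x _ => hf.diff x)
  simpa [dirD] using this

lemma integral_dbar_eq_zero {f : Cn n → ℂ} (hf : ContDiff ℝ ∞ f) (hc : HasCompactSupport f)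
    (j : Fin n) : ∫ z, dbar j f z = 0 := by
  have hi : ∀ a, Integrable (dirD a f) volume := fun a =>
    (hf.dirD a).continuous.integrable_of_hasCompactSupport (hc.dirD a)
  simp only [dbar]
  rw [integral_div, integral_add (hi _) ((hi _).const_mul _), integral_const_mul,
    integral_dirD_eq_zero hf hc, integral_dirD_eq_zero hf hc]
  simp

lemma integral_dbar_mul {f g : Cn n → ℂ} (hf : ContDiff ℝ ∞ f) (hg : ContDiff ℝ ∞ g)
    (hc : HasCompactSupport g) (j : Fin n) :
    ∫ z, dbar j f z * g z = - ∫ z, f z * dbar j g z := by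
  have h := integral_dbar_eq_zero (hf.mul hg) hc.mul_left j
  rw [dbar_mul hf hg, integral_add] at h
  · exact eq_neg_of_add_eq_zero_left h
  · exact ((hf.dbar j).continuous.mul hg.continuous).integrable_of_hasCompactSupport hc.mul_left
  · exact (hf.continuous.mul (hg.dbar j).continuous).integrable_of_hasCompactSupport
      (hc.dbar j).mul_left

/-- The weight `e^{-Φ}`. -/
def wt (Φ : Cn n → ℝ) (z : Cn n) : ℝ := Real.exp (-Φ z)

lemma wt_pos (Φ : Cn n → ℝ) (z : Cn n) : 0 < wt Φ z := Real.exp_pos _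

lemma ContDiff.wt {Φ : Cn n → ℝ} (hΦ : ContDiff ℝ ∞ Φ) : ContDiff ℝ ∞ (wt Φ) := hΦ.neg.exp

/-- The formal adjoint of `dbar j` for the weight `e^{-Φ}`. -/
def dstar (Φ : Cn n → ℝ) (j : Fin n) (a : Cn n → ℂ) (z : Cn n) : ℂ :=
  del j (fun z => (Φ z : ℂ)) z * a z - del j a z

/-- The weighted Laplacian on functions. -/
def lap (Φ : Cn n → ℝ) (τ : Cn n → ℂ) (z : Cn n) : ℂ := ∑ j, dstar Φ j (dbar j τ) z

section weight
variable {Φ : Cn n → ℝ} (hΦ : ContDiff ℝ ∞ Φ) {a τ f : Cn n → ℂ} (ha : ContDiff ℝ ∞ a)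
  (hτ : ContDiff ℝ ∞ τ)
include hΦ

lemma del_wt (j : Fin n) : del j (fun z => (wt Φ z : ℂ)) =
    fun z => - del j (fun z => (Φ z : ℂ)) z * wt Φ z := by
  have h := del_comp (χ := fun x => Real.exp (-x)) (by fun_prop) hΦ j
  have hd : deriv (fun x : ℝ => Real.exp (-x)) = fun x => - Real.exp (-x) := by
    ext x; simpa using ((hasDerivAt_neg x).exp).deriv
  rw [hd] at h
  rw [show (fun z => (wt Φ z : ℂ)) = fun z => ((Real.exp (-Φ z) : ℝ) : ℂ) from rfl, h]
  ext z
  simp only [wt]; push_cast; ring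

include ha in
lemma ContDiff.dstar (j : Fin n) : ContDiff ℝ ∞ (dstar Φ j a) :=
  ((hΦ.ofReal.del j).mul ha).sub (ha.del j)

include hτ in
lemma ContDiff.lap : ContDiff ℝ ∞ (lap Φ τ) :=
  ContDiff.sum fun j _ => ContDiff.dstar hΦ (hτ.dbar j) j

omit hΦ in
lemma HasCompactSupport.dstar (hc : HasCompactSupport a) (j : Fin n) :
    HasCompactSupport (dstar Φ j a) :=
  hc.mul_left.sub (hc.del j)

omit hΦ in
lemma HasCompactSupport.lap (hc : HasCompactSupport τ) : HasCompactSupport (lap Φ τ) := by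
  have := HasCompactSupport.finset_sum (s := Finset.univ)
    (f := fun j => _root_.dstar Φ j (_root_.dbar j τ)) fun j _ => (hc.dbar j).dstar j
  rwa [show _root_.lap Φ τ = ∑ j, _root_.dstar Φ j (_root_.dbar j τ) by
    ext z; simp [_root_.lap]]

include ha in
lemma del_mul_wt (j : Fin n) : del j (fun z => a z * wt Φ z) = fun z => - (dstar Φ j a z * wt Φ z) := by
  rw [del_mul ha hΦ.wt.ofReal, del_wt hΦ]
  ext z; simp only [dstar]; ring

include ha in
lemma integral_dbar_mul_conj (hf : ContDiff ℝ ∞ f) (hc : HasCompactSupport a) (j : Fin n) :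
    ∫ z, dbar j f z * starRingEnd ℂ (a z) * wt Φ z =
      ∫ z, f z * starRingEnd ℂ (dstar Φ j a z) * wt Φ z := by
  have h1 : ContDiff ℝ ∞ fun z => starRingEnd ℂ (a z * wt Φ z) := (ha.mul hΦ.wt.ofReal).conj
  have := integral_dbar_mul hf h1 hc.mul_right.conj j
  rw [dbar_conj (ha.mul hΦ.wt.ofReal), del_mul_wt hΦ ha] at this
  simp only [map_mul, Complex.conj_ofReal, map_neg, mul_neg, integral_neg, neg_neg] at this
  simpa only [mul_assoc] using this

include ha in
lemma dbar_dstar (j k : Fin n) : dbar j (dstar Φ k a) = fun z => dstar Φ k (dbar j a) z +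
    dbar j (del k (fun z => (Φ z : ℂ))) z * a z := by
  have h1 := hΦ.ofReal.del k
  change dbar j (fun z => del k (fun z => (Φ z : ℂ)) z * a z - del k a z) = _
  rw [dbar_sub (h1.mul ha) (ha.del k), dbar_mul h1 ha, dbar_del_comm ha]
  ext z; simp only [dstar]; ring


omit hΦ in
lemma ContDiff.integrable_of_hasCompactSupport {f : Cn n → ℂ} (hf : ContDiff ℝ ∞ f)
    (hc : HasCompactSupport f) : Integrable f volume :=
  hf.continuous.integrable_of_hasCompactSupport hc

include ha in
lemma integral_dstar_mul_conj {b : Cn n → ℂ} (hb : ContDiff ℝ ∞ b) (hc : HasCompactSupport b)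
    (k : Fin n) : ∫ z, dstar Φ k b z * starRingEnd ℂ (a z) * wt Φ z =
      ∫ z, b z * starRingEnd ℂ (dbar k a z) * wt Φ z := by
  have h := congrArg (starRingEnd ℂ) (integral_dbar_mul_conj hΦ hb ha hc k)
  rw [← integral_conj, ← integral_conj] at h
  simp only [map_mul, Complex.conj_conj, Complex.conj_ofReal] at h
  rw [show (fun z => dstar Φ k b z * starRingEnd ℂ (a z) * (wt Φ z : ℂ)) =
    fun z => starRingEnd ℂ (a z) * dstar Φ k b z * (wt Φ z : ℂ) by ext z; ring, ← h]
  congr 1; ext z; ring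

include ha hτ in
/-- `⟪f, L τ⟫ = ⟪∂̄f, ∂̄τ⟫`. -/
lemma integral_mul_conj_lap (hc : HasCompactSupport τ) :
    ∫ z, a z * starRingEnd ℂ (lap Φ τ z) * wt Φ z =
      ∫ z, (∑ j, dbar j a z * starRingEnd ℂ (dbar j τ z)) * wt Φ z := by
  simp only [lap, map_sum, Finset.mul_sum, Finset.sum_mul]
  rw [integral_finsetSum, integral_finsetSum]
  · exact Finset.sum_congr rfl fun j _ =>
      (integral_dbar_mul_conj hΦ (hτ.dbar j) ha (hc.dbar j) j).symm
  · intro j _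
    exact (((ha.dbar j).mul (hτ.dbar j).conj).mul hΦ.wt.ofReal).integrable_of_hasCompactSupport
      (hc.dbar j).conj.mul_left.mul_right
  · intro j _
    exact ((ha.mul (ContDiff.dstar hΦ (hτ.dbar j) j).conj).mul
      hΦ.wt.ofReal).integrable_of_hasCompactSupport ((hc.dbar j).dstar j).conj.mul_left.mul_right

include hτ in
lemma dbar_lap (j : Fin n) : dbar j (lap Φ τ) = fun z => ∑ k, dbar j (dstar Φ k (dbar k τ)) z := by
  ext z
  have h : ∀ a, dirD a (lap Φ τ) z = ∑ k, dirD a (dstar Φ k (dbar k τ)) z := fun a => by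
    have := dirD_sum (s := Finset.univ) (f := fun k => dstar Φ k (dbar k τ)) (a := a)
      (fun k => ContDiff.dstar hΦ (hτ.dbar k) k)
    exact congrFun this z
  simp only [dbar, h, Finset.mul_sum, ← Finset.sum_add_distrib, Finset.sum_div]

include hτ in
/-- The Bochner inequality. -/
lemma bochner (hc : HasCompactSupport τ) :
    ∫ z, levi Φ z (fun k => dbar k τ z) * wt Φ z ≤ ∫ z, ‖lap Φ τ z‖ ^ 2 * wt Φ z := by
  have hL := ContDiff.lap hΦ hτ
  have hα := fun j => hτ.dbar j
  have hcα := fun j => hc.dbar j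
  have hW := hΦ.wt.ofReal
  have key : ∫ z, lap Φ τ z * starRingEnd ℂ (lap Φ τ z) * wt Φ z =
      (∫ z, ((levi Φ z (fun k => dbar k τ z) : ℝ) : ℂ) * wt Φ z) +
      ∑ j, ∑ k, ∫ z, dbar j (dbar k τ) z * starRingEnd ℂ (dbar j (dbar k τ) z) * wt Φ z := by
    rw [integral_mul_conj_lap hΦ hL hτ hc]
    simp only [dbar_lap hΦ hτ, dbar_dstar hΦ (hα _), levi_eq_sum hΦ, Finset.sum_mul]
    have i1 : ∀ j k, Integrable (fun z => dstar Φ k (dbar j (dbar k τ)) z *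
        starRingEnd ℂ (dbar j τ z) * wt Φ z) volume := fun j k =>
      (((ContDiff.dstar hΦ ((hα k).dbar j) k).mul (hα j).conj).mul
        hW).integrable_of_hasCompactSupport (hcα j).conj.mul_left.mul_right
    have i2 : ∀ j k, Integrable (fun z => dbar j (del k (fun z => (Φ z : ℂ))) z * dbar k τ z *
        starRingEnd ℂ (dbar j τ z) * wt Φ z) volume := fun j k =>
      (((((hΦ.ofReal.del k).dbar j).mul (hα k)).mul (hα j).conj).mul
        hW).integrable_of_hasCompactSupport (hcα j).conj.mul_left.mul_right
    have i3 : ∀ j k, Integrable (fun z => (dstar Φ k (dbar j (dbar k τ)) z +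
        dbar j (del k (fun z => (Φ z : ℂ))) z * dbar k τ z) *
        starRingEnd ℂ (dbar j τ z) * wt Φ z) volume := fun j k =>
      ((i1 j k).add (i2 j k)).congr (Eventually.of_forall fun z => by
        simp only [Pi.add_apply]; ring)
    rw [integral_finsetSum _ fun j _ => integrable_finsetSum _ fun k _ => i3 j k,
      integral_finsetSum _ fun j _ => integrable_finsetSum _ fun k _ => i2 j k,
      ← Finset.sum_add_distrib]
    refine Finset.sum_congr rfl fun j _ => ?_
    rw [integral_finsetSum _ fun k _ => i3 j k, integral_finsetSum _ fun k _ => i2 j k,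
      ← Finset.sum_add_distrib]
    refine Finset.sum_congr rfl fun k _ => ?_
    have h := integral_dstar_mul_conj hΦ (hα j) ((hα k).dbar j) ((hcα k).dbar j) k
    rw [dbar_dbar_comm hτ k j] at h
    rw [← h, ← integral_add (i2 j k) (i1 j k)]
    congr 1; ext z; ring
  have e : ∀ (g : Cn n → ℂ), ∫ z, g z * starRingEnd ℂ (g z) * wt Φ z =
      ((∫ z, ‖g z‖ ^ 2 * wt Φ z : ℝ) : ℂ) := fun g => by
    rw [← integral_complex_ofReal]
    congr 1; ext z; rw [Complex.mul_conj']; push_cast; ring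
  simp only [e] at key
  rw [show (fun z => ((levi Φ z (fun k => dbar k τ z) : ℝ) : ℂ) * (wt Φ z : ℂ)) =
    fun z => ((levi Φ z (fun k => dbar k τ z) * wt Φ z : ℝ) : ℂ) by ext z; push_cast; ring,
    integral_complex_ofReal] at key
  norm_cast at key
  rw [key]
  have : 0 ≤ ∑ j, ∑ k, ∫ z, ‖dbar j (dbar k τ) z‖ ^ 2 * wt Φ z :=
    Finset.sum_nonneg fun j _ => Finset.sum_nonneg fun k _ => integral_nonneg fun z =>
      mul_nonneg (by positivity) (wt_pos Φ z).le
  linarith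

end weight

/-! ### Mollification of test functions and Weyl's lemma -/

lemma moll_eq_integral_kernel {E : Type*} [NormedAddCommGroup E] [NormedSpace ℝ E] (ε : ℝ)
    (f : Cn n → E) (z : Cn n) : moll ε f z = ∫ x, rho ε (z - x) • f x := by
  rw [moll_apply, ← integral_sub_left_eq_self (fun x => rho ε (z - x) • f x) volume z]
  simp

lemma HasCompactSupport.moll {G : Cn n → ℂ} (hG : HasCompactSupport G) {ε : ℝ} (hε : 0 < ε) :
    HasCompactSupport (moll ε G) :=
  HasCompactSupport.convolution (L := ContinuousLinearMap.lsmul ℝ ℝ) (hasCompactSupport_rho hε) hG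

lemma moll_eq_zero_of_notMem {G : Cn n → ℂ} {ε : ℝ} (hε : 0 < ε) (hε1 : ε ≤ 1) {z : Cn n}
    (hz : z ∉ Metric.cthickening 1 (tsupport G)) : moll ε G z = 0 := by
  rw [moll_apply]
  refine integral_eq_zero_of_ae (Eventually.of_forall fun y => ?_)
  by_cases h0 : rho ε y = 0
  · simp [h0]
  have h1 := norm_lt_of_rho_ne hε h0
  have : G (z - y) = 0 := by
    by_contra h
    refine hz (Metric.mem_cthickening_of_dist_le z (z - y) 1 _ (subset_tsupport _ h) ?_)
    simpa [dist_eq_norm] using h1.le.trans hε1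
  simp [this]

/-- Mollification is symmetric. -/
lemma integral_moll_mul {X G : Cn n → ℂ} (hX : LocallyIntegrable X volume) (hG : Continuous G)
    (hc : HasCompactSupport G) {ε : ℝ} (hε : 0 < ε) :
    ∫ z, moll ε X z * G z = ∫ z, X z * moll ε G z := by
  set K := Metric.cthickening ε (tsupport G)
  have hK : IsCompact K := hc.isCompact.cthickening
  have hXK : Integrable (K.indicator X) volume :=
    (integrable_indicator_iff hK.isClosed.measurableSet).2 (hX.integrableOn_isCompact hK)
  have hGi : Integrable G volume := hG.integrable_of_hasCompactSupport hc
  obtain ⟨C, hC0, hC⟩ := exists_rho_le (n := n) hε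
  have hint : Integrable (fun p : Cn n × Cn n => ((rho ε (p.1 - p.2) : ℝ) : ℂ) *
      (G p.1 * K.indicator X p.2)) (volume.prod volume) := by
    refine (hGi.mul_prod hXK).bdd_mul (c := C) ?_ ?_
    · exact (Complex.continuous_ofReal.comp ((continuous_rho ε).comp
        (continuous_fst.sub continuous_snd))).aestronglyMeasurable
    · exact Eventually.of_forall fun p => by
        rw [Complex.norm_real, Real.norm_of_nonneg (rho_nonneg _ _)]; exact hC _
  have key : ∀ z x, ((rho ε (z - x) : ℝ) : ℂ) * (G z * K.indicator X x) =
      ((rho ε (z - x) : ℝ) : ℂ) * (G z * X x) := by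
    intro z x
    by_cases h0 : rho ε (z - x) = 0
    · simp [h0]
    by_cases hGz : G z = 0
    · simp [hGz]
    rw [Set.indicator_of_mem]
    refine Metric.mem_cthickening_of_dist_le x z ε _ (subset_tsupport _ hGz) ?_
    rw [dist_comm, dist_eq_norm]
    exact (norm_lt_of_rho_ne hε h0).le
  have hsw := integral_integral_swap (f := fun z x => ((rho ε (z - x) : ℝ) : ℂ) *
    (G z * K.indicator X x)) hint
  simp only [key] at hsw
  calc ∫ z, moll ε X z * G z = ∫ z, ∫ x, ((rho ε (z - x) : ℝ) : ℂ) * (G z * X x) := by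
        congr 1; ext z
        rw [moll_eq_integral_kernel, ← integral_mul_const]
        congr 1; ext x; simp only [Complex.real_smul]; ring
    _ = _ := hsw
    _ = _ := by
        congr 1; ext x
        rw [moll_eq_integral_kernel, ← integral_const_mul]
        congr 1; ext z
        rw [← rho_neg ε (x - z), neg_sub]
        simp only [Complex.real_smul]; ring

lemma dirD_moll {σ : Cn n → ℂ} (hσ : ContDiff ℝ ∞ σ) (hc : HasCompactSupport σ) {ε : ℝ}
    (hε : 0 < ε) (a : Cn n) : dirD a (moll ε σ) = moll ε (dirD a σ) := by
  ext z
  have h := hc.hasFDerivAt_convolution_right (ContinuousLinearMap.lsmul ℝ ℝ) (μ := volume)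
    (integrable_rho hε).locallyIntegrable (hσ.of_le (by norm_cast)) z
  have h2 : fderiv ℝ (moll ε σ) z = _ := h.fderiv
  rw [dirD, h2]
  exact convolution_precompR_apply (ContinuousLinearMap.lsmul ℝ ℝ)
    (integrable_rho hε).locallyIntegrable (hc.fderiv ℝ) (hσ.continuous_fderiv (by simp)) z a

lemma moll_add {f g : Cn n → ℂ} (hf : Continuous f) (hg : Continuous g) {ε : ℝ} (hε : 0 < ε) :
    moll ε (fun z => f z + g z) = fun z => moll ε f z + moll ε g z := by
  ext z
  simp only [moll_apply, smul_add]
  have : ∀ {f : Cn n → ℂ}, Continuous f → Integrable (fun y => rho ε y • f (z - y)) volume :=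
    fun {f} hf => ((continuous_rho ε).smul (hf.comp (continuous_const.sub
      continuous_id))).integrable_of_hasCompactSupport (hasCompactSupport_rho hε).smul_right
  exact integral_add (this hf) (this hg)

lemma moll_const_mul (c : ℂ) (f : Cn n → ℂ) (ε : ℝ) :
    moll ε (fun z => c * f z) = fun z => c * moll ε f z := by
  ext z
  simp only [moll_apply]
  rw [← integral_const_mul]
  congr 1; ext y; simp only [Complex.real_smul]; ring

lemma dbar_moll {σ : Cn n → ℂ} (hσ : ContDiff ℝ ∞ σ) (hc : HasCompactSupport σ) {ε : ℝ}
    (hε : 0 < ε) (j : Fin n) : dbar j (moll ε σ) = moll ε (dbar j σ) := by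
  have : dbar j σ = fun z => (1 / 2 : ℂ) * dirD (ee j) σ z +
      (Complex.I / 2) * dirD (Complex.I • ee j) σ z := by ext z; simp only [dbar]; ring
  rw [this, moll_add ((hσ.dirD _).continuous.const_mul _) ((hσ.dirD _).continuous.const_mul _) hε, moll_const_mul, moll_const_mul,
    ← dirD_moll hσ hc hε, ← dirD_moll hσ hc hε]
  ext z; simp only [dbar]; ring

lemma del_moll {σ : Cn n → ℂ} (hσ : ContDiff ℝ ∞ σ) (hc : HasCompactSupport σ) {ε : ℝ}
    (hε : 0 < ε) (j : Fin n) : del j (moll ε σ) = moll ε (del j σ) := by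
  have : del j σ = fun z => (1 / 2 : ℂ) * dirD (ee j) σ z +
      (-Complex.I / 2) * dirD (Complex.I • ee j) σ z := by ext z; simp only [del]; ring
  rw [this, moll_add ((hσ.dirD _).continuous.const_mul _) ((hσ.dirD _).continuous.const_mul _) hε, moll_const_mul, moll_const_mul,
    ← dirD_moll hσ hc hε, ← dirD_moll hσ hc hε]
  ext z; simp only [del]; ring

lemma tendsto_integral_mul_moll {X G : Cn n → ℂ} (hX : LocallyIntegrable X volume)
    (hG : Continuous G) (hc : HasCompactSupport G) :
    Tendsto (fun ε => ∫ z, X z * moll ε G z) (𝓝[>] 0) (𝓝 (∫ z, X z * G z)) := by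
  set K := Metric.cthickening 1 (tsupport G)
  have hK : IsCompact K := hc.isCompact.cthickening
  have hXK := hX.integrableOn_isCompact hK
  rw [Metric.tendsto_nhds]
  intro δ hδ
  set I := ∫ z in K, ‖X z‖
  have hI : 0 ≤ I := integral_nonneg fun _ => norm_nonneg _
  have hη : 0 < δ / (I + 1) := by positivity
  obtain ⟨r, hr, hru⟩ := Metric.uniformContinuous_iff.1
    (hc.uniformContinuous_of_continuous hG) _ hη
  filter_upwards [Ioo_mem_nhdsGT (lt_min hr one_pos)] with ε hε
  have hε0 := hε.1
  have hεr := hε.2.trans_le (min_le_left _ _)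
  have hε1 := hε.2.trans_le (min_le_right _ _)
  have hclose : ∀ z, ‖moll ε G z - G z‖ ≤ δ / (I + 1) := by
    intro z
    rw [← dist_eq_norm]
    refine dist_convolution_le (R := ε) hη.le ?_ (rho_nonneg ε) (integral_rho hε0)
      hG.aestronglyMeasurable ?_
    · intro y hy; simpa using norm_lt_of_rho_ne hε0 hy
    · intro x hx; exact (hru ((Metric.mem_ball.1 hx).trans hεr)).le
  have hcm : Continuous (moll ε G) := (contDiff_moll hε0 hG.locallyIntegrable).continuous
  have hint : ∀ {H : Cn n → ℂ}, Continuous H → HasCompactSupport H →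
      Integrable (fun z => X z * H z) volume := fun {H} hH hHc => by
    simpa [mul_comm] using hX.integrable_smul_left_of_hasCompactSupport hH hHc
  rw [dist_eq_norm, ← integral_sub (hint hcm (hc.moll hε0)) (hint hG hc)]
  have hzero : ∀ z ∉ K, X z * moll ε G z - X z * G z = 0 := by
    intro z hz
    have : G z = 0 := by
      by_contra h
      exact hz (Metric.self_subset_cthickening _ (subset_tsupport _ h))
    rw [moll_eq_zero_of_notMem hε0 hε1.le hz, this]; simp
  rw [← setIntegral_eq_integral_of_forall_compl_eq_zero hzero]
  calc ‖∫ z in K, (X z * moll ε G z - X z * G z)‖ ≤ ∫ z in K, ‖X z‖ * (δ / (I + 1)) := by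
        refine norm_integral_le_of_norm_le (hXK.norm.mul_const _) (Eventually.of_forall fun z => ?_)
        rw [← mul_sub, norm_mul]
        gcongr; exact hclose z
    _ = I * (δ / (I + 1)) := integral_mul_const _ _
    _ < δ := by
        rw [mul_div_assoc', div_lt_iff₀ (by positivity)]; nlinarith

lemma differentiable_of_dbar_eq_zero {f : Cn n → ℂ} (hf : ContDiff ℝ ∞ f)
    (h : ∀ j z, dbar j f z = 0) : Differentiable ℂ f := by
  intro z
  have hd : ∀ β, fderiv ℝ f z β = ∑ k, β k * del k f z := fun β => by
    have := dirD_eq_sum β f z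
    simpa [h, dirD] using this
  rw [differentiableAt_iff_restrictScalars ℝ (hf.diff z)]
  refine ⟨LinearMap.toContinuousLinearMap
    { toFun := fun β => ∑ k, β k * del k f z
      map_add' := fun β γ => by simp [add_mul, Finset.sum_add_distrib]
      map_smul' := fun c β => by simp [Finset.mul_sum, mul_assoc] }, ?_⟩
  ext β
  simp [hd]

lemma dbar_eq_zero_of_differentiableAt {f : Cn n → ℂ} {z : Cn n} (h : DifferentiableAt ℂ f z)
    (j : Fin n) : dbar j f z = 0 := by
  have h1 : fderiv ℝ f z = (fderiv ℂ f z).restrictScalars ℝ := h.fderiv_restrictScalars ℝ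
  simp only [dbar, dirD, h1, ContinuousLinearMap.coe_restrictScalars', map_smul, smul_eq_mul]
  rw [← mul_assoc, Complex.I_mul_I]; ring

lemma eq_of_integral_mul_eq {f g : Cn n → ℂ} (hf : Continuous f) (hg : Continuous g)
    (h : ∀ σ : Cn n → ℂ, ContDiff ℝ ∞ σ → HasCompactSupport σ →
      ∫ z, f z * σ z = ∫ z, g z * σ z) : f = g := by
  refine (hf.ae_eq_iff_eq volume hg).1
    (ae_eq_of_integral_contDiff_smul_eq hf.locallyIntegrable hg.locallyIntegrable ?_)
  intro σ hσ hc
  have := h (fun z => (σ z : ℂ)) hσ.ofReal (hc.comp_left (g := ((↑) : ℝ → ℂ)) (by simp))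
  simpa [Complex.real_smul, mul_comm] using this

/-- Weyl's lemma. -/
lemma exists_entire_of_weak {w : Cn n → ℂ} (hw : LocallyIntegrable w volume)
    (h : ∀ j, ∀ σ : Cn n → ℂ, ContDiff ℝ ∞ σ → HasCompactSupport σ →
      ∫ z, w z * dbar j σ z = 0) :
    ∃ f : Cn n → ℂ, Differentiable ℂ f ∧ w =ᵐ[volume] f := by
  have hsm : ∀ {ε : ℝ}, 0 < ε → ContDiff ℝ ∞ (moll ε w) := fun hε => contDiff_moll hε hw
  have hmσ : ∀ {ε : ℝ} {σ : Cn n → ℂ}, 0 < ε → ContDiff ℝ ∞ σ → ContDiff ℝ ∞ (moll ε σ) :=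
    fun hε hσ => contDiff_moll hε hσ.continuous.locallyIntegrable
  have hent : ∀ {ε : ℝ}, 0 < ε → Differentiable ℂ (moll ε w) := fun {ε} hε => by
    refine differentiable_of_dbar_eq_zero (hsm hε) fun j => congrFun ?_
    refine eq_of_integral_mul_eq (g := 0) ((hsm hε).dbar j).continuous continuous_zero
      fun σ hσ hc => ?_
    rw [integral_dbar_mul (hsm hε) hσ hc, integral_moll_mul hw (hσ.dbar j).continuous (hc.dbar j) hε,
      ← dbar_moll hσ hc hε, h j _ (hmσ hε hσ) (hc.moll hε)]
    simp
  have hcomm : ∀ {ε δ : ℝ} {σ : Cn n → ℂ}, 0 < ε → 0 < δ → ContDiff ℝ ∞ σ → HasCompactSupport σ →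
      ∫ z, w z * moll ε (moll δ σ) z = ∫ z, moll ε w z * σ z := fun {ε δ σ} hε hδ hσ hc => by
    rw [← integral_moll_mul hw (hmσ hδ hσ).continuous (hc.moll hδ) hε,
      ← integral_moll_mul (hsm hε).continuous.locallyIntegrable hσ.continuous hc hδ]
    congr 1; ext z
    rw [moll_eq_self_of_differentiableOn isOpen_univ (hent hε).differentiableOn hδ
      (Set.subset_univ _)]
  have hswap : ∀ {ε δ : ℝ} {σ : Cn n → ℂ}, 0 < ε → 0 < δ → ContDiff ℝ ∞ σ → HasCompactSupport σ →
      moll ε (moll δ σ) = moll δ (moll ε σ) := fun {ε δ σ} hε hδ hσ hc => by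
    refine eq_of_integral_mul_eq (hmσ hε (hmσ hδ hσ)).continuous (hmσ hδ (hmσ hε hσ)).continuous
      fun τ hτ hτc => ?_
    have hi : Integrable (fun p : Cn n × Cn n => rho ε p.1 * rho δ p.2) (volume.prod volume) :=
      (integrable_rho hε).mul_prod (integrable_rho hδ)
    congr 1; ext z; congr 1
    simp only [moll_apply]
    obtain ⟨C, hC⟩ := hc.exists_bound_of_continuous hσ.continuous
    have hi2 : Integrable (fun p : Cn n × Cn n => (rho ε p.1 * rho δ p.2) • σ (z - p.1 - p.2))
        (volume.prod volume) := by
      refine hi.smul_bdd C ?_ (Eventually.of_forall fun p => hC _)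
      exact (hσ.continuous.comp (by fun_prop)).aestronglyMeasurable
    have := integral_integral_swap (f := fun x y => (rho ε x * rho δ y) • σ (z - x - y)) hi2
    calc _ = ∫ x, ∫ y, (rho ε x * rho δ y) • σ (z - x - y) := by
          congr 1; ext x; rw [← integral_smul]; congr 1; ext y; rw [smul_smul]
      _ = _ := this
      _ = _ := by
          congr 1; ext x; rw [← integral_smul]; congr 1; ext y; rw [smul_smul, mul_comm]
          congr 2; abel
  have hind : ∀ {ε : ℝ}, 0 < ε → moll ε w = moll 1 w := fun {ε} hε =>
    eq_of_integral_mul_eq (hsm hε).continuous (hsm one_pos).continuous fun σ hσ hc => by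
      rw [← hcomm hε one_pos hσ hc, ← hcomm one_pos hε hσ hc, hswap hε one_pos hσ hc]
  refine ⟨moll 1 w, hent one_pos, ae_eq_of_integral_contDiff_smul_eq hw
    (hsm one_pos).continuous.locallyIntegrable fun σ hσ hc => ?_⟩
  have hσ' := hσ.ofReal
  have hc' : HasCompactSupport fun z => (σ z : ℂ) := hc.comp_left (g := ((↑) : ℝ → ℂ)) (by simp)
  have ht := tendsto_integral_mul_moll hw hσ'.continuous hc'
  have hconst : (fun ε => ∫ z, w z * moll ε (fun z => (σ z : ℂ)) z) =ᶠ[𝓝[>] 0]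
      fun _ => ∫ z, moll 1 w z * σ z := by
    filter_upwards [self_mem_nhdsWithin] with ε hε
    rw [← integral_moll_mul hw hσ'.continuous hc' hε, hind hε]
  have := tendsto_nhds_unique (tendsto_const_nhds.congr' hconst.symm) ht
  simpa [Complex.real_smul, mul_comm] using this.symm

/-! ### Functions orthogonal to the range of the weighted Laplacian are entire -/

/-- A Jensen type inequality for mollifications. -/
lemma norm_moll_sq_le {Y : Cn n → ℂ} {g : Cn n → ℝ} (hY : LocallyIntegrable Y volume)
    (hg : LocallyIntegrable g volume) {ε : ℝ} (hε : 0 < ε) {κ : ℝ} {z : Cn n}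
    (h : ∀ y, ‖y‖ < ε → ‖Y (z - y)‖ ^ 2 ≤ κ * g (z - y)) :
    ‖moll ε Y z‖ ^ 2 ≤ κ * moll ε g z := by
  have hint : ∀ {F : Type} [NormedAddCommGroup F] [NormedSpace ℝ F] {f : Cn n → F},
      LocallyIntegrable f volume → Integrable (fun y => rho ε y • f (z - y)) volume :=
    fun {F} _ _ {f} hf =>
      (hasCompactSupport_rho hε).convolutionExists_left (ContinuousLinearMap.lsmul ℝ ℝ)
        (continuous_rho ε) hf z
  have hYn := hint (f := fun z => ‖Y z‖) fun x => by
    obtain ⟨s, hs, h⟩ := hY x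
    exact ⟨s, hs, h.norm⟩
  have hgi := hint hg
  set m := ‖moll ε Y z‖
  have hm : m ≤ ∫ y, rho ε y • ‖Y (z - y)‖ := by
    refine (norm_integral_le_integral_norm _).trans_eq ?_
    congr 1; ext y
    change ‖rho ε y • Y (z - y)‖ = _
    rw [norm_smul, Real.norm_of_nonneg (rho_nonneg _ _), smul_eq_mul]
  have hm0 : 0 ≤ m := norm_nonneg _
  have h2 : ∫ y, 2 * m * (rho ε y • ‖Y (z - y)‖) ≤
      ∫ y, (m ^ 2 * rho ε y + κ * (rho ε y • g (z - y))) := by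
    refine integral_mono (hYn.const_mul _)
      (((integrable_rho hε).const_mul _).add (hgi.const_mul _)) fun y => ?_
    simp only [smul_eq_mul]
    by_cases h0 : rho ε y = 0
    · simp [h0]
    have h3 := h y (norm_lt_of_rho_ne hε h0)
    have h4 := rho_nonneg ε y
    nlinarith [mul_nonneg h4 (sq_nonneg (m - ‖Y (z - y)‖)), mul_le_mul_of_nonneg_left h3 h4]
  rw [integral_const_mul, integral_add ((integrable_rho hε).const_mul _) (hgi.const_mul _),
    integral_const_mul, integral_const_mul, integral_rho hε] at h2
  rw [moll_apply]
  nlinarith [mul_le_mul_of_nonneg_left hm hm0]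

lemma integrable_moll {g : Cn n → ℝ} (hg : Integrable g volume) {ε : ℝ} (hε : 0 < ε) :
    Integrable (moll ε g) volume :=
  (integrable_rho hε).integrable_convolution (ContinuousLinearMap.lsmul ℝ ℝ) hg

lemma integral_moll {g : Cn n → ℝ} (hg : Integrable g volume) {ε : ℝ} (hε : 0 < ε) :
    ∫ z, moll ε g z = ∫ z, g z := by
  have := integral_convolution (ContinuousLinearMap.lsmul ℝ ℝ) (μ := volume) (ν := volume)
    (integrable_rho hε) hg
  rw [integral_rho hε] at this
  simpa [moll] using this

lemma energy_pointwise (W χ : ℝ) (hW : 0 < W) (D c x w : ℂ) :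
    1 / 2 * (χ ^ 2 * ‖D‖ ^ 2 * W) ≤ ((W * D + c) *
      ((χ : ℂ) ^ 2 * starRingEnd ℂ D + 2 * χ * x * starRingEnd ℂ w)).re +
      5 * (‖x‖ ^ 2 * ‖w‖ ^ 2 * W) + 2 * (χ ^ 2 * ‖c‖ ^ 2 / W) := by
  have e : (W * D + c) * ((χ : ℂ) ^ 2 * starRingEnd ℂ D + 2 * χ * x * starRingEnd ℂ w) =
      ((χ ^ 2 * ‖D‖ ^ 2 * W : ℝ) : ℂ) + (W * D * (2 * χ * x * starRingEnd ℂ w) +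
        c * (χ : ℂ) ^ 2 * starRingEnd ℂ D + c * (2 * χ * x * starRingEnd ℂ w)) := by
    push_cast; rw [← Complex.mul_conj' D]; ring
  rw [e, Complex.add_re, Complex.ofReal_re]
  set Q := W * D * (2 * χ * x * starRingEnd ℂ w) +
        c * (χ : ℂ) ^ 2 * starRingEnd ℂ D + c * (2 * χ * x * starRingEnd ℂ w)
  have hQ : ‖Q‖ ≤ W * ‖D‖ * (2 * |χ| * ‖x‖ * ‖w‖) + ‖c‖ * χ ^ 2 * ‖D‖ +
      ‖c‖ * (2 * |χ| * ‖x‖ * ‖w‖) := by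
    refine (norm_add₃_le).trans_eq ?_
    simp [abs_of_pos hW]
  have hre : -‖Q‖ ≤ Q.re := by
    have := Complex.abs_re_le_norm Q
    exact (abs_le.1 this).1
  have hc2 : χ ^ 2 * ‖c‖ ^ 2 / W = (|χ| * ‖c‖ / √W) ^ 2 := by
    rw [div_pow, mul_pow, Real.sq_sqrt hW.le, sq_abs]
  set d := |χ| * ‖D‖ * √W
  set p := ‖x‖ * ‖w‖ * √W
  set q := |χ| * ‖c‖ / √W with hq
  have hs : √W ≠ 0 := (Real.sqrt_pos.2 hW).ne'
  have hsq : √W * √W = W := Real.mul_self_sqrt hW.le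
  have t1 : W * ‖D‖ * (2 * |χ| * ‖x‖ * ‖w‖) = 2 * d * p := by
    simp only [d, p]; nth_rewrite 1 [← hsq]; ring
  have t2 : ‖c‖ * χ ^ 2 * ‖D‖ = q * d := by
    simp only [q, d]; rw [← sq_abs χ]; field_simp
  have t3 : ‖c‖ * (2 * |χ| * ‖x‖ * ‖w‖) = 2 * q * p := by
    simp only [q, p]; field_simp
  have t4 : χ ^ 2 * ‖D‖ ^ 2 * W = d ^ 2 := by
    simp only [d]; rw [mul_pow, mul_pow, Real.sq_sqrt hW.le, sq_abs]
  have t5 : ‖x‖ ^ 2 * ‖w‖ ^ 2 * W = p ^ 2 := by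
    simp only [p]; rw [mul_pow, mul_pow, Real.sq_sqrt hW.le]
  rw [t4, t5, hc2]
  rw [t1, t2, t3] at hQ
  nlinarith [sq_nonneg (d / 2 - 2 * p), sq_nonneg (d / 2 - q), sq_nonneg (q - p)]

/-- Caccioppoli type inequality. -/
lemma energy_le {W : Cn n → ℝ} (hW : Continuous W) (hWp : ∀ z, 0 < W z) {u : Cn n → ℂ}
    (hu : ContDiff ℝ ∞ u) {c : Fin n → Cn n → ℂ} (hc : ∀ j, Continuous (c j))
    (h : ∀ σ : Cn n → ℂ, ContDiff ℝ ∞ σ → HasCompactSupport σ →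
      ∫ z, ∑ j, (W z * dbar j u z + c j z) * del j σ z = 0)
    {χ : Cn n → ℝ} (hχ : ContDiff ℝ ∞ χ) (hχc : HasCompactSupport χ) :
    ∫ z, ∑ j, χ z ^ 2 * ‖dbar j u z‖ ^ 2 * W z ≤
      10 * (∫ z, ∑ j, ‖del j (fun z => (χ z : ℂ)) z‖ ^ 2 * ‖u z‖ ^ 2 * W z) +
      4 * ∫ z, ∑ j, χ z ^ 2 * ‖c j z‖ ^ 2 / W z := by
  set X : Cn n → ℂ := fun z => (χ z : ℂ) with hX
  have hXs : ContDiff ℝ ∞ X := hχ.ofReal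
  have hXc : HasCompactSupport X := hχc.comp_left (g := ((↑) : ℝ → ℂ)) (by simp)
  set σ : Cn n → ℂ := fun z => (X z * X z) * starRingEnd ℂ (u z)
  have hσ : ContDiff ℝ ∞ σ := (hXs.mul hXs).mul hu.conj
  have hσc : HasCompactSupport σ := hXc.mul_right.mul_right
  have hdσ : ∀ j z, del j σ z = (χ z : ℂ) ^ 2 * starRingEnd ℂ (dbar j u z) +
      2 * χ z * del j X z * starRingEnd ℂ (u z) := by
    intro j z
    have h1 := congrFun (del_mul (hXs.mul hXs) hu.conj j) z
    rw [show del j σ z = _ from h1, del_conj hu, congrFun (del_mul hXs hXs j) z]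
    simp only [hX]; ring
  have hdu := fun j => (hu.dbar j).continuous
  have hdX := fun j => (hXs.del j).continuous
  have hi : ∀ {F : Type} [NormedAddCommGroup F] {f : Cn n → F}, Continuous f →
      HasCompactSupport f → Integrable f volume :=
    fun {F} _ {f} hf hfc => hf.integrable_of_hasCompactSupport hfc
  have i0 : ∀ j, Integrable (fun z => (W z * dbar j u z + c j z) * del j σ z) volume := fun j =>
    hi (((Complex.continuous_ofReal.comp hW).mul (hdu j) |>.add (hc j)).mul
      (hσ.del j).continuous) (hσc.del j).mul_left
  have i1 : ∀ j, Integrable (fun z => χ z ^ 2 * ‖dbar j u z‖ ^ 2 * W z) volume := fun j =>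
    hi (((hχ.continuous.pow 2).mul ((hdu j).norm.pow 2)).mul hW)
      ((hχc.comp_left (g := fun x => x ^ 2) (by simp)).mul_right.mul_right)
  have i2 : ∀ j, Integrable (fun z => ‖del j X z‖ ^ 2 * ‖u z‖ ^ 2 * W z) volume := fun j =>
    hi ((((hdX j).norm.pow 2).mul (hu.continuous.norm.pow 2)).mul hW)
      (((hXc.del j).comp_left (g := fun x => ‖x‖ ^ 2) (by simp)).mul_right.mul_right)
  have i3 : ∀ j, Integrable (fun z => χ z ^ 2 * ‖c j z‖ ^ 2 / W z) volume := fun j => by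
    simp only [div_eq_mul_inv]
    exact hi (((hχ.continuous.pow 2).mul ((hc j).norm.pow 2)).mul (hW.inv₀ fun z => (hWp z).ne'))
      ((hχc.comp_left (g := fun x => x ^ 2) (by simp)).mul_right.mul_right)
  have I1 := integrable_finsetSum Finset.univ fun j _ => i1 j
  have I2 := integrable_finsetSum Finset.univ fun j _ => i2 j
  have I3 := integrable_finsetSum Finset.univ fun j _ => i3 j
  have I0 := integrable_finsetSum Finset.univ fun j _ => i0 j
  have hre : ∫ z, (∑ j, (W z * dbar j u z + c j z) * del j σ z).re = 0 := by
    have := integral_re I0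
    simp only [RCLike.re_eq_complex_re] at this
    rw [this, h σ hσ hσc]; simp
  have hle : ∫ z, 1 / 2 * (∑ j, χ z ^ 2 * ‖dbar j u z‖ ^ 2 * W z) ≤
      ∫ z, ((∑ j, (W z * dbar j u z + c j z) * del j σ z).re +
        5 * (∑ j, ‖del j X z‖ ^ 2 * ‖u z‖ ^ 2 * W z) +
        2 * ∑ j, χ z ^ 2 * ‖c j z‖ ^ 2 / W z) := by
    refine integral_mono (I1.const_mul _) ((I0.re.add (I2.const_mul 5)).add (I3.const_mul 2))
      fun z => ?_
    simp only [Finset.mul_sum, Complex.re_sum, ← Finset.sum_add_distrib]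
    refine Finset.sum_le_sum fun j _ => ?_
    rw [hdσ]
    exact energy_pointwise (W z) (χ z) (hWp z) _ _ _ _
  have Ire : Integrable (fun z => (∑ j, (W z * dbar j u z + c j z) * del j σ z).re) volume := I0.re
  have Isum : Integrable (fun z => (∑ j, (W z * dbar j u z + c j z) * del j σ z).re +
      5 * (∑ j, ‖del j X z‖ ^ 2 * ‖u z‖ ^ 2 * W z)) volume := Ire.add (I2.const_mul 5)
  rw [integral_const_mul, integral_add Isum (I3.const_mul 2),
    integral_add Ire (I2.const_mul 5), integral_const_mul, integral_const_mul, hre] at hle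
  linarith

/-- Cutoff functions with small gradient. -/
lemma exists_cutoff : ∃ C : ℝ, 0 ≤ C ∧ ∀ R : ℝ, 0 < R → ∃ χ : Cn n → ℝ, ContDiff ℝ ∞ χ ∧
    HasCompactSupport χ ∧ (∀ z, ‖z‖ ≤ R → χ z = 1) ∧ (∀ z, χ z ^ 2 ≤ 1) ∧
    ∀ j z, ‖del j (fun z => (χ z : ℂ)) z‖ ≤ C / R := by
  set N : ℝ := n + 1
  have hN : 0 < N := by positivity
  set χ : Cn n → ℝ := fun z => Real.smoothTransition (N + 1 - nsq z)
  have hχ : ContDiff ℝ ∞ χ := Real.smoothTransition.contDiff.comp (contDiff_const.sub contDiff_nsq)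
  have hχc : HasCompactSupport χ := by
    refine HasCompactSupport.of_support_subset_isCompact
      (isCompact_closedBall (0 : Cn n) (N + 1)) fun z hz => ?_
    simp only [mem_closedBall_zero_iff]
    by_contra hlt
    push Not at hlt
    refine hz (Real.smoothTransition.zero_of_nonpos ?_)
    nlinarith [norm_sq_le_nsq z]
  have hXs : ContDiff ℝ ∞ fun z => (χ z : ℂ) := hχ.ofReal
  have hXc : HasCompactSupport fun z => (χ z : ℂ) :=
    hχc.comp_left (g := ((↑) : ℝ → ℂ)) (by simp)
  have hb : ∀ j, ∃ C, ∀ z, ‖del j (fun z => (χ z : ℂ)) z‖ ≤ C := fun j =>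
    (hXc.del j).exists_bound_of_continuous (hXs.del j).continuous
  choose C hC using hb
  refine ⟨∑ j, |C j|, Finset.sum_nonneg fun j _ => abs_nonneg _, fun R hR =>
    ⟨fun z => χ (R⁻¹ • z), ?_, ?_, ?_, ?_, ?_⟩⟩
  · exact hχ.comp (contDiff_const_smul _)
  · exact hχc.comp_smul (inv_ne_zero hR.ne')
  · intro z hz
    refine Real.smoothTransition.one_of_one_le ?_
    have h1 : ‖R⁻¹ • z‖ ≤ 1 := by
      rw [norm_smul, norm_inv, Real.norm_of_nonneg hR.le, inv_mul_le_iff₀ hR]; simpa using hz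
    have h2 := nsq_le_norm_sq (R⁻¹ • z)
    have h3 : ‖R⁻¹ • z‖ ^ 2 ≤ 1 := pow_le_one₀ (norm_nonneg _) h1
    have : (n : ℝ) * ‖R⁻¹ • z‖ ^ 2 ≤ n := mul_le_of_le_one_right (Nat.cast_nonneg n) h3
    simp only [N]; linarith
  · intro z
    exact pow_le_one₀ (Real.smoothTransition.nonneg _) (Real.smoothTransition.le_one _)
  · intro j z
    have hs : del j (fun z => (χ (R⁻¹ • z) : ℂ)) z =
        (R⁻¹ : ℝ) • del j (fun z => (χ z : ℂ)) (R⁻¹ • z) := by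
      have h1 : ∀ a, dirD a (fun z => (χ (R⁻¹ • z) : ℂ)) z =
          (R⁻¹ : ℝ) • dirD a (fun z => (χ z : ℂ)) (R⁻¹ • z) := fun a => by
        have := fderiv_comp_smul (𝕜 := ℝ) (f := fun z => (χ z : ℂ)) (R⁻¹ : ℝ) (x := z)
        simp only [dirD]
        rw [this]; rfl
      simp only [del, h1, Complex.real_smul]; ring
    rw [hs, norm_smul, norm_inv, Real.norm_of_nonneg hR.le, div_eq_inv_mul]
    gcongr
    exact (hC j _).trans ((le_abs_self _).trans
      (Finset.single_le_sum (f := fun j => |C j|) (fun _ _ => abs_nonneg _) (Finset.mem_univ j)))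

section weight
variable {Φ : Cn n → ℝ} (hΦ : ContDiff ℝ ∞ Φ)
include hΦ

lemma dbar_wt (j : Fin n) : dbar j (fun z => (wt Φ z : ℂ)) =
    fun z => - dbar j (fun z => (Φ z : ℂ)) z * wt Φ z := by
  have h := del_wt hΦ j
  ext z
  have h1 := congrArg (starRingEnd ℂ) (congrFun h z)
  rw [del_ofReal hΦ.wt, del_ofReal hΦ] at h1
  simpa using h1

lemma locallyIntegrable_mul_of_sq {w : Cn n → ℂ} (hw : AEStronglyMeasurable w volume)
    (hg : Integrable (fun z => ‖w z‖ ^ 2 * wt Φ z) volume) {a : Cn n → ℂ} (ha : Continuous a) :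
    LocallyIntegrable (fun z => a z * w z) volume := by
  have h1 : LocallyIntegrable (fun z => ‖w z‖ ^ 2 * wt Φ z + ‖a z‖ ^ 2 / wt Φ z) volume := by
    refine hg.locallyIntegrable.add (Continuous.locallyIntegrable ?_)
    exact (ha.norm.pow 2).div hΦ.wt.continuous fun z => (wt_pos Φ z).ne'
  refine h1.mono (ha.aestronglyMeasurable.mul hw) (Eventually.of_forall fun z => ?_)
  have hW := wt_pos Φ z
  have hs : √(wt Φ z) ≠ 0 := (Real.sqrt_pos.2 hW).ne'
  rw [Real.norm_of_nonneg (by positivity), norm_mul]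
  have e1 : ‖w z‖ ^ 2 * wt Φ z = (‖w z‖ * √(wt Φ z)) ^ 2 := by
    rw [mul_pow, Real.sq_sqrt hW.le]
  have e2 : ‖a z‖ ^ 2 / wt Φ z = (‖a z‖ / √(wt Φ z)) ^ 2 := by
    rw [div_pow, Real.sq_sqrt hW.le]
  have e3 : ‖a z‖ * ‖w z‖ = (‖a z‖ / √(wt Φ z)) * (‖w z‖ * √(wt Φ z)) := by field_simp
  rw [e1, e2, e3]
  nlinarith [sq_nonneg ((‖a z‖ / √(wt Φ z)) - (‖w z‖ * √(wt Φ z))),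
    sq_nonneg (‖a z‖ / √(wt Φ z)), sq_nonneg (‖w z‖ * √(wt Φ z))]

/-- The equation satisfied by the mollifications. -/
lemma mollified_equation {w : Cn n → ℂ} (hw : AEStronglyMeasurable w volume)
    (hg : Integrable (fun z => ‖w z‖ ^ 2 * wt Φ z) volume)
    (h : ∀ τ : Cn n → ℂ, ContDiff ℝ ∞ τ → HasCompactSupport τ →
      ∫ z, w z * starRingEnd ℂ (lap Φ τ z) * wt Φ z = 0) {ε : ℝ} (hε : 0 < ε)
    {σ : Cn n → ℂ} (hσ : ContDiff ℝ ∞ σ) (hσc : HasCompactSupport σ) :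
    ∫ z, ∑ j, (dbar j (moll ε fun z => wt Φ z * w z) z +
      moll ε (fun z => (dbar j (fun z => (Φ z : ℂ)) z * wt Φ z) * w z) z) * del j σ z = 0 := by
  have hP := fun j => (hΦ.ofReal.dbar j).continuous
  have hWc : Continuous fun z => (wt Φ z : ℂ) := hΦ.wt.ofReal.continuous
  have hX := locallyIntegrable_mul_of_sq hΦ hw hg hWc
  have hPX : ∀ j, LocallyIntegrable (fun z => (dbar j (fun z => (Φ z : ℂ)) z * wt Φ z) * w z)
      volume := fun j => locallyIntegrable_mul_of_sq hΦ hw hg ((hP j).mul hWc)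
  set X := fun z => (wt Φ z : ℂ) * w z
  set Y := fun j => fun z => (dbar j (fun z => (Φ z : ℂ)) z * wt Φ z) * w z with hY
  have hXs := contDiff_moll hε hX
  have hYs := fun j => contDiff_moll hε (hPX j)
  set s := moll ε σ
  have hs : ContDiff ℝ ∞ s := contDiff_moll hε hσ.continuous.locallyIntegrable
  have hsc : HasCompactSupport s := hσc.moll hε
  have hint : ∀ {X H : Cn n → ℂ}, LocallyIntegrable X volume → ContDiff ℝ ∞ H →
      HasCompactSupport H → Integrable (fun z => X z * H z) volume := fun {X H} hX hH hHc => by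
    simpa [mul_comm] using hX.integrable_smul_left_of_hasCompactSupport hH.continuous hHc
  have iY := fun j => hint (hPX j) (hs.del j) (hsc.del j)
  have iX := fun j => hint hX ((hs.del j).dbar j) ((hsc.del j).dbar j)
  have h0 := h (fun z => starRingEnd ℂ (s z)) hs.conj hsc.conj
  have e0 : ∀ z, w z * starRingEnd ℂ (lap Φ (fun z => starRingEnd ℂ (s z)) z) * wt Φ z =
      ∑ j, (Y j z * del j s z - X z * dbar j (del j s) z) := by
    intro z
    simp only [lap, map_sum, Finset.mul_sum, Finset.sum_mul]
    refine Finset.sum_congr rfl fun j _ => ?_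
    rw [dbar_conj hs, dstar, del_conj (hs.del j), del_ofReal hΦ]
    simp only [hY, X, map_sub, map_mul, Complex.conj_conj]; ring
  simp only [e0] at h0
  have iYX : ∀ j ∈ Finset.univ, Integrable (fun z => Y j z * del j s z - X z * dbar j (del j s) z)
      volume := fun j _ => (iY j).sub (iX j)
  rw [integral_finsetSum _ iYX] at h0
  have i1 : ∀ j, Integrable (fun z => dbar j (moll ε X) z * del j σ z) volume := fun j =>
    ((hXs.dbar j).mul (hσ.del j)).integrable_of_hasCompactSupport (hσc.del j).mul_left
  have i2 : ∀ j, Integrable (fun z => moll ε (Y j) z * del j σ z) volume := fun j =>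
    ((hYs j).mul (hσ.del j)).integrable_of_hasCompactSupport (hσc.del j).mul_left
  have i12 : ∀ j ∈ Finset.univ, Integrable (fun z => dbar j (moll ε X) z * del j σ z +
      moll ε (Y j) z * del j σ z) volume := fun j _ => (i1 j).add (i2 j)
  change ∫ z, ∑ j, (dbar j (moll ε X) z + moll ε (Y j) z) * del j σ z = 0
  simp only [add_mul]
  rw [integral_finsetSum _ i12, ← h0]
  refine Finset.sum_congr rfl fun j _ => ?_
  rw [integral_add (i1 j) (i2 j), show ∫ z, (Y j z * del j s z - X z * dbar j (del j s) z) = _ from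
    integral_sub (iY j) (iX j), integral_dbar_mul hXs (hσ.del j)
    (hσc.del j), integral_moll_mul hX ((hσ.del j).dbar j).continuous ((hσc.del j).dbar j) hε,
    integral_moll_mul (hPX j) (hσ.del j).continuous (hσc.del j) hε,
    ← dbar_moll (hσ.del j) (hσc.del j) hε, ← del_moll hσ hσc hε]
  ring

/-- The mollifications have small `∂̄` on compact sets. -/
lemma exists_cutoff_energy_le {w : Cn n → ℂ} (hw : AEStronglyMeasurable w volume)
    (hg : Integrable (fun z => ‖w z‖ ^ 2 * wt Φ z) volume)
    (h : ∀ τ : Cn n → ℂ, ContDiff ℝ ∞ τ → HasCompactSupport τ →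
      ∫ z, w z * starRingEnd ℂ (lap Φ τ z) * wt Φ z = 0) {t : ℝ} (ht : 0 < t) (r : ℝ) :
    ∃ χ : Cn n → ℝ, ContDiff ℝ ∞ χ ∧ HasCompactSupport χ ∧ (∀ z, ‖z‖ ≤ r → χ z = 1) ∧
      ∀ᶠ ε in 𝓝[>] (0:ℝ), ∫ z, ∑ j, χ z ^ 2 *
        ‖dbar j (fun z => (moll ε (fun z => wt Φ z * w z) z) * (Real.exp (Φ z) : ℝ)) z‖ ^ 2 *
          wt Φ z ≤ t := by
  set g : Cn n → ℝ := fun z => ‖w z‖ ^ 2 * wt Φ z with hgdef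
  set N := ∫ z, g z
  have hN : 0 ≤ N := integral_nonneg fun z => mul_nonneg (sq_nonneg _) (wt_pos Φ z).le
  obtain ⟨C, hC0, hC⟩ := exists_cutoff (n := n)
  obtain ⟨R, hRr, hR0, hR⟩ : ∃ R, r ≤ R ∧ 0 < R ∧ 10 * (n * (C / R) ^ 2 * (2 * N)) ≤ t / 2 := by
    have : Tendsto (fun R : ℝ => 10 * (n * (C / R) ^ 2 * (2 * N))) atTop
        (𝓝 (10 * (n * 0 ^ 2 * (2 * N)))) :=
      ((((tendsto_const_nhds.div_atTop tendsto_id).pow 2).const_mul _).mul_const _).const_mul _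
    have h2 := (this.eventually_le_const (u := t / 2) (by simp; positivity)).and
      ((eventually_ge_atTop r).and (eventually_gt_atTop 0))
    obtain ⟨R, h1, h2, h3⟩ := h2.exists
    exact ⟨R, h2, h3, h1⟩
  obtain ⟨χ, hχ, hχc, hχ1, hχle, hχd⟩ := hC R hR0
  refine ⟨χ, hχ, hχc, fun z hz => hχ1 z (hz.trans hRr), ?_⟩
  obtain ⟨η, hη0, hη⟩ : ∃ η : ℝ, 0 < η ∧ 4 * (n * (η ^ 2 * (2 * N))) ≤ t / 2 := by
    have : Tendsto (fun η : ℝ => 4 * (n * (η ^ 2 * (2 * N)))) (𝓝[>] 0)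
        (𝓝 (4 * (n * ((0:ℝ) ^ 2 * (2 * N))))) :=
      (Continuous.tendsto (by fun_prop) 0).mono_left nhdsWithin_le_nhds
    have h2 := (this.eventually_le_const (u := t / 2) (by simp; positivity)).and
      self_mem_nhdsWithin
    obtain ⟨η, h1, h2⟩ := h2.exists
    exact ⟨η, h2, h1⟩
  have hP := fun j => (hΦ.ofReal.dbar j).continuous
  have hWc : Continuous fun z => (wt Φ z : ℂ) := hΦ.wt.ofReal.continuous
  have hX := locallyIntegrable_mul_of_sq hΦ hw hg hWc
  have hPX : ∀ j, LocallyIntegrable (fun z => (dbar j (fun z => (Φ z : ℂ)) z * wt Φ z) * w z)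
      volume := fun j => locallyIntegrable_mul_of_sq hΦ hw hg ((hP j).mul hWc)
  set X := fun z => (wt Φ z : ℂ) * w z with hXdef
  set Y := fun j => fun z => (dbar j (fun z => (Φ z : ℂ)) z * wt Φ z) * w z with hY
  set K := tsupport χ
  have hK : IsCompact K := hχc
  set K' := Metric.cthickening 1 K
  have hK' : IsCompact K' := hK.cthickening
  have hKK' : K ⊆ K' := Metric.self_subset_cthickening _
  have huc : ∀ {F : Type} [NormedAddCommGroup F] {f : Cn n → F}, Continuous f → ∀ {η : ℝ}, 0 < η →
      ∀ᶠ ε in 𝓝[>] (0:ℝ), ∀ z ∈ K, ∀ y, ‖y‖ < ε → ‖f (z - y) - f z‖ < η :=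
    fun {F} _ {f} hf {η} hη => by
      have hu := hK'.uniformContinuousOn_of_continuous hf.continuousOn
      obtain ⟨δ, hδ, hδu⟩ := Metric.uniformContinuousOn_iff.1 hu η hη
      filter_upwards [Ioo_mem_nhdsGT (lt_min hδ one_pos)] with ε hε z hz y hy
      have hy1 := hy.trans hε.2
      rw [← dist_eq_norm]
      have hd : dist (z - y) z = ‖y‖ := by simp
      refine hδu _ (Metric.mem_cthickening_of_dist_le _ z 1 _ hz ?_) z (hKK' hz) ?_
      · rw [hd]; exact (hy1.trans_le (min_le_right _ _)).le
      · rw [hd]; exact hy1.trans_le (min_le_left _ _)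
  have hlog2 : 0 < Real.log 2 := Real.log_pos (by norm_num)
  have hev := eventually_all.2 fun j => huc (hP j) hη0
  filter_upwards [self_mem_nhdsWithin, huc hΦ.continuous hlog2, hev] with ε hε hΦε hPε
  replace hε : 0 < ε := hε
  have hXs := contDiff_moll hε hX
  have hYs := fun j => contDiff_moll hε (hPX j)
  have hexp : ContDiff ℝ ∞ fun z => ((Real.exp (Φ z) : ℝ) : ℂ) := hΦ.exp.ofReal
  set u : Cn n → ℂ := fun z => (moll ε X z) * (Real.exp (Φ z) : ℝ) with hu
  have hus : ContDiff ℝ ∞ u := hXs.mul hexp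
  have hew : ∀ z, Real.exp (Φ z) * wt Φ z = 1 := fun z => by
    rw [wt, ← Real.exp_add]; simp
  have huX : ∀ z, moll ε X z = u z * wt Φ z := fun z => by
    rw [hu, mul_assoc, ← Complex.ofReal_mul, hew]; simp
  set c : Fin n → Cn n → ℂ := fun j z =>
    moll ε (Y j) z - dbar j (fun z => (Φ z : ℂ)) z * moll ε X z with hc
  have hcc : ∀ j, Continuous (c j) := fun j =>
    (hYs j).continuous.sub ((hP j).mul hXs.continuous)
  have hwe : ∀ z ∈ K, ∀ y, ‖y‖ < ε → wt Φ (z - y) ≤ 2 * wt Φ z := by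
    intro z hz y hy
    have h1 := (abs_lt.1 (hΦε z hz y hy)).1
    rw [wt, wt, ← Real.exp_log (two_pos : (0:ℝ) < 2), ← Real.exp_add]
    exact Real.exp_le_exp.2 (by linarith)
  have bu : ∀ z ∈ K, ‖u z‖ ^ 2 * wt Φ z ≤ 2 * moll ε g z := by
    intro z hz
    have h1 : ‖moll ε X z‖ ^ 2 ≤ (2 * wt Φ z) * moll ε g z := by
      refine norm_moll_sq_le hX hg.locallyIntegrable hε fun y hy => ?_
      simp only [hXdef, hgdef, norm_mul, Complex.norm_real, Real.norm_of_nonneg (wt_pos Φ _).le]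
      have h2 := mul_le_mul_of_nonneg_right (hwe z hz y hy)
        (mul_nonneg (sq_nonneg ‖w (z - y)‖) (wt_pos Φ (z - y)).le)
      nlinarith
    rw [huX, norm_mul, Complex.norm_real, Real.norm_of_nonneg (wt_pos Φ _).le] at h1
    have hpos := wt_pos Φ z
    nlinarith
  have bc : ∀ j, ∀ z ∈ K, ‖c j z‖ ^ 2 / wt Φ z ≤ η ^ 2 * 2 * moll ε g z := by
    intro j z hz
    have hcz : c j z = moll ε (fun x => ((dbar j (fun z => (Φ z : ℂ)) x -
        dbar j (fun z => (Φ z : ℂ)) z) * wt Φ x) * w x) z := by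
      have hint : ∀ {f : Cn n → ℂ}, LocallyIntegrable f volume →
          Integrable (fun y => rho ε y • f (z - y)) volume := fun {f} hf =>
        (hasCompactSupport_rho hε).convolutionExists_left (ContinuousLinearMap.lsmul ℝ ℝ)
          (continuous_rho ε) hf z
      simp only [hc, moll_apply]
      rw [← integral_const_mul, ← integral_sub (hint (hPX j)) ((hint hX).const_mul _)]
      congr 1; ext y
      simp only [hXdef, Complex.real_smul]; ring
    rw [hcz, div_le_iff₀ (wt_pos Φ z)]
    have h1 : _ ≤ (η ^ 2 * 2 * wt Φ z) * moll ε g z := norm_moll_sq_le (z := z) (κ := η ^ 2 * 2 * wt Φ z)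
      (Y := fun x => ((dbar j (fun z => (Φ z : ℂ)) x -
        dbar j (fun z => (Φ z : ℂ)) z) * wt Φ x) * w x)
      (locallyIntegrable_mul_of_sq hΦ hw hg (((hP j).sub continuous_const).mul hWc))
      hg.locallyIntegrable hε fun y hy => by
        simp only [hgdef, norm_mul, Complex.norm_real, Real.norm_of_nonneg (wt_pos Φ _).le]
        have h2 := hwe z hz y hy
        have h3 := (hPε j z hz y hy).le
        have h4 : ‖dbar j (fun z => (Φ z : ℂ)) (z - y) - dbar j (fun z => (Φ z : ℂ)) z‖ ^ 2 *
          wt Φ (z - y) ≤ η ^ 2 * (2 * wt Φ z) := by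
            have := (wt_pos Φ (z - y)).le
            gcongr
        have h5 := mul_le_mul_of_nonneg_right h4
          (mul_nonneg (sq_nonneg ‖w (z - y)‖) (wt_pos Φ (z - y)).le)
        nlinarith
    linarith
  have hE := energy_le hΦ.wt.continuous (wt_pos Φ) hus hcc (fun σ hσ hσc => by
    have h1 := mollified_equation hΦ hw hg h hε hσ hσc
    rw [← h1]
    congr 1; ext z
    refine Finset.sum_congr rfl fun j _ => ?_
    congr 1
    have h2 : dbar j (moll ε X) z = dbar j u z * wt Φ z +
        u z * (- dbar j (fun z => (Φ z : ℂ)) z * wt Φ z) := by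
      rw [show moll ε X = fun z => u z * wt Φ z from funext huX, dbar_mul hus hΦ.wt.ofReal,
        dbar_wt hΦ]
    change _ = dbar j (moll ε X) z + moll ε (Y j) z
    rw [h2]
    simp only [hc, huX]; ring) hχ hχc
  refine hE.trans ?_
  have hmg := integrable_moll hg hε
  have hIg : ∫ z, moll ε g z = N := integral_moll hg hε
  have hmg0 : ∀ z, 0 ≤ moll ε g z := fun z => integral_nonneg fun y =>
    mul_nonneg (rho_nonneg ε y) (mul_nonneg (sq_nonneg _) (wt_pos Φ _).le)
  have hχ0 : ∀ z ∉ K, χ z = 0 := fun z hz => image_eq_zero_of_notMem_tsupport hz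
  have hdχ0 : ∀ j, ∀ z ∉ K, del j (fun z => (χ z : ℂ)) z = 0 := by
    intro j z hz
    have h1 : (fun z => (χ z : ℂ)) =ᶠ[𝓝 z] fun _ => 0 := by
      filter_upwards [(isClosed_tsupport χ).isOpen_compl.mem_nhds hz] with x hx
      rw [hχ0 x hx]; simp
    simp [del, dirD, h1.fderiv_eq]
  have B1 : ∫ z, ∑ j, ‖del j (fun z => (χ z : ℂ)) z‖ ^ 2 * ‖u z‖ ^ 2 * wt Φ z ≤
      n * (C / R) ^ 2 * (2 * N) := by
    rw [← hIg, ← integral_const_mul, ← integral_const_mul]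
    refine integral_mono_of_nonneg (Eventually.of_forall fun z => Finset.sum_nonneg fun j _ => ?_)
      ((hmg.const_mul 2).const_mul _) (Eventually.of_forall fun z => ?_)
    · have := (wt_pos Φ z).le
      positivity
    · have : ∀ j ∈ Finset.univ, ‖del j (fun z => (χ z : ℂ)) z‖ ^ 2 * ‖u z‖ ^ 2 * wt Φ z ≤
          (C / R) ^ 2 * (2 * moll ε g z) := by
        intro j _
        by_cases hz : z ∈ K
        · rw [mul_assoc]
          have := hχd j z
          have h3 := bu z hz
          have h4 := (wt_pos Φ z).le
          gcongr
        · rw [hdχ0 j z hz]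
          have := hmg0 z
          simp; positivity
      simpa [mul_assoc] using Finset.sum_le_sum this
  have B2 : ∫ z, ∑ j, χ z ^ 2 * ‖c j z‖ ^ 2 / wt Φ z ≤ n * (η ^ 2 * (2 * N)) := by
    rw [← hIg, ← integral_const_mul, ← integral_const_mul, ← integral_const_mul]
    refine integral_mono_of_nonneg (Eventually.of_forall fun z => Finset.sum_nonneg fun j _ => ?_)
      (((hmg.const_mul 2).const_mul _).const_mul _) (Eventually.of_forall fun z => ?_)
    · have := (wt_pos Φ z).le
      positivity
    · have : ∀ j ∈ Finset.univ, χ z ^ 2 * ‖c j z‖ ^ 2 / wt Φ z ≤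
          η ^ 2 * (2 * moll ε g z) := by
        intro j _
        have h5 := hmg0 z
        by_cases hz : z ∈ K
        · rw [mul_div_assoc]
          have h3 := bc j z hz
          have h4 := (wt_pos Φ z).le
          calc χ z ^ 2 * (‖c j z‖ ^ 2 / wt Φ z) ≤ 1 * (η ^ 2 * 2 * moll ε g z) := by
                have := hχle z
                gcongr
            _ = _ := by ring
        · rw [hχ0 z hz]
          simp; positivity
      simpa [mul_assoc] using Finset.sum_le_sum this
  linarith

/-- A function in `L²(e^{-Φ})` orthogonal to the range of the weighted Laplacian is entire. -/
lemma exists_entire_of_orthogonal_lap {w : Cn n → ℂ} (hw : AEStronglyMeasurable w volume)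
    (hg : Integrable (fun z => ‖w z‖ ^ 2 * wt Φ z) volume)
    (h : ∀ τ : Cn n → ℂ, ContDiff ℝ ∞ τ → HasCompactSupport τ →
      ∫ z, w z * starRingEnd ℂ (lap Φ τ z) * wt Φ z = 0) :
    ∃ f : Cn n → ℂ, Differentiable ℂ f ∧ w =ᵐ[volume] f := by
  have hwl : LocallyIntegrable w volume := by
    simpa using locallyIntegrable_mul_of_sq hΦ hw hg (a := fun _ => 1) continuous_const
  have hWc : Continuous fun z => (wt Φ z : ℂ) := hΦ.wt.ofReal.continuous
  have hX := locallyIntegrable_mul_of_sq hΦ hw hg hWc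
  refine exists_entire_of_weak hwl fun j σ hσ hσc => ?_
  set X := fun z => (wt Φ z : ℂ) * w z with hXdef
  have hexp : ContDiff ℝ ∞ fun z => ((Real.exp (Φ z) : ℝ) : ℂ) := hΦ.exp.ofReal
  set S := ∫ z, ‖σ z‖ ^ 2 * Real.exp (Φ z)
  have hS : 0 ≤ S := integral_nonneg fun z => by positivity
  set I := ∫ z, w z * dbar j σ z
  obtain ⟨r, hr⟩ := hσc.isCompact.isBounded.subset_closedBall 0
  have hew : ∀ z, wt Φ z * Real.exp (Φ z) = 1 := fun z => by
    rw [wt, ← Real.exp_add]; simp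
  have hG : ContDiff ℝ ∞ fun z => ((Real.exp (Φ z) : ℝ) : ℂ) * dbar j σ z := hexp.mul (hσ.dbar j)
  have hGc : HasCompactSupport fun z => ((Real.exp (Φ z) : ℝ) : ℂ) * dbar j σ z :=
    (hσc.dbar j).mul_left
  have hlim := tendsto_integral_mul_moll hX hG.continuous hGc
  have hI : ∫ z, X z * (((Real.exp (Φ z) : ℝ) : ℂ) * dbar j σ z) = I := by
    congr 1; ext z
    simp only [hXdef]
    calc _ = ((wt Φ z * Real.exp (Φ z) : ℝ) : ℂ) * (w z * dbar j σ z) := by push_cast; ring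
      _ = _ := by rw [hew]; simp
  rw [hI] at hlim
  have key : ∀ l : ℝ, 0 < l → 2 * ‖I‖ ≤ (1 + S) / l := by
    intro l hl
    obtain ⟨χ, hχ, hχc, hχ1, hev⟩ := exists_cutoff_energy_le hΦ hw hg h
      (t := 1 / l ^ 2) (by positivity) r
    refine le_of_tendsto (hlim.norm.const_mul 2) ?_
    filter_upwards [hev, self_mem_nhdsWithin] with ε hE hε
    replace hε : 0 < ε := hε
    have hXs := contDiff_moll hε hX
    set u : Cn n → ℂ := fun z => (moll ε X z) * (Real.exp (Φ z) : ℝ) with hu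
    have hus : ContDiff ℝ ∞ u := hXs.mul hexp
    rw [← integral_moll_mul hX hG.continuous hGc hε]
    have e1 : ∫ z, moll ε X z * (((Real.exp (Φ z) : ℝ) : ℂ) * dbar j σ z) =
        - ∫ z, dbar j u z * σ z := by
      rw [integral_dbar_mul hus hσ hσc, neg_neg]
      simp only [hu, mul_assoc]
    rw [e1, norm_neg]
    have iE : Integrable (fun z => ∑ j, χ z ^ 2 * ‖dbar j u z‖ ^ 2 * wt Φ z) volume := by
      refine integrable_finsetSum _ fun j _ => Continuous.integrable_of_hasCompactSupport ?_
        ((hχc.comp_left (g := fun x => x ^ 2) (by simp)).mul_right.mul_right)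
      exact ((hχ.continuous.pow 2).mul ((hus.dbar j).continuous.norm.pow 2)).mul hΦ.wt.continuous
    have iS : Integrable (fun z => ‖σ z‖ ^ 2 * Real.exp (Φ z)) volume := by
      have h1 : Continuous fun z => ‖σ z‖ ^ 2 * Real.exp (Φ z) :=
        (hσ.continuous.norm.pow 2).mul (Real.continuous_exp.comp hΦ.continuous)
      have h2 : HasCompactSupport fun z => ‖σ z‖ ^ 2 * Real.exp (Φ z) :=
        hσc.mono fun z hz => by
          intro h0
          simp [h0] at hz
      exact h1.integrable_of_hasCompactSupport h2
    have hmain : ‖∫ z, dbar j u z * σ z‖ ≤ ∫ z, (l / 2 * (∑ j, χ z ^ 2 * ‖dbar j u z‖ ^ 2 * wt Φ z) +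
        1 / (2 * l) * (‖σ z‖ ^ 2 * Real.exp (Φ z))) := by
      refine norm_integral_le_of_norm_le ((iE.const_mul _).add (iS.const_mul _))
        (Eventually.of_forall fun z => ?_)
      have hWp := wt_pos Φ z
      have hs0 : 0 ≤ ∑ j, χ z ^ 2 * ‖dbar j u z‖ ^ 2 * wt Φ z :=
        Finset.sum_nonneg fun j _ => by positivity
      by_cases hz : z ∈ tsupport σ
      · have hχz := hχ1 z (by simpa using hr hz)
        have h1 : ‖dbar j u z‖ ^ 2 * wt Φ z ≤ ∑ j, χ z ^ 2 * ‖dbar j u z‖ ^ 2 * wt Φ z := by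
          have := Finset.single_le_sum (f := fun j => χ z ^ 2 * ‖dbar j u z‖ ^ 2 * wt Φ z)
            (fun j _ => by positivity) (Finset.mem_univ j)
          simpa [hχz] using this
        rw [norm_mul]
        have h2 : ‖dbar j u z‖ * ‖σ z‖ ≤ l / 2 * (‖dbar j u z‖ ^ 2 * wt Φ z) +
            1 / (2 * l) * (‖σ z‖ ^ 2 * Real.exp (Φ z)) := by
          have h3 : Real.exp (Φ z) = (wt Φ z)⁻¹ := by
            exact eq_inv_of_mul_eq_one_right (hew z)
          rw [h3]
          have h4 := sq_nonneg (l * wt Φ z * ‖dbar j u z‖ - ‖σ z‖)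
          have e : l / 2 * (‖dbar j u z‖ ^ 2 * wt Φ z) + 1 / (2 * l) * (‖σ z‖ ^ 2 * (wt Φ z)⁻¹) -
            ‖dbar j u z‖ * ‖σ z‖ = (l * wt Φ z * ‖dbar j u z‖ - ‖σ z‖) ^ 2 / (2 * l * wt Φ z) := by
              field_simp; ring
          have : 0 ≤ (l * wt Φ z * ‖dbar j u z‖ - ‖σ z‖) ^ 2 / (2 * l * wt Φ z) := by positivity
          linarith
        have h5 := mul_le_mul_of_nonneg_left h1 (show 0 ≤ l / 2 by positivity)
        linarith
      · rw [image_eq_zero_of_notMem_tsupport hz]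
        simp; positivity
    rw [integral_add (iE.const_mul _) (iS.const_mul _), integral_const_mul,
      integral_const_mul] at hmain
    have h6 := mul_le_mul_of_nonneg_left hE (show 0 ≤ l / 2 by positivity)
    have h7 : l / 2 * (1 / l ^ 2) = 1 / (2 * l) := by field_simp
    have h8 : (1 + S) / l = 2 * (1 / (2 * l) + 1 / (2 * l) * S) := by field_simp
    rw [h8]; linarith
  by_contra hne
  have hpos : 0 < ‖I‖ := norm_pos_iff.2 hne
  have h1 := key ((1 + S) / ‖I‖) (by positivity)
  rw [div_div_cancel₀ (by positivity)] at h1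
  linarith

end weight

/-- Square integrability with respect to the weight `e^{-Φ}`. -/
abbrev SqInt (Φ : Cn n → ℝ) (w : Cn n → ℂ) : Prop :=
  MemLp (fun z => w z * (wt (fun x => Φ x / 2) z : ℝ)) 2 volume

lemma wt_half_mul (Φ : Cn n → ℝ) (z : Cn n) :
    wt (fun x => Φ x / 2) z * wt (fun x => Φ x / 2) z = wt Φ z := by
  simp only [wt, ← Real.exp_add]; congr 1; ring

lemma norm_mul_wt_half_sq (Φ : Cn n → ℝ) (w : Cn n → ℂ) (z : Cn n) :
    ‖w z * (wt (fun x => Φ x / 2) z : ℝ)‖ ^ 2 = ‖w z‖ ^ 2 * wt Φ z := by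
  rw [norm_mul, Complex.norm_real, Real.norm_of_nonneg (wt_pos _ z).le, mul_pow,
    ← wt_half_mul Φ z]; ring

section weight
variable {Φ : Cn n → ℝ} (hΦ : ContDiff ℝ ∞ Φ)
include hΦ

lemma ContDiff.wt_half : ContDiff ℝ ∞ (_root_.wt fun x => Φ x / 2) :=
  ContDiff.wt (hΦ.div_const 2)

lemma sqInt_iff {w : Cn n → ℂ} (hw : AEStronglyMeasurable w volume) :
    SqInt Φ w ↔ Integrable (fun z => ‖w z‖ ^ 2 * wt Φ z) volume := by
  rw [SqInt, memLp_two_iff_integrable_sq_norm]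
  · simp only [norm_mul_wt_half_sq]
  · exact hw.mul (hΦ.wt_half).ofReal.continuous.aestronglyMeasurable

omit hΦ in
lemma inner_toLp {v w : Cn n → ℂ} (hv : SqInt Φ v) (hw : SqInt Φ w) :
    inner ℂ (MemLp.toLp _ hv) (MemLp.toLp _ hw) =
      ∫ z, w z * starRingEnd ℂ (v z) * wt Φ z := by
  rw [L2.inner_def]
  refine integral_congr_ae ?_
  filter_upwards [hv.coeFn_toLp, hw.coeFn_toLp] with z h1 h2
  rw [h1, h2, RCLike.inner_apply, ← wt_half_mul Φ z]
  simp only [map_mul, Complex.conj_ofReal, Complex.ofReal_mul]; ring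

omit hΦ in
lemma norm_toLp_sq {w : Cn n → ℂ} (hw : SqInt Φ w) :
    ‖MemLp.toLp _ hw‖ ^ 2 = ∫ z, ‖w z‖ ^ 2 * wt Φ z := by
  have h := inner_self_eq_norm_sq_to_K (𝕜 := ℂ) (MemLp.toLp _ hw)
  rw [inner_toLp] at h
  have h2 : ∫ z, w z * starRingEnd ℂ (w z) * (wt Φ z : ℂ) =
      ((∫ z, ‖w z‖ ^ 2 * wt Φ z : ℝ) : ℂ) := by
    rw [← integral_complex_ofReal]
    congr 1; ext z
    rw [Complex.mul_conj, Complex.normSq_eq_norm_sq]; push_cast; ring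
  rw [h2] at h
  refine Complex.ofReal_injective ?_
  rw [h]
  simp

lemma sqInt_of_hasCompactSupport {w : Cn n → ℂ} (hw : Continuous w) (hc : HasCompactSupport w) :
    SqInt Φ w :=
  Continuous.memLp_of_hasCompactSupport
    (hw.mul (hΦ.wt_half).ofReal.continuous) hc.mul_right

omit hΦ in
lemma lap_add {τ σ : Cn n → ℂ} (hτ : ContDiff ℝ ∞ τ) (hσ : ContDiff ℝ ∞ σ) (z : Cn n) :
    lap Φ (fun z => τ z + σ z) z = lap Φ τ z + lap Φ σ z := by
  simp only [lap, dstar, ← Finset.sum_add_distrib, dbar_add hτ hσ]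
  refine Finset.sum_congr rfl fun j _ => ?_
  rw [del_add (hτ.dbar j) (hσ.dbar j)]; ring

omit hΦ in
lemma del_const_mul {f : Cn n → ℂ} (hf : ContDiff ℝ ∞ f) (j : Fin n) (c : ℂ) :
    del j (fun z => c * f z) = fun z => c * del j f z := by
  ext z; simp only [del, dirD_const_mul _ c hf]; ring

omit hΦ in
lemma lap_const_mul {τ : Cn n → ℂ} (hτ : ContDiff ℝ ∞ τ) (c : ℂ) (z : Cn n) :
    lap Φ (fun z => c * τ z) z = c * lap Φ τ z := by
  simp only [lap, dstar, Finset.mul_sum, dbar_const_mul hτ]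
  refine Finset.sum_congr rfl fun j _ => ?_
  rw [del_const_mul (hτ.dbar j)]; ring

omit hΦ in
lemma sqInt_lap (hΦ : ContDiff ℝ ∞ Φ) {τ : Cn n → ℂ} (hτ : ContDiff ℝ ∞ τ)
    (hc : HasCompactSupport τ) : SqInt Φ (lap Φ τ) :=
  sqInt_of_hasCompactSupport hΦ (ContDiff.lap hΦ hτ).continuous hc.lap

/-- The range of the weighted Laplacian in `L²`, after multiplication by `e^{-Φ/2}`. -/
def lapRange (hΦ : ContDiff ℝ ∞ Φ) : Submodule ℂ (Lp ℂ 2 (volume : Measure (Cn n))) where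
  carrier := {g | ∃ (τ : Cn n → ℂ) (hτ : ContDiff ℝ ∞ τ) (hc : HasCompactSupport τ),
    g = MemLp.toLp _ (sqInt_lap hΦ hτ hc)}
  zero_mem' := by
    refine ⟨fun _ => 0, contDiff_const, HasCompactSupport.zero, ?_⟩
    symm
    rw [Lp.ext_iff]
    filter_upwards [MemLp.coeFn_toLp (sqInt_lap hΦ (τ := fun _ => 0) contDiff_const
      HasCompactSupport.zero), Lp.coeFn_zero ℂ 2 (volume : Measure (Cn n))] with z h1 h2
    rw [h1, h2]
    have := lap_const_mul (Φ := Φ) (τ := fun _ => 0) contDiff_const 0 z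
    simp only [zero_mul] at this
    simp [this]
  add_mem' := by
    rintro _ _ ⟨τ, hτ, hc, rfl⟩ ⟨σ, hσ, hc', rfl⟩
    refine ⟨fun z => τ z + σ z, hτ.add hσ, hc.add hc', ?_⟩
    rw [← MemLp.toLp_add]
    congr 1
    ext z
    simp [lap_add hτ hσ, add_mul]
  smul_mem' := by
    rintro c _ ⟨τ, hτ, hc, rfl⟩
    refine ⟨fun z => c * τ z, contDiff_const.mul hτ, hc.mul_left, ?_⟩
    rw [← MemLp.toLp_const_smul]
    congr 1
    ext z
    simp [lap_const_mul hτ, mul_assoc]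

omit hΦ in
lemma sqInt_mul_exp (g : Lp ℂ 2 (volume : Measure (Cn n))) :
    SqInt Φ (fun z => g z * (Real.exp (Φ z / 2) : ℝ)) := by
  have h : (fun z => g z * (Real.exp (Φ z / 2) : ℝ) * (wt (fun x => Φ x / 2) z : ℝ)) = g := by
    ext z
    rw [mul_assoc, ← Complex.ofReal_mul, wt, ← Real.exp_add]
    simp
  rw [SqInt, h]
  exact Lp.memLp g

/-- Elements orthogonal to the range of the weighted Laplacian are entire functions. -/
lemma exists_entire_of_mem_orthogonal {g : Lp ℂ 2 (volume : Measure (Cn n))}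
    (hg : g ∈ (lapRange hΦ)ᗮ) :
    ∃ (f : Cn n → ℂ) (hf : SqInt Φ f), Differentiable ℂ f ∧ g = MemLp.toLp _ hf := by
  set w := fun z => g z * (Real.exp (Φ z / 2) : ℝ) with hw
  have hexp : ContDiff ℝ ∞ fun z => ((Real.exp (Φ z / 2) : ℝ) : ℂ) :=
    (hΦ.div_const 2).exp.ofReal
  have hwm : AEStronglyMeasurable w volume :=
    (Lp.aestronglyMeasurable g).mul hexp.continuous.aestronglyMeasurable
  have hws : SqInt Φ w := sqInt_mul_exp g
  have hgw : g = MemLp.toLp _ hws := by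
    rw [Lp.ext_iff]
    filter_upwards [hws.coeFn_toLp] with z hz
    rw [hz, hw]
    simp only
    rw [mul_assoc, ← Complex.ofReal_mul, wt, ← Real.exp_add]
    simp
  obtain ⟨f, hf, hwf⟩ := exists_entire_of_orthogonal_lap hΦ hwm ((sqInt_iff hΦ hwm).1 hws)
    fun τ hτ hc => by
      have h1 := (Submodule.mem_orthogonal _ _).1 hg _ ⟨τ, hτ, hc, rfl⟩
      rw [hgw, inner_toLp] at h1
      exact h1
  have hae : (fun z => w z * (wt (fun x => Φ x / 2) z : ℝ)) =ᵐ[volume]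
      fun z => f z * (wt (fun x => Φ x / 2) z : ℝ) := by
    filter_upwards [hwf] with z hz
    rw [hz]
  refine ⟨f, (memLp_congr_ae hae).1 hws, hf, ?_⟩
  rw [hgw]
  exact (MemLp.toLp_eq_toLp_iff _ _).2 hae

omit hΦ in
lemma Differentiable.contDiff_real {f : Cn n → ℂ} (hf : Differentiable ℂ f) : ContDiff ℝ ∞ f :=
  contDiff_iff_contDiffAt.2 fun _ =>
    DifferentiableOn.contDiffAt_real isOpen_univ hf.differentiableOn (Set.mem_univ _)

lemma mem_orthogonal_of_entire {f : Cn n → ℂ} (hf : SqInt Φ f) (hd : Differentiable ℂ f) :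
    MemLp.toLp _ hf ∈ (lapRange hΦ)ᗮ := by
  rw [Submodule.mem_orthogonal]
  rintro _ ⟨τ, hτ, hc, rfl⟩
  rw [inner_toLp, integral_mul_conj_lap hΦ hd.contDiff_real hτ hc]
  simp [dbar_eq_zero_of_differentiableAt (hd _)]

/-- Bergman projection of a test function. -/
lemma exists_bergman_projection {v : Cn n → ℂ} (hv : SqInt Φ v) :
    ∃ F : Cn n → ℂ, Differentiable ℂ F ∧ SqInt Φ F ∧
      (∫ z, ‖F z‖ ^ 2 * wt Φ z ≤ ∫ z, ‖v z‖ ^ 2 * wt Φ z) ∧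
      SqInt Φ (fun z => v z - F z) ∧
      ∀ h : Cn n → ℂ, Differentiable ℂ h → SqInt Φ h →
        ∫ z, (v z - F z) * starRingEnd ℂ (h z) * wt Φ z = 0 := by
  set K := (lapRange hΦ)ᗮ
  set V := MemLp.toLp _ hv
  obtain ⟨F, hF, hFd, hFe⟩ := exists_entire_of_mem_orthogonal hΦ
    (Submodule.starProjection_apply_mem K V)
  have hsub : SqInt Φ (fun z => v z - F z) := by
    have := MemLp.sub hv hF
    rw [SqInt]
    convert this using 2 with z
    simp [sub_mul]
  refine ⟨F, hFd, hF, ?_, hsub, fun h hhd hh => ?_⟩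
  · rw [← norm_toLp_sq hv, ← norm_toLp_sq hF, ← hFe]
    have h1 := K.norm_starProjection_apply_le V
    gcongr
  · rw [← inner_toLp hh hsub]
    have e : MemLp.toLp _ hsub = V - K.starProjection V := by
      rw [hFe, ← MemLp.toLp_sub]
      congr 1
      ext z; simp [sub_mul]
    rw [e]
    exact (Submodule.mem_orthogonal _ _).1 (Submodule.sub_starProjection_mem_orthogonal V) _
      (mem_orthogonal_of_entire hΦ hh hhd)

/-- Hörmander's estimate for functions orthogonal to the entire functions. -/
lemma integral_le_of_orthogonal_entire {w : Cn n → ℂ} (hw : ContDiff ℝ ∞ w) (hws : SqInt Φ w)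
    (horth : ∀ h : Cn n → ℂ, Differentiable ℂ h → SqInt Φ h →
        ∫ z, w z * starRingEnd ℂ (h z) * wt Φ z = 0)
    {G : Cn n → ℝ} (hG : ∀ z, 0 ≤ G z) (hGi : Integrable (fun z => G z * wt Φ z) volume)
    (hlev : ∀ z β, 0 ≤ levi Φ z β)
    (hle : ∀ z β, ‖∑ j, dbar j w z * starRingEnd ℂ (β j)‖ ^ 2 ≤ G z * levi Φ z β) :
    ∫ z, ‖w z‖ ^ 2 * wt Φ z ≤ ∫ z, G z * wt Φ z := by
  set V := MemLp.toLp _ hws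
  have hV : V ∈ (lapRange hΦ).topologicalClosure := by
    rw [← Submodule.orthogonal_orthogonal_eq_closure, Submodule.mem_orthogonal]
    intro g hg
    obtain ⟨f, hf, hfd, rfl⟩ := exists_entire_of_mem_orthogonal hΦ hg
    rw [inner_toLp]
    exact horth f hfd hf
  obtain ⟨x, hx, hxV⟩ := mem_closure_iff_seq_limit.1 hV
  have hk : ∀ k, ‖inner ℂ (x k) V‖ ≤ 1 / 2 * (∫ z, G z * wt Φ z) + 1 / 2 * ‖x k‖ ^ 2 := by
    intro k
    obtain ⟨τ, hτ, hc, hxk⟩ := hx k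
    rw [hxk, inner_toLp, norm_toLp_sq, integral_mul_conj_lap hΦ hw hτ hc]
    have il : Integrable (fun z => levi Φ z (fun k => dbar k τ z) * wt Φ z) volume := by
      have h1 : Integrable (fun z => (levi Φ z (fun k => dbar k τ z) : ℂ) * wt Φ z) volume := by
        simp only [levi_eq_sum hΦ, Finset.sum_mul]
        refine integrable_finsetSum _ fun j _ => integrable_finsetSum _ fun l _ => ?_
        refine (((((hΦ.ofReal.del l).dbar j).mul (hτ.dbar l)).mul (hτ.dbar j).conj).mul
          hΦ.wt.ofReal).integrable_of_hasCompactSupport ?_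
        exact ((hc.dbar j).conj.mul_left).mul_right
      simpa [← Complex.ofReal_mul] using h1.re
    have hb := bochner hΦ hτ hc
    have h2 : ‖∫ z, (∑ j, dbar j w z * starRingEnd ℂ (dbar j τ z)) * wt Φ z‖ ≤
        ∫ z, (1 / 2 * (G z * wt Φ z) + 1 / 2 * (levi Φ z (fun k => dbar k τ z) * wt Φ z)) := by
      refine norm_integral_le_of_norm_le ((hGi.const_mul _).add (il.const_mul _))
        (Eventually.of_forall fun z => ?_)
      rw [norm_mul, Complex.norm_real, Real.norm_of_nonneg (wt_pos _ z).le]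
      have h3 := hle z (fun k => dbar k τ z)
      have h4 := hlev z (fun k => dbar k τ z)
      have h5 := hG z
      have h6 : ‖∑ j, dbar j w z * starRingEnd ℂ (dbar j τ z)‖ ≤
          (G z + levi Φ z (fun k => dbar k τ z)) / 2 := by
        refine abs_le_of_sq_le_sq' ?_ (by positivity) |>.2
        nlinarith [sq_nonneg (G z - levi Φ z (fun k => dbar k τ z))]
      nlinarith [wt_pos Φ z]
    rw [integral_add (hGi.const_mul _) (il.const_mul _), integral_const_mul,
      integral_const_mul] at h2
    linarith
  have hlim1 : Tendsto (fun k => ‖inner ℂ (x k) V‖) atTop (𝓝 ‖inner ℂ V V‖) :=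
    (hxV.inner tendsto_const_nhds).norm
  have hlim2 : Tendsto (fun k => 1 / 2 * (∫ z, G z * wt Φ z) + 1 / 2 * ‖x k‖ ^ 2) atTop
      (𝓝 (1 / 2 * (∫ z, G z * wt Φ z) + 1 / 2 * ‖V‖ ^ 2)) :=
    ((hxV.norm.pow 2).const_mul _).const_add _
  have h := le_of_tendsto_of_tendsto' hlim1 hlim2 hk
  rw [inner_self_eq_norm_sq_to_K] at h
  rw [← norm_toLp_sq hws]
  have : ‖((‖V‖ : ℂ)) ^ 2‖ = ‖V‖ ^ 2 := by simp
  have h' : ‖V‖ ^ 2 ≤ 1 / 2 * (∫ z, G z * wt Φ z) + 1 / 2 * ‖V‖ ^ 2 := by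
    rw [← this]; exact this.symm ▸ h
  change ‖V‖ ^ 2 ≤ _
  linarith

end weight

/-- The pairing of `∂̄s` with a vector. -/
def gradc (s : Cn n → ℝ) (z β : Cn n) : ℂ :=
  ∑ j, dbar j (fun z => (s z : ℂ)) z * starRingEnd ℂ (β j)

lemma dirD_real_eq {s : Cn n → ℝ} (hs : ContDiff ℝ ∞ s) (z β : Cn n) :
    dirD β s z = 2 * (gradc s z β).re ∧ dirD (Complex.I • β) s z = 2 * (gradc s z β).im := by
  have h1 := dirD_eq_sum β (fun z => (s z : ℂ)) z
  have h2 := dirD_I_eq_sum β (fun z => (s z : ℂ)) z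
  rw [dirD_ofReal _ hs] at h1 h2
  simp only [del_ofReal hs] at h1 h2
  have e1 : ∑ k, (β k * starRingEnd ℂ (dbar k (fun z => (s z : ℂ)) z) +
      starRingEnd ℂ (β k) * dbar k (fun z => (s z : ℂ)) z) =
      starRingEnd ℂ (gradc s z β) + gradc s z β := by
    simp only [gradc, map_sum, ← Finset.sum_add_distrib]
    refine Finset.sum_congr rfl fun k _ => ?_
    simp; ring
  have e2 : ∑ k, (Complex.I * β k * starRingEnd ℂ (dbar k (fun z => (s z : ℂ)) z) -
      Complex.I * starRingEnd ℂ (β k) * dbar k (fun z => (s z : ℂ)) z) =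
      Complex.I * (starRingEnd ℂ (gradc s z β) - gradc s z β) := by
    simp only [gradc, map_sum, ← Finset.sum_sub_distrib, Finset.mul_sum]
    refine Finset.sum_congr rfl fun k _ => ?_
    simp; ring
  rw [e1] at h1
  rw [e2] at h2
  constructor
  · have := congrArg Complex.re h1
    simp at this; linarith
  · have := congrArg Complex.re h2
    simp at this; linarith

lemma norm_gradc_sq {s : Cn n → ℝ} (hs : ContDiff ℝ ∞ s) (z β : Cn n) :
    ‖gradc s z β‖ ^ 2 = (dirD β s z ^ 2 + dirD (Complex.I • β) s z ^ 2) / 4 := by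
  obtain ⟨h1, h2⟩ := dirD_real_eq hs z β
  rw [h1, h2, ← Complex.normSq_eq_norm_sq, Complex.normSq_apply]; ring

lemma levi_comp {χ : ℝ → ℝ} (hχ : ContDiff ℝ ∞ χ) {s : Cn n → ℝ} (hs : ContDiff ℝ ∞ s)
    (z β : Cn n) : levi (fun z => χ (s z)) z β =
      deriv χ (s z) * levi s z β + deriv (deriv χ) (s z) * ‖gradc s z β‖ ^ 2 := by
  have hχ' : ContDiff ℝ ∞ (deriv χ) := (contDiff_infty_iff_deriv.1 hχ).2
  have h : ∀ a : Cn n, dirD a (dirD a fun z => χ (s z)) z =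
      deriv (deriv χ) (s z) * dirD a s z ^ 2 + deriv χ (s z) * dirD a (dirD a s) z := by
    intro a
    have hc : ContDiff ℝ ∞ fun z => deriv χ (s z) := hχ'.comp hs
    rw [dirD_comp a hχ hs, dirD_mul a hc (hs.dirD a), dirD_comp a hχ' hs]
    ring
  rw [levi, h, h, norm_gradc_sq hs, levi]; ring

lemma levi_add {u v : Cn n → ℝ} (hu : ContDiff ℝ ∞ u) (hv : ContDiff ℝ ∞ v) (z β : Cn n) :
    levi (fun z => u z + v z) z β = levi u z β + levi v z β := by
  simp only [levi, dirD_add _ hu hv, dirD_add _ (hu.dirD _) (hv.dirD _)]; ring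

lemma levi_sub {u v : Cn n → ℝ} (hu : ContDiff ℝ ∞ u) (hv : ContDiff ℝ ∞ v) (z β : Cn n) :
    levi (fun z => u z - v z) z β = levi u z β - levi v z β := by
  simp only [levi, dirD_sub _ hu hv, dirD_sub _ (hu.dirD _) (hv.dirD _)]; ring

lemma levi_const_mul (c : ℝ) {u : Cn n → ℝ} (hu : ContDiff ℝ ∞ u) (z β : Cn n) :
    levi (fun z => c * u z) z β = c * levi u z β := by
  simp only [levi, dirD_const_mul _ c hu, dirD_const_mul _ c (hu.dirD _)]; ring

lemma gradc_comp {χ : ℝ → ℝ} (hχ : ContDiff ℝ ∞ χ) {s : Cn n → ℝ} (hs : ContDiff ℝ ∞ s)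
    (z β : Cn n) : gradc (fun z => χ (s z)) z β = (deriv χ (s z) : ℝ) * gradc s z β := by
  simp only [gradc, dbar_comp hχ hs, Finset.mul_sum, mul_assoc]

/-- A smooth step from `0` (left of `t`) to `1` (right of `t + 1`). -/
def bt (t x : ℝ) : ℝ := Real.smoothTransition (x - t)

/-- A primitive controlling the twist. -/
def St (t x : ℝ) : ℝ := 1 + ∫ y in (0:ℝ)..x, (1 - bt t y) * (1 + Real.exp (-y))

/-- The gain factor in the twisted estimate. -/
def gain (t x : ℝ) : ℝ :=
  ((1 - bt t x) * (1 + Real.exp (-x)) ^ 2 + St t x * Real.exp (-x))⁻¹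

lemma contDiff_bt (t : ℝ) : ContDiff ℝ ∞ (bt t) :=
  (Real.smoothTransition.contDiff (n := ⊤)).comp (contDiff_id.sub contDiff_const)

lemma bt_nonneg (t x : ℝ) : 0 ≤ bt t x := Real.smoothTransition.nonneg _
lemma bt_le_one (t x : ℝ) : bt t x ≤ 1 := Real.smoothTransition.le_one _
lemma bt_of_le {t x : ℝ} (h : x ≤ t) : bt t x = 0 :=
  Real.smoothTransition.zero_of_nonpos (by linarith)
lemma bt_of_ge {t x : ℝ} (h : t + 1 ≤ x) : bt t x = 1 :=
  Real.smoothTransition.one_of_one_le (by linarith)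

lemma deriv_bt (t x : ℝ) : deriv (bt t) x = deriv Real.smoothTransition (x - t) := by
  unfold bt
  rw [deriv_comp_sub_const]

lemma deriv_bt_nonneg (t x : ℝ) : 0 ≤ deriv (bt t) x := by
  rw [deriv_bt]; exact Real.smoothTransition.monotone.deriv_nonneg

lemma deriv_bt_of_le {t x : ℝ} (h : x ≤ t) : deriv (bt t) x = 0 := by
  refine IsLocalMin.deriv_eq_zero (Eventually.of_forall fun y => ?_)
  rw [bt_of_le h]; exact bt_nonneg t y

lemma deriv_bt_of_ge {t x : ℝ} (h : t + 1 ≤ x) : deriv (bt t) x = 0 := by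
  refine IsLocalMax.deriv_eq_zero (Eventually.of_forall fun y => ?_)
  rw [bt_of_ge h]; exact bt_le_one t y

lemma exists_deriv_bt_le : ∃ C : ℝ, 0 < C ∧ ∀ t x, deriv (bt t) x ≤ C := by
  have hc : Continuous (deriv Real.smoothTransition) :=
    (Real.smoothTransition.contDiff (n := 1)).continuous_deriv le_rfl
  obtain ⟨C, hC⟩ := isCompact_Icc.exists_bound_of_continuousOn (s := Set.Icc (0:ℝ) 1)
    hc.continuousOn
  refine ⟨max C 1, lt_max_of_lt_right one_pos, fun t x => ?_⟩
  rcases le_total x t with h | h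
  · rw [deriv_bt_of_le h]; exact (le_max_right _ _).trans' zero_le_one
  rcases le_total (t + 1) x with h' | h'
  · rw [deriv_bt_of_ge h']; exact (le_max_right _ _).trans' zero_le_one
  · rw [deriv_bt]
    exact (le_abs_self _).trans ((hC _ ⟨by linarith, by linarith⟩).trans (le_max_left _ _))

lemma continuous_St_deriv (t : ℝ) : Continuous fun y => (1 - bt t y) * (1 + Real.exp (-y)) := by
  have := (contDiff_bt t).continuous
  fun_prop

lemma hasDerivAt_St (t x : ℝ) :
    HasDerivAt (St t) ((1 - bt t x) * (1 + Real.exp (-x))) x := by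
  have h := (continuous_St_deriv t).integral_hasStrictDerivAt 0 x
  exact h.hasDerivAt.const_add 1

lemma deriv_St (t : ℝ) : deriv (St t) = fun x => (1 - bt t x) * (1 + Real.exp (-x)) :=
  funext fun x => (hasDerivAt_St t x).deriv

lemma contDiff_St (t : ℝ) : ContDiff ℝ ∞ (St t) := by
  rw [contDiff_infty_iff_deriv]
  refine ⟨fun x => (hasDerivAt_St t x).differentiableAt, ?_⟩
  rw [deriv_St]
  have := contDiff_bt t
  fun_prop

lemma deriv_deriv_St (t x : ℝ) : deriv (deriv (St t)) x =
    - (deriv (bt t) x * (1 + Real.exp (-x))) - (1 - bt t x) * Real.exp (-x) := by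
  rw [deriv_St]
  have h1 := (((contDiff_bt t).differentiable (by simp) x).hasDerivAt).const_sub 1
  have h2 := ((hasDerivAt_neg x).exp).const_add 1
  have h3 : HasDerivAt (fun x => (1 - bt t x) * (1 + Real.exp (-x))) _ x := h1.mul h2
  rw [h3.deriv]; ring

lemma one_le_St (t : ℝ) {x : ℝ} (hx : 0 ≤ x) : 1 ≤ St t x := by
  have : 0 ≤ ∫ y in (0:ℝ)..x, (1 - bt t y) * (1 + Real.exp (-y)) :=
    intervalIntegral.integral_nonneg hx fun y _ =>
      mul_nonneg (by linarith [bt_le_one t y]) (by positivity)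
  rw [St]; linarith

lemma St_le (t : ℝ) {x : ℝ} (hx : 0 ≤ x) : St t x ≤ 1 + 2 * x := by
  have : ∫ y in (0:ℝ)..x, (1 - bt t y) * (1 + Real.exp (-y)) ≤ ∫ y in (0:ℝ)..x, (2:ℝ) := by
    refine intervalIntegral.integral_mono_on hx
      ((continuous_St_deriv t).intervalIntegrable _ _) (by simp) fun y hy => ?_
    have h1 := bt_nonneg t y
    have h2 := bt_le_one t y
    have h3 : Real.exp (-y) ≤ 1 := Real.exp_le_one_iff.2 (by linarith [hy.1])
    have h4 := Real.exp_pos (-y)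
    nlinarith
  rw [intervalIntegral.integral_const] at this
  rw [St]
  simp at this; linarith

lemma St_le_of_ge {t x : ℝ} (ht : 0 ≤ t) (hx : t + 1 ≤ x) : St t x ≤ 1 + 2 * (t + 1) := by
  have hi := fun a b => (continuous_St_deriv t).intervalIntegrable (μ := volume) a b
  have h0 : ∫ y in (t + 1)..x, (1 - bt t y) * (1 + Real.exp (-y)) = 0 := by
    rw [intervalIntegral.integral_congr (g := fun _ => (0:ℝ))]
    · simp
    · intro y hy
      rw [Set.uIcc_of_le hx] at hy
      simp [bt_of_ge hy.1]
  have h1 := St_le t (show 0 ≤ t + 1 by linarith)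
  rw [St] at h1 ⊢
  rw [← intervalIntegral.integral_add_adjacent_intervals (hi 0 (t+1)) (hi (t+1) x), h0]
  linarith

lemma gain_denom_pos (t : ℝ) {x : ℝ} (hx : 0 ≤ x) :
    0 < (1 - bt t x) * (1 + Real.exp (-x)) ^ 2 + St t x * Real.exp (-x) := by
  have h2 := bt_le_one t x
  have h3 := one_le_St t hx
  have : 0 ≤ (1 - bt t x) * (1 + Real.exp (-x)) ^ 2 := mul_nonneg (by linarith) (by positivity)
  have : 0 < St t x * Real.exp (-x) := mul_pos (by linarith) (Real.exp_pos _)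
  linarith

lemma gain_denom_le (t : ℝ) {x : ℝ} (hx : 0 ≤ x) :
    (1 - bt t x) * (1 + Real.exp (-x)) ^ 2 + St t x * Real.exp (-x) ≤ 6 := by
  have h1 := bt_nonneg t x
  have h2 := bt_le_one t x
  have h3 : Real.exp (-x) ≤ 1 := Real.exp_le_one_iff.2 (by linarith)
  have h4 := Real.exp_pos (-x)
  have h5 := St_le t hx
  have h6 : (1 + 2 * x) * Real.exp (-x) ≤ 2 := by
    have h7 : x * Real.exp (-x) ≤ Real.exp (-1) := Real.mul_exp_neg_le_exp_neg_one x
    have h8 : Real.exp (-1) ≤ 1 / 2 := by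
      have := Real.add_one_le_exp (1:ℝ)
      rw [Real.exp_neg, inv_eq_one_div]
      exact one_div_le_one_div_of_le (by norm_num) (by linarith)
    nlinarith
  have h9 : (1 - bt t x) * (1 + Real.exp (-x)) ^ 2 ≤ 1 * 2 ^ 2 := by
    refine mul_le_mul (by linarith) ?_ (by positivity) zero_le_one
    exact pow_le_pow_left₀ (by positivity) (by linarith) 2
  nlinarith

lemma gain_ge (t : ℝ) {x : ℝ} (hx : 0 ≤ x) : 1 / 6 ≤ gain t x := by
  rw [gain, ← one_div]
  exact one_div_le_one_div_of_le (gain_denom_pos t hx) (gain_denom_le t hx)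

lemma gain_pos (t : ℝ) {x : ℝ} (hx : 0 ≤ x) : 0 < gain t x :=
  (gain_ge t hx).trans_lt' (by norm_num)

lemma exists_le_gain {t : ℝ} (ht : 0 ≤ t) : ∃ c : ℝ, 0 < c ∧ ∀ x, 0 ≤ x → c * Real.exp x ≤ gain t x := by
  refine ⟨min (1 / (1 + 2 * (t + 1))) (Real.exp (-(t + 1)) / 6), by positivity, fun x hx => ?_⟩
  rcases le_total (t + 1) x with h | h
  · have hS := one_le_St t hx
    calc _ ≤ 1 / (1 + 2 * (t + 1)) * Real.exp x := by gcongr; exact min_le_left _ _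
      _ ≤ 1 / St t x * Real.exp x := by
        gcongr
        exact St_le_of_ge ht h
      _ = gain t x := by
        rw [gain, bt_of_ge h, Real.exp_neg]; field_simp; ring
  · calc _ ≤ Real.exp (-(t + 1)) / 6 * Real.exp x := by gcongr; exact min_le_right _ _
      _ = Real.exp (x - (t + 1)) / 6 := by rw [div_mul_eq_mul_div, ← Real.exp_add]; ring_nf
      _ ≤ 1 / 6 := by
        gcongr
        exact Real.exp_le_one_iff.2 (by linarith)
      _ ≤ gain t x := gain_ge t hx

lemma norm_add_three_sq_le {a₁ a₂ a₃ : ℂ} {c₁ c₂ c₃ p₁ p₂ p₃ : ℝ} (hc₁ : 0 ≤ c₁) (hc₂ : 0 ≤ c₂)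
    (hc₃ : 0 ≤ c₃) (hp₁ : 0 ≤ p₁) (hp₂ : 0 ≤ p₂) (hp₃ : 0 ≤ p₃) (h₁ : ‖a₁‖ ^ 2 ≤ c₁ * p₁)
    (h₂ : ‖a₂‖ ^ 2 ≤ c₂ * p₂) (h₃ : ‖a₃‖ ^ 2 ≤ c₃ * p₃) :
    ‖a₁ + a₂ + a₃‖ ^ 2 ≤ (c₁ + c₂ + c₃) * (p₁ + p₂ + p₃) := by
  have cross : ∀ {a b : ℂ} {c d p q : ℝ}, 0 ≤ c → 0 ≤ d → 0 ≤ p → 0 ≤ q → ‖a‖ ^ 2 ≤ c * p →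
      ‖b‖ ^ 2 ≤ d * q → 2 * (‖a‖ * ‖b‖) ≤ c * q + d * p := by
    intro a b c d p q hc hd hp hq h1 h2
    have h3 : (‖a‖ * ‖b‖) ^ 2 ≤ (c * p) * (d * q) := by
      rw [mul_pow]; gcongr
    refine abs_le_of_sq_le_sq' ?_ (by positivity) |>.2
    nlinarith [sq_nonneg (c * q - d * p)]
  have h12 := cross hc₁ hc₂ hp₁ hp₂ h₁ h₂
  have h13 := cross hc₁ hc₃ hp₁ hp₃ h₁ h₃
  have h23 := cross hc₂ hc₃ hp₂ hp₃ h₂ h₃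
  have h := norm_add₃_le (a := a₁) (b := a₂) (c := a₃)
  have h' := pow_le_pow_left₀ (norm_nonneg _) h 2
  nlinarith

lemma norm_gradc_sq_le (s : Cn n → ℝ) (z β : Cn n) :
    ‖gradc s z β‖ ^ 2 ≤ (∑ j, ‖dbar j (fun z => (s z : ℂ)) z‖ ^ 2) * ∑ j, ‖β j‖ ^ 2 := by
  have h1 : ‖gradc s z β‖ ≤ ∑ j, ‖dbar j (fun z => (s z : ℂ)) z‖ * ‖β j‖ := by
    refine (norm_sum_le _ _).trans (le_of_eq ?_)
    simp
  exact (pow_le_pow_left₀ (norm_nonneg _) h1 2).trans (Finset.sum_mul_sq_le_sq_mul_sq _ _ _)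

/-- The Levi form of the logarithm of the twist factor. -/
lemma levi_log_St {s : Cn n → ℝ} (hs : ContDiff ℝ ∞ s) (hs0 : ∀ z, 0 ≤ s z) (t : ℝ) (z β : Cn n) :
    levi (fun z => Real.log (St t (s z))) z β =
      (1 - bt t (s z)) * (1 + Real.exp (-s z)) / St t (s z) * levi s z β -
      ((1 - bt t (s z)) ^ 2 * (1 + Real.exp (-s z)) ^ 2 / St t (s z) ^ 2 +
        deriv (bt t) (s z) * (1 + Real.exp (-s z)) / St t (s z) +
        (1 - bt t (s z)) * Real.exp (-s z) / St t (s z)) * ‖gradc s z β‖ ^ 2 := by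
  have hpos : ∀ z, 0 < St t (s z) := fun z => one_pos.trans_le (one_le_St t (hs0 z))
  have hS : ContDiff ℝ ∞ fun z => St t (s z) := (contDiff_St t).comp hs
  have hl : ContDiff ℝ ∞ fun z => Real.log (St t (s z)) := hS.log fun z => (hpos z).ne'
  have e : (fun z => Real.exp (Real.log (St t (s z)))) = fun z => St t (s z) :=
    funext fun z => Real.exp_log (hpos z)
  have h1 := levi_comp Real.contDiff_exp hl z β
  have h2 := levi_comp (contDiff_St t) hs z β
  have h3 := gradc_comp Real.contDiff_exp hl z β
  have h4 := gradc_comp (contDiff_St t) hs z β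
  rw [e] at h1 h3
  rw [h2] at h1
  rw [h4] at h3
  rw [deriv_deriv_St] at h1
  simp only [deriv_St, Real.deriv_exp] at h1 h3
  rw [Real.exp_log (hpos z)] at h1 h3
  have h5 := congrArg (fun x => ‖x‖ ^ 2) h3
  simp only [norm_mul, Complex.norm_real, mul_pow, Real.norm_eq_abs, sq_abs] at h5
  have hp := (hpos z).ne'
  set S := St t (s z)
  set g := ‖gradc (fun z => Real.log (St t (s z))) z β‖ ^ 2
  have h6 : g = ((1 - bt t (s z)) * (1 + Real.exp (-s z))) ^ 2 * ‖gradc s z β‖ ^ 2 / S ^ 2 := by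
    rw [eq_div_iff (by positivity), mul_pow]; linarith
  rw [h6] at h1
  field_simp
  field_simp at h1
  linear_combination -h1

section twist
variable {B s θ : Cn n → ℝ} {f : Cn n → ℂ} {K t : ℝ}

/-- The twisted `L²` estimate. -/
lemma twisted_estimate (hB : ContDiff ℝ ∞ B) (hs : ContDiff ℝ ∞ s) (hθ : ContDiff ℝ ∞ θ)
    (hf : ContDiff ℝ ∞ f) (hθc : HasCompactSupport θ) (hs0 : ∀ z, 0 ≤ s z)
    (hfθ : ∀ z j, (θ z : ℂ) * dbar j f z = 0) (hK : 0 < K)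
    (hlev : ∀ z β l, 1 ≤ l → l ≤ 3 → 0 ≤ levi B z β - l * levi s z β)
    (hlevK : ∀ z β l, 1 ≤ l → l ≤ 3 → (∃ j, dbar j (fun z => (θ z : ℂ)) z ≠ 0) →
      K * ∑ j, ‖β j‖ ^ 2 ≤ levi B z β - l * levi s z β) :
    ∃ F : Cn n → ℂ, Differentiable ℂ F ∧
      Integrable (fun z => ‖(θ z * bt t (s z) : ℝ) * f z - F z‖ ^ 2 * gain t (s z) *
        Real.exp (-B z)) volume ∧
      ∫ z, ‖(θ z * bt t (s z) : ℝ) * f z - F z‖ ^ 2 * gain t (s z) * Real.exp (-B z) ≤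
        (∫ z, θ z ^ 2 * deriv (bt t) (s z) * ‖f z‖ ^ 2 * Real.exp (s z - B z)) +
        1 / K * ∫ z, (∑ j, ‖dbar j (fun z => (θ z : ℂ)) z‖ ^ 2) * ‖f z‖ ^ 2 *
          Real.exp (s z - B z) := by
  have hL1 : ∀ z, 1 ≤ St t (s z) := fun z => one_le_St t (hs0 z)
  have hpos : ∀ z, 0 < St t (s z) := fun z => one_pos.trans_le (hL1 z)
  have hS : ContDiff ℝ ∞ fun z => St t (s z) := (contDiff_St t).comp hs
  have hb : ContDiff ℝ ∞ fun z => bt t (s z) := (contDiff_bt t).comp hs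
  have hb' : ContDiff ℝ ∞ fun z => deriv (bt t) (s z) :=
    ((contDiff_infty_iff_deriv.1 (contDiff_bt t)).2).comp hs
  have hl : ContDiff ℝ ∞ fun z => Real.log (St t (s z)) := hS.log fun z => (hpos z).ne'
  set Φ₀ : Cn n → ℝ := fun z => B z - s z with hΦ₀def
  have hΦ₀ : ContDiff ℝ ∞ Φ₀ := hB.sub hs
  set Φ : Cn n → ℝ := fun z => Φ₀ z - Real.log (St t (s z)) with hΦdef
  have hΦ : ContDiff ℝ ∞ Φ := hΦ₀.sub hl
  have hwt : ∀ z, wt Φ z = wt Φ₀ z * St t (s z) := fun z => by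
    simp only [wt, hΦdef]
    rw [neg_sub, sub_eq_neg_add, Real.exp_add, Real.exp_log (hpos z)]
  have hwt₀ : ∀ z, wt Φ₀ z = Real.exp (s z - B z) := fun z => by
    simp only [wt, hΦ₀def]; congr 1; ring
  set v : Cn n → ℂ := fun z => (θ z * bt t (s z) : ℝ) * f z with hv
  have hθb : ContDiff ℝ ∞ fun z => θ z * bt t (s z) := hθ.mul hb
  have hvs : ContDiff ℝ ∞ v := hθb.ofReal.mul hf
  have hvc : HasCompactSupport v := hθc.mono fun z hz h0 => hz (by simp [hv, h0])
  obtain ⟨F, hF, hFi, -, hui, horth⟩ := exists_bergman_projection hΦ₀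
    (sqInt_of_hasCompactSupport hΦ₀ hvs.continuous hvc)
  refine ⟨F, hF, ?_⟩
  set u : Cn n → ℂ := fun z => v z - F z with hu
  have hus : ContDiff ℝ ∞ u := hvs.sub hF.contDiff_real
  have hSi : ContDiff ℝ ∞ fun z => (((St t (s z))⁻¹ : ℝ) : ℂ) :=
    (hS.inv fun z => (hpos z).ne').ofReal
  set w : Cn n → ℂ := fun z => u z * ((St t (s z))⁻¹ : ℝ) with hw
  have hws : ContDiff ℝ ∞ w := hus.mul hSi
  have hu2 : Integrable (fun z => ‖u z‖ ^ 2 * wt Φ₀ z) volume :=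
    (sqInt_iff hΦ₀ hus.continuous.aestronglyMeasurable).1 hui
  have hwn : ∀ z, ‖w z‖ ^ 2 * wt Φ z = ‖u z‖ ^ 2 * wt Φ₀ z * (St t (s z))⁻¹ := fun z => by
    have := (hpos z).ne'
    simp only [hw, norm_mul, Complex.norm_real, Real.norm_eq_abs, mul_pow, sq_abs, hwt]
    field_simp
  have hwi : SqInt Φ w := by
    rw [sqInt_iff hΦ hws.continuous.aestronglyMeasurable]
    refine hu2.mono (((hws.continuous.norm.pow 2).mul hΦ.wt.continuous).aestronglyMeasurable)
      (Eventually.of_forall fun z => ?_)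
    have h1 := (wt_pos Φ₀ z).le
    have h2 := (inv_pos.2 (hpos z)).le
    have h3 : (St t (s z))⁻¹ ≤ 1 := inv_le_one_of_one_le₀ (hL1 z)
    rw [hwn, Real.norm_of_nonneg (by positivity), Real.norm_of_nonneg (by positivity)]
    exact mul_le_of_le_one_right (by positivity) h3
  have hworth : ∀ h : Cn n → ℂ, Differentiable ℂ h → SqInt Φ h →
      ∫ z, w z * starRingEnd ℂ (h z) * wt Φ z = 0 := by
    intro h hh hhi
    have hhi₀ : SqInt Φ₀ h := by
      have hm := hh.continuous.aestronglyMeasurable (μ := (volume : Measure (Cn n)))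
      rw [sqInt_iff hΦ₀ hm]
      refine ((sqInt_iff hΦ hm).1 hhi).mono
        (((hh.continuous.norm.pow 2).mul hΦ₀.wt.continuous).aestronglyMeasurable)
        (Eventually.of_forall fun z => ?_)
      have h1 := (wt_pos Φ₀ z).le
      have h2 := (wt_pos Φ z).le
      rw [Real.norm_of_nonneg (by positivity), Real.norm_of_nonneg (by positivity), hwt]
      gcongr
      exact le_mul_of_one_le_right h1 (hL1 z)
    rw [← horth h hh hhi₀]
    congr 1; ext z
    have : ((St t (s z) : ℝ) : ℂ) ≠ 0 := by exact_mod_cast (hpos z).ne'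
    simp only [hw, hwt]
    push_cast
    field_simp
    simp only [hu]; ring
  set N : Cn n → ℝ := fun z => ∑ j, ‖dbar j (fun z => (θ z : ℂ)) z‖ ^ 2 with hN
  have hNc : Continuous N := by
    refine continuous_finsetSum _ fun j _ => ?_
    exact ((hθ.ofReal.dbar j).continuous.norm.pow 2)
  have hNcs : HasCompactSupport N := by
    refine HasCompactSupport.intro hθc.isCompact fun z hz => ?_
    have h0 : ∀ j, dbar j (fun z => (θ z : ℂ)) z = 0 := by
      intro j
      have h1 : (fun z => (θ z : ℂ)) =ᶠ[𝓝 z] fun _ => 0 := by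
        filter_upwards [(isClosed_tsupport θ).isOpen_compl.mem_nhds hz] with x hx
        rw [image_eq_zero_of_notMem_tsupport hx]; simp
      simp [dbar, dirD, h1.fderiv_eq]
    simp [hN, h0]
  have hN0 : ∀ z, 0 ≤ N z := fun z => Finset.sum_nonneg fun j _ => by positivity
  set σ : Cn n → ℝ := fun z => 1 + Real.exp (-s z) with hσ
  have hσ1 : ∀ z, 1 ≤ σ z := fun z => by simp only [hσ]; linarith [Real.exp_pos (-s z)]
  have hσ2 : ∀ z, σ z ≤ 2 := fun z => by
    have : Real.exp (-s z) ≤ 1 := Real.exp_le_one_iff.2 (by linarith [hs0 z])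
    simp only [hσ]; linarith
  have hσs : ContDiff ℝ ∞ σ := contDiff_const.add hs.neg.exp
  set q : Cn n → ℝ := fun z => (1 - bt t (s z)) * σ z ^ 2 * gain t (s z) with hq
  have hD : ∀ z, 0 < (1 - bt t (s z)) * σ z ^ 2 + St t (s z) * Real.exp (-s z) :=
    fun z => gain_denom_pos t (hs0 z)
  have hgain : ∀ z, gain t (s z) =
      ((1 - bt t (s z)) * σ z ^ 2 + St t (s z) * Real.exp (-s z))⁻¹ := fun z => rfl
  have hgc : Continuous fun z => gain t (s z) := by
    simp only [hgain]
    refine Continuous.inv₀ ?_ fun z => (hD z).ne'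
    exact ((continuous_const.sub hb.continuous).mul (hσs.continuous.pow 2)).add
      (hS.continuous.mul hs.neg.exp.continuous)
  have hq0 : ∀ z, 0 ≤ q z := fun z =>
    mul_nonneg (mul_nonneg (by linarith [bt_le_one t (s z)]) (sq_nonneg _)) (gain_pos t (hs0 z)).le
  have hq1 : ∀ z, 1 - q z = St t (s z) * Real.exp (-s z) * gain t (s z) := fun z => by
    simp only [hq, hgain]
    have := (hD z).ne'
    field_simp
    ring
  have hqle : ∀ z, q z ≤ 1 := fun z => by
    have h1 : 0 ≤ 1 - q z := by
      rw [hq1]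
      exact mul_nonneg (mul_nonneg (hpos z).le (Real.exp_pos _).le) (gain_pos t (hs0 z)).le
    linarith
  have hqc : Continuous q :=
    ((continuous_const.sub hb.continuous).mul (hσs.continuous.pow 2)).mul hgc
  set c₁ : Cn n → ℝ := fun z => θ z ^ 2 * deriv (bt t) (s z) * ‖f z‖ ^ 2 * St t (s z) / σ z with hc₁
  set c₂ : Cn n → ℝ := fun z => q z * ‖u z‖ ^ 2 with hc₂
  set c₃ : Cn n → ℝ := fun z => bt t (s z) ^ 2 * ‖f z‖ ^ 2 * N z / K with hc₃
  have hc₁0 : ∀ z, 0 ≤ c₁ z := fun z => by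
    have h1 := deriv_bt_nonneg t (s z)
    have h2 := (hpos z).le
    have h3 := (zero_le_one.trans (hσ1 z))
    simp only [hc₁]; positivity
  have hc₂0 : ∀ z, 0 ≤ c₂ z := fun z => mul_nonneg (hq0 z) (sq_nonneg _)
  have hc₃0 : ∀ z, 0 ≤ c₃ z := fun z => by
    have h1 := hN0 z
    simp only [hc₃]; positivity
  -- integrability of the three terms
  have iA : Integrable (fun z => θ z ^ 2 * deriv (bt t) (s z) * ‖f z‖ ^ 2 * Real.exp (s z - B z))
      volume := by
    refine Continuous.integrable_of_hasCompactSupport ?_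
      (hθc.mono fun z hz h0 => hz (by simp [h0]))
    exact (((hθ.continuous.pow 2).mul hb'.continuous).mul (hf.continuous.norm.pow 2)).mul
      (Real.continuous_exp.comp (hs.continuous.sub hB.continuous))
  have iC : Integrable (fun z => N z * ‖f z‖ ^ 2 * Real.exp (s z - B z)) volume := by
    refine Continuous.integrable_of_hasCompactSupport ?_
      (hNcs.mono fun z hz h0 => hz (by simp [h0]))
    exact (hNc.mul (hf.continuous.norm.pow 2)).mul
      (Real.continuous_exp.comp (hs.continuous.sub hB.continuous))
  have hdbar_w : ∀ z β, ((St t (s z) : ℝ) : ℂ) * ∑ j, dbar j w z * starRingEnd ℂ (β j) =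
      (θ z * deriv (bt t) (s z) : ℝ) * f z * gradc s z β +
      (-(u z * ((1 - bt t (s z)) * σ z / St t (s z) : ℝ) * gradc s z β)) +
      (bt t (s z) : ℝ) * f z * gradc θ z β := by
    intro z β
    have e1 : u = fun z => w z * ((St t (s z) : ℝ) : ℂ) := by
      ext z
      have : ((St t (s z) : ℝ) : ℂ) ≠ 0 := by exact_mod_cast (hpos z).ne'
      simp only [hw]
      push_cast
      field_simp
    have key : ∀ j, ((St t (s z) : ℝ) : ℂ) * dbar j w z =
        (θ z * deriv (bt t) (s z) : ℝ) * f z * dbar j (fun z => (s z : ℂ)) z +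
        (-(u z * ((1 - bt t (s z)) * σ z / St t (s z) : ℝ) * dbar j (fun z => (s z : ℂ)) z)) +
        (bt t (s z) : ℝ) * f z * dbar j (fun z => (θ z : ℂ)) z := by
      intro j
      have h1 : dbar j u z = dbar j w z * ((St t (s z) : ℝ) : ℂ) +
          w z * (((1 - bt t (s z)) * σ z : ℝ) * dbar j (fun z => (s z : ℂ)) z) := by
        conv_lhs => rw [e1, dbar_mul hws hS.ofReal, dbar_comp (contDiff_St t) hs, deriv_St]
      have h2 : dbar j u z = dbar j v z := by
        rw [hu, dbar_sub hvs hF.contDiff_real]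
        simp [dbar_eq_zero_of_differentiableAt (hF z)]
      have h3 : dbar j v z = (dbar j (fun z => (θ z : ℂ)) z * (bt t (s z) : ℝ) +
          θ z * ((deriv (bt t) (s z) : ℝ) * dbar j (fun z => (s z : ℂ)) z)) * f z := by
        have e2 : (fun z => ((θ z * bt t (s z) : ℝ) : ℂ)) =
            fun z => (θ z : ℂ) * (bt t (s z) : ℝ) := by ext z; push_cast; ring
        rw [hv, dbar_mul hθb.ofReal hf, e2, dbar_mul hθ.ofReal hb.ofReal,
          dbar_comp (contDiff_bt t) hs]
        have := hfθ z j
        push_cast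
        linear_combination ((bt t (s z) : ℝ) : ℂ) * this
      have h4 : w z = u z * ((St t (s z))⁻¹ : ℝ) := rfl
      rw [h2, h3, h4] at h1
      rw [div_eq_mul_inv]
      push_cast at h1 ⊢
      linear_combination -h1
    simp only [gradc, Finset.mul_sum, ← mul_assoc, key, ← Finset.sum_neg_distrib,
      ← Finset.sum_add_distrib]
    refine Finset.sum_congr rfl fun j _ => ?_
    ring
  have hleviΦ : ∀ z β, levi Φ z β = deriv (bt t) (s z) * σ z / St t (s z) * ‖gradc s z β‖ ^ 2 +
      ((1 - bt t (s z)) ^ 2 * σ z ^ 2 / St t (s z) ^ 2 +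
        (1 - bt t (s z)) * Real.exp (-s z) / St t (s z)) * ‖gradc s z β‖ ^ 2 +
      (levi B z β - (1 + (1 - bt t (s z)) * σ z / St t (s z)) * levi s z β) := by
    intro z β
    rw [hΦdef, levi_sub hΦ₀ hl, levi_log_St hs hs0, hΦ₀def, levi_sub hB hs]
    ring
  have hlrange : ∀ z, 1 ≤ 1 + (1 - bt t (s z)) * σ z / St t (s z) ∧
      1 + (1 - bt t (s z)) * σ z / St t (s z) ≤ 3 := by
    intro z
    have h1 := bt_le_one t (s z)
    have h2 := bt_nonneg t (s z)
    have h3 := hσ1 z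
    have h4 := hσ2 z
    constructor
    · have : 0 ≤ (1 - bt t (s z)) * σ z / St t (s z) :=
        div_nonneg (mul_nonneg (by linarith) (by linarith)) (hpos z).le
      linarith
    · have : (1 - bt t (s z)) * σ z / St t (s z) ≤ 2 := by
        rw [div_le_iff₀ (hpos z)]
        nlinarith [hL1 z]
      linarith
  have hp₁ : ∀ z β, 0 ≤ deriv (bt t) (s z) * σ z / St t (s z) * ‖gradc s z β‖ ^ 2 := by
    intro z β
    have h1 := deriv_bt_nonneg t (s z)
    have h2 := (hpos z).le
    have h3 := (zero_le_one.trans (hσ1 z))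
    positivity
  have hp₂ : ∀ z β, 0 ≤ ((1 - bt t (s z)) ^ 2 * σ z ^ 2 / St t (s z) ^ 2 +
      (1 - bt t (s z)) * Real.exp (-s z) / St t (s z)) * ‖gradc s z β‖ ^ 2 := by
    intro z β
    have h1 : 0 ≤ 1 - bt t (s z) := by linarith [bt_le_one t (s z)]
    have h2 := (hpos z).le
    positivity
  have hp₃ : ∀ z β, 0 ≤ levi B z β - (1 + (1 - bt t (s z)) * σ z / St t (s z)) * levi s z β :=
    fun z β => hlev z β _ (hlrange z).1 (hlrange z).2
  have hleviΦ0 : ∀ z β, 0 ≤ levi Φ z β := fun z β => by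
    rw [hleviΦ]
    exact add_nonneg (add_nonneg (hp₁ z β) (hp₂ z β)) (hp₃ z β)
  have hmain : ∀ z β, ‖∑ j, dbar j w z * starRingEnd ℂ (β j)‖ ^ 2 ≤
      ((c₁ z + c₂ z + c₃ z) / St t (s z) ^ 2) * levi Φ z β := by
    intro z β
    have h1 := norm_add_three_sq_le (hc₁0 z) (hc₂0 z) (hc₃0 z) (hp₁ z β) (hp₂ z β) (hp₃ z β)
      (a₁ := (θ z * deriv (bt t) (s z) : ℝ) * f z * gradc s z β)
      (a₂ := -(u z * ((1 - bt t (s z)) * σ z / St t (s z) : ℝ) * gradc s z β))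
      (a₃ := (bt t (s z) : ℝ) * f z * gradc θ z β) ?_ ?_ ?_
    · rw [← hdbar_w, ← hleviΦ, norm_mul, mul_pow, Complex.norm_real, Real.norm_eq_abs, sq_abs] at h1
      rw [div_mul_eq_mul_div, le_div_iff₀ (pow_pos (hpos z) 2)]
      linarith
    · simp only [norm_mul, Complex.norm_real, Real.norm_eq_abs, mul_pow, sq_abs, hc₁]
      have := (hpos z).ne'
      have h3 := (one_pos.trans_le (hσ1 z)).ne'
      refine le_of_eq ?_
      field_simp
    · simp only [norm_mul, norm_neg, Complex.norm_real, Real.norm_eq_abs, mul_pow, sq_abs, hc₂, hq,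
        hgain]
      have h2 := (hpos z).ne'
      have h3 := (hD z).ne'
      refine le_of_eq ?_
      field_simp
    · simp only [norm_mul, Complex.norm_real, Real.norm_eq_abs, mul_pow, sq_abs, hc₃]
      have hg := norm_gradc_sq_le θ z β
      by_cases h0 : ∃ j, dbar j (fun z => (θ z : ℂ)) z ≠ 0
      · have h4 := hlevK z β _ (hlrange z).1 (hlrange z).2 h0
        have h5 : ‖gradc θ z β‖ ^ 2 ≤ N z / K * (levi B z β -
            (1 + (1 - bt t (s z)) * σ z / St t (s z)) * levi s z β) := by
          refine hg.trans ?_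
          calc N z * ∑ j, ‖β j‖ ^ 2 = N z / K * (K * ∑ j, ‖β j‖ ^ 2) := by field_simp
            _ ≤ _ := mul_le_mul_of_nonneg_left h4 (div_nonneg (hN0 z) hK.le)
        have h6 := mul_le_mul_of_nonneg_left h5
          (show 0 ≤ bt t (s z) ^ 2 * ‖f z‖ ^ 2 by positivity)
        refine h6.trans (le_of_eq ?_)
        ring
      · push Not at h0
        have h4 : gradc θ z β = 0 := by simp [gradc, h0]
        rw [h4]
        have := mul_nonneg (hc₃0 z) (hp₃ z β)
        simpa [hc₃] using this
  have hGW : ∀ z, (c₁ z + c₂ z + c₃ z) / St t (s z) ^ 2 * wt Φ z =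
      (c₁ z + c₂ z + c₃ z) * (St t (s z))⁻¹ * wt Φ₀ z := fun z => by
    have := (hpos z).ne'
    rw [hwt]; field_simp
  have t₁ : ∀ z, c₁ z * (St t (s z))⁻¹ * wt Φ₀ z ≤
      θ z ^ 2 * deriv (bt t) (s z) * ‖f z‖ ^ 2 * Real.exp (s z - B z) := fun z => by
    rw [hwt₀]
    refine mul_le_mul_of_nonneg_right ?_ (Real.exp_pos _).le
    have h1 := deriv_bt_nonneg t (s z)
    have e : c₁ z * (St t (s z))⁻¹ = θ z ^ 2 * deriv (bt t) (s z) * ‖f z‖ ^ 2 / σ z := by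
      have := (hpos z).ne'
      simp only [hc₁]; field_simp
    rw [e]
    exact div_le_self (by positivity) (hσ1 z)
  have hinv : ∀ z, 0 ≤ (St t (s z))⁻¹ ∧ (St t (s z))⁻¹ ≤ 1 := fun z =>
    ⟨(inv_pos.2 (hpos z)).le, inv_le_one_of_one_le₀ (hL1 z)⟩
  have t₃ : ∀ z, c₃ z * (St t (s z))⁻¹ * wt Φ₀ z ≤
      1 / K * (N z * ‖f z‖ ^ 2 * Real.exp (s z - B z)) := fun z => by
    rw [hwt₀]
    have h1 : c₃ z * (St t (s z))⁻¹ ≤ 1 / K * (N z * ‖f z‖ ^ 2) := by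
      refine (mul_le_of_le_one_right (hc₃0 z) (hinv z).2).trans ?_
      simp only [hc₃]
      have h2 : bt t (s z) ^ 2 ≤ 1 := pow_le_one₀ (bt_nonneg _ _) (bt_le_one _ _)
      have h3 := hN0 z
      calc bt t (s z) ^ 2 * ‖f z‖ ^ 2 * N z / K ≤ 1 * ‖f z‖ ^ 2 * N z / K := by gcongr
        _ = _ := by ring
    have := mul_le_mul_of_nonneg_right h1 (Real.exp_pos (s z - B z)).le
    linarith
  have hSc : Continuous fun z => (St t (s z))⁻¹ := hS.continuous.inv₀ fun z => (hpos z).ne'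
  have i₂ : Integrable (fun z => c₂ z * (St t (s z))⁻¹ * wt Φ₀ z) volume := by
    refine hu2.mono ((((hqc.mul (hus.continuous.norm.pow 2)).mul hSc).mul
      hΦ₀.wt.continuous).aestronglyMeasurable) (Eventually.of_forall fun z => ?_)
    have h1 := (wt_pos Φ₀ z).le
    rw [Real.norm_of_nonneg (mul_nonneg (mul_nonneg (hc₂0 z) (hinv z).1) h1),
      Real.norm_of_nonneg (by positivity)]
    refine mul_le_mul_of_nonneg_right ?_ h1
    refine (mul_le_of_le_one_right (hc₂0 z) (hinv z).2).trans ?_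
    exact mul_le_of_le_one_left (sq_nonneg _) (hqle z)
  have hc₁c : Continuous c₁ := by
    refine Continuous.div ?_ hσs.continuous fun z => (one_pos.trans_le (hσ1 z)).ne'
    exact (((hθ.continuous.pow 2).mul hb'.continuous).mul (hf.continuous.norm.pow 2)).mul
      hS.continuous
  have hc₃c : Continuous c₃ :=
    (((hb.continuous.pow 2).mul (hf.continuous.norm.pow 2)).mul hNc).div_const K
  have i₁ : Integrable (fun z => c₁ z * (St t (s z))⁻¹ * wt Φ₀ z) volume := by
    refine iA.mono (((hc₁c.mul hSc).mul hΦ₀.wt.continuous).aestronglyMeasurable)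
      (Eventually.of_forall fun z => ?_)
    rw [Real.norm_of_nonneg (mul_nonneg (mul_nonneg (hc₁0 z) (hinv z).1) (wt_pos Φ₀ z).le)]
    exact (t₁ z).trans (le_abs_self _)
  have i₃ : Integrable (fun z => c₃ z * (St t (s z))⁻¹ * wt Φ₀ z) volume := by
    refine (iC.const_mul (1 / K)).mono
      (((hc₃c.mul hSc).mul hΦ₀.wt.continuous).aestronglyMeasurable)
      (Eventually.of_forall fun z => ?_)
    rw [Real.norm_of_nonneg (mul_nonneg (mul_nonneg (hc₃0 z) (hinv z).1) (wt_pos Φ₀ z).le)]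
    exact (t₃ z).trans (le_abs_self _)
  have hsplit : ∀ z, (c₁ z + c₂ z + c₃ z) / St t (s z) ^ 2 * wt Φ z =
      c₁ z * (St t (s z))⁻¹ * wt Φ₀ z + c₂ z * (St t (s z))⁻¹ * wt Φ₀ z +
        c₃ z * (St t (s z))⁻¹ * wt Φ₀ z := fun z => by rw [hGW]; ring
  have hGi : Integrable (fun z => (c₁ z + c₂ z + c₃ z) / St t (s z) ^ 2 * wt Φ z) volume := by
    simp only [hsplit]
    exact (i₁.add i₂).add i₃
  have hest := integral_le_of_orthogonal_entire hΦ hws hwi hworth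
    (G := fun z => (c₁ z + c₂ z + c₃ z) / St t (s z) ^ 2)
    (fun z => div_nonneg (add_nonneg (add_nonneg (hc₁0 z) (hc₂0 z)) (hc₃0 z)) (sq_nonneg _))
    hGi hleviΦ0 hmain
  simp only [hsplit, hwn] at hest
  have i₁₂ : Integrable (fun z => c₁ z * (St t (s z))⁻¹ * wt Φ₀ z +
    c₂ z * (St t (s z))⁻¹ * wt Φ₀ z) volume := i₁.add i₂
  rw [integral_add i₁₂ i₃, integral_add i₁ i₂] at hest
  have i₀ : Integrable (fun z => ‖u z‖ ^ 2 * wt Φ₀ z * (St t (s z))⁻¹) volume := by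
    have := (sqInt_iff hΦ hws.continuous.aestronglyMeasurable).1 hwi
    simpa only [hwn] using this
  have hLHS : ∀ z, ‖u z‖ ^ 2 * gain t (s z) * Real.exp (-B z) =
      ‖u z‖ ^ 2 * wt Φ₀ z * (St t (s z))⁻¹ - c₂ z * (St t (s z))⁻¹ * wt Φ₀ z := fun z => by
    have e : ‖u z‖ ^ 2 * wt Φ₀ z * (St t (s z))⁻¹ - c₂ z * (St t (s z))⁻¹ * wt Φ₀ z =
        (1 - q z) * ‖u z‖ ^ 2 * (St t (s z))⁻¹ * wt Φ₀ z := by simp only [hc₂]; ring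
    have h2 := (hpos z).ne'
    rw [e, hq1, hwt₀, show -B z = -s z + (s z - B z) by ring, Real.exp_add]
    field_simp
  constructor
  · exact (i₀.sub i₂).congr (Eventually.of_forall fun z => (hLHS z).symm)
  · change ∫ z, ‖u z‖ ^ 2 * gain t (s z) * Real.exp (-B z) ≤ _
    simp only [hLHS]
    rw [integral_sub i₀ i₂]
    have j₁ := integral_mono i₁ iA t₁
    have j₃ := integral_mono i₃ (iC.const_mul (1 / K)) t₃
    rw [integral_const_mul] at j₃
    linarith

end twist

lemma levi_nsq (z β : Cn n) : levi nsq z β = nsq β := by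
  have h1 : ∀ a : Cn n, dirD a nsq = fun z => ∑ j, 2 * inner ℝ (z j) (a j) := by
    intro a
    have e : (nsq : Cn n → ℝ) = fun z => ∑ j, ‖z j‖ ^ 2 := rfl
    have hj : ∀ j : Fin n, ContDiff ℝ ∞ fun z : Cn n => ‖z j‖ ^ 2 := fun j =>
      (contDiff_norm_sq ℝ).comp (contDiff_apply ℝ ℂ j)
    rw [e, dirD_sum a Finset.univ hj]
    ext z
    refine Finset.sum_congr rfl fun j _ => ?_
    have := ((hasFDerivAt_apply (𝕜 := ℝ) j z).norm_sq).fderiv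
    simp [dirD, this]
    ring
  have h2 : ∀ a : Cn n, dirD a (dirD a nsq) z = 2 * nsq a := by
    intro a
    have hj : ∀ j : Fin n, ContDiff ℝ ∞ fun z : Cn n => 2 * inner ℝ (z j) (a j) := fun j =>
      contDiff_const.mul ((contDiff_apply ℝ ℂ j).inner ℝ contDiff_const)
    rw [h1, dirD_sum a Finset.univ hj, nsq, Finset.mul_sum]
    refine Finset.sum_congr rfl fun j _ => ?_
    have := (((hasFDerivAt_apply (𝕜 := ℝ) (F' := fun _ : Fin n => ℂ) j z).inner ℝ
      (hasFDerivAt_const (a j) z)).const_mul 2).fderiv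
    simp only [dirD]
    rw [this]
    simp only [_root_.smul_apply, ContinuousLinearMap.comp_apply, ContinuousLinearMap.prod_apply,
      ContinuousLinearMap.proj_apply, fderivInnerCLM_apply, _root_.zero_apply, inner_zero_right, zero_add,
      real_inner_self_eq_norm_sq, smul_eq_mul]
  rw [levi, h2, h2, nsq_smul]
  simp
  ring

lemma exists_abs_levi_le {v : Cn n → ℝ} (hv : ContDiff ℝ ∞ v) (hc : HasCompactSupport v) :
    ∃ C : ℝ, ∀ z β, |levi v z β| ≤ C * nsq β := by
  have hc' : HasCompactSupport fun z => (v z : ℂ) := hc.mono fun z hz h0 => hz (by simp [h0])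
  have h1 : ∀ j k, ∃ C : ℝ, ∀ z, ‖dbar j (del k (fun z => (v z : ℂ))) z‖ ≤ C := fun j k =>
    ((hc'.del k).dbar j).exists_bound_of_continuous ((hv.ofReal.del k).dbar j).continuous
  choose C hC using h1
  refine ⟨∑ j, ∑ k, C j k, fun z β => ?_⟩
  have h2 : |levi v z β| = ‖(levi v z β : ℂ)‖ := by simp
  have hβ : ∀ j, ‖β j‖ ≤ ‖β‖ := norm_le_pi_norm β
  rw [h2, levi_eq_sum hv, Finset.sum_mul]
  refine (norm_sum_le _ _).trans (Finset.sum_le_sum fun j _ => ?_)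
  rw [Finset.sum_mul]
  refine (norm_sum_le _ _).trans (Finset.sum_le_sum fun k _ => ?_)
  have hC0 : 0 ≤ C j k := (norm_nonneg _).trans (hC j k z)
  calc _ = ‖dbar j (del k (fun z => (v z : ℂ))) z‖ * ‖β k‖ * ‖β j‖ := by simp
    _ ≤ C j k * ‖β‖ * ‖β‖ := by gcongr <;> first | exact hC j k z | exact hβ _
    _ = C j k * ‖β‖ ^ 2 := by ring
    _ ≤ _ := by gcongr; exact norm_sq_le_nsq β

lemma levi_congr {u v : Cn n → ℝ} {z : Cn n} (h : u =ᶠ[𝓝 z] v) (β : Cn n) :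
    levi u z β = levi v z β := by
  have h1 : ∀ a : Cn n, dirD a (dirD a u) z = dirD a (dirD a v) z := by
    intro a
    have : dirD a u =ᶠ[𝓝 z] dirD a v := (h.fderiv (𝕜 := ℝ)).mono fun x hx => by simp only [dirD, hx]
    simp only [dirD]
    exact congrArg (fun L : Cn n →L[ℝ] ℝ => L a) this.fderiv_eq
  rw [levi, levi, h1, h1]

/-- A convex function, zero for `0 ≤ x ≤ c` and increasing beyond. -/
def wall (c x : ℝ) : ℝ := ∫ y in (0:ℝ)..x, bt c y

lemma hasDerivAt_wall (c x : ℝ) : HasDerivAt (wall c) (bt c x) x :=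
  intervalIntegral.integral_hasDerivAt_right ((contDiff_bt c).continuous.intervalIntegrable _ _)
    ((contDiff_bt c).continuous.stronglyMeasurableAtFilter _ _) (contDiff_bt c).continuous.continuousAt

lemma deriv_wall (c : ℝ) : deriv (wall c) = bt c := funext fun x => (hasDerivAt_wall c x).deriv

lemma contDiff_wall (c : ℝ) : ContDiff ℝ ∞ (wall c) := by
  rw [contDiff_infty_iff_deriv, deriv_wall]
  exact ⟨fun x => (hasDerivAt_wall c x).differentiableAt, contDiff_bt c⟩

lemma wall_nonneg (c : ℝ) {x : ℝ} (hx : 0 ≤ x) : 0 ≤ wall c x :=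
  intervalIntegral.integral_nonneg hx fun _ _ => bt_nonneg _ _

lemma wall_of_le {c x : ℝ} (hx : 0 ≤ x) (hxc : x ≤ c) : wall c x = 0 := by
  rw [wall, intervalIntegral.integral_congr (g := fun _ => 0)]
  · simp
  · intro y hy
    rw [Set.uIcc_of_le hx] at hy
    exact bt_of_le (hy.2.trans hxc)

lemma levi_wall_ge (c : ℝ) (z β : Cn n) :
    bt c (nsq z) * nsq β ≤ levi (fun z => wall c (nsq z)) z β := by
  rw [levi_comp (contDiff_wall c) contDiff_nsq, levi_nsq, deriv_wall]
  have := deriv_bt_nonneg c (nsq z)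
  have : 0 ≤ deriv (bt c) (nsq z) * ‖gradc nsq z β‖ ^ 2 := by positivity
  linarith

/-- A radial cutoff function, equal to `1` where `nsq z ≤ a` and to `0` where `nsq z ≥ b`. -/
def cut (a b : ℝ) (z : Cn n) : ℝ := Real.smoothTransition ((b - nsq z) / (b - a))

section cut
variable {a b : ℝ} {z : Cn n}

lemma contDiff_cut : ContDiff ℝ ∞ (cut (n := n) a b) :=
  (Real.smoothTransition.contDiff (n := ⊤)).comp
    ((contDiff_const.sub contDiff_nsq).div_const _)

lemma cut_nonneg (a b : ℝ) (z : Cn n) : 0 ≤ cut a b z := Real.smoothTransition.nonneg _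
lemma cut_le_one (a b : ℝ) (z : Cn n) : cut a b z ≤ 1 := Real.smoothTransition.le_one _

lemma cut_of_le (hab : a < b) (hz : nsq z ≤ a) : cut a b z = 1 :=
  Real.smoothTransition.one_of_one_le (by rw [le_div_iff₀ (by linarith)]; linarith)

lemma nsq_lt_of_cut_ne (hab : a < b) (hz : cut a b z ≠ 0) : nsq z < b := by
  by_contra h
  push Not at h
  exact hz (Real.smoothTransition.zero_of_nonpos
    (div_nonpos_of_nonpos_of_nonneg (by linarith) (by linarith)))

lemma hasCompactSupport_cut (hab : a < b) : HasCompactSupport (cut (n := n) a b) := by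
  refine HasCompactSupport.of_support_subset_isCompact
    (isCompact_closedBall (0 : Cn n) (|b| + 1)) fun z hz => ?_
  have h1 := nsq_lt_of_cut_ne hab hz
  have h2 := norm_sq_le_nsq z
  have h3 := le_abs_self b
  rw [mem_closedBall_zero_iff]
  nlinarith [norm_nonneg z, abs_nonneg b]

end cut

lemma mem_ball_of_nsq_lt {r : ℝ} (hr : 0 < r) {z : Cn n} (hz : nsq z < r ^ 2) :
    z ∈ Metric.ball (0 : Cn n) r := by
  rw [mem_ball_zero_iff]
  exact lt_of_pow_lt_pow_left₀ 2 hr.le ((norm_sq_le_nsq z).trans_lt hz)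

lemma contDiff_cut_mul {f : Cn n → ℂ} {a b r : ℝ} (hr : 0 < r) (hab : a < b) (hbr : b < r ^ 2)
    (hf : DifferentiableOn ℂ f (Metric.ball 0 r)) :
    ContDiff ℝ ∞ fun z => (cut a b z : ℂ) * f z := by
  rw [contDiff_iff_contDiffAt]
  intro z
  by_cases hz : nsq z < r ^ 2
  · exact contDiff_cut.ofReal.contDiffAt.mul
      (hf.contDiffAt_real Metric.isOpen_ball (mem_ball_of_nsq_lt hr hz))
  · have : (fun z => (cut a b z : ℂ) * f z) =ᶠ[𝓝 z] fun _ => 0 := by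
      have ho : {x : Cn n | b < nsq x} ∈ 𝓝 z :=
        (isOpen_lt continuous_const continuous_nsq).mem_nhds (by simp at hz ⊢; linarith)
      filter_upwards [ho] with x hx
      have : cut a b x = 0 := by
        by_contra h
        exact absurd (nsq_lt_of_cut_ne hab h) (not_lt.2 (le_of_lt hx))
      simp [this]
    exact contDiffAt_const.congr_of_eventuallyEq this

/-- Approximation of `f` by entire functions, for smooth weights on a ball. -/
lemma exists_entire_approx {r r₀ : ℝ} (hr : 0 < r) (hr₀ : n * r₀ ^ 2 ≤ r ^ 2 / 5) {f : Cn n → ℂ}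
    (hf : DifferentiableOn ℂ f (Metric.ball 0 r)) {p q : Cn n → ℝ} (hp : ContDiff ℝ ∞ p)
    (hq : ContDiff ℝ ∞ q) (hlp : ∀ z ∈ Metric.ball (0 : Cn n) r, ∀ β, 0 ≤ levi p z β)
    (hlq : ∀ z ∈ Metric.ball (0 : Cn n) r, ∀ β, 0 ≤ levi q z β)
    (hp0 : ∀ z ∈ Metric.ball (0 : Cn n) r, p z ≤ 0) (t : ℝ) {δ C : ℝ} (hδ : 0 < δ)
    (hC : ∀ t x, deriv (bt t) x ≤ C) :
    ∃ F : Cn n → ℂ, Differentiable ℂ F ∧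
      ∫⁻ z in Metric.ball 0 r₀, ENNReal.ofReal
        (‖(bt t (-p z) : ℂ) * f z - F z‖ ^ 2 * gain t (-p z) * Real.exp (-q z)) ≤
      ENNReal.ofReal (C * Real.exp (t + 1)) * (∫⁻ z in {z | p z < -t} ∩ Metric.ball 0 r,
        ENNReal.ofReal (‖f z‖ ^ 2 * Real.exp (-q z))) + ENNReal.ofReal δ := by
  have hr2 : 0 < r ^ 2 := by positivity
  have h12 : 2 * r ^ 2 / 5 < 3 * r ^ 2 / 5 := by linarith
  have h23 : 3 * r ^ 2 / 5 < 4 * r ^ 2 / 5 := by linarith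
  set θ : Cn n → ℝ := cut (2 * r ^ 2 / 5) (3 * r ^ 2 / 5) with hθ
  set η : Cn n → ℝ := cut (3 * r ^ 2 / 5) (4 * r ^ 2 / 5) with hη
  have hη1 : ∀ z, nsq z < 3 * r ^ 2 / 5 → η z = 1 := fun z hz => cut_of_le h23 hz.le
  have hηr : ∀ z, η z ≠ 0 → z ∈ Metric.ball (0 : Cn n) r := fun z hz =>
    mem_ball_of_nsq_lt hr ((nsq_lt_of_cut_ne h23 hz).trans (by linarith))
  have hev : ∀ z, nsq z < 3 * r ^ 2 / 5 → ∀ᶠ x in 𝓝 z, η x = 1 := fun z hz => by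
    filter_upwards [(isOpen_lt continuous_nsq continuous_const).mem_nhds hz] with x hx
    exact hη1 x hx
  set s : Cn n → ℝ := fun z => (-1) * (η z * p z) with hs
  set Q : Cn n → ℝ := fun z => η z * q z with hQ
  set g : Cn n → ℝ := fun z => wall (r ^ 2 / 5) (nsq z) with hg
  have hηp : ContDiff ℝ ∞ fun z => η z * p z := contDiff_cut.mul hp
  have hsC : ContDiff ℝ ∞ s := contDiff_const.mul hηp
  have hQC : ContDiff ℝ ∞ Q := contDiff_cut.mul hq
  have hgC : ContDiff ℝ ∞ g := (contDiff_wall _).comp contDiff_nsq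
  have hηc : HasCompactSupport η := hasCompactSupport_cut h23
  have hθc : HasCompactSupport θ := hasCompactSupport_cut h12
  have hθC : ContDiff ℝ ∞ θ := contDiff_cut
  obtain ⟨Cs, hCs⟩ := exists_abs_levi_le hsC (hηc.mono fun z hz h0 => hz (by simp [hs, h0]))
  obtain ⟨CQ, hCQ⟩ := exists_abs_levi_le hQC (hηc.mono fun z hz h0 => hz (by simp [hQ, h0]))
  have hg0 : ∀ z, 0 ≤ g z := fun z => wall_nonneg _ (nsq_nonneg z)
  set h : Cn n → ℂ := fun z => (η z : ℂ) * f z with hh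
  have hhC : ContDiff ℝ ∞ h := contDiff_cut_mul hr h23 (by linarith) hf
  set N : Cn n → ℝ := fun z => ∑ j, ‖dbar j (fun z => (θ z : ℂ)) z‖ ^ 2 with hN
  have hN0 : ∀ z, 0 ≤ N z := fun z => Finset.sum_nonneg fun j _ => by positivity
  have hNC : Continuous N := continuous_finsetSum _ fun j _ =>
    (hθC.ofReal.dbar j).continuous.norm.pow 2
  have hθ0 : ∀ z, N z ≠ 0 → z ∈ tsupport θ := by
    intro z hz
    by_contra hzt
    refine hz (Finset.sum_eq_zero fun j _ => ?_)
    have h2 : (fun z => (θ z : ℂ)) =ᶠ[𝓝 z] fun _ => 0 :=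
      (notMem_tsupport_iff_eventuallyEq.1 hzt).mono fun x hx => by simp [hx]
    have h3 : ∀ a : Cn n, dirD a (fun z => (θ z : ℂ)) z = 0 := fun a => by
      simp only [dirD]
      rw [h2.fderiv_eq]; simp
    simp [dbar, h3]
  have hNc : HasCompactSupport N :=
    HasCompactSupport.of_support_subset_isCompact hθc.isCompact fun z hz => hθ0 z hz
  set D : ℝ := ∫ z, N z * ‖h z‖ ^ 2 * Real.exp (s z - Q z) with hD
  have hDi : ∀ a : ℝ, Integrable fun z => N z * ‖h z‖ ^ 2 * Real.exp (s z - (Q z + a * g z)) := by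
    intro a
    refine Continuous.integrable_of_hasCompactSupport ?_ ?_
    · exact (hNC.mul (hhC.continuous.norm.pow 2)).mul (Real.continuous_exp.comp
        (hsC.continuous.sub (hQC.continuous.add (continuous_const.mul hgC.continuous))))
    · exact hNc.mono fun z hz h0 => hz (by simp [h0])
  have hD0 : 0 ≤ D := integral_nonneg fun z => by have := hN0 z; positivity
  set K : ℝ := (D + 1) / δ with hK
  have hK0 : 0 < K := by positivity
  set κ : ℝ := bt (r ^ 2 / 5) (2 * r ^ 2 / 5) with hκ
  have hκ0 : 0 < κ := Real.smoothTransition.pos_of_pos (by linarith)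
  set A : ℝ := (|CQ| + 3 * |Cs| + K) / κ with hA
  have hA0 : 0 ≤ A := by positivity
  set B : Cn n → ℝ := fun z => Q z + A * g z with hB
  have hBC : ContDiff ℝ ∞ B := hQC.add (contDiff_const.mul hgC)
  have hs0 : ∀ z, 0 ≤ s z := by
    intro z
    by_cases hz : η z = 0
    · simp [hs, hz]
    · have h1 := hp0 z (hηr z hz)
      have h2 : 0 ≤ η z := cut_nonneg _ _ z
      simp only [hs]
      nlinarith
  have hlB : ∀ z β, levi B z β = levi Q z β + A * levi g z β := fun z β => by
    rw [hB, levi_add hQC (contDiff_const.mul hgC), levi_const_mul A hgC]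
  have hlev_out : ∀ z β l, 1 ≤ l → l ≤ 3 → 2 * r ^ 2 / 5 ≤ nsq z →
      K * nsq β ≤ levi B z β - l * levi s z β := by
    intro z β l hl1 hl3 hz
    have h1 := levi_wall_ge (r ^ 2 / 5) z β
    have h2 : κ ≤ bt (r ^ 2 / 5) (nsq z) := by
      refine (monotone_of_deriv_nonneg ((contDiff_bt _).differentiable (by simp))
        (fun x => deriv_bt_nonneg _ x)) hz
    have hβ := nsq_nonneg β
    have h3 : A * (κ * nsq β) ≤ A * levi g z β := by
      refine mul_le_mul_of_nonneg_left (le_trans ?_ h1) hA0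
      gcongr
    have h4 : A * (κ * nsq β) = (|CQ| + 3 * |Cs| + K) * nsq β := by
      rw [hA]; field_simp
    have h5 := (abs_le.1 (hCQ z β)).1
    have h6 := (abs_le.1 (hCs z β)).2
    have h7 : CQ * nsq β ≤ |CQ| * nsq β := by gcongr; exact le_abs_self _
    have h8 : Cs * nsq β ≤ |Cs| * nsq β := by gcongr; exact le_abs_self _
    have h9 : l * levi s z β ≤ 3 * (|Cs| * nsq β) := by
      have : 0 ≤ |Cs| * nsq β := by positivity
      calc l * levi s z β ≤ l * (|Cs| * nsq β) := by gcongr; linarith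
        _ ≤ _ := by gcongr
    rw [hlB]
    linarith
  have hlev : ∀ z β l, 1 ≤ l → l ≤ 3 → 0 ≤ levi B z β - l * levi s z β := by
    intro z β l hl1 hl3
    rcases le_or_gt (2 * r ^ 2 / 5) (nsq z) with hz | hz
    · exact (mul_nonneg hK0.le (nsq_nonneg β)).trans (hlev_out z β l hl1 hl3 hz)
    · have hz' : nsq z < 3 * r ^ 2 / 5 := by linarith
      have hzr : z ∈ Metric.ball (0 : Cn n) r := mem_ball_of_nsq_lt hr (by linarith)
      have h1 : levi Q z β = levi q z β :=
        levi_congr ((hev z hz').mono fun x hx => by simp [hQ, hx]) β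
      have h2 : levi s z β = (-1) * levi p z β := by
        rw [← levi_const_mul (-1) hp]
        exact levi_congr ((hev z hz').mono fun x hx => by simp [hs, hx]) β
      have h3 : 0 ≤ levi g z β :=
        (mul_nonneg (bt_nonneg _ _) (nsq_nonneg _)).trans (levi_wall_ge (r ^ 2 / 5) z β)
      have h4 := hlp z hzr β
      have h5 := hlq z hzr β
      rw [hlB, h1, h2]
      nlinarith [mul_nonneg hA0 h3, mul_nonneg (zero_le_one.trans hl1) h4]
  have hlevK : ∀ z β l, 1 ≤ l → l ≤ 3 → (∃ j, dbar j (fun z => (θ z : ℂ)) z ≠ 0) →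
      K * ∑ j, ‖β j‖ ^ 2 ≤ levi B z β - l * levi s z β := by
    intro z β l hl1 hl3 ⟨j, hj⟩
    refine hlev_out z β l hl1 hl3 ?_
    by_contra! hlt
    have h1 : (fun z => (θ z : ℂ)) =ᶠ[𝓝 z] fun _ => 1 := by
      filter_upwards [(isOpen_lt continuous_nsq continuous_const).mem_nhds hlt] with x hx
      simp [hθ, cut_of_le h12 (le_of_lt hx)]
    have h3 : ∀ a : Cn n, dirD a (fun z => (θ z : ℂ)) z = 0 := fun a => by
      simp only [dirD]
      rw [h1.fderiv_eq]; simp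
    exact hj (by simp [dbar, h3])
  have hhθ : ∀ z j, (θ z : ℂ) * dbar j h z = 0 := by
    intro z j
    by_cases hz : θ z = 0
    · simp [hz]
    · have hz' := nsq_lt_of_cut_ne h12 hz
      have h1 : h =ᶠ[𝓝 z] f := (hev z hz').mono fun x hx => by simp [hh, hx]
      have h2 : DifferentiableAt ℂ f z := hf.differentiableAt
        (Metric.isOpen_ball.mem_nhds (mem_ball_of_nsq_lt hr (by linarith)))
      rw [dbar_eq_zero_of_differentiableAt (h1.differentiableAt_iff.2 h2), mul_zero]
  obtain ⟨F, hF, hFi, hle⟩ := twisted_estimate (t := t) hBC hsC hθC hhC hθc hs0 hhθ hK0 hlev hlevK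
  refine ⟨F, hF, ?_⟩
  have hloc : ∀ z, nsq z < 3 * r ^ 2 / 5 → s z = -p z ∧ Q z = q z ∧ h z = f z := fun z hz => by
    simp [hs, hQ, hh, hη1 z hz]
  set L : Cn n → ℝ := fun z =>
    ‖((θ z * bt t (s z) : ℝ) : ℂ) * h z - F z‖ ^ 2 * gain t (s z) * Real.exp (-B z) with hL
  have hL0 : ∀ z, 0 ≤ L z := fun z => by
    have := (gain_pos t (hs0 z)).le
    positivity
  have hleft : ∫⁻ z in Metric.ball 0 r₀, ENNReal.ofReal
        (‖(bt t (-p z) : ℂ) * f z - F z‖ ^ 2 * gain t (-p z) * Real.exp (-q z)) ≤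
      ENNReal.ofReal (∫ z, L z) := by
    rw [ofReal_integral_eq_lintegral_ofReal hFi (Eventually.of_forall hL0)]
    refine le_trans (le_of_eq ?_) (setLIntegral_le_lintegral (Metric.ball 0 r₀) _)
    refine setLIntegral_congr_fun measurableSet_ball fun z hz => ?_
    have hz1 : nsq z ≤ r ^ 2 / 5 := by
      refine (nsq_le_norm_sq z).trans (le_trans ?_ hr₀)
      rw [mem_ball_zero_iff] at hz
      gcongr
    obtain ⟨e1, e2, e3⟩ := hloc z (by linarith)
    have e4 : θ z = 1 := cut_of_le h12 (by linarith)
    have e5 : g z = 0 := wall_of_le (nsq_nonneg z) hz1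
    simp only [hL, hB, e1, e2, e3, e4, e5, one_mul, mul_zero, add_zero]
  have hR1 : ∫ z, N z * ‖h z‖ ^ 2 * Real.exp (s z - B z) ≤ D := by
    refine integral_mono (hDi A) (by simpa using hDi 0) fun z => ?_
    have := hN0 z
    have h1 : s z - B z ≤ s z - Q z := by
      have := mul_nonneg hA0 (hg0 z)
      simp only [hB]; linarith
    have := Real.exp_le_exp.2 h1
    dsimp only
    gcongr
  have hR1' : 1 / K * ∫ z, N z * ‖h z‖ ^ 2 * Real.exp (s z - B z) ≤ δ := by
    refine (mul_le_mul_of_nonneg_left hR1 (by positivity)).trans ?_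
    rw [hK]
    field_simp
    linarith
  set T : Cn n → ℝ := fun z => θ z ^ 2 * deriv (bt t) (s z) * ‖h z‖ ^ 2 * Real.exp (s z - B z)
    with hT
  have hT0 : ∀ z, 0 ≤ T z := fun z => by
    have := deriv_bt_nonneg t (s z)
    positivity
  have hTi : Integrable T := by
    refine Continuous.integrable_of_hasCompactSupport ?_ ?_
    · refine ((((hθC.continuous.pow 2).mul ?_).mul (hhC.continuous.norm.pow 2)).mul
        (Real.continuous_exp.comp (hsC.continuous.sub hBC.continuous)))
      exact ((contDiff_bt t).continuous_deriv (by simp)).comp hsC.continuous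
    · exact hθc.mono fun z hz h0 => hz (by simp [hT, h0])
  have hmeas : MeasurableSet ({z | p z < -t} ∩ Metric.ball (0 : Cn n) r) :=
    ((isOpen_lt hp.continuous continuous_const).inter Metric.isOpen_ball).measurableSet
  have hright : ENNReal.ofReal (∫ z, T z) ≤ ENNReal.ofReal (C * Real.exp (t + 1)) *
      (∫⁻ z in {z | p z < -t} ∩ Metric.ball 0 r, ENNReal.ofReal (‖f z‖ ^ 2 * Real.exp (-q z))) := by
    rw [ofReal_integral_eq_lintegral_ofReal hTi (Eventually.of_forall hT0),
      ← lintegral_indicator hmeas, ← lintegral_const_mul' _ _ ENNReal.ofReal_ne_top]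
    refine lintegral_mono fun z => ?_
    by_cases hz : T z = 0
    · simp [hz]
    have hθz : θ z ≠ 0 := fun h0 => hz (by simp [hT, h0])
    have hdz : deriv (bt t) (s z) ≠ 0 := fun h0 => hz (by simp [hT, h0])
    have hz1 := nsq_lt_of_cut_ne h12 hθz
    obtain ⟨e1, e2, e3⟩ := hloc z hz1
    have hst : t < s z := by
      by_contra! hle
      exact hdz (deriv_bt_of_le hle)
    have hst' : s z < t + 1 := by
      by_contra! hle
      exact hdz (deriv_bt_of_ge hle)
    have hzm : z ∈ {z | p z < -t} ∩ Metric.ball (0 : Cn n) r :=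
      ⟨by simp only [Set.mem_ofPred_eq]; linarith, mem_ball_of_nsq_lt hr (by linarith)⟩
    have hd0 := deriv_bt_nonneg t (s z)
    have hC0 : 0 ≤ C := hd0.trans (hC _ _)
    rw [Set.indicator_of_mem hzm, ← ENNReal.ofReal_mul (by positivity)]
    apply ENNReal.ofReal_le_ofReal
    have h1 : s z - B z ≤ (t + 1) + -q z := by
      have := mul_nonneg hA0 (hg0 z)
      simp only [hB, e2]; linarith
    have h2 := Real.exp_le_exp.2 h1
    rw [Real.exp_add] at h2
    have h3 : θ z ^ 2 ≤ 1 := pow_le_one₀ (cut_nonneg _ _ z) (cut_le_one _ _ z)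
    calc T z ≤ 1 * C * ‖h z‖ ^ 2 * (Real.exp (t + 1) * Real.exp (-q z)) := by
          simp only [hT]
          gcongr
          exact hC _ _
      _ = _ := by rw [e3]; ring
  refine hleft.trans ((ENNReal.ofReal_le_ofReal hle).trans ?_)
  refine ENNReal.ofReal_add_le.trans (add_le_add hright (ENNReal.ofReal_le_ofReal hR1'))

lemma wexp_eq_rpow (c : ℝ) (φ : Cn n → EReal) (z : Cn n) :
    wexp c φ z = EReal.exp (φ z) ^ c := by
  have h : ∀ x : EReal, expE x = EReal.exp x := by
    intro x
    induction x <;> simp [expE]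
  rw [wexp, h, mul_comm, EReal.exp_mul]

lemma wexp_eq_ofReal {φ : Cn n → EReal} {z : Cn n} {c x : ℝ} (h : φ z = x) :
    wexp c φ z = ENNReal.ofReal (Real.exp (c * x)) := by
  rw [wexp_eq_rpow, h, EReal.exp_coe, ENNReal.ofReal_rpow_of_pos (Real.exp_pos x), ← Real.exp_mul,
    mul_comm]

lemma wexp_anti {φ ψ : Cn n → EReal} {z : Cn n} (h : φ z ≤ ψ z) :
    wexp (-2) ψ z ≤ wexp (-2) φ z := by
  rw [wexp_eq_rpow, wexp_eq_rpow]
  rw [ENNReal.rpow_neg, ENNReal.rpow_neg]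
  exact ENNReal.inv_le_inv.2 (ENNReal.rpow_le_rpow (EReal.exp_monotone h) (by norm_num))

lemma wexp_add {φ ψ : Cn n → EReal} {z : Cn n} (h₁ : φ z < ⊤) (h₂ : ψ z < ⊤) :
    wexp (-2) (fun w => φ w + ψ w) z = wexp (-2) φ z * wexp (-2) ψ z := by
  simp only [wexp_eq_rpow, EReal.exp_add]
  exact ENNReal.mul_rpow_of_ne_top (EReal.exp_lt_top_iff.2 h₁).ne (EReal.exp_lt_top_iff.2 h₂).ne _

lemma wexp_ne_zero {φ : Cn n → EReal} {z : Cn n} (h : φ z < ⊤) : wexp (-2) φ z ≠ 0 := by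
  rw [wexp_eq_rpow]
  have := (EReal.exp_lt_top_iff.2 h).ne
  simp [ENNReal.rpow_eq_zero_iff, this]

lemma tendsto_wexp {v : ℕ → Cn n → ℝ} {φ : Cn n → EReal} {z : Cn n} (h₁ : ∀ k, φ z ≤ v k z)
    (h₂ : ∀ a : ℝ, φ z < a → ∀ᶠ k in atTop, v k z < a) :
    Tendsto (fun k => ENNReal.ofReal (Real.exp (-2 * v k z))) atTop (𝓝 (wexp (-2) φ z)) := by
  have h3 : Tendsto (fun k => (v k z : EReal)) atTop (𝓝 (φ z)) := by
    rw [tendsto_order]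
    refine ⟨fun a ha => Eventually.of_forall fun k => ha.trans_le (h₁ k), fun a ha => ?_⟩
    obtain ⟨b, hb1, hb2⟩ := EReal.lt_iff_exists_real_btwn.1 ha
    filter_upwards [h₂ b hb1] with k hk
    exact (EReal.coe_lt_coe_iff.2 hk).trans hb2
  have h4 := (ENNReal.continuous_rpow_const (y := -2)).tendsto _ |>.comp
    ((ENNReal.continuous_exp.tendsto (φ z)).comp h3)
  rw [wexp_eq_rpow]
  refine h4.congr fun k => ?_
  simp only [Function.comp]
  rw [← wexp_eq_ofReal (φ := fun z => (v k z : EReal)) rfl, wexp_eq_rpow]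

lemma PSHOn.aemeasurable_wexp {u : Cn n → EReal} (hu : PSHOn u (polydisc n)) {r : ℝ} (hr : r < 1) :
    AEMeasurable (wexp (-2) u) (volume.restrict (Metric.ball 0 r)) := by
  obtain ⟨v, hv, hle, -, hlim, -⟩ := hu.exists_smooth_approx (r := r) (r' := (r + 1) / 2)
    (by linarith) (by linarith)
  refine aemeasurable_of_tendsto_metrizable_ae' (f := fun k z =>
    ENNReal.ofReal (Real.exp (-2 * v k z))) (fun k => ?_) ?_
  · exact (ENNReal.measurable_ofReal.comp (Real.continuous_exp.comp
      (continuous_const.mul (hv k).continuous)).measurable).aemeasurable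
  · refine (ae_restrict_iff' measurableSet_ball).2 (Eventually.of_forall fun z hz => ?_)
    exact tendsto_wexp (fun k => hle k z hz) (hlim z hz)

lemma PSHOn.exists_le {u : Cn n → EReal} (hu : PSHOn u (polydisc n)) {r : ℝ} (hr : r < 1) :
    ∃ M : ℝ, 0 ≤ M ∧ ∀ z ∈ Metric.ball (0 : Cn n) r, u z ≤ M := by
  rcases le_or_gt r 0 with h0 | h0
  · exact ⟨0, le_rfl, fun z hz => by simp [Metric.ball_eq_empty.2 h0] at hz⟩
  have hs : Metric.closedBall (0 : Cn n) r ⊆ polydisc n := by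
    rw [polydisc_eq_ball]; exact Metric.closedBall_subset_ball hr
  obtain ⟨x, hx, hmax⟩ := (hu.usc.mono hs).exists_isMaxOn
    ⟨0, by simpa using h0.le⟩ (isCompact_closedBall _ _)
  have hxt := hu.lt_top x (hs hx)
  refine ⟨max (u x).toReal 0, le_max_right _ _, fun z hz => ?_⟩
  refine (hmax (Metric.ball_subset_closedBall hz)).trans ?_
  refine (EReal.le_coe_toReal hxt.ne).trans ?_
  exact_mod_cast le_max_left _ _

lemma PSHOn.measurableSet_lt {u : Cn n → EReal} (hu : PSHOn u (polydisc n)) {r : ℝ} (hr : r < 1)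
    (a : EReal) : MeasurableSet ({z | u z < a} ∩ Metric.ball (0 : Cn n) r) := by
  refine IsOpen.measurableSet (isOpen_iff_mem_nhds.2 fun z hz => ?_)
  have hz' : z ∈ polydisc n := by
    rw [polydisc_eq_ball]; exact Metric.ball_subset_ball hr.le hz.2
  have h1 := hu.usc z hz' a hz.1
  rw [IsOpen.nhdsWithin_eq (by rw [polydisc_eq_ball]; exact Metric.isOpen_ball) hz'] at h1
  exact inter_mem h1 (Metric.isOpen_ball.mem_nhds hz.2)

lemma enorm_sq_le (a b : ℂ) : ‖a‖ₑ ^ 2 ≤ 2 * ‖a - b‖ₑ ^ 2 + 2 * ‖b‖ₑ ^ 2 := by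
  have h : ‖a‖ ^ 2 ≤ 2 * ‖a - b‖ ^ 2 + 2 * ‖b‖ ^ 2 := by
    have h1 : ‖a‖ ≤ ‖a - b‖ + ‖b‖ := by simpa using norm_add_le (a - b) b
    nlinarith [norm_nonneg a, sq_nonneg (‖a - b‖ - ‖b‖)]
  have h2 : ∀ c : ℂ, ‖c‖ₑ ^ 2 = ENNReal.ofReal (‖c‖ ^ 2) := fun c => by
    rw [← ofReal_norm, ENNReal.ofReal_pow (norm_nonneg _)]
  have h3 : (2 : ℝ≥0∞) = ENNReal.ofReal 2 := by simp
  rw [h2, h2, h2, h3, ← ENNReal.ofReal_mul (by norm_num), ← ENNReal.ofReal_mul (by norm_num),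
    ← ENNReal.ofReal_add (by positivity) (by positivity)]
  exact ENNReal.ofReal_le_ofReal h

lemma enorm_sq_eq_ofReal (c : ℂ) : ‖c‖ₑ ^ 2 = ENNReal.ofReal (‖c‖ ^ 2) := by
  rw [← ofReal_norm, ENNReal.ofReal_pow (norm_nonneg _)]

/-- Uniform estimates for entire approximations of `f`, for smooth majorants of the weights. -/
lemma exists_entire_estimates {φ φ₀ : Cn n → EReal} (hφ : PSHOn φ (polydisc n))
    (hφ₀ : PSHOn φ₀ (polydisc n)) {r r₀ M : ℝ} (hr : 0 < r) (hr1 : r < 1) (hr₀r : r₀ ≤ r)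
    (hr₀ : n * r₀ ^ 2 ≤ r ^ 2 / 5) {f : Cn n → ℂ} (hf : DifferentiableOn ℂ f (Metric.ball 0 r))
    {v w : Cn n → ℝ} (hv : ContDiff ℝ ∞ v) (hw : ContDiff ℝ ∞ w)
    (hlv : ∀ z ∈ Metric.ball (0 : Cn n) r, ∀ β, 0 ≤ levi v z β)
    (hlw : ∀ z ∈ Metric.ball (0 : Cn n) r, ∀ β, 0 ≤ levi w z β)
    (hvM : ∀ z ∈ Metric.ball (0 : Cn n) r, v z ≤ M)
    (hwM : ∀ z ∈ Metric.ball (0 : Cn n) r, w z ≤ M)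
    (hφv : ∀ z ∈ Metric.ball (0 : Cn n) r, φ z ≤ v z)
    (hφw : ∀ z ∈ Metric.ball (0 : Cn n) r, φ₀ z ≤ w z) (hM : 0 ≤ M) {t C c δ : ℝ}
    (hδ : 0 < δ) (hC : ∀ t x, deriv (bt t) x ≤ C) (hc : 0 < c)
    (hcg : ∀ x, 0 ≤ x → c * Real.exp x ≤ gain (2 * (t + M)) x) :
    ∃ F : Cn n → ℂ, Differentiable ℂ F ∧
      ∫⁻ z in Metric.ball 0 r₀, ‖F z‖ₑ ^ 2 ≤ ENNReal.ofReal (12 * Real.exp (2 * M)) *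
        (ENNReal.ofReal (C * Real.exp (2 * (t + M) + 1)) *
          (∫⁻ z in {z | φ z < (-t : ℝ)} ∩ Metric.ball 0 r, ‖f z‖ₑ ^ 2 * wexp (-2) φ₀ z) +
          ENNReal.ofReal δ) + ENNReal.ofReal (2 * Real.exp (2 * M)) *
          ∫⁻ z in {z | φ z < (-t : ℝ)} ∩ Metric.ball 0 r, ‖f z‖ₑ ^ 2 * wexp (-2) φ₀ z ∧
      ∫⁻ z in Metric.ball 0 r₀, ‖f z - F z‖ₑ ^ 2 *
          (ENNReal.ofReal (Real.exp (-2 * v z)) * ENNReal.ofReal (Real.exp (-2 * w z))) ≤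
        ENNReal.ofReal (2 / c) * (ENNReal.ofReal (C * Real.exp (2 * (t + M) + 1)) *
          (∫⁻ z in {z | φ z < (-t : ℝ)} ∩ Metric.ball 0 r, ‖f z‖ₑ ^ 2 * wexp (-2) φ₀ z) +
          ENNReal.ofReal δ) + ENNReal.ofReal (2 * Real.exp (2 * (t + M) + 1)) *
          ∫⁻ z in Metric.ball 0 r, ‖f z‖ₑ ^ 2 * wexp (-2) φ₀ z := by
  set p : Cn n → ℝ := fun z => 2 * (v z - M) with hp
  set q : Cn n → ℝ := fun z => 2 * w z with hq
  set t' : ℝ := 2 * (t + M) with ht'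
  set B := Metric.ball (0 : Cn n) r with hB
  have hball : Metric.ball (0 : Cn n) r₀ ⊆ B := Metric.ball_subset_ball hr₀r
  set G : Cn n → ℝ≥0∞ := fun z => ‖f z‖ₑ ^ 2 * wexp (-2) φ₀ z with hG
  have hGm : AEMeasurable G (volume.restrict B) :=
    ((hf.continuousOn.aemeasurable measurableSet_ball).enorm.pow_const 2).mul
      (hφ₀.aemeasurable_wexp hr1)
  have hS := hφ.measurableSet_lt hr1 ((-t : ℝ) : EReal)
  set S := {z | φ z < (-t : ℝ)} ∩ B with hSdef
  have hpC : ContDiff ℝ ∞ p := contDiff_const.mul (hv.sub contDiff_const)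
  have hqC : ContDiff ℝ ∞ q := contDiff_const.mul hw
  obtain ⟨F, hF, hFle⟩ := exists_entire_approx hr hr₀ hf hpC hqC
    (fun z hz β => by
      have e : levi p z β = 2 * levi v z β := by
        rw [hp, levi_const_mul 2 (hv.sub contDiff_const)]
        have h1 := levi_sub hv (contDiff_const (c := M)) z β
        have h2 : levi (fun _ : Cn n => M) z β = 0 := by
          simp [levi, dirD_const]
        rw [h1, h2, sub_zero]
      rw [e]
      linarith [hlv z hz β])
    (fun z hz β => by
      rw [hq, levi_const_mul 2 hw]
      linarith [hlw z hz β])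
    (fun z hz => by have := hvM z hz; simp only [hp]; linarith) t' hδ hC
  have hGle : ∀ z ∈ B, ENNReal.ofReal (‖f z‖ ^ 2 * Real.exp (-q z)) ≤ G z := by
    intro z hz
    rw [ENNReal.ofReal_mul (by positivity), ← enorm_sq_eq_ofReal]
    simp only [hG]
    gcongr
    have h1 : -q z = -2 * w z := by simp only [hq]; ring
    rw [h1, ← wexp_eq_ofReal (φ := fun z => (w z : EReal)) rfl]
    exact wexp_anti (hφw z hz)
  have hpt : ∀ z ∈ B, p z < -t' → z ∈ S := by
    intro z hz h
    refine ⟨?_, hz⟩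
    have : v z < -t := by simp only [hp, ht'] at h; linarith
    exact (hφv z hz).trans_lt (EReal.coe_lt_coe_iff.2 this)
  set X : Cn n → ℝ≥0∞ := fun z => ENNReal.ofReal
    (‖(bt t' (-p z) : ℂ) * f z - F z‖ ^ 2 * gain t' (-p z) * Real.exp (-q z)) with hX
  have hXle : ∫⁻ z in Metric.ball 0 r₀, X z ≤
      ENNReal.ofReal (C * Real.exp (t' + 1)) * (∫⁻ z in S, G z) + ENNReal.ofReal δ := by
    refine hFle.trans ?_
    refine add_le_add (mul_le_mul_right ?_ _) le_rfl
    have hm : MeasurableSet ({z | p z < -t'} ∩ B) :=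
      ((isOpen_lt hpC.continuous continuous_const).inter Metric.isOpen_ball).measurableSet
    refine (setLIntegral_mono' hm fun z hz => hGle z hz.2).trans ?_
    exact lintegral_mono_set fun z hz => hpt z hz.2 hz.1
  have hs0 : ∀ z ∈ B, 0 ≤ -p z := fun z hz => by
    have := hvM z hz; simp only [hp]; linarith
  refine ⟨F, hF, ?_, ?_⟩
  · have hpw : ∀ z ∈ Metric.ball (0 : Cn n) r₀, ‖F z‖ₑ ^ 2 ≤
        ENNReal.ofReal (12 * Real.exp (2 * M)) * X z +
        S.indicator (fun z => ENNReal.ofReal (2 * Real.exp (2 * M)) * G z) z := by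
      intro z hz
      have hzB := hball hz
      have hg := gain_ge t' (hs0 z hzB)
      have hqM : 1 ≤ Real.exp (2 * M) * Real.exp (-q z) := by
        rw [← Real.exp_add]
        exact Real.one_le_exp (by have := hwM z hzB; simp only [hq]; linarith)
      refine (enorm_sq_le (F z) ((bt t' (-p z) : ℂ) * f z)).trans (add_le_add ?_ ?_)
      · rw [enorm_sq_eq_ofReal, hX, ← ENNReal.ofReal_mul (by positivity),
          show (2 : ℝ≥0∞) = ENNReal.ofReal 2 by simp, ← ENNReal.ofReal_mul (by norm_num)]
        apply ENNReal.ofReal_le_ofReal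
        rw [norm_sub_rev]
        set N := ‖(bt t' (-p z) : ℂ) * f z - F z‖ ^ 2
        have hN : 0 ≤ N := by positivity
        calc 2 * N = 12 * N * (1 / 6) * 1 := by ring
          _ ≤ 12 * N * gain t' (-p z) * (Real.exp (2 * M) * Real.exp (-q z)) := by gcongr
          _ = _ := by ring
      · by_cases hb : -p z ≤ t'
        · simp [bt_of_le hb]
        · push Not at hb
          have hzS := hpt z hzB (by linarith)
          rw [Set.indicator_of_mem hzS]
          refine le_trans ?_ (mul_le_mul_right (hGle z hzB) _)
          rw [enorm_sq_eq_ofReal, ← ENNReal.ofReal_mul (by positivity),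
            show (2 : ℝ≥0∞) = ENNReal.ofReal 2 by simp, ← ENNReal.ofReal_mul (by norm_num)]
          apply ENNReal.ofReal_le_ofReal
          rw [norm_mul, mul_pow, Complex.norm_real, Real.norm_of_nonneg (bt_nonneg _ _)]
          have h1 : bt t' (-p z) ^ 2 ≤ 1 := pow_le_one₀ (bt_nonneg _ _) (bt_le_one _ _)
          calc 2 * (bt t' (-p z) ^ 2 * ‖f z‖ ^ 2) ≤ 2 * (1 * ‖f z‖ ^ 2) * 1 := by
                rw [mul_one]; gcongr
            _ ≤ 2 * (1 * ‖f z‖ ^ 2) * (Real.exp (2 * M) * Real.exp (-q z)) := by gcongr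
            _ = _ := by ring
    refine (setLIntegral_mono' measurableSet_ball hpw).trans ?_
    rw [lintegral_add_right' _ (((hGm.mono_measure (Measure.restrict_mono_set _ hball)).const_mul
      _).indicator hS), lintegral_const_mul' _ _ ENNReal.ofReal_ne_top]
    refine add_le_add (by gcongr) ?_
    rw [lintegral_indicator hS, Measure.restrict_restrict hS,
      lintegral_const_mul' _ _ ENNReal.ofReal_ne_top]
    gcongr
    exact Set.inter_subset_left
  · have hpw : ∀ z ∈ Metric.ball (0 : Cn n) r₀, ‖f z - F z‖ₑ ^ 2 *
          (ENNReal.ofReal (Real.exp (-2 * v z)) * ENNReal.ofReal (Real.exp (-2 * w z))) ≤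
        ENNReal.ofReal (2 / c) * X z + ENNReal.ofReal (2 * Real.exp (t' + 1)) * G z := by
      intro z hz
      have hzB := hball hz
      have hg := hcg _ (hs0 z hzB)
      have hvs : Real.exp (-2 * v z) ≤ Real.exp (-p z) :=
        Real.exp_le_exp.2 (by simp only [hp]; linarith)
      have hqw : -2 * w z = -q z := by simp only [hq]; ring
      have hsplit := enorm_sq_le (f z - F z) ((1 - bt t' (-p z) : ℝ) * f z)
      have e1 : f z - F z - ((1 - bt t' (-p z) : ℝ) : ℂ) * f z =
          (bt t' (-p z) : ℂ) * f z - F z := by push_cast; ring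
      rw [e1] at hsplit
      refine (mul_le_mul_left hsplit _).trans ?_
      rw [add_mul, hqw, ← ENNReal.ofReal_mul (by positivity)]
      refine add_le_add ?_ ?_
      · rw [enorm_sq_eq_ofReal, hX, ← ENNReal.ofReal_mul (by positivity),
          show (2 : ℝ≥0∞) = ENNReal.ofReal 2 by simp, ← ENNReal.ofReal_mul (by norm_num),
          ← ENNReal.ofReal_mul (by positivity)]
        apply ENNReal.ofReal_le_ofReal
        set N := ‖(bt t' (-p z) : ℂ) * f z - F z‖ ^ 2
        have hN : 0 ≤ N := by positivity
        calc 2 * N * (Real.exp (-2 * v z) * Real.exp (-q z))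
            ≤ 2 * N * (Real.exp (-p z) * Real.exp (-q z)) := by gcongr
          _ = 2 / c * (N * (c * Real.exp (-p z)) * Real.exp (-q z)) := by field_simp
          _ ≤ _ := by gcongr
      · refine le_trans ?_ (mul_le_mul_right (hGle z hzB) _)
        rw [enorm_sq_eq_ofReal, ← ENNReal.ofReal_mul (by positivity),
          show (2 : ℝ≥0∞) = ENNReal.ofReal 2 by simp, ← ENNReal.ofReal_mul (by norm_num),
          ← ENNReal.ofReal_mul (by positivity)]
        apply ENNReal.ofReal_le_ofReal
        rw [norm_mul, mul_pow, Complex.norm_real,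
          Real.norm_of_nonneg (sub_nonneg.2 (bt_le_one _ _))]
        by_cases hb : t' + 1 ≤ -p z
        · rw [bt_of_ge hb]
          simp only [sub_self, ne_eq, OfNat.ofNat_ne_zero, not_false_eq_true, zero_pow, zero_mul,
            mul_zero]
          positivity
        · push Not at hb
          have h1 : (1 - bt t' (-p z)) ^ 2 ≤ 1 :=
            pow_le_one₀ (sub_nonneg.2 (bt_le_one _ _)) (by linarith [bt_nonneg t' (-p z)])
          have h2 := hvs.trans (Real.exp_le_exp.2 hb.le)
          calc 2 * ((1 - bt t' (-p z)) ^ 2 * ‖f z‖ ^ 2) *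
                (Real.exp (-2 * v z) * Real.exp (-q z))
              ≤ 2 * (1 * ‖f z‖ ^ 2) * (Real.exp (t' + 1) * Real.exp (-q z)) := by gcongr
            _ = _ := by ring
    refine (setLIntegral_mono' measurableSet_ball hpw).trans ?_
    rw [lintegral_add_right' _ ((hGm.mono_measure (Measure.restrict_mono_set _ hball)).const_mul
      _), lintegral_const_mul' _ _ ENNReal.ofReal_ne_top,
      lintegral_const_mul' _ _ ENNReal.ofReal_ne_top]
    refine add_le_add (by gcongr) ?_
    gcongr

/-- Holomorphic approximation of `f` modulo functions which are square integrable against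
`e^{-2(φ+φ₀)}`, with a uniform bound by the mass of the sublevel set `{φ < -t}`. -/
lemma exists_holomorphic_approx {φ φ₀ : Cn n → EReal} (hφ : PSHOn φ (polydisc n))
    (hφ₀ : PSHOn φ₀ (polydisc n)) {r r₀ : ℝ} (hr : 0 < r) (hr1 : r < 1) (hr₀p : 0 < r₀)
    (hr₀r : r₀ ≤ r) (hr₀ : n * r₀ ^ 2 ≤ r ^ 2 / 5) {f : Cn n → ℂ}
    (hf : DifferentiableOn ℂ f (Metric.ball 0 r))
    (hJ : ∫⁻ z in Metric.ball 0 r, ‖f z‖ₑ ^ 2 * wexp (-2) φ₀ z < ⊤) :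
    ∃ K : ℝ≥0∞, K ≠ ⊤ ∧ ∀ t : ℝ, 0 ≤ t → ∃ F : Cn n → ℂ,
      DifferentiableOn ℂ F (Metric.ball 0 (r₀ / 4)) ∧
      (∀ z ∈ Metric.ball (0 : Cn n) (r₀ / 4), ‖F z‖ₑ ^ 2 ≤ K * (ENNReal.ofReal (Real.exp (2 * t)) *
        ∫⁻ z in {z | φ z < (-t : ℝ)} ∩ Metric.ball 0 r, ‖f z‖ₑ ^ 2 * wexp (-2) φ₀ z)) ∧
      ∫⁻ z in Metric.ball 0 (r₀ / 4), ‖f z - F z‖ₑ ^ 2 * wexp (-2) (fun w => φ w + φ₀ w) z < ⊤ := by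
  obtain ⟨r', hrr', hr'1⟩ := exists_between hr1
  obtain ⟨M₁, hM₁, hφM₁⟩ := hφ.exists_le hr'1
  obtain ⟨M₂, hM₂, hφM₂⟩ := hφ₀.exists_le hr'1
  set M := max M₁ M₂ with hMdef
  have hM : 0 ≤ M := hM₁.trans (le_max_left _ _)
  obtain ⟨v, hv, hφv, hlv, hvlim, hvM⟩ := hφ.exists_smooth_approx hrr' hr'1
  obtain ⟨w, hw, hφw, hlw, hwlim, hwM⟩ := hφ₀.exists_smooth_approx hrr' hr'1
  replace hvM := hvM M hM fun z hz =>
    (hφM₁ z hz).trans (EReal.coe_le_coe_iff.2 (le_max_left _ _))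
  replace hwM := hwM M hM fun z hz =>
    (hφM₂ z hz).trans (EReal.coe_le_coe_iff.2 (le_max_right _ _))
  obtain ⟨C, hC0, hC⟩ := exists_deriv_bt_le
  obtain ⟨C₁, hC₁, hsq⟩ := exists_sq_le_lintegral (n := n) (ε := r₀ / 4) (by positivity)
  set D := ENNReal.ofReal (12 * Real.exp (2 * M)) with hD
  set K₁ : ℝ≥0∞ := D * ENNReal.ofReal (C * Real.exp (2 * M + 1)) +
    ENNReal.ofReal (2 * Real.exp (2 * M)) with hK₁
  have hK₁t : K₁ ≠ ⊤ := by
    rw [hK₁, hD, ← ENNReal.ofReal_mul (by positivity)]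
    exact ENNReal.add_ne_top.2 ⟨ENNReal.ofReal_ne_top, ENNReal.ofReal_ne_top⟩
  refine ⟨C₁ * K₁, ENNReal.mul_ne_top hC₁ hK₁t, fun t ht => ?_⟩
  obtain ⟨c, hc, hcg⟩ := exists_le_gain (t := 2 * (t + M)) (by positivity)
  set I := ∫⁻ z in {z | φ z < (-t : ℝ)} ∩ Metric.ball 0 r, ‖f z‖ₑ ^ 2 * wexp (-2) φ₀ z with hI
  set J := ∫⁻ z in Metric.ball 0 r, ‖f z‖ₑ ^ 2 * wexp (-2) φ₀ z with hJdef
  have hIt : I ≠ ⊤ := ((lintegral_mono_set Set.inter_subset_right).trans_lt hJ).ne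
  set δ : ℕ → ℝ := fun k => 1 / ((k : ℝ) + 1) with hδdef
  have hδ : ∀ k, 0 < δ k := fun k => by simp only [hδdef]; positivity
  have hδ1 : ∀ k, ENNReal.ofReal (δ k) ≤ 1 := fun k => by
    rw [ENNReal.ofReal_le_one]
    simp only [hδdef]
    rw [div_le_one (by positivity)]
    linarith [(Nat.cast_nonneg k : (0 : ℝ) ≤ k)]
  have hδlim : Tendsto (fun k => ENNReal.ofReal (δ k)) atTop (𝓝 0) := by
    simpa [hδdef] using ENNReal.tendsto_ofReal (tendsto_one_div_add_atTop_nhds_zero_nat (𝕜 := ℝ))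
  have hest := fun k => exists_entire_estimates hφ hφ₀ hr hr1 hr₀r hr₀ hf (hv k) (hw k) (hlv k)
    (hlw k) (hvM k) (hwM k) (hφv k) (hφw k) hM (hδ k) hC hc hcg
  choose F hF hF₁ hF₂ using hest
  set E := ENNReal.ofReal (Real.exp (2 * t)) * I with hE
  have hEt : E ≠ ⊤ := ENNReal.mul_ne_top ENNReal.ofReal_ne_top hIt
  have hIE : I ≤ E := by
    rw [hE]
    refine le_mul_of_one_le_left zero_le ?_
    rw [ENNReal.one_le_ofReal]
    exact Real.one_le_exp (by positivity)
  have hF₁' : ∀ k, ∫⁻ z in Metric.ball 0 r₀, ‖F k z‖ₑ ^ 2 ≤ K₁ * E + D * ENNReal.ofReal (δ k) := by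
    intro k
    refine (hF₁ k).trans ?_
    have e : ENNReal.ofReal (C * Real.exp (2 * (t + M) + 1)) * I =
        ENNReal.ofReal (C * Real.exp (2 * M + 1)) * E := by
      rw [hE, ← mul_assoc, ← ENNReal.ofReal_mul (by positivity), mul_assoc C, ← Real.exp_add]
      congr 4
      ring
    rw [e, mul_add, ← mul_assoc, hK₁, add_mul, add_right_comm]
    exact add_le_add (add_le_add le_rfl (mul_le_mul_right hIE _)) le_rfl
  have hsup : ∀ k, ∀ z ∈ Metric.ball (0 : Cn n) (2 * (r₀ / 4)),
      ‖F k z‖ₑ ^ 2 ≤ C₁ * (K₁ * E + D * ENNReal.ofReal (δ k)) := by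
    intro k z hz
    refine (hsq (F k) Set.univ isOpen_univ (hF k).differentiableOn z (Set.subset_univ _)).trans ?_
    refine mul_le_mul_right ((lintegral_mono_set ?_).trans (hF₁' k)) _
    refine Metric.ball_subset_ball' ?_
    rw [Metric.mem_ball] at hz
    linarith
  set B := C₁ * (K₁ * E + D) with hB
  have hBt : B ≠ ⊤ := ENNReal.mul_ne_top hC₁
    (ENNReal.add_ne_top.2 ⟨ENNReal.mul_ne_top hK₁t hEt, ENNReal.ofReal_ne_top⟩)
  have hbd : ∀ k, ∀ z ∈ Metric.ball (0 : Cn n) (2 * (r₀ / 4)), ‖F k z‖ ≤ Real.sqrt B.toReal := by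
    intro k z hz
    apply Real.le_sqrt_of_sq_le
    rw [← ENNReal.ofReal_le_ofReal_iff ENNReal.toReal_nonneg, ENNReal.ofReal_toReal hBt,
      ← enorm_sq_eq_ofReal]
    refine (hsup k z hz).trans ?_
    rw [hB]
    refine mul_le_mul_right (add_le_add le_rfl ?_) _
    exact mul_le_of_le_one_right' (hδ1 k)
  obtain ⟨G, s, hs, hG, hGd⟩ := exists_tendstoUniformlyOn_of_bounded (F := F) (z := 0)
    (R := r₀ / 4) (by positivity) (fun k => (hF k).differentiableOn) hbd
  have hpt : ∀ z ∈ Metric.ball (0 : Cn n) (r₀ / 4), Tendsto (fun k => F (s k) z) atTop (𝓝 (G z)) :=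
    fun z hz => hG.tendsto_at hz
  have hsub : Metric.ball (0 : Cn n) (r₀ / 4) ⊆ Metric.ball 0 r :=
    Metric.ball_subset_ball (by linarith)
  refine ⟨G, hGd, fun z hz => ?_, ?_⟩
  · have h1 : Tendsto (fun k => ‖F (s k) z‖ₑ ^ 2) atTop (𝓝 (‖G z‖ₑ ^ 2)) :=
      ((ENNReal.continuous_pow 2).tendsto _).comp ((hpt z hz).enorm)
    have h2 : Tendsto (fun k => C₁ * (K₁ * E + D * ENNReal.ofReal (δ (s k)))) atTop
        (𝓝 (C₁ * (K₁ * E + D * 0))) := by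
      refine ENNReal.Tendsto.const_mul (tendsto_const_nhds.add ?_) (Or.inr hC₁)
      exact ENNReal.Tendsto.const_mul (hδlim.comp hs) (Or.inr ENNReal.ofReal_ne_top)
    have h3 := le_of_tendsto_of_tendsto' h1 h2 fun k => hsup (s k) z
      (Metric.ball_subset_ball (by linarith) hz)
    rwa [mul_zero, add_zero, ← mul_assoc] at h3
  · set B₂ := ENNReal.ofReal (2 / c) * (ENNReal.ofReal (C * Real.exp (2 * (t + M) + 1)) * I + 1) +
      ENNReal.ofReal (2 * Real.exp (2 * (t + M) + 1)) * J with hB₂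
    have hB₂t : B₂ < ⊤ := by
      refine ENNReal.add_lt_top.2 ⟨ENNReal.mul_lt_top ENNReal.ofReal_lt_top ?_,
        ENNReal.mul_lt_top ENNReal.ofReal_lt_top hJ⟩
      exact ENNReal.add_lt_top.2 ⟨ENNReal.mul_lt_top ENNReal.ofReal_lt_top hIt.lt_top,
        ENNReal.one_lt_top⟩
    set X : ℕ → Cn n → ℝ≥0∞ := fun k z => ‖f z - F (s k) z‖ₑ ^ 2 *
      (ENNReal.ofReal (Real.exp (-2 * v (s k) z)) * ENNReal.ofReal (Real.exp (-2 * w (s k) z)))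
      with hX
    have hXle : ∀ k, ∫⁻ z in Metric.ball 0 (r₀ / 4), X k z ≤ B₂ := by
      intro k
      refine (lintegral_mono_set (Metric.ball_subset_ball (by linarith))).trans
        ((hF₂ (s k)).trans ?_)
      rw [hB₂]
      exact add_le_add (mul_le_mul_right (add_le_add le_rfl (hδ1 _)) _) le_rfl
    have hXm : ∀ k, AEMeasurable (X k) (volume.restrict (Metric.ball 0 (r₀ / 4))) := by
      intro k
      have h1 : ContinuousOn (fun z => f z - F (s k) z) (Metric.ball 0 (r₀ / 4)) :=
        (hf.continuousOn.mono hsub).sub (hF (s k)).continuous.continuousOn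
      refine ((h1.aemeasurable measurableSet_ball).enorm.pow_const 2).mul (Continuous.aemeasurable ?_)
      have h2 := (hv (s k)).continuous
      have h3 := (hw (s k)).continuous
      have h4 : Continuous fun z => Real.exp (-2 * v (s k) z) := by fun_prop
      have h5 : Continuous fun z => Real.exp (-2 * w (s k) z) := by fun_prop
      simp_rw [← ENNReal.ofReal_mul (Real.exp_pos _).le]
      exact ENNReal.continuous_ofReal.comp (h4.mul h5)
    calc _ ≤ ∫⁻ z in Metric.ball 0 (r₀ / 4), liminf (fun k => X k z) atTop := by
          refine setLIntegral_mono' measurableSet_ball fun z hz => ?_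
          have hzr := hsub hz
          have hzp : z ∈ polydisc n := fun j => ((norm_le_pi_norm z j).trans_lt
            (mem_ball_zero_iff.1 hzr)).trans hr1
          by_cases h0 : f z = G z
          · simp [h0]
          have hne : ‖f z - G z‖ₑ ^ 2 ≠ 0 := by
            simpa [sub_eq_zero] using h0
          rw [wexp_add (hφ.lt_top z hzp) (hφ₀.lt_top z hzp)]
          have hw₁ := (tendsto_wexp (fun k => hφv k z hzr) (hvlim z hzr)).comp hs
          have hw₂ := (tendsto_wexp (fun k => hφw k z hzr) (hwlim z hzr)).comp hs
          have n1 := wexp_ne_zero (hφ.lt_top z hzp)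
          have n2 := wexp_ne_zero (hφ₀.lt_top z hzp)
          have hp := ENNReal.Tendsto.mul hw₁ (Or.inl n1) hw₂ (Or.inl n2)
          have hd : Tendsto (fun k => ‖f z - F (s k) z‖ₑ ^ 2) atTop (𝓝 (‖f z - G z‖ₑ ^ 2)) :=
            ((ENNReal.continuous_pow 2).tendsto _).comp ((tendsto_const_nhds.sub (hpt z hz)).enorm)
          have := ENNReal.Tendsto.mul hd (Or.inl hne) hp (Or.inl (mul_ne_zero n1 n2))
          exact this.liminf_eq.ge
      _ ≤ liminf (fun k => ∫⁻ z in Metric.ball 0 (r₀ / 4), X k z) atTop := lintegral_liminf_le' hXm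
      _ ≤ B₂ := by
          refine (liminf_le_liminf (v := fun _ => B₂) (Eventually.of_forall hXle)).trans ?_
          simp
      _ < ⊤ := hB₂t

lemma differentiableOn_fderiv_apply {f : Cn n → ℂ} {U : Set (Cn n)} (hU : IsOpen U)
    (hf : DifferentiableOn ℂ f U) (w : Cn n) :
    DifferentiableOn ℂ (fun z => fderiv ℂ f z w) U := by
  intro z₀ hz₀
  obtain ⟨M, R, hR, hsub, hM⟩ : ∃ M R : ℝ, 0 < R ∧ Metric.ball z₀ (4 * R) ⊆ U ∧
      ∀ z ∈ Metric.ball z₀ (4 * R), ‖f z‖ ≤ M := by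
    have hc : ContinuousAt f z₀ := (hf.differentiableAt (hU.mem_nhds hz₀)).continuousAt
    have h1 : ∀ᶠ z in 𝓝 z₀, ‖f z‖ < ‖f z₀‖ + 1 :=
      hc.norm.eventually (gt_mem_nhds (by simp))
    obtain ⟨ε, hε, h⟩ := Metric.eventually_nhds_iff_ball.1 (h1.and (hU.mem_nhds hz₀))
    refine ⟨‖f z₀‖ + 1, ε / 4, by positivity, fun z hz => (h z ?_).2, fun z hz => (h z ?_).1.le⟩ <;>
    · convert hz using 2
      ring
  obtain ⟨K, hK⟩ := exists_nat_gt (‖w‖ / R)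
  have hK0 : 0 < (K : ℝ) := lt_of_le_of_lt (by positivity) hK
  set c : ℕ → ℂ := fun k => ((k + K : ℕ) : ℂ) with hc
  have hcn : ∀ k, ‖c k‖ = k + K := fun k => by simp only [hc, Complex.norm_natCast]; push_cast; ring
  have hcw : ∀ k, ‖(c k)⁻¹ • w‖ < R := by
    intro k
    rw [norm_smul, norm_inv, hcn]
    rw [div_lt_iff₀ hR] at hK
    rw [inv_mul_lt_iff₀ (by positivity)]
    nlinarith [(Nat.cast_nonneg k : (0 : ℝ) ≤ k)]
  set D : ℕ → Cn n → ℂ := fun k z => c k • (f (z + (c k)⁻¹ • w) - f z) with hD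
  have hDd : ∀ k, DifferentiableOn ℂ (D k) (Metric.ball z₀ (2 * R)) := by
    intro k
    have h1 : DifferentiableOn ℂ f (Metric.ball z₀ (2 * R)) :=
      hf.mono ((Metric.ball_subset_ball (by linarith)).trans hsub)
    suffices h2 : DifferentiableOn ℂ (fun z => f (z + (c k)⁻¹ • w)) (Metric.ball z₀ (2 * R)) from
      (h2.sub h1).const_smul (c k)
    refine hf.comp (by fun_prop) fun z hz => hsub ?_
    rw [Metric.mem_ball, dist_eq_norm] at hz ⊢
    have := hcw k
    calc ‖z + (c k)⁻¹ • w - z₀‖ = ‖(z - z₀) + (c k)⁻¹ • w‖ := by congr 1; abel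
      _ ≤ ‖z - z₀‖ + ‖(c k)⁻¹ • w‖ := norm_add_le _ _
      _ < _ := by linarith
  have hDM : ∀ k, ∀ z ∈ Metric.ball z₀ (2 * R), ‖D k z‖ ≤ 2 * M / R * ‖w‖ := by
    intro k z hz
    have hs : Metric.ball z (2 * R) ⊆ Metric.ball z₀ (4 * R) :=
      Metric.ball_subset_ball' (by rw [Metric.mem_ball] at hz; linarith)
    have h := norm_sub_le_of_bounded (hf.mono (hs.trans hsub)) hR (fun x hx => hM x (hs hx))
      (Metric.mem_ball_self hR) (b := z + (c k)⁻¹ • w) (by simpa using hcw k)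
    have hpos : 0 < ‖c k‖ := by rw [hcn]; positivity
    simp only [hD, norm_smul]
    calc _ ≤ ‖c k‖ * (2 * M / R * ‖z + (c k)⁻¹ • w - z‖) := by gcongr
      _ = _ := by
        rw [add_sub_cancel_left, norm_smul, norm_inv]
        field_simp
  obtain ⟨g, φ, hφ, hg, hgd⟩ := exists_tendstoUniformlyOn_of_bounded hR hDd hDM
  have heq : ∀ z ∈ Metric.ball z₀ R, fderiv ℂ f z w = g z := by
    intro z hz
    have h1 := hg.tendsto_at hz
    have hzU : z ∈ U := hsub (Metric.ball_subset_ball (by linarith) hz)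
    have hcl : Tendsto (fun k => ‖c k‖) atTop atTop := by
      simp_rw [hcn]
      exact tendsto_atTop_add_const_right _ _ tendsto_natCast_atTop_atTop
    have h2 := (hf.differentiableAt (hU.mem_nhds hzU)).hasFDerivAt.lim w hcl
    exact tendsto_nhds_unique (h2.comp hφ) h1
  have hnb : Metric.ball z₀ R ∈ 𝓝 z₀ := Metric.ball_mem_nhds _ hR
  refine DifferentiableAt.differentiableWithinAt ?_
  refine (hgd.differentiableAt hnb).congr_of_eventuallyEq ?_
  filter_upwards [hnb] with z hz using heq z hz

/-- The open polydisc centred at the origin with polyradius `ρ`. -/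
def polyD (ρ : Fin n → ℝ) : Set (Cn n) := {z | ∀ j, ‖z j‖ < ρ j}

lemma isOpen_polyD (ρ : Fin n → ℝ) : IsOpen (polyD ρ) := by
  have : polyD ρ = ⋂ j, {z : Cn n | ‖z j‖ < ρ j} := by ext; simp [polyD]
  rw [this]
  exact isOpen_iInter_of_finite fun j => isOpen_lt (by fun_prop) continuous_const

lemma update_mem_polyD {ρ : Fin n → ℝ} {z : Cn n} (hz : z ∈ polyD ρ) {i : Fin n} {ζ : ℂ}
    (hζ : ‖ζ‖ < ρ i) : Function.update z i ζ ∈ polyD ρ := by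
  intro j
  by_cases h : j = i
  · subst h; simpa using hζ
  · simpa [h] using hz j

lemma update_zero_mem_polyD {ρ : Fin n → ℝ} {z : Cn n} (hz : z ∈ polyD ρ) (i : Fin n) :
    Function.update z i 0 ∈ polyD ρ :=
  update_mem_polyD hz (by simpa using (norm_nonneg _).trans_lt (hz i))

lemma update_eq_add_smul (z : Cn n) (i : Fin n) (ζ : ℂ) :
    Function.update z i ζ = z + (ζ - z i) • Pi.single i (1 : ℂ) := by
  ext j
  by_cases h : j = i
  · subst h; simp
  · simp [h]

/-- The divided difference of `f` in the `i`-th variable, between `z` and its projection to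
`{z i = 0}`. -/
def tau (i : Fin n) (f : Cn n → ℂ) (z : Cn n) : ℂ :=
  dslope (fun ζ => f (Function.update z i ζ)) 0 (z i)

lemma eq_add_mul_tau (i : Fin n) (f : Cn n → ℂ) (z : Cn n) :
    f z = f (Function.update z i 0) + z i * tau i f z := by
  have h := sub_smul_dslope (fun ζ => f (Function.update z i ζ)) 0 (z i)
  simp only [sub_zero, smul_eq_mul, Function.update_eq_self] at h
  rw [tau, h]
  ring

lemma hasDerivAt_comp_update {i : Fin n} {f : Cn n → ℂ} {z : Cn n} {ζ : ℂ}
    (hf : DifferentiableAt ℂ f (Function.update z i ζ)) :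
    HasDerivAt (fun ζ => f (Function.update z i ζ))
      (fderiv ℂ f (Function.update z i ζ) (Pi.single i 1)) ζ := by
  have h1 : HasDerivAt (fun ζ => Function.update z i ζ) (Pi.single i (1 : ℂ)) ζ :=
    hasDerivAt_update z i ζ
  exact hf.hasFDerivAt.comp_hasDerivAt ζ h1

lemma tau_of_eq_zero {i : Fin n} {f : Cn n → ℂ} {z : Cn n} (hf : DifferentiableAt ℂ f z)
    (hz : z i = 0) : tau i f z = fderiv ℂ f z (Pi.single i 1) := by
  have e : Function.update z i 0 = z := by rw [← hz, Function.update_eq_self]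
  rw [tau, hz, dslope_same, (hasDerivAt_comp_update (by rwa [e])).deriv, e]

lemma norm_tau_le {i : Fin n} {ρ : Fin n → ℝ} {f : Cn n → ℂ} {M : ℝ}
    (hf : DifferentiableOn ℂ f (polyD ρ)) (hM : ∀ z ∈ polyD ρ, ‖f z‖ ≤ M) {z : Cn n}
    (hz : z ∈ polyD ρ) : ‖tau i f z‖ ≤ 2 / ρ i * M := by
  have hρ : 0 < ρ i := (norm_nonneg _).trans_lt (hz i)
  have h := Complex.norm_dslope_le_div_of_mapsTo_ball (c := 0) (R₁ := ρ i) (R₂ := 2 * M) (z := z i)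
    (f := fun ζ => f (Function.update z i ζ)) (fun ζ hζ => ?_) (fun ζ hζ => ?_) (by simpa using hz i)
  · exact h.trans_eq (by ring)
  · have hζ' := update_mem_polyD hz (i := i) (mem_ball_zero_iff.1 hζ)
    exact (hasDerivAt_comp_update (hf.differentiableAt
      ((isOpen_polyD ρ).mem_nhds hζ'))).differentiableAt.differentiableWithinAt
  · have hζ' := update_mem_polyD hz (i := i) (mem_ball_zero_iff.1 hζ)
    rw [Metric.mem_closedBall, dist_eq_norm]
    refine (norm_sub_le _ _).trans ?_
    linarith [hM _ hζ', hM _ (update_zero_mem_polyD hz i)]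

lemma tau_sub {i : Fin n} {ρ : Fin n → ℝ} {f g k : Cn n → ℂ}
    (hf : DifferentiableOn ℂ f (polyD ρ)) (hg : DifferentiableOn ℂ g (polyD ρ))
    (hk : ∀ z ∈ polyD ρ, k z = f z - g z) {z : Cn n} (hz : z ∈ polyD ρ) :
    tau i k z = tau i f z - tau i g z := by
  by_cases h0 : z i = 0
  · have hnb := (isOpen_polyD ρ).mem_nhds hz
    have hf' := hf.differentiableAt hnb
    have hg' := hg.differentiableAt hnb
    have hk' : k =ᶠ[𝓝 z] fun z => f z - g z := by filter_upwards [hnb] with w hw using hk w hw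
    have hkd : DifferentiableAt ℂ k z := (hf'.sub hg').congr_of_eventuallyEq hk'
    rw [tau_of_eq_zero hf' h0, tau_of_eq_zero hg' h0, tau_of_eq_zero hkd h0, hk'.fderiv_eq,
      fderiv_fun_sub hf' hg']
    rfl
  · have h1 := eq_add_mul_tau i f z
    have h2 := eq_add_mul_tau i g z
    have h3 := eq_add_mul_tau i k z
    rw [hk z hz, hk _ (update_zero_mem_polyD hz i)] at h3
    apply mul_left_cancel₀ h0
    linear_combination h1 - h2 - h3

lemma differentiableOn_tau {i : Fin n} {ρ : Fin n → ℝ} {f : Cn n → ℂ}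
    (hf : DifferentiableOn ℂ f (polyD ρ)) : DifferentiableOn ℂ (tau i f) (polyD ρ) := by
  have hP := isOpen_polyD ρ
  set e : Cn n := Pi.single i 1 with he
  set p : Cn n → ℂ := fun z => fderiv ℂ f z e with hp
  have hpd : DifferentiableOn ℂ p (polyD ρ) := differentiableOn_fderiv_apply hP hf e
  have hupd : ∀ z : Cn n, Function.update z i 0 = z - z i • e := fun z => by
    rw [update_eq_add_smul, zero_sub, neg_smul, sub_eq_add_neg]
  have hfm : DifferentiableOn ℂ (fun z => f (Function.update z i 0)) (polyD ρ) := by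
    refine hf.comp ?_ fun z hz => update_zero_mem_polyD hz i
    simp_rw [hupd]
    fun_prop
  have hne : ∀ x ∈ polyD ρ, x i ≠ 0 → DifferentiableAt ℂ (tau i f) x := by
    intro x hx h0
    have hnb := hP.mem_nhds hx
    have hi : DifferentiableAt ℂ (fun z : Cn n => z i) x := differentiableAt_apply i x
    have h1 : DifferentiableAt ℂ (fun z => (f z - f (Function.update z i 0)) / z i) x := by
      simp_rw [div_eq_mul_inv]
      exact ((hf.differentiableAt hnb).fun_sub (hfm.differentiableAt hnb)).fun_mul
        (DifferentiableAt.comp x (differentiableAt_inv h0) hi)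
    refine h1.congr_of_eventuallyEq ?_
    have h2 : ∀ᶠ z : Cn n in 𝓝 x, z i ≠ 0 := (continuous_apply i).continuousAt.eventually_ne h0
    filter_upwards [h2] with z hz
    rw [eq_div_iff hz, eq_sub_iff_add_eq]
    linear_combination -eq_add_mul_tau i f z
  refine differentiableOn_of_line hP (fun x hx => ContinuousAt.continuousWithinAt ?_)
    fun x hx w => ?_
  · by_cases h0 : x i = 0
    · rw [Metric.continuousAt_iff']
      intro ε hε
      have hnb := hP.mem_nhds hx
      have h1 : ∀ᶠ z in 𝓝 x, dist (p z) (p x) < ε / 2 :=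
        (Metric.continuousAt_iff'.1 (hpd.differentiableAt hnb).continuousAt) _ (by positivity)
      obtain ⟨δ, hδ, h⟩ := Metric.eventually_nhds_iff_ball.1 (h1.and hnb)
      filter_upwards [Metric.ball_mem_nhds x hδ] with z hz
      have hzP := (h z hz).2
      rw [tau_of_eq_zero (hf.differentiableAt hnb) h0]
      by_cases hz0 : z i = 0
      · rw [tau_of_eq_zero (hf.differentiableAt (hP.mem_nhds hzP)) hz0]
        exact (h z hz).1.trans (by linarith)
      have hzi : ‖z i‖ < δ := by
        have := norm_le_pi_norm (z - x) i
        rw [Metric.mem_ball, dist_eq_norm] at hz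
        simp only [Pi.sub_apply, h0, sub_zero] at this
        linarith
      have hmem : ∀ ζ ∈ Metric.ball (0 : ℂ) δ, Function.update z i ζ ∈ Metric.ball x δ := by
        intro ζ hζ
        rw [mem_ball_zero_iff] at hζ
        rw [Metric.mem_ball, dist_pi_lt_iff hδ] at hz ⊢
        intro j
        by_cases hj : j = i
        · subst hj; simpa [h0] using hζ
        · simpa [hj] using hz j
      have hd : ∀ ζ ∈ Metric.ball (0 : ℂ) δ,
          HasDerivAt (fun ζ => f (Function.update z i ζ) - ζ * p x)
            (p (Function.update z i ζ) - p x) ζ := by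
        intro ζ hζ
        have h2 := hasDerivAt_comp_update (hf.differentiableAt
          (hP.mem_nhds (h _ (hmem ζ hζ)).2))
        have h3 : HasDerivAt (fun ζ : ℂ => ζ * p x) (p x) ζ := by
          simpa using (hasDerivAt_id ζ).mul_const (p x)
        exact h2.fun_sub h3
      have hbd := Convex.norm_image_sub_le_of_norm_deriv_le (C := ε / 2)
        (fun ζ hζ => (hd ζ hζ).differentiableAt) (fun ζ hζ => by
          rw [(hd ζ hζ).deriv, ← dist_eq_norm]
          exact (h _ (hmem ζ hζ)).1.le) (convex_ball (0 : ℂ) δ) (Metric.mem_ball_self hδ)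
        (mem_ball_zero_iff.2 hzi)
      have e1 : f (Function.update z i (z i)) - z i * p x - (f (Function.update z i 0) - 0 * p x) =
          z i * (tau i f z - p x) := by
        have := eq_add_mul_tau i f z
        rw [Function.update_eq_self]
        linear_combination this
      rw [e1, norm_mul, sub_zero, mul_comm (ε / 2)] at hbd
      rw [dist_eq_norm]
      have := le_of_mul_le_mul_left hbd (norm_pos_iff.2 hz0)
      exact this.trans_lt (by linarith)
    · exact (hne x hx h0).continuousAt
  · by_cases h0 : x i = 0
    · have hnb := hP.mem_nhds hx
      have hcont : Continuous fun ζ : ℂ => x + ζ • w := by fun_prop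
      have hline : ∀ᶠ ζ : ℂ in 𝓝 0, x + ζ • w ∈ polyD ρ :=
        hcont.continuousAt.eventually (by simpa using hnb)
      by_cases hw : w i = 0
      · refine (differentiableAt_line (hpd.differentiableAt hnb) w).congr_of_eventuallyEq ?_
        filter_upwards [hline] with ζ hζ
        exact tau_of_eq_zero (hf.differentiableAt (hP.mem_nhds hζ)) (by simp [h0, hw])
      · set H : ℂ → ℂ := fun ζ => f (x + ζ • w) - f (Function.update (x + ζ • w) i 0) with hH
        have hx0 : Function.update x i 0 = x := by rw [← h0, Function.update_eq_self]
        have hH0 : H 0 = 0 := by simp [hH, hx0]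
        obtain ⟨δ, hδ, h⟩ := Metric.eventually_nhds_iff_ball.1 hline
        have hHd : DifferentiableOn ℂ H (Metric.ball 0 δ) := by
          have hl : DifferentiableOn ℂ (fun ζ : ℂ => x + ζ • w) (Metric.ball 0 δ) := by fun_prop
          exact (hf.comp hl fun ζ hζ => h ζ hζ).sub (hfm.comp hl fun ζ hζ => h ζ hζ)
        have hball := Metric.ball_mem_nhds (0 : ℂ) hδ
        have hds := ((Complex.differentiableOn_dslope hball).2 hHd).differentiableAt hball
        refine (hds.const_mul (w i)⁻¹).congr_of_eventuallyEq ?_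
        filter_upwards [hball] with ζ hζ
        rw [eq_inv_mul_iff_mul_eq₀ hw]
        by_cases hζ0 : ζ = 0
        · subst hζ0
          rw [zero_smul, add_zero, tau_of_eq_zero (hf.differentiableAt hnb) h0, dslope_same]
          have hl : HasDerivAt (fun ζ : ℂ => x + ζ • w) w 0 := by
            simpa using ((hasDerivAt_id (0 : ℂ)).smul_const w).const_add x
          have hl2 : HasDerivAt (fun ζ : ℂ => Function.update (x + ζ • w) i 0) (w - w i • e) 0 := by
            simp_rw [hupd]
            have h3 : HasDerivAt (fun ζ : ℂ => (x + ζ • w) i) (w i) 0 := hasDerivAt_pi.1 hl i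
            exact hl.sub (h3.smul_const e)
          have hfx := (hf.differentiableAt hnb).hasFDerivAt
          have k1 : HasDerivAt (fun ζ : ℂ => f (x + ζ • w)) (fderiv ℂ f x w) 0 :=
            HasFDerivAt.comp_hasDerivAt (l := f) 0 (by simpa using hfx) hl
          have k2 : HasDerivAt (fun ζ : ℂ => f (Function.update (x + ζ • w) i 0))
              (fderiv ℂ f x (w - w i • e)) 0 :=
            HasFDerivAt.comp_hasDerivAt (l := f) 0 (by simpa [hx0] using hfx) hl2
          rw [hH, (k1.fun_sub k2).deriv, map_sub, map_smul, smul_eq_mul]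
          ring
        · rw [dslope_of_ne _ hζ0, slope_def_field, hH0, sub_zero, sub_zero, eq_div_iff hζ0, hH]
          have := eq_add_mul_tau i f (x + ζ • w)
          simp only [Pi.add_apply, h0, zero_add, Pi.smul_apply, smul_eq_mul] at this
          linear_combination -this
    · exact differentiableAt_line (hne x hx h0) w

lemma differentiableOn_iterate_tau {i : Fin n} {ρ : Fin n → ℝ} {f : Cn n → ℂ}
    (hf : DifferentiableOn ℂ f (polyD ρ)) (b : ℕ) :
    DifferentiableOn ℂ ((tau i)^[b] f) (polyD ρ) := by
  induction b with
  | zero => exact hf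
  | succ b ih => rw [Function.iterate_succ_apply']; exact differentiableOn_tau ih

lemma norm_iterate_tau_le {i : Fin n} {ρ : Fin n → ℝ} {f : Cn n → ℂ} {M : ℝ}
    (hf : DifferentiableOn ℂ f (polyD ρ)) (hM : ∀ z ∈ polyD ρ, ‖f z‖ ≤ M) (b : ℕ) {z : Cn n}
    (hz : z ∈ polyD ρ) : ‖(tau i)^[b] f z‖ ≤ (2 / ρ i) ^ b * M := by
  induction b generalizing z with
  | zero => simpa using hM z hz
  | succ b ih =>
    rw [Function.iterate_succ_apply', pow_succ', mul_assoc]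
    exact norm_tau_le (differentiableOn_iterate_tau hf b) (fun z hz => ih hz) hz

lemma iterate_tau_sub {i : Fin n} {ρ : Fin n → ℝ} {f g k : Cn n → ℂ}
    (hf : DifferentiableOn ℂ f (polyD ρ)) (hg : DifferentiableOn ℂ g (polyD ρ))
    (hk : ∀ z ∈ polyD ρ, k z = f z - g z) (b : ℕ) {z : Cn n} (hz : z ∈ polyD ρ) :
    (tau i)^[b] k z = (tau i)^[b] f z - (tau i)^[b] g z := by
  induction b generalizing z with
  | zero => exact hk z hz
  | succ b ih =>
    simp only [Function.iterate_succ_apply']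
    exact tau_sub (differentiableOn_iterate_tau hf b) (differentiableOn_iterate_tau hg b)
      (fun z hz => ih hz) hz

lemma eq_sum_add_pow_mul_iterate_tau (i : Fin n) (f : Cn n → ℂ) (b : ℕ) (z : Cn n) :
    f z = ∑ j ∈ Finset.range b, (tau i)^[j] f (Function.update z i 0) * z i ^ j +
      z i ^ b * (tau i)^[b] f z := by
  induction b with
  | zero => simp
  | succ b ih =>
    rw [Finset.sum_range_succ, Function.iterate_succ_apply']
    have := eq_add_mul_tau i ((tau i)^[b] f) z
    linear_combination ih + z i ^ b * this

lemma HoloNear.exists_ball {f : Cn n → ℂ} (hf : HoloNear f) :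
    ∃ r M : ℝ, 0 < r ∧ DifferentiableOn ℂ f (Metric.ball 0 r) ∧
      ∀ z ∈ Metric.ball (0 : Cn n) r, ‖f z‖ ≤ M := by
  obtain ⟨U, hU, hUo, hd⟩ := hf
  have hc : ContinuousAt f 0 := (hd.differentiableAt hU).continuousAt
  have h1 : ∀ᶠ z in 𝓝 0, ‖f z‖ < ‖f 0‖ + 1 := hc.norm.eventually (gt_mem_nhds (by simp))
  obtain ⟨ε, hε, h⟩ := Metric.eventually_nhds_iff_ball.1 (h1.and hU)
  exact ⟨ε, ‖f 0‖ + 1, hε, hd.mono fun z hz => (h z hz).2, fun z hz => (h z hz).1.le⟩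

lemma holoNear_of_ball {f : Cn n → ℂ} {r : ℝ} (hr : 0 < r)
    (hf : DifferentiableOn ℂ f (Metric.ball 0 r)) : HoloNear f :=
  ⟨_, Metric.ball_mem_nhds _ hr, Metric.isOpen_ball, hf⟩

lemma polyD_const {r : ℝ} (hr : 0 < r) : polyD (fun _ : Fin n => r) = Metric.ball 0 r := by
  ext z
  rw [mem_ball_zero_iff, pi_norm_lt_iff hr]
  rfl

lemma update_zero_eq_cons_tail (z : Cn (n + 1)) :
    Function.update z 0 0 = (Fin.cons 0 (Fin.tail z) : Cn (n + 1)) := by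
  ext j
  refine Fin.cases ?_ (fun k => ?_) j <;> simp [Fin.tail]

/-- If the operator `u ↦ h * u` composed with the `b`-th divided difference is a contraction,
then the equation `u = τ^b (f - h * u)` has a holomorphic solution on the polydisc. -/
lemma exists_eq_iterate_tau {i : Fin n} {ρ : Fin n → ℝ} (hρ : 0 < ρ i) {f h : Cn n → ℂ} {M : ℝ}
    (hf : DifferentiableOn ℂ f (polyD ρ)) (hM : ∀ z ∈ polyD ρ, ‖f z‖ ≤ M)
    (hh : DifferentiableOn ℂ h (polyD ρ)) (b : ℕ)
    (hhb : ∀ z ∈ polyD ρ, ‖h z‖ ≤ (ρ i / 2) ^ b / 2) :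
    ∃ Q : Cn n → ℂ, DifferentiableOn ℂ Q (polyD ρ) ∧
      ∀ z ∈ polyD ρ, (tau i)^[b] (fun z => f z - h z * Q z) z = Q z := by
  set A := (2 / ρ i) ^ b * M with hA
  set q : ℕ → Cn n → ℂ := fun k =>
    (fun u => (tau i)^[b] fun z => f z - h z * u z)^[k] fun _ => 0 with hq
  have hq1 : ∀ k, q (k + 1) = (tau i)^[b] fun z => f z - h z * q k z := fun k => by
    simp only [hq, Function.iterate_succ_apply']
  have hsub : ∀ u, DifferentiableOn ℂ u (polyD ρ) →
      DifferentiableOn ℂ (fun z => f z - h z * u z) (polyD ρ) := fun u hu => hf.fun_sub (hh.fun_mul hu)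
  have hqd : ∀ k, DifferentiableOn ℂ (q k) (polyD ρ) := by
    intro k
    induction k with
    | zero => exact differentiableOn_const 0
    | succ k ih =>
      rw [hq1]
      exact differentiableOn_iterate_tau (hsub _ ih) b
  have hcontr : ∀ u v : Cn n → ℂ, DifferentiableOn ℂ u (polyD ρ) → DifferentiableOn ℂ v (polyD ρ) →
      ∀ B : ℝ, (∀ z ∈ polyD ρ, ‖u z - v z‖ ≤ B) → ∀ z ∈ polyD ρ,
      ‖(tau i)^[b] (fun z => f z - h z * u z) z - (tau i)^[b] (fun z => f z - h z * v z) z‖ ≤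
        B / 2 := by
    intro u v hu hv B hB z hz
    rw [← iterate_tau_sub (hsub u hu) (hsub v hv) (k := fun z => h z * (v z - u z))
      (fun z _ => by ring) b hz]
    refine (norm_iterate_tau_le (M := (ρ i / 2) ^ b / 2 * B) (hh.fun_mul (hv.fun_sub hu))
      (fun z hz => ?_) b hz).trans_eq ?_
    · rw [norm_mul, norm_sub_rev]
      have := hhb z hz
      have := hB z hz
      gcongr
    · have : (2 / ρ i) ^ b * (ρ i / 2) ^ b = 1 := by
        rw [← mul_pow, show 2 / ρ i * (ρ i / 2) = 1 by field_simp, one_pow]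
      linear_combination B / 2 * this
  have hdist : ∀ k, ∀ z ∈ polyD ρ, ‖q k z - q (k + 1) z‖ ≤ A * (1 / 2) ^ k := by
    intro k
    induction k with
    | zero =>
      intro z hz
      have h0 : q 0 = fun _ => 0 := rfl
      rw [hq1, h0]
      simpa [hA] using norm_iterate_tau_le (i := i) hf hM b hz
    | succ k ih =>
      intro z hz
      have := hcontr _ _ (hqd k) (hqd (k + 1)) _ ih z hz
      rw [hq1, hq1 (k + 1)]
      refine this.trans_eq ?_
      rw [pow_succ]; ring
  have hdist' : ∀ z ∈ polyD ρ, ∀ k, dist (q k z) (q (k + 1) z) ≤ A * (1 / 2) ^ k :=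
    fun z hz k => by rw [dist_eq_norm]; exact hdist k z hz
  have hlim : ∀ z, ∃ a, z ∈ polyD ρ → Tendsto (fun k => q k z) atTop (𝓝 a) := by
    intro z
    by_cases hz : z ∈ polyD ρ
    · obtain ⟨a, ha⟩ := cauchySeq_tendsto_of_complete
        (cauchySeq_of_le_geometric (1 / 2) A (by norm_num) (hdist' z hz))
      exact ⟨a, fun _ => ha⟩
    · exact ⟨0, fun h => absurd h hz⟩
  choose Q hQ using hlim
  have hQb : ∀ k, ∀ z ∈ polyD ρ, ‖Q z - q k z‖ ≤ A * (1 / 2) ^ k / (1 - 1 / 2) := by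
    intro k z hz
    rw [← dist_eq_norm, dist_comm]
    exact dist_le_of_le_geometric_of_tendsto (1 / 2) A (by norm_num) (hdist' z hz) (hQ z hz) k
  have hz0 : Tendsto (fun k : ℕ => A * (1 / 2) ^ k / (1 - 1 / 2)) atTop (𝓝 0) := by
    have := (tendsto_pow_atTop_nhds_zero_of_lt_one (r := (1 / 2 : ℝ)) (by norm_num)
      (by norm_num)).const_mul A |>.div_const (1 - 1 / 2)
    simpa using this
  have hunif : TendstoUniformlyOn q Q atTop (polyD ρ) := by
    rw [Metric.tendstoUniformlyOn_iff]
    intro ε hε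
    filter_upwards [hz0.eventually (gt_mem_nhds hε)] with k hk z hz
    rw [dist_eq_norm]
    exact (hQb k z hz).trans_lt hk
  have hQd : DifferentiableOn ℂ Q (polyD ρ) :=
    differentiableOn_of_tendstoLocallyUniformlyOn (isOpen_polyD ρ) (Eventually.of_forall hqd)
      hunif.tendstoLocallyUniformlyOn
  refine ⟨Q, hQd, fun z hz => ?_⟩
  have hz1 : Tendsto (fun k : ℕ => A * (1 / 2) ^ k / (1 - 1 / 2) / 2) atTop (𝓝 0) := by
    have := hz0.div_const 2
    rwa [zero_div] at this
  have h1 : Tendsto (fun k => q (k + 1) z) atTop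
      (𝓝 ((tau i)^[b] (fun z => f z - h z * Q z) z)) := by
    rw [tendsto_iff_norm_sub_tendsto_zero]
    refine squeeze_zero (fun _ => norm_nonneg _) (fun k => ?_) hz1
    rw [hq1, norm_sub_rev]
    exact hcontr _ _ hQd (hqd k) _ (hQb k) z hz
  exact tendsto_nhds_unique h1 ((hQ z hz).comp (tendsto_add_atTop_nat 1))

/-- Weierstrass division. -/
theorem weierstrass_division {f g : Cn (n + 1) → ℂ} (hf : HoloNear f) (hg : HoloNear g) {b : ℕ}
    (hlt : ∀ j < b, (tau 0)^[j] g 0 = 0) (hb : (tau 0)^[b] g 0 ≠ 0) :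
    ∃ q : Cn (n + 1) → ℂ, HoloNear q ∧ ∃ c : ℕ → Cn n → ℂ, (∀ j, HoloNear (c j)) ∧
      ∀ᶠ z in 𝓝 (0 : Cn (n + 1)),
        f z = q z * g z + ∑ j ∈ Finset.range b, c j (Fin.tail z) * z 0 ^ j := by
  obtain ⟨Rf, M, hRf, hfd, hfM⟩ := hf.exists_ball
  obtain ⟨Rg, -, hRg, hgd, -⟩ := hg.exists_ball
  set U := (tau 0)^[b] g with hU
  have hTd : ∀ j, DifferentiableOn ℂ ((tau 0)^[j] g) (Metric.ball 0 Rg) := fun j => by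
    rw [← polyD_const hRg] at hgd ⊢
    exact differentiableOn_iterate_tau hgd j
  have hTc : ∀ j, ContinuousAt ((tau 0)^[j] g) 0 := fun j =>
    ((hTd j).differentiableAt (Metric.ball_mem_nhds _ hRg)).continuousAt
  set c := ‖U 0‖ / 2 with hc
  have hUpos : 0 < ‖U 0‖ := norm_pos_iff.2 hb
  have hc0 : 0 < c := by positivity
  obtain ⟨ρ₀, hρ₀, hρU⟩ := Metric.eventually_nhds_iff_ball.1
    ((hTc b).norm.eventually (lt_mem_nhds (show c < ‖U 0‖ by rw [hc]; linarith)))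
  set ρ := min (min ρ₀ 1) (min Rf Rg) with hρdef
  have hρ : 0 < ρ := by positivity
  have hρ1 : ρ ≤ 1 := (min_le_left _ _).trans (min_le_right _ _)
  have hρρ : ρ ≤ ρ₀ := (min_le_left _ _).trans (min_le_left _ _)
  have hρf : ρ ≤ Rf := (min_le_right _ _).trans (min_le_left _ _)
  have hρg : ρ ≤ Rg := (min_le_right _ _).trans (min_le_right _ _)
  set ε := c * ((ρ / 2) ^ b / 2) with hε
  have hε0 : 0 < ε := by positivity
  have hsum : ∀ᶠ z in 𝓝 (0 : Cn (n + 1)), ∑ j ∈ Finset.range b, ‖(tau 0)^[j] g z‖ < ε := by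
    have h1 : ContinuousAt (fun z => ∑ j ∈ Finset.range b, ‖(tau 0)^[j] g z‖) 0 :=
      tendsto_finsetSum _ fun j _ => (hTc j).norm
    refine h1.eventually (gt_mem_nhds ?_)
    have h2 : ∑ j ∈ Finset.range b, ‖(tau 0)^[j] g 0‖ = 0 :=
      Finset.sum_eq_zero fun j hj => by rw [hlt j (Finset.mem_range.1 hj), norm_zero]
    exact h2.trans_lt hε0
  obtain ⟨r₀, hr₀, hr⟩ := Metric.eventually_nhds_iff_ball.1 hsum
  set r := min r₀ ρ with hrdef
  have hr0 : 0 < r := by positivity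
  set ϱ : Fin (n + 1) → ℝ := Fin.cons ρ fun _ => r with hϱ
  have hϱ0 : ϱ 0 = ρ := rfl
  have hϱle : ∀ j, ϱ j ≤ ρ := fun j => by
    refine Fin.cases le_rfl (fun k => ?_) j
    exact min_le_right _ _
  have hϱge : ∀ j, r ≤ ϱ j := fun j => by
    refine Fin.cases (min_le_right _ _) (fun k => ?_) j
    exact le_rfl
  have hPρ : polyD ϱ ⊆ Metric.ball 0 ρ := fun z hz => by
    rw [← polyD_const hρ]
    exact fun j => (hz j).trans_le (hϱle j)
  have hrP : Metric.ball 0 r ⊆ polyD ϱ := fun z hz => by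
    rw [← polyD_const hr0] at hz
    exact fun j => (hz j).trans_le (hϱge j)
  have hfP := hfd.mono (hPρ.trans (Metric.ball_subset_ball hρf))
  have hgP := hgd.mono (hPρ.trans (Metric.ball_subset_ball hρg))
  have hUP := (hTd b).mono (hPρ.trans (Metric.ball_subset_ball hρg))
  have hU0 : ∀ z ∈ polyD ϱ, c < ‖U z‖ := fun z hz =>
    hρU z (Metric.ball_subset_ball hρρ (hPρ hz))
  have hUne : ∀ z ∈ polyD ϱ, U z ≠ 0 := fun z hz => norm_pos_iff.1 (hc0.trans (hU0 z hz))
  have hinv : DifferentiableOn ℂ (fun z => (U z)⁻¹) (polyD ϱ) := fun z hz =>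
    (DifferentiableAt.comp z (differentiableAt_inv (hUne z hz))
      (hUP.differentiableAt ((isOpen_polyD ϱ).mem_nhds hz))).differentiableWithinAt
  set h : Cn (n + 1) → ℂ := fun z => (g z - z 0 ^ b * U z) * (U z)⁻¹ with hh
  have hhd : DifferentiableOn ℂ h (polyD ϱ) := by
    refine (hgP.fun_sub (DifferentiableOn.fun_mul ?_ hUP)).fun_mul hinv
    exact (Differentiable.pow (differentiable_apply (0 : Fin (n + 1))) b).differentiableOn
  have hhb : ∀ z ∈ polyD ϱ, ‖h z‖ ≤ (ϱ 0 / 2) ^ b / 2 := by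
    intro z hz
    have h1 : g z - z 0 ^ b * U z =
        ∑ j ∈ Finset.range b, (tau 0)^[j] g (Function.update z 0 0) * z 0 ^ j := by
      have := eq_sum_add_pow_mul_iterate_tau 0 g b z
      linear_combination this
    have h2 : ‖g z - z 0 ^ b * U z‖ ≤ ε := by
      rw [h1]
      refine (norm_sum_le _ _).trans ((Finset.sum_le_sum fun j _ => ?_).trans (hr (Function.update z 0 0) ?_).le)
      · rw [norm_mul, norm_pow]
        refine mul_le_of_le_one_right (norm_nonneg _) (pow_le_one₀ (norm_nonneg _) ?_)
        exact (hz 0).le.trans hρ1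
      · refine Metric.ball_subset_ball (min_le_left _ _ : r ≤ r₀) ?_
        rw [← polyD_const hr0]
        intro j
        refine Fin.cases ?_ (fun k => ?_) j
        · simpa using hr0
        · rw [Function.update_of_ne (Fin.succ_ne_zero k)]
          exact hz k.succ
    rw [hh, norm_mul, norm_inv, ← div_eq_mul_inv, div_le_iff₀ (hc0.trans (hU0 z hz)), hϱ0]
    refine h2.trans ?_
    rw [hε, mul_comm]
    gcongr
    exact (hU0 z hz).le
  obtain ⟨Q, hQd, hQ⟩ := exists_eq_iterate_tau (i := 0) (ρ := ϱ) (M := M) hρ hfP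
    (fun z hz => hfM z (Metric.ball_subset_ball hρf (hPρ hz))) hhd b hhb
  set F : Cn (n + 1) → ℂ := fun z => f z - h z * Q z with hF
  have hFd : DifferentiableOn ℂ F (polyD ϱ) := hfP.fun_sub (hhd.fun_mul hQd)
  refine ⟨fun z => Q z * (U z)⁻¹, holoNear_of_ball hr0 ((hQd.fun_mul hinv).mono hrP),
    fun j z => (tau 0)^[j] F (Fin.cons 0 z), fun j => ?_, ?_⟩
  · refine holoNear_of_ball hr0 ((differentiableOn_iterate_tau hFd j).comp ?_ fun z hz => ?_)
    · refine Differentiable.differentiableOn (differentiable_pi.2 fun k => ?_)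
      refine Fin.cases ?_ (fun k => ?_) k
      · simp
      · simpa using differentiable_apply k
    · rw [← polyD_const hr0] at hz
      intro k
      refine Fin.cases ?_ (fun k => ?_) k
      · simpa [hϱ0] using hρ
      · simpa [hϱ] using hz k
  · filter_upwards [Metric.ball_mem_nhds _ hr0] with z hz
    have hzP := hrP hz
    have h1 := eq_sum_add_pow_mul_iterate_tau 0 F b z
    rw [hQ z hzP, update_zero_eq_cons_tail] at h1
    have h2 : f z = F z + h z * Q z := by simp only [hF]; ring
    have h3 : (U z)⁻¹ * U z = 1 := inv_mul_cancel₀ (hUne z hzP)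
    rw [h2, h1]
    simp only [hh]
    linear_combination (-Q z * z 0 ^ b) * h3

/-- A ring in which every nonzero element divides, after an automorphism, with remainder in a
fixed finitely generated module over a Noetherian ring is Noetherian. -/
lemma isNoetherianRing_of_division {R S : Type*} [CommRing R] [CommRing S]
    [IsNoetherianRing R] (π : R →+* S) (t : S)
    (h : ∀ x : S, x ≠ 0 → ∃ (e : S ≃+* S) (b : ℕ), ∀ y, ∃ (q : S) (c : ℕ → R),
      y = q * e x + ∑ j ∈ Finset.range b, π (c j) * t ^ j) :
    IsNoetherianRing S := by
  let _ : Algebra R S := π.toAlgebra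
  rw [isNoetherianRing_iff_ideal_fg]
  intro I
  by_cases hI : I = ⊥
  · rw [hI]
    exact Submodule.fg_bot
  obtain ⟨x, hxI, hx0⟩ := Submodule.exists_mem_ne_zero_of_ne_bot hI
  obtain ⟨e, b, he⟩ := h x hx0
  set N := Submodule.span R ((fun j : ℕ => t ^ j) '' (Finset.range b : Set ℕ)) with hN
  have hNoeth : IsNoetherian R N :=
    isNoetherian_span_of_finite R ((Finset.finite_toSet _).image _)
  set J : Ideal S := I.map (e : S →+* S) with hJ
  have hex : e x ∈ J := Ideal.mem_map_of_mem (e : S →+* S) hxI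
  obtain ⟨s, hs⟩ := isNoetherian_submodule.1 hNoeth (J.restrictScalars R ⊓ N) inf_le_right
  have hJfg : J.FG := by
    refine Submodule.fg_def.2 ⟨insert (e x) (s : Set S), s.finite_toSet.insert _, ?_⟩
    apply le_antisymm
    · rw [Submodule.span_le]
      refine Set.insert_subset hex fun y hy => ?_
      have : y ∈ J.restrictScalars R ⊓ N := hs ▸ Submodule.subset_span hy
      exact this.1
    · intro y hy
      obtain ⟨q, c, hqc⟩ := he y
      have hq : y - q * e x ∈ N := by
        rw [hqc, add_sub_cancel_left]
        refine Submodule.sum_mem _ fun j hj => ?_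
        have h1 := Submodule.smul_mem N (c j)
          (Submodule.subset_span ⟨j, by simpa using hj, rfl⟩ : t ^ j ∈ N)
        rwa [Algebra.smul_def] at h1
      have h1 : y - q * e x ∈ J.restrictScalars R ⊓ N :=
        ⟨J.sub_mem hy (J.mul_mem_left q hex), hq⟩
      rw [← hs] at h1
      have h2 : y - q * e x ∈ Submodule.span S (insert (e x) (s : Set S)) :=
        Submodule.span_mono (Set.subset_insert _ _) (Submodule.span_le_restrictScalars R S _ h1)
      have h3 : q * e x ∈ Submodule.span S (insert (e x) (s : Set S)) :=
        Ideal.mul_mem_left _ q (Submodule.subset_span (Set.mem_insert _ _))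
      simpa using add_mem h2 h3
  have hIJ : I = J.map (e.symm : S →+* S) := by
    rw [hJ, Ideal.map_map]
    simp
  rw [hIJ]
  exact hJfg.map _

lemma HoloNear.add {f g : Cn n → ℂ} (hf : HoloNear f) (hg : HoloNear g) :
    HoloNear fun z => f z + g z := by
  obtain ⟨U, hU, hUo, hd⟩ := hf
  obtain ⟨V, hV, hVo, hd'⟩ := hg
  exact ⟨U ∩ V, inter_mem hU hV, hUo.inter hVo,
    (hd.mono Set.inter_subset_left).fun_add (hd'.mono Set.inter_subset_right)⟩

lemma HoloNear.mul {f g : Cn n → ℂ} (hf : HoloNear f) (hg : HoloNear g) :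
    HoloNear fun z => f z * g z := by
  obtain ⟨U, hU, hUo, hd⟩ := hf
  obtain ⟨V, hV, hVo, hd'⟩ := hg
  exact ⟨U ∩ V, inter_mem hU hV, hUo.inter hVo,
    (hd.mono Set.inter_subset_left).fun_mul (hd'.mono Set.inter_subset_right)⟩

lemma holoNear_of_differentiable {f : Cn n → ℂ} (hf : Differentiable ℂ f) : HoloNear f :=
  ⟨Set.univ, univ_mem, isOpen_univ, hf.differentiableOn⟩

lemma HoloNear.comp {m : ℕ} {f : Cn n → ℂ} (hf : HoloNear f) (A : Cn m →L[ℂ] Cn n) :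
    HoloNear (f ∘ A) := by
  obtain ⟨U, hU, hUo, hd⟩ := hf
  refine ⟨A ⁻¹' U, A.continuous.continuousAt.preimage_mem_nhds (by simpa using hU),
    hUo.preimage A.continuous, hd.comp A.differentiable.differentiableOn fun z hz => hz⟩

/-- The algebra of functions that are holomorphic near the origin. -/
def holoSub (n : ℕ) : Subalgebra ℂ (Cn n → ℂ) where
  carrier := {f | HoloNear f}
  mul_mem' hf hg := HoloNear.mul hf hg
  add_mem' hf hg := HoloNear.add hf hg
  algebraMap_mem' c := holoNear_of_differentiable (differentiable_const c)

/-- The ideal of functions vanishing near the origin. -/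
def germZero (n : ℕ) : Ideal (holoSub n) where
  carrier := {f | ∀ᶠ z in 𝓝 (0 : Cn n), f.1 z = 0}
  add_mem' {f g} hf hg := by
    filter_upwards [hf, hg] with z h1 h2
    simp [h1, h2]
  zero_mem' := Eventually.of_forall fun _ => rfl
  smul_mem' c f hf := by
    filter_upwards [hf] with z h1
    simp [h1]

/-- The ring of germs at the origin of holomorphic functions. -/
def HoloGerm (n : ℕ) : Type := holoSub n ⧸ germZero n

instance (n : ℕ) : CommRing (HoloGerm n) := inferInstanceAs (CommRing (holoSub n ⧸ germZero n))

instance (n : ℕ) : Algebra ℂ (HoloGerm n) :=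
  inferInstanceAs (Algebra ℂ (holoSub n ⧸ germZero n))

/-- The projection from functions to germs. -/
def germMk (n : ℕ) : holoSub n →ₐ[ℂ] HoloGerm n := Ideal.Quotient.mkₐ ℂ (germZero n)

/-- The germ of a function that is holomorphic near the origin. -/
def toGerm (f : Cn n → ℂ) (hf : HoloNear f) : HoloGerm n :=
  germMk n ⟨f, hf⟩

lemma exists_toGerm_eq (x : HoloGerm n) : ∃ (f : Cn n → ℂ) (hf : HoloNear f), toGerm f hf = x := by
  obtain ⟨⟨f, hf⟩, rfl⟩ := Ideal.Quotient.mk_surjective x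
  exact ⟨f, hf, rfl⟩

lemma toGerm_eq_toGerm {f g : Cn n → ℂ} {hf : HoloNear f} {hg : HoloNear g} :
    toGerm f hf = toGerm g hg ↔ ∀ᶠ z in 𝓝 0, f z = g z := by
  refine (Ideal.Quotient.eq (I := germZero n) (x := ⟨f, hf⟩) (y := ⟨g, hg⟩)).trans ?_
  refine eventually_congr (Eventually.of_forall fun z => ?_)
  simp [sub_eq_zero]

lemma toGerm_eq_zero {f : Cn n → ℂ} {hf : HoloNear f} :
    toGerm f hf = 0 ↔ ∀ᶠ z in 𝓝 0, f z = 0 :=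
  Ideal.Quotient.eq_zero_iff_mem

lemma toGerm_mul {f g : Cn n → ℂ} (hf : HoloNear f) (hg : HoloNear g) :
    toGerm f hf * toGerm g hg = toGerm (fun z => f z * g z) (hf.mul hg) := rfl

lemma toGerm_add {f g : Cn n → ℂ} (hf : HoloNear f) (hg : HoloNear g) :
    toGerm f hf + toGerm g hg = toGerm (fun z => f z + g z) (hf.add hg) := rfl

/-- Pull-back of germs along a linear map. -/
def germComp {m : ℕ} (A : Cn m →L[ℂ] Cn n) : HoloGerm n →+* HoloGerm m :=
  Ideal.Quotient.lift (germZero n)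
    ((Ideal.Quotient.mk (germZero m)).comp
      { toFun := fun f => ⟨f.1 ∘ A, HoloNear.comp f.2 A⟩
        map_one' := rfl
        map_mul' := fun _ _ => rfl
        map_zero' := rfl
        map_add' := fun _ _ => rfl })
    fun f hf => by
      refine Ideal.Quotient.eq_zero_iff_mem.2 ?_
      have h : Tendsto A (𝓝 0) (𝓝 0) := by simpa using A.continuous.tendsto 0
      exact h.eventually hf

lemma germComp_toGerm {m : ℕ} (A : Cn m →L[ℂ] Cn n) {f : Cn n → ℂ} (hf : HoloNear f) :
    germComp A (toGerm f hf) = toGerm (f ∘ A) (hf.comp A) := rfl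

/-- Pull-back of germs along a linear automorphism. -/
def germEquiv (L : Cn n ≃L[ℂ] Cn n) : HoloGerm n ≃+* HoloGerm n :=
  RingEquiv.ofRingHom (germComp (L : Cn n →L[ℂ] Cn n)) (germComp (L.symm : Cn n →L[ℂ] Cn n))
    (by
      refine RingHom.ext fun x => ?_
      obtain ⟨f, hf, rfl⟩ := exists_toGerm_eq x
      simp only [RingHom.comp_apply, germComp_toGerm, RingHom.id_apply]
      refine toGerm_eq_toGerm.2 (Eventually.of_forall fun z => ?_)
      simp)
    (by
      refine RingHom.ext fun x => ?_
      obtain ⟨f, hf, rfl⟩ := exists_toGerm_eq x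
      simp only [RingHom.comp_apply, germComp_toGerm, RingHom.id_apply]
      refine toGerm_eq_toGerm.2 (Eventually.of_forall fun z => ?_)
      simp)

lemma germEquiv_toGerm (L : Cn n ≃L[ℂ] Cn n) {f : Cn n → ℂ} (hf : HoloNear f) :
    germEquiv L (toGerm f hf) = toGerm (f ∘ L) (hf.comp (L : Cn n →L[ℂ] Cn n)) := rfl

/-- A nonzero germ does not vanish identically along some complex line. -/
lemma exists_line_not_eventually_zero {f : Cn (n + 1) → ℂ} (hf : HoloNear f)
    (h : ¬ ∀ᶠ z in 𝓝 0, f z = 0) :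
    ∃ w : Cn (n + 1), w ≠ 0 ∧ ¬ ∀ᶠ ζ in 𝓝 (0 : ℂ), f (ζ • w) = 0 := by
  obtain ⟨r, -, hr, hd, -⟩ := hf.exists_ball
  have h1 : ∃ z ∈ Metric.ball (0 : Cn (n + 1)) r, f z ≠ 0 := by
    by_contra! hcon
    exact h (eventually_of_mem (Metric.ball_mem_nhds _ hr) hcon)
  obtain ⟨z, hz, hfz⟩ := h1
  by_cases hz0 : z = 0
  · refine ⟨Pi.single 0 1, by simp, fun hcon => hfz ?_⟩
    have := hcon.self_of_nhds
    rwa [zero_smul, ← hz0] at this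
  refine ⟨z, hz0, fun hcon => hfz ?_⟩
  have hzn : 0 < ‖z‖ := norm_pos_iff.2 hz0
  have hmaps : Set.MapsTo (fun ζ : ℂ => ζ • z) (Metric.ball 0 (r / ‖z‖)) (Metric.ball 0 r) := by
    intro ζ hζ
    rw [mem_ball_zero_iff] at hζ ⊢
    rw [norm_smul]
    exact (lt_div_iff₀ hzn).1 hζ
  have han : AnalyticOnNhd ℂ (fun ζ : ℂ => f (ζ • z)) (Metric.ball 0 (r / ‖z‖)) := by
    refine DifferentiableOn.analyticOnNhd (hd.comp ?_ hmaps) Metric.isOpen_ball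
    exact (differentiable_id.smul_const z).differentiableOn
  have h2 := han.eqOn_zero_of_preconnected_of_eventuallyEq_zero
    (convex_ball (0 : ℂ) _).isPreconnected (Metric.mem_ball_self (by positivity)) hcon
  have h3 : (1 : ℂ) ∈ Metric.ball (0 : ℂ) (r / ‖z‖) := by
    rw [mem_ball_zero_iff] at hz ⊢
    rw [norm_one]
    exact (one_lt_div hzn).2 hz
  simpa using h2 h3

/-- A germ that does not vanish along the first axis has a finite order along it. -/
lemma exists_order {g : Cn (n + 1) → ℂ} (hg : HoloNear g)
    (h : ¬ ∀ᶠ ζ in 𝓝 (0 : ℂ), g (ζ • Pi.single 0 1) = 0) :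
    ∃ b, (∀ j < b, (tau 0)^[j] g 0 = 0) ∧ (tau 0)^[b] g 0 ≠ 0 := by
  have hex : ∃ b, (tau 0)^[b] g 0 ≠ 0 := by
    by_contra! hcon
    apply h
    obtain ⟨r, M, hr, hd, hM⟩ := hg.exists_ball
    rw [← polyD_const hr] at hd hM
    filter_upwards [Metric.ball_mem_nhds (0 : ℂ) (half_pos hr)] with ζ hζ
    rw [mem_ball_zero_iff] at hζ
    set z : Cn (n + 1) := ζ • Pi.single 0 1 with hz
    have hz0 : z 0 = ζ := by simp [hz]
    have hup : Function.update z 0 0 = 0 := by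
      ext j
      refine Fin.cases ?_ (fun k => ?_) j <;> simp [hz]
    have hzP : z ∈ polyD fun _ => r := by
      intro j
      refine Fin.cases ?_ (fun k => ?_) j
      · rw [hz0]; linarith
      · simpa [hz] using hr
    have hle : ∀ b : ℕ, ‖g z‖ ≤ (‖ζ‖ * (2 / r)) ^ b * M := by
      intro b
      have h1 := eq_sum_add_pow_mul_iterate_tau 0 g b z
      rw [hup, Finset.sum_eq_zero (fun j _ => by rw [hcon j, zero_mul]), zero_add, hz0] at h1
      rw [h1, norm_mul, norm_pow, mul_pow, mul_assoc]
      gcongr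
      exact norm_iterate_tau_le hd hM b hzP
    have hlt : ‖ζ‖ * (2 / r) < 1 := by
      rw [← lt_div_iff₀ (by positivity)]
      simpa using hζ
    have hlim : Tendsto (fun b : ℕ => (‖ζ‖ * (2 / r)) ^ b * M) atTop (𝓝 0) := by
      simpa using (tendsto_pow_atTop_nhds_zero_of_lt_one (by positivity) hlt).mul_const M
    exact norm_le_zero_iff.1 (ge_of_tendsto' hlim hle)
  classical
  exact ⟨Nat.find hex, fun j hj => not_not.1 (Nat.find_min hex hj), Nat.find_spec hex⟩

/-- The projection `(z₀, z') ↦ z'`. -/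
def tailCLM (n : ℕ) : Cn (n + 1) →L[ℂ] Cn n :=
  ContinuousLinearMap.pi fun j => ContinuousLinearMap.proj j.succ

lemma holoNear_apply (i : Fin n) : HoloNear fun z : Cn n => z i :=
  holoNear_of_differentiable (differentiable_apply i)

lemma toGerm_sum {ι : Type*} (s : Finset ι) {f : ι → Cn n → ℂ} (hf : ∀ i, HoloNear (f i))
    (h : HoloNear fun z => ∑ i ∈ s, f i z) :
    toGerm (fun z => ∑ i ∈ s, f i z) h = ∑ i ∈ s, toGerm (f i) (hf i) := by
  unfold toGerm
  rw [← map_sum]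
  congr 1
  ext z
  simp

theorem isNoetherianRing_holoGerm (n : ℕ) : IsNoetherianRing (HoloGerm n) := by
  induction n with
  | zero =>
    refine isNoetherianRing_of_surjective ℂ _ (algebraMap ℂ (HoloGerm 0)) fun x => ?_
    obtain ⟨f, hf, rfl⟩ := exists_toGerm_eq x
    refine ⟨f 0, ?_⟩
    change toGerm (fun _ => f 0) (holoNear_of_differentiable (differentiable_const _)) = _
    exact toGerm_eq_toGerm.2 (Eventually.of_forall fun z => by rw [Subsingleton.elim z 0])
  | succ n ih =>
    refine isNoetherianRing_of_division (R := HoloGerm n) (S := HoloGerm (n + 1))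
      (germComp (tailCLM n)) (toGerm _ (holoNear_apply 0)) ?_
    intro x hx
    obtain ⟨f, hf, rfl⟩ := exists_toGerm_eq x
    obtain ⟨w, hw, hfw⟩ := exists_line_not_eventually_zero hf (mt toGerm_eq_zero.2 hx)
    obtain ⟨L, hL⟩ := SeparatingDual.exists_continuousLinearEquiv_apply_eq (R := ℂ)
      (x := (Pi.single 0 1 : Cn (n + 1))) (y := w) (by simp) hw
    have hg := hf.comp (L : Cn (n + 1) →L[ℂ] Cn (n + 1))
    obtain ⟨b, hlt, hb⟩ := exists_order hg (by simpa [hL] using hfw)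
    refine ⟨germEquiv L, b, fun y => ?_⟩
    obtain ⟨h, hh, rfl⟩ := exists_toGerm_eq y
    obtain ⟨q, hq, c, hc, hev⟩ := weierstrass_division hh hg hlt hb
    refine ⟨toGerm q hq, fun j => toGerm (c j) (hc j), ?_⟩
    have hterm : ∀ j, HoloNear fun z : Cn (n + 1) => c j (Fin.tail z) * z 0 ^ j := fun j =>
      ((hc j).comp (tailCLM n)).mul
        (holoNear_of_differentiable ((differentiable_apply 0).pow j))
    have hsum : HoloNear fun z : Cn (n + 1) => ∑ j ∈ Finset.range b, c j (Fin.tail z) * z 0 ^ j := by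
      have h1 : HoloNear (∑ j ∈ Finset.range b, fun z : Cn (n + 1) => c j (Fin.tail z) * z 0 ^ j) :=
        (holoSub (n + 1)).sum_mem (t := Finset.range b) fun j _ => hterm j
      convert h1 using 1
      ext z
      simp
    have h1 : toGerm h hh = toGerm _ ((hq.mul hg).add hsum) := toGerm_eq_toGerm.2 hev
    rw [h1, ← toGerm_add (hq.mul hg) hsum, ← toGerm_mul hq hg, toGerm_sum _ hterm]
    rfl

/-- Evaluation of germs at the origin. -/
def germEval (n : ℕ) : HoloGerm n →+* ℂ :=
  Ideal.Quotient.lift (germZero n)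
    { toFun := fun f => f.1 0
      map_one' := rfl
      map_mul' := fun _ _ => rfl
      map_zero' := rfl
      map_add' := fun _ _ => rfl }
    fun f hf => Eventually.self_of_nhds (p := fun z => f.1 z = 0) hf

lemma germEval_toGerm {f : Cn n → ℂ} (hf : HoloNear f) : germEval n (toGerm f hf) = f 0 := rfl

/-- The ideal of germs vanishing at the origin. -/
def germMax (n : ℕ) : Ideal (HoloGerm n) := RingHom.ker (germEval n)

lemma toGerm_mem_germMax {f : Cn n → ℂ} (hf : HoloNear f) :
    toGerm f hf ∈ germMax n ↔ f 0 = 0 := Iff.rfl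

lemma isUnit_of_germEval_ne_zero {x : HoloGerm n} (hx : germEval n x ≠ 0) : IsUnit x := by
  obtain ⟨f, hf, rfl⟩ := exists_toGerm_eq x
  rw [germEval_toGerm] at hx
  obtain ⟨r, -, hr, hd, -⟩ := hf.exists_ball
  have hc : ContinuousAt f 0 := (hd.differentiableAt (Metric.ball_mem_nhds _ hr)).continuousAt
  obtain ⟨δ, hδ, hne⟩ := Metric.eventually_nhds_iff_ball.1
    ((hc.eventually_ne hx).and (Metric.ball_mem_nhds (0 : Cn n) hr))
  have hinv : HoloNear fun z => (f z)⁻¹ := holoNear_of_ball hδ fun z hz =>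
    (DifferentiableAt.comp z (differentiableAt_inv (hne z hz).1)
      (hd.differentiableAt (Metric.isOpen_ball.mem_nhds (hne z hz).2))).differentiableWithinAt
  refine IsUnit.of_mul_eq_one (toGerm _ hinv) ?_
  rw [toGerm_mul hf hinv]
  refine toGerm_eq_toGerm (hg := holoNear_of_differentiable (differentiable_const 1)).2 ?_
  filter_upwards [Metric.ball_mem_nhds _ hδ] with z hz
  exact mul_inv_cancel₀ (hne z hz).1

lemma germMax_le_jacobson (n : ℕ) : germMax n ≤ Ideal.jacobson ⊥ := by
  intro x hx
  rw [Ideal.mem_jacobson_bot]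
  intro y
  refine isUnit_of_germEval_ne_zero ?_
  have h0 : germEval n x = 0 := hx
  simp [h0]

/-- An ideal of germs is the intersection of its neighbourhoods for the adic topology. -/
lemma mem_of_forall_mem_sup_pow {I : Ideal (HoloGerm n)} {x : HoloGerm n}
    (h : ∀ k : ℕ, x ∈ I ⊔ germMax n ^ k) : x ∈ I := by
  have := isNoetherianRing_holoGerm n
  have hkrull := Ideal.iInf_pow_smul_eq_bot_of_le_jacobson (M := HoloGerm n ⧸ I) _
    (germMax_le_jacobson n)
  rw [← Ideal.Quotient.eq_zero_iff_mem, ← Submodule.mem_bot (HoloGerm n), ← hkrull,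
    Submodule.mem_iInf]
  intro k
  obtain ⟨a, ha, c, hc, rfl⟩ := Submodule.mem_sup.1 (h k)
  rw [map_add, Ideal.Quotient.eq_zero_iff_mem.2 ha, zero_add]
  have h1 := Submodule.smul_mem_smul hc (Submodule.mem_top (x := (1 : HoloGerm n ⧸ I)))
  rwa [Algebra.smul_def, mul_one] at h1

/-- The projection annihilating the coordinates in `S`. -/
def mask (S : Finset (Fin n)) (z : Cn n) : Cn n := fun j => if j ∈ S then 0 else z j

lemma differentiable_mask (S : Finset (Fin n)) : Differentiable ℂ (mask S) := by
  refine differentiable_pi.2 fun j => ?_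
  by_cases hj : j ∈ S
  · simp [mask, hj]
  · simpa [mask, hj] using differentiable_apply j

lemma mask_mem_ball {S : Finset (Fin n)} {z : Cn n} {r : ℝ} (hz : z ∈ Metric.ball (0 : Cn n) r) :
    mask S z ∈ Metric.ball (0 : Cn n) r := by
  have hr : 0 < r := Metric.pos_of_mem_ball hz
  rw [← polyD_const hr] at hz ⊢
  intro j
  by_cases hj : j ∈ S
  · simpa [mask, hj] using hr
  · simpa [mask, hj] using hz j

lemma mask_insert [DecidableEq (Fin n)] (i : Fin n) (S : Finset (Fin n)) (z : Cn n) :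
    mask (insert i S) z = mask S (Function.update z i 0) := by
  ext j
  by_cases hj : j = i
  · subst hj; simp [mask]
  · simp [mask, hj]

/-- A linear functional on germs that vanishes on a power of the maximal ideal is bounded for the
sup norm on balls. -/
lemma exists_norm_functional_le {r : ℝ} (hr : 0 < r) (k : ℕ) (ℓ : HoloGerm n →ₗ[ℂ] ℂ)
    (hℓ : ∀ x ∈ germMax n ^ k, ℓ x = 0) :
    ∃ K : ℝ, 0 ≤ K ∧ ∀ (F : Cn n → ℂ) (hF : DifferentiableOn ℂ F (Metric.ball 0 r)) (M : ℝ),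
      (∀ z ∈ Metric.ball (0 : Cn n) r, ‖F z‖ ≤ M) → ‖ℓ (toGerm F (holoNear_of_ball hr hF))‖ ≤ K * M := by
  induction k generalizing ℓ with
  | zero =>
    refine ⟨0, le_rfl, fun F hF M _ => ?_⟩
    rw [hℓ _ (by simp), norm_zero, zero_mul]
  | succ k ih =>
    have hcoord : ∀ i : Fin n, ∃ K : ℝ, 0 ≤ K ∧
        ∀ (F : Cn n → ℂ) (hF : DifferentiableOn ℂ F (Metric.ball 0 r)) (M : ℝ),
        (∀ z ∈ Metric.ball (0 : Cn n) r, ‖F z‖ ≤ M) →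
        ‖ℓ (toGerm _ (holoNear_apply i) * toGerm F (holoNear_of_ball hr hF))‖ ≤ K * M := by
      intro i
      refine ih (ℓ ∘ₗ LinearMap.mulLeft ℂ (toGerm _ (holoNear_apply i))) fun x hx => ?_
      refine hℓ _ ?_
      rw [pow_succ']
      exact Ideal.mul_mem_mul ((toGerm_mem_germMax _).2 rfl) hx
    have hmaskd : ∀ (S : Finset (Fin n)) {F : Cn n → ℂ}, DifferentiableOn ℂ F (Metric.ball 0 r) →
        DifferentiableOn ℂ (F ∘ mask S) (Metric.ball 0 r) := fun S F hF =>
      hF.comp (differentiable_mask S).differentiableOn fun z hz => mask_mem_ball hz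
    have hstep : ∀ S : Finset (Fin n), ∃ K : ℝ, 0 ≤ K ∧
        ∀ (F : Cn n → ℂ) (hF : DifferentiableOn ℂ F (Metric.ball 0 r)) (M : ℝ),
        (∀ z ∈ Metric.ball (0 : Cn n) r, ‖F z‖ ≤ M) →
        ‖ℓ (toGerm F (holoNear_of_ball hr hF)) -
          ℓ (toGerm (F ∘ mask S) (holoNear_of_ball hr (hmaskd S hF)))‖ ≤ K * M := by
      intro S
      induction S using Finset.induction_on with
      | empty =>
        refine ⟨0, le_rfl, fun F hF M _ => ?_⟩
        have : F ∘ mask ∅ = F := by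
          ext z
          exact congrArg F (funext fun j => by simp [mask])
        simp [this]
      | insert i S hi ihS =>
        obtain ⟨K, hK, hKb⟩ := ihS
        obtain ⟨K', hK', hKb'⟩ := hcoord i
        refine ⟨K + K' * (2 / r), by positivity, fun F hF M hM => ?_⟩
        set G := F ∘ mask S with hG
        have hGd : DifferentiableOn ℂ G (Metric.ball 0 r) := hmaskd S hF
        have hGM : ∀ z ∈ Metric.ball (0 : Cn n) r, ‖G z‖ ≤ M := fun z hz => hM _ (mask_mem_ball hz)
        have hTd : DifferentiableOn ℂ (tau i G) (Metric.ball 0 r) := by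
          rw [← polyD_const hr] at hGd ⊢
          exact differentiableOn_tau hGd
        have hTM : ∀ z ∈ Metric.ball (0 : Cn n) r, ‖tau i G z‖ ≤ 2 / r * M := by
          rw [← polyD_const hr] at hGd hGM ⊢
          exact fun z hz => norm_tau_le hGd hGM hz
        have hsplit : toGerm G (holoNear_of_ball hr hGd) =
            toGerm (F ∘ mask (insert i S)) (holoNear_of_ball hr (hmaskd _ hF)) +
              toGerm _ (holoNear_apply i) * toGerm _ (holoNear_of_ball hr hTd) := by
          rw [toGerm_mul, toGerm_add]
          refine toGerm_eq_toGerm.2 (Eventually.of_forall fun z => ?_)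
          rw [eq_add_mul_tau i G z]
          simp [hG, mask_insert]
        have h1 := hKb F hF M hM
        have h2 := hKb' _ hTd _ hTM
        rw [hsplit, map_add] at h1
        calc _ = ‖(ℓ (toGerm F (holoNear_of_ball hr hF)) -
                (ℓ (toGerm (F ∘ mask (insert i S)) (holoNear_of_ball hr (hmaskd _ hF))) +
                  ℓ (toGerm _ (holoNear_apply i) * toGerm _ (holoNear_of_ball hr hTd)))) +
                ℓ (toGerm _ (holoNear_apply i) * toGerm _ (holoNear_of_ball hr hTd))‖ := by
              congr 1; ring
          _ ≤ K * M + K' * (2 / r * M) := (norm_add_le _ _).trans (add_le_add h1 h2)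
          _ = _ := by ring
    obtain ⟨K, hK, hKb⟩ := hstep Finset.univ
    refine ⟨K + ‖ℓ 1‖, by positivity, fun F hF M hM => ?_⟩
    have hconst : toGerm (F ∘ mask Finset.univ) (holoNear_of_ball hr (hmaskd _ hF)) =
        F 0 • (1 : HoloGerm n) := by
      have hm : F ∘ mask Finset.univ = fun _ => F 0 * 1 := by
        ext z
        rw [Function.comp_apply, mul_one]
        congr 1
        ext j
        simp [mask]
      simp only [hm]
      rfl
    have h1 := hKb F hF M hM
    rw [hconst, map_smul, smul_eq_mul] at h1
    have h2 : ‖F 0 * ℓ 1‖ ≤ M * ‖ℓ 1‖ := by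
      rw [norm_mul]
      have := hM 0 (Metric.mem_ball_self hr)
      gcongr
    calc _ = ‖(ℓ (toGerm F (holoNear_of_ball hr hF)) - F 0 * ℓ 1) + F 0 * ℓ 1‖ := by
          rw [sub_add_cancel]
      _ ≤ K * M + M * ‖ℓ 1‖ := (norm_add_le _ _).trans (add_le_add h1 h2)
      _ = _ := by ring

/-- Ideals of germs are closed under uniform convergence. -/
theorem toGerm_mem_of_approx {I : Ideal (HoloGerm n)} {r : ℝ} (hr : 0 < r) {f : Cn n → ℂ}
    (hf : HoloNear f)
    (h : ∀ ε : ℝ, 0 < ε → ∃ (F : Cn n → ℂ) (hF : DifferentiableOn ℂ F (Metric.ball 0 r)),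
      (∀ z ∈ Metric.ball (0 : Cn n) r, ‖F z‖ ≤ ε) ∧
        toGerm f hf - toGerm F (holoNear_of_ball hr hF) ∈ I) :
    toGerm f hf ∈ I := by
  refine mem_of_forall_mem_sup_pow fun k => ?_
  by_contra hk
  obtain ⟨ℓ, hℓf, hℓ⟩ := Submodule.exists_le_ker_of_notMem
    (p := (I ⊔ germMax n ^ k).restrictScalars ℂ) (v := toGerm f hf) hk
  have hI : ∀ x ∈ I, ℓ x = 0 := fun x hx => hℓ (Submodule.mem_sup_left hx)
  obtain ⟨K, hK, hKb⟩ := exists_norm_functional_le hr k ℓ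
    fun x hx => hℓ (Submodule.mem_sup_right hx)
  have hpos : 0 < ‖ℓ (toGerm f hf)‖ := norm_pos_iff.2 hℓf
  obtain ⟨F, hF, hFb, hFI⟩ := h (‖ℓ (toGerm f hf)‖ / (2 * (K + 1))) (by positivity)
  have h1 := hKb F hF _ hFb
  have h2 := hI _ hFI
  rw [map_sub, sub_eq_zero] at h2
  rw [← h2] at h1
  have h3 : K * (‖ℓ (toGerm f hf)‖ / (2 * (K + 1))) < ‖ℓ (toGerm f hf)‖ := by
    rw [mul_div_assoc', div_lt_iff₀ (by positivity)]
    nlinarith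
  linarith

lemma IntNear.mono {g h : Cn n → ℝ≥0∞} (hg : IntNear g) {c : ℝ≥0∞} (hc : c ≠ ⊤)
    (hle : ∀ᶠ z in 𝓝 0, h z ≤ c * g z) : IntNear h := by
  obtain ⟨U, hU, hint⟩ := hg
  obtain ⟨ε, hε, hb⟩ := Metric.eventually_nhds_iff_ball.1 (hle.and hU)
  refine ⟨_, Metric.ball_mem_nhds _ hε, ?_⟩
  calc ∫⁻ z in Metric.ball 0 ε, h z ≤ ∫⁻ z in Metric.ball 0 ε, c * g z :=
        setLIntegral_mono' measurableSet_ball fun z hz => (hb z hz).1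
    _ = c * ∫⁻ z in Metric.ball 0 ε, g z := lintegral_const_mul' _ _ hc
    _ < ⊤ := ENNReal.mul_lt_top hc.lt_top
        ((lintegral_mono_set fun z hz => (hb z hz).2).trans_lt hint)

lemma IntNear.add {g h : Cn n → ℝ≥0∞} {r : ℝ} (hr : 0 < r) (hg : IntNear g) (hh : IntNear h)
    (hm : AEMeasurable g (volume.restrict (Metric.ball 0 r))) : IntNear fun z => g z + h z := by
  obtain ⟨U, hU, hgi⟩ := hg
  obtain ⟨V, hV, hhi⟩ := hh
  obtain ⟨ε, hε, hb⟩ := Metric.nhds_basis_ball.mem_iff.1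
    (inter_mem (inter_mem hU hV) (Metric.ball_mem_nhds _ hr))
  refine ⟨_, Metric.ball_mem_nhds _ hε, ?_⟩
  rw [lintegral_add_left' (hm.mono_measure (Measure.restrict_mono (fun z hz => (hb hz).2) le_rfl))]
  exact ENNReal.add_lt_top.2
    ⟨(lintegral_mono_set fun z hz => (hb hz).1.1).trans_lt hgi,
      (lintegral_mono_set fun z hz => (hb hz).1.2).trans_lt hhi⟩

lemma HoloNear.exists_aemeasurable {f : Cn n → ℂ} (hf : HoloNear f) {W : Cn n → ℝ≥0∞} {r : ℝ}
    (hr : 0 < r) (hW : AEMeasurable W (volume.restrict (Metric.ball 0 r))) :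
    ∃ s : ℝ, 0 < s ∧
      AEMeasurable (fun z => ‖f z‖ₑ ^ 2 * W z) (volume.restrict (Metric.ball 0 s)) := by
  obtain ⟨s, -, hs, hd, -⟩ := hf.exists_ball
  refine ⟨min r s, lt_min hr hs, ?_⟩
  have h1 : AEMeasurable f (volume.restrict (Metric.ball 0 (min r s))) :=
    (hd.continuousOn.mono (Metric.ball_subset_ball (min_le_right _ _))).aemeasurable
      measurableSet_ball
  exact (h1.enorm.pow_const 2).mul
    (hW.mono_measure (Measure.restrict_mono (Metric.ball_subset_ball (min_le_left _ _)) le_rfl))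

/-- The ideal of germs `f` with `|f|² W` integrable near the origin. -/
def multIdeal (W : Cn n → ℝ≥0∞) {r : ℝ} (hr : 0 < r)
    (hW : AEMeasurable W (volume.restrict (Metric.ball 0 r))) : Ideal (HoloGerm n) where
  carrier := {x | ∃ (f : Cn n → ℂ) (hf : HoloNear f), toGerm f hf = x ∧
    IntNear fun z => ‖f z‖ₑ ^ 2 * W z}
  add_mem' := by
    rintro _ _ ⟨f, hf, rfl, hfi⟩ ⟨g, hg, rfl, hgi⟩
    refine ⟨_, hf.add hg, (toGerm_add hf hg).symm, ?_⟩
    obtain ⟨s, hs, hm⟩ := hf.exists_aemeasurable hr hW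
    refine (IntNear.add hs hfi hgi hm).mono (c := 2) (by simp) (Eventually.of_forall fun z => ?_)
    have h1 := enorm_sq_le (f z + g z) (g z)
    rw [add_sub_cancel_right] at h1
    calc ‖f z + g z‖ₑ ^ 2 * W z ≤ (2 * ‖f z‖ₑ ^ 2 + 2 * ‖g z‖ₑ ^ 2) * W z := mul_le_mul_left h1 _
      _ = _ := by ring
  zero_mem' := ⟨fun _ => 0, holoNear_of_differentiable (differentiable_const 0), rfl,
    Set.univ, univ_mem, by simp⟩
  smul_mem' := by
    rintro c _ ⟨f, hf, rfl, hfi⟩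
    obtain ⟨g, hg, rfl⟩ := exists_toGerm_eq c
    refine ⟨_, hg.mul hf, (toGerm_mul hg hf).symm, ?_⟩
    obtain ⟨s, M, hs, -, hM⟩ := hg.exists_ball
    refine hfi.mono (c := ENNReal.ofReal M ^ 2) (by simp) ?_
    filter_upwards [Metric.ball_mem_nhds _ hs] with z hz
    rw [enorm_mul, mul_pow, mul_assoc]
    have h1 : ‖g z‖ₑ ≤ ENNReal.ofReal M := by
      rw [← ofReal_norm]
      exact ENNReal.ofReal_le_ofReal (hM z hz)
    gcongr

lemma toGerm_mem_multIdeal {W : Cn n → ℝ≥0∞} {r : ℝ} {hr : 0 < r}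
    {hW : AEMeasurable W (volume.restrict (Metric.ball 0 r))} {f : Cn n → ℂ} {hf : HoloNear f} :
    toGerm f hf ∈ multIdeal W hr hW ↔ IntNear fun z => ‖f z‖ₑ ^ 2 * W z := by
  refine ⟨?_, fun h => ⟨f, hf, rfl, h⟩⟩
  rintro ⟨g, hg, hgf, hgi⟩
  refine hgi.mono ENNReal.one_ne_top ?_
  filter_upwards [toGerm_eq_toGerm.1 hgf] with z hz
  rw [hz, one_mul]

lemma toGerm_sub {f g : Cn n → ℂ} (hf : HoloNear f) (hg : HoloNear g)
    (h : HoloNear fun z => f z - g z) :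
    toGerm f hf - toGerm g hg = toGerm (fun z => f z - g z) h :=
  (map_sub (germMk n) ⟨f, hf⟩ ⟨g, hg⟩).symm

lemma IntNear.sum {ι : Type*} (s : Finset ι) {f : ι → Cn n → ℂ} (hf : ∀ i, HoloNear (f i))
    {W : Cn n → ℝ≥0∞} {r : ℝ} (hr : 0 < r)
    (hW : AEMeasurable W (volume.restrict (Metric.ball 0 r)))
    (h : ∀ i, IntNear fun z => ‖f i z‖ₑ ^ 2 * W z) :
    IntNear fun z => ∑ i ∈ s, ‖f i z‖ₑ ^ 2 * W z := by
  classical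
  induction s using Finset.induction_on with
  | empty => exact ⟨Set.univ, univ_mem, by simp⟩
  | insert i s hi ih =>
    simp only [Finset.sum_insert hi]
    obtain ⟨ρ, hρ, hm⟩ := (hf i).exists_aemeasurable hr hW
    exact IntNear.add hρ (h i) ih hm

lemma PSHOn.aemeasurable_wexp_add {φ φ₀ : Cn n → EReal} (hφ : PSHOn φ (polydisc n))
    (hφ₀ : PSHOn φ₀ (polydisc n)) {r : ℝ} (hr : r < 1) :
    AEMeasurable (wexp (-2) fun w => φ w + φ₀ w) (volume.restrict (Metric.ball 0 r)) := by
  refine ((hφ.aemeasurable_wexp hr).mul (hφ₀.aemeasurable_wexp hr)).congr ?_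
  refine ae_restrict_of_forall_mem measurableSet_ball fun z hz => ?_
  have hz' : z ∈ polydisc n := by
    rw [polydisc_eq_ball]; exact Metric.ball_subset_ball hr.le hz
  exact (wexp_add (hφ.lt_top z hz') (hφ₀.lt_top z hz')).symm

/-- If the normalized sublevel integrals of `|f|² e^{-2φ₀}` are not bounded below, then
`|f|² e^{-2(φ+φ₀)}` is integrable near the origin. -/
lemma intNear_of_forall_exists_le {φ φ₀ : Cn n → EReal} (hφ : PSHOn φ (polydisc n))
    (hφ₀ : PSHOn φ₀ (polydisc n)) {r : ℝ} (hr : 0 < r) (hr1 : r < 1) {f : Cn n → ℂ}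
    (hf : DifferentiableOn ℂ f (Metric.ball 0 r))
    (hJ : ∫⁻ z in Metric.ball 0 r, ‖f z‖ₑ ^ 2 * wexp (-2) φ₀ z < ⊤)
    (h : ∀ C : ℝ, 0 < C → ∃ t : ℝ, 0 ≤ t ∧ ENNReal.ofReal (Real.exp (2 * t)) *
      ∫⁻ z in {z | φ z < ((-t : ℝ) : EReal)} ∩ Metric.ball 0 r, ‖f z‖ₑ ^ 2 * wexp (-2) φ₀ z ≤
        ENNReal.ofReal C) :
    IntNear fun z => ‖f z‖ₑ ^ 2 * wexp (-2) (fun w => φ w + φ₀ w) z := by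
  set r₀ : ℝ := r / (3 * (n + 1)) with hr₀
  have hn : (0 : ℝ) ≤ n := n.cast_nonneg
  have hr₀p : 0 < r₀ := by positivity
  have hr₀r : r₀ ≤ r := div_le_self hr.le (by linarith)
  have hr₀n : n * r₀ ^ 2 ≤ r ^ 2 / 5 := by
    rw [hr₀, div_pow, mul_div_assoc', div_le_div_iff₀ (by positivity) (by norm_num)]
    nlinarith [sq_nonneg r, mul_nonneg (sq_nonneg r) hn, mul_nonneg (sq_nonneg r) (sq_nonneg (n : ℝ))]
  obtain ⟨K, hK, hF⟩ := exists_holomorphic_approx hφ hφ₀ hr hr1 hr₀p hr₀r hr₀n hf hJ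
  have hfn : HoloNear f := holoNear_of_ball hr hf
  rw [← toGerm_mem_multIdeal (hr := hr) (hW := hφ.aemeasurable_wexp_add hφ₀ hr1) (hf := hfn)]
  refine toGerm_mem_of_approx (r := r₀ / 4) (by positivity) hfn fun ε hε => ?_
  obtain ⟨t, ht, htC⟩ := h (ε ^ 2 / (K.toReal + 1)) (by positivity)
  obtain ⟨F, hFd, hFb, hFi⟩ := hF t ht
  refine ⟨F, hFd, fun z hz => ?_, ?_⟩
  · have h1 : ‖F z‖ₑ ^ 2 ≤ ENNReal.ofReal (ε ^ 2) := by
      refine (hFb z hz).trans ((mul_le_mul_right htC K).trans ?_)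
      rw [← ENNReal.ofReal_toReal hK, ← ENNReal.ofReal_mul ENNReal.toReal_nonneg]
      refine ENNReal.ofReal_le_ofReal ?_
      rw [ENNReal.toReal_ofReal ENNReal.toReal_nonneg, mul_div_assoc',
        div_le_iff₀ (by positivity)]
      nlinarith [sq_nonneg ε]
    rw [enorm_sq_eq_ofReal, ENNReal.ofReal_le_ofReal_iff (by positivity)] at h1
    exact abs_le_of_sq_le_sq' h1 hε.le |>.2
  · have hsub : HoloNear fun z => f z - F z :=
      holoNear_of_ball (r := r₀ / 4) (by positivity)
        ((hf.mono (Metric.ball_subset_ball (by linarith))).fun_sub hFd)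
    rw [toGerm_sub _ _ hsub, toGerm_mem_multIdeal]
    exact ⟨_, Metric.ball_mem_nhds _ (by positivity), hFi⟩

/-- lower bound `e^{2t} ∫_{{φ<-t}∩U} |f₀|²e^{-2φ₀} > C` when
`|f₀|²e^{-2(φ+φ₀)}` is not integrable near the origin. -/
theorem statement9 {n m : ℕ} (f₀ : Fin m → Cn n → ℂ) (φ φ₀ : Cn n → EReal)
    (hf₀ : ∀ j, DifferentiableOn ℂ (f₀ j) (polydisc n))
    (hφ : PSHOn φ (polydisc n)) (hφ₀ : PSHOn φ₀ (polydisc n))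
    (hnonint : ¬ IntNear fun z => normSq2 f₀ z * wexp (-2) (fun w => φ w + φ₀ w) z)
    (hint : IntNear (dens0 f₀ φ₀)) :
    ∃ U₀ ∈ 𝓝 (0 : Cn n), ∀ U ∈ 𝓝 (0 : Cn n), U ⊆ U₀ → closure U ⊆ polydisc n →
      ∃ C : ℝ, 0 < C ∧ ∀ t : ℝ, 0 ≤ t →
        ENNReal.ofReal C <
          ENNReal.ofReal (Real.exp (2 * t)) *
            ∫⁻ z in {z : Cn n | φ z < ((-t : ℝ) : EReal)} ∩ U, dens0 f₀ φ₀ z := by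
  refine ⟨Set.univ, univ_mem, fun U hU _ _ => ?_⟩
  by_contra! hcon
  apply hnonint
  rw [polydisc_eq_ball] at hf₀
  obtain ⟨V, hV, hVint⟩ := hint
  obtain ⟨ε, hε, hεb⟩ := Metric.nhds_basis_ball.mem_iff.1 (inter_mem hU hV)
  set r := min ε (1 / 2) with hr
  have hr0 : 0 < r := by positivity
  have hr1 : r < 1 := (min_le_right _ _).trans_lt (by norm_num)
  have hrb : Metric.ball 0 r ⊆ U ∩ V := (Metric.ball_subset_ball (min_le_left _ _)).trans hεb
  have hle : ∀ j z, ‖f₀ j z‖ₑ ^ 2 * wexp (-2) φ₀ z ≤ dens0 f₀ φ₀ z := fun j z =>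
    mul_le_mul_left (Finset.single_le_sum (f := fun j => (‖f₀ j z‖₊ : ℝ≥0∞) ^ 2)
      (fun _ _ => zero_le) (Finset.mem_univ j)) _
  have hcomp : ∀ j, IntNear fun z => ‖f₀ j z‖ₑ ^ 2 * wexp (-2) (fun w => φ w + φ₀ w) z := by
    intro j
    refine intNear_of_forall_exists_le hφ hφ₀ hr0 hr1
      ((hf₀ j).mono (Metric.ball_subset_ball hr1.le)) ?_ fun C hC => ?_
    · exact (lintegral_mono (hle j)).trans_lt
        ((lintegral_mono_set fun z hz => (hrb hz).2).trans_lt hVint)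
    · obtain ⟨t, ht, htC⟩ := hcon C hC
      refine ⟨t, ht, le_trans (mul_le_mul_right ?_ _) htC⟩
      exact (lintegral_mono (hle j)).trans
        (lintegral_mono_set (Set.inter_subset_inter_right _ fun z hz => (hrb hz).1))
  have hsum := IntNear.sum Finset.univ (fun j => holoNear_of_ball one_pos (hf₀ j)) hr0
    (hφ.aemeasurable_wexp_add hφ₀ hr1) hcomp
  refine hsum.mono ENNReal.one_ne_top (Eventually.of_forall fun z => ?_)
  rw [one_mul, normSq2, Finset.sum_mul]
  rfl
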